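/- Let n be a positive integer and let the cyclic group C_n of order n act on ℚ(x₁,…,x_n) by cyclically permuting the indeterminates (the regular action). Then the fixed field ℚ(x₁,…,x_n)^{C_n} is rational (purely transcendental) over ℚ if and only if n divides 2²·3^m·5²·7²·11·13·17·19·23·29·31·37·41·43·61·67·71 for some non-negative integer m. -/

import Mathlib

namespace NoetherCn

section Extension

variable {Λ U : Type} [CommRing Λ] [AddCommGroup U] [Module Λ U]
  (cl : ClosureOperator (Submodule Λ U))

/-- `B` maps to `U` with generating image. -/
def Gen (B : Type) [AddCommGroup B] [Module Λ B] : Prop :=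
  ∃ φ : B →ₗ[Λ] U, cl (LinearMap.range φ) = ⊤

/-- Homomorphisms into closed submodules extend along embeddings with cokernel `C`. -/
def ExtVanish (C : Type) [AddCommGroup C] [Module Λ C] : Prop :=
  ∀ (N : Submodule Λ U) (B : Type) [AddCommGroup B] [Module Λ B] (f : B →ₗ[Λ] C),
    Function.Surjective f → ∀ φ : LinearMap.ker f →ₗ[Λ] cl N,
      ∃ r : B →ₗ[Λ] cl N, ∀ a : LinearMap.ker f, r a = φ a

variable {cl}

variable {A B C D : Type} [AddCommGroup A] [Module Λ A] [AddCommGroup B] [Module Λ B]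
  [AddCommGroup C] [Module Λ C] [AddCommGroup D] [Module Λ D]

theorem Gen.of_surjective (h : Gen cl B) (f : A →ₗ[Λ] B) (hf : Function.Surjective f) :
    Gen cl A := by
  obtain ⟨φ, hφ⟩ := h
  refine ⟨φ ∘ₗ f, ?_⟩
  rw [LinearMap.range_comp, LinearMap.range_eq_top.2 hf, Submodule.map_top, hφ]

theorem ExtVanish.of_equiv (h : ExtVanish cl C) (e : C ≃ₗ[Λ] D) : ExtVanish cl D := by
  intro N B _ _ f hf φ
  have hk : LinearMap.ker (e.symm.toLinearMap ∘ₗ f) = LinearMap.ker f := by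
    ext; simp
  obtain ⟨r, hr⟩ := h N B (e.symm.toLinearMap ∘ₗ f) (e.symm.surjective.comp hf)
    (φ ∘ₗ (LinearEquiv.ofEq _ _ hk).toLinearMap)
  exact ⟨r, fun a => hr ⟨a, hk.symm.le a.2⟩⟩

/-- The property passes to retracts. -/
theorem ExtVanish.of_retract (h : ExtVanish cl C) (i : D →ₗ[Λ] C) (ρ : C →ₗ[Λ] D)
    (hρ : ρ ∘ₗ i = LinearMap.id) : ExtVanish cl D := by
  intro N B _ _ f hf φ
  let P : Submodule Λ (B × C) := LinearMap.ker (f.coprod (-ρ))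
  have hP : ∀ x : B × C, x ∈ P ↔ f x.1 = ρ x.2 := by
    intro x
    simp [P, ← sub_eq_add_neg, sub_eq_zero]
  let g : P →ₗ[Λ] C := LinearMap.snd Λ B C ∘ₗ P.subtype
  have hg : Function.Surjective g := by
    intro c
    obtain ⟨b, hb⟩ := hf (ρ c)
    exact ⟨⟨(b, c), (hP _).2 hb⟩, rfl⟩
  have hgk : ∀ x : LinearMap.ker g, ((x : P) : B × C).1 ∈ LinearMap.ker f := by
    intro x
    have h1 := (hP _).1 x.1.2
    have h2 : ((x : P) : B × C).2 = 0 := x.2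
    rw [h2, map_zero] at h1
    exact h1
  let ψ : LinearMap.ker g →ₗ[Λ] LinearMap.ker f :=
    LinearMap.codRestrict _ (LinearMap.fst Λ B C ∘ₗ P.subtype ∘ₗ (LinearMap.ker g).subtype) hgk
  obtain ⟨r, hr⟩ := h N P g hg (φ ∘ₗ ψ)
  let j : B →ₗ[Λ] P := LinearMap.codRestrict P (LinearMap.prod LinearMap.id (i ∘ₗ f)) (by
    intro b
    rw [hP]
    exact (LinearMap.congr_fun hρ (f b)).symm)
  refine ⟨r ∘ₗ j, fun a => ?_⟩
  have ha : j a ∈ LinearMap.ker g := by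
    change i (f a) = 0
    rw [show f a = 0 from a.2, map_zero]
  exact hr ⟨j a, ha⟩

theorem ExtVanish.prod (hC : ExtVanish cl C) (hD : ExtVanish cl D) : ExtVanish cl (C × D) := by
  intro N B _ _ f hf φ
  let f2 : B →ₗ[Λ] D := LinearMap.snd Λ C D ∘ₗ f
  have hf2 : Function.Surjective f2 := Prod.snd_surjective.comp hf
  let f1 : LinearMap.ker f2 →ₗ[Λ] C := LinearMap.fst Λ C D ∘ₗ f ∘ₗ (LinearMap.ker f2).subtype
  have hf1 : Function.Surjective f1 := by
    intro c
    obtain ⟨b, hb⟩ := hf (c, 0)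
    exact ⟨⟨b, by simp [f2, hb]⟩, by simp [f1, hb]⟩
  have hk : ∀ x : LinearMap.ker f1, ((x : LinearMap.ker f2) : B) ∈ LinearMap.ker f := by
    intro x
    have h1 : (f x.1.1).1 = 0 := x.2
    have h2 : (f x.1.1).2 = 0 := x.1.2
    exact Prod.ext h1 h2
  obtain ⟨r1, hr1⟩ := hC N _ f1 hf1 (φ ∘ₗ LinearMap.codRestrict _
    ((LinearMap.ker f2).subtype ∘ₗ (LinearMap.ker f1).subtype) hk)
  obtain ⟨r2, hr2⟩ := hD N _ f2 hf2 r1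
  refine ⟨r2, fun a => ?_⟩
  have ha2 : (a : B) ∈ LinearMap.ker f2 := by
    change (f a).2 = 0
    rw [show f a = 0 from a.2]; rfl
  have ha1 : (⟨a, ha2⟩ : LinearMap.ker f2) ∈ LinearMap.ker f1 := by
    change (f a).1 = 0
    rw [show f a = 0 from a.2]; rfl
  rw [hr2 ⟨a, ha2⟩, hr1 ⟨⟨a, ha2⟩, ha1⟩]
  rfl

theorem ExtVanish.punit : ExtVanish cl PUnit := by
  intro N B _ _ f hf φ
  refine ⟨φ ∘ₗ LinearMap.codRestrict _ LinearMap.id (fun _ => Subsingleton.elim _ _), fun a => rfl⟩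

theorem ExtVanish.pi {ι : Type} [Finite ι] {C : ι → Type} [∀ i, AddCommGroup (C i)]
    [∀ i, Module Λ (C i)] (h : ∀ i, ExtVanish cl (C i)) : ExtVanish cl (∀ i, C i) := by
  cases nonempty_fintype ι
  classical
  suffices H : ∀ s : Finset ι, ExtVanish cl (∀ i : s, C i) by
    exact (H Finset.univ).of_equiv
      { toFun := fun x i => x ⟨i, Finset.mem_univ i⟩
        invFun := fun x i => x i
        map_add' := fun _ _ => rfl
        map_smul' := fun _ _ => rfl
        left_inv := fun _ => rfl
        right_inv := fun _ => rfl }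
  intro s
  induction s using Finset.induction_on with
  | empty =>
    exact ExtVanish.punit.of_equiv
      { toFun := fun _ i => absurd i.2 (Finset.notMem_empty _)
        invFun := fun _ => PUnit.unit
        map_add' := fun _ _ => funext fun i => absurd i.2 (Finset.notMem_empty _)
        map_smul' := fun _ _ => funext fun i => absurd i.2 (Finset.notMem_empty _)
        left_inv := fun _ => rfl
        right_inv := fun _ => funext fun i => absurd i.2 (Finset.notMem_empty _) }
  | insert a s ha ih =>
    refine ((h a).prod ih).of_retract
      { toFun := fun x => (x ⟨a, Finset.mem_insert_self a s⟩,
          fun i => x ⟨i, Finset.mem_insert_of_mem i.2⟩)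
        map_add' := fun _ _ => rfl
        map_smul' := fun _ _ => rfl }
      { toFun := fun x i => if hi : i.1 = a then cast (congrArg C hi.symm) x.1 else
          x.2 ⟨i, (Finset.mem_insert.1 i.2).resolve_left hi⟩
        map_add' := ?_
        map_smul' := ?_ } ?_
    · intro x y
      funext i
      obtain ⟨i, hi⟩ := i
      by_cases h : i = a
      · subst h; simp
      · simp [h]
    · intro c x
      funext i
      obtain ⟨i, hi⟩ := i
      by_cases h : i = a
      · subst h; simp
      · simp [h]
    · refine LinearMap.ext fun x => funext fun i => ?_
      obtain ⟨i, hi⟩ := i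
      by_cases h : i = a
      · subst h; simp
      · simp [h]

/-- A generating map on an extension of `C` by `A` gives one on `A × C`, and conversely. -/
theorem gen_iff_of_exact (hC : ExtVanish cl C) (i : A →ₗ[Λ] B) (f : B →ₗ[Λ] C)
    (hi : Function.Injective i) (hf : Function.Surjective f) (hif : Function.Exact i f) :
    Gen cl B ↔ Gen cl (A × C) := by
  have hr : LinearMap.range i = LinearMap.ker f := by
    ext b; exact (hif b).symm
  let e : A ≃ₗ[Λ] LinearMap.ker f := (LinearEquiv.ofInjective i hi).trans (LinearEquiv.ofEq _ _ hr)
  have he : ∀ a, ((e a : LinearMap.ker f) : B) = i a := fun a => rfl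
  have hext : ∀ φ : A →ₗ[Λ] U, ∃ r : B →ₗ[Λ] cl (LinearMap.range φ), ∀ a,
      (r (i a) : U) = φ a := by
    intro φ
    obtain ⟨r, hr⟩ := hC (LinearMap.range φ) B f hf
      (LinearMap.codRestrict (cl (LinearMap.range φ)) φ
        (fun a => cl.le_closure _ ⟨a, rfl⟩) ∘ₗ e.symm.toLinearMap)
    refine ⟨r, fun a => ?_⟩
    rw [← he, hr]
    simp
  constructor
  · rintro ⟨φ, hφ⟩
    obtain ⟨r, hr⟩ := hext (φ ∘ₗ i)
    let δ : B →ₗ[Λ] U := φ - (Submodule.subtype _) ∘ₗ r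
    have hδ : LinearMap.ker f ≤ LinearMap.ker δ := by
      rw [← hif.linearMap_ker_eq.symm]
      rintro _ ⟨a, rfl⟩
      simp [δ, hr]
    let ε : C →ₗ[Λ] U := (LinearMap.ker f).liftQ δ hδ ∘ₗ
      (f.quotKerEquivOfSurjective hf).symm.toLinearMap
    have hε : ∀ b, ε (f b) = φ b - r b := by
      intro b
      have : (f.quotKerEquivOfSurjective hf).symm (f b) = Submodule.Quotient.mk b := by
        rw [LinearEquiv.symm_apply_eq]; rfl
      simp only [ε, LinearMap.comp_apply, LinearEquiv.coe_coe, this]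
      rfl
    refine ⟨(φ ∘ₗ i).coprod ε, ?_⟩
    set N := LinearMap.range ((φ ∘ₗ i).coprod ε) with hN
    have h1 : LinearMap.range (φ ∘ₗ i) ≤ N := by
      rintro _ ⟨a, rfl⟩
      exact ⟨(a, 0), by simp⟩
    have h2 : LinearMap.range φ ≤ cl N := by
      rintro _ ⟨b, rfl⟩
      have : φ b = r b + ε (f b) := by rw [hε]; abel
      rw [this]
      refine add_mem (cl.monotone h1 (r b).2) (cl.le_closure _ ⟨(0, f b), by simp⟩)
    rw [eq_top_iff, ← hφ]
    exact cl.closure_min h2 (cl.isClosed_closure _)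
  · rintro ⟨φ, hφ⟩
    obtain ⟨r, hr⟩ := hext (φ ∘ₗ LinearMap.inl Λ A C)
    let ψ : B →ₗ[Λ] U := (Submodule.subtype _) ∘ₗ r + φ ∘ₗ LinearMap.inr Λ A C ∘ₗ f
    have hψi : ∀ a, ψ (i a) = φ (a, 0) := by
      intro a
      have : f (i a) = 0 := hif.apply_apply_eq_zero a
      simp only [ψ, LinearMap.add_apply, LinearMap.comp_apply, Submodule.subtype_apply, hr, this,
        map_zero, add_zero, LinearMap.inl_apply]
    refine ⟨ψ, ?_⟩
    have h1 : LinearMap.range (φ ∘ₗ LinearMap.inl Λ A C) ≤ LinearMap.range ψ := by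
      rintro _ ⟨a, rfl⟩
      exact ⟨i a, by rw [hψi]; rfl⟩
    have h2 : LinearMap.range φ ≤ cl (LinearMap.range ψ) := by
      rintro _ ⟨⟨a, c⟩, rfl⟩
      obtain ⟨b, rfl⟩ := hf c
      have : φ (a, f b) = ψ (i a) + (ψ b - r b) := by
        rw [hψi]
        simp only [ψ, LinearMap.add_apply, LinearMap.comp_apply, Submodule.subtype_apply,
          add_sub_cancel_left, ← map_add]
        simp
      rw [this]
      exact add_mem (cl.le_closure _ ⟨_, rfl⟩) (sub_mem (cl.le_closure _ ⟨_, rfl⟩)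
        (cl.monotone h1 (r b).2))
    rw [eq_top_iff, ← hφ]
    exact cl.closure_min h2 (cl.isClosed_closure _)

theorem gen_prod_iff_of_exact (hC : ExtVanish cl C) (i : A →ₗ[Λ] B) (f : B →ₗ[Λ] C)
    (hi : Function.Injective i) (hf : Function.Surjective f) (hif : Function.Exact i f) :
    Gen cl (B × D) ↔ Gen cl ((A × D) × C) := by
  refine gen_iff_of_exact hC (i.prodMap LinearMap.id) (f ∘ₗ LinearMap.fst Λ B D)
    (hi.prodMap Function.injective_id) (hf.comp Prod.fst_surjective) ?_
  rintro ⟨b, d⟩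
  constructor
  · intro h
    obtain ⟨a, rfl⟩ := (hif b).1 h
    exact ⟨(a, d), rfl⟩
  · rintro ⟨⟨a, d⟩, h⟩
    obtain ⟨rfl, rfl⟩ := Prod.ext_iff.1 h
    exact hif.apply_apply_eq_zero a

end Extension

section Cyclic

variable {Λ U : Type} [CommRing Λ] [AddCommGroup U] [Module Λ U]
  {cl : ClosureOperator (Submodule Λ U)}

/-- Extension along a map onto a cyclic module, given the values forced on the annihilator. -/
theorem extVanish_quotient (I : Ideal Λ)
    (h : ∀ (N : Submodule Λ U) (c : I →ₗ[Λ] cl N), ∃ u : cl N, ∀ x : I, c x = (x : Λ) • u) :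
    ExtVanish cl (Λ ⧸ I) := by
  intro N B _ _ f hf φ
  obtain ⟨b, hb⟩ := hf 1
  have hfb : ∀ x : Λ, f (x • b) = Ideal.Quotient.mk I x := by
    intro x
    rw [map_smul, hb]
    change Ideal.Quotient.mk I (x * 1) = _
    rw [mul_one]
  have hIb : ∀ x : I, (LinearMap.toSpanSingleton Λ B b ∘ₗ Submodule.subtype I) x ∈
      LinearMap.ker f := by
    intro x
    change f ((x : Λ) • b) = 0
    rw [hfb]
    exact Ideal.Quotient.eq_zero_iff_mem.2 x.2
  obtain ⟨u, hu⟩ := h N (φ ∘ₗ LinearMap.codRestrict _ _ hIb)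
  let p : (LinearMap.ker f × Λ) →ₗ[Λ] B :=
    (LinearMap.ker f).subtype.coprod (LinearMap.toSpanSingleton Λ B b)
  let q : (LinearMap.ker f × Λ) →ₗ[Λ] cl N := φ.coprod (LinearMap.toSpanSingleton Λ _ u)
  have hp : Function.Surjective p := by
    intro y
    obtain ⟨x, hx⟩ := Ideal.Quotient.mk_surjective (f y)
    refine ⟨(⟨y - x • b, ?_⟩, x), ?_⟩
    · rw [LinearMap.mem_ker, map_sub, hfb, hx, sub_self]
    · simp [p]
  have hpq : LinearMap.ker p ≤ LinearMap.ker q := by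
    rintro ⟨a, x⟩ hax
    have h1 : (a : B) + x • b = 0 := hax
    have hx : x ∈ I := by
      rw [← Ideal.Quotient.eq_zero_iff_mem, ← hfb]
      have := congrArg f h1
      rw [map_add, show f a = 0 from a.2, zero_add, map_zero] at this
      exact this
    have h2 : a = -(LinearMap.codRestrict _ _ hIb ⟨x, hx⟩) := by
      apply Subtype.ext
      exact eq_neg_of_add_eq_zero_left h1
    change φ a + x • u = 0
    rw [h2, map_neg, ← hu ⟨x, hx⟩]
    simp
  refine ⟨(LinearMap.ker p).liftQ q hpq ∘ₗ (p.quotKerEquivOfSurjective hp).symm.toLinearMap,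
    fun a => ?_⟩
  have : (p.quotKerEquivOfSurjective hp).symm (a : B) = Submodule.Quotient.mk (a, 0) := by
    rw [LinearEquiv.symm_apply_eq]
    change (a : B) = p (a, 0)
    simp [p]
  simp only [LinearMap.comp_apply, LinearEquiv.coe_coe, this]
  change q (a, 0) = φ a
  simp [q]

end Cyclic

section GroupRing

variable {π Λ U : Type} [CommGroup π] [CommRing Λ] (ι : π →* Λ) [AddCommGroup U] [Module Λ U]
  {cl : ClosureOperator (Submodule Λ U)}

/-- The ideal generated by the augmentation ideal of a subgroup. -/
def augIdeal (H : Subgroup π) : Ideal Λ :=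
  Ideal.span {x | ∃ h ∈ H, x = ι h - 1}

/-- Vanishing of the first cohomology of all closed submodules. -/
def H1Vanish (cl : ClosureOperator (Submodule Λ U)) : Prop :=
  ∀ (H : Subgroup π) (N : Submodule Λ U) (c : H → cl N),
    (∀ g h : H, c (g * h) = ι g • c h + c g) →
      ∃ u : cl N, ∀ h : H, c h = ι h • u - u

theorem H1Vanish.extVanish (h1 : H1Vanish ι cl) (H : Subgroup π) :
    ExtVanish cl (Λ ⧸ augIdeal ι H) := by
  refine extVanish_quotient _ fun N c => ?_
  have hm : ∀ h : H, ι h - 1 ∈ augIdeal ι H :=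
    fun h => Ideal.subset_span ⟨h, h.2, rfl⟩
  obtain ⟨u, hu⟩ := h1 H N (fun h => c ⟨_, hm h⟩) (by
    intro g h
    rw [← map_smul, ← map_add]
    congr 1
    apply Subtype.ext
    simp only [Submodule.coe_add, Submodule.coe_smul, Subgroup.coe_mul, map_mul, smul_eq_mul]
    ring)
  refine ⟨u, ?_⟩
  rintro ⟨x, hx⟩
  suffices H : ∃ hx : x ∈ augIdeal ι H, c ⟨x, hx⟩ = x • u by
    obtain ⟨_, h⟩ := H; exact h
  refine Submodule.span_induction (p := fun x _ => ∃ hx : x ∈ augIdeal ι H, c ⟨x, hx⟩ = x • u)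
    ?_ ?_ ?_ ?_ hx
  · rintro _ ⟨h, hh, rfl⟩
    refine ⟨hm ⟨h, hh⟩, ?_⟩
    rw [hu ⟨h, hh⟩, sub_smul, one_smul]
  · exact ⟨zero_mem _, by rw [zero_smul]; exact map_zero c⟩
  · rintro x y _ _ ⟨hx, hx'⟩ ⟨hy, hy'⟩
    refine ⟨add_mem hx hy, ?_⟩
    rw [add_smul, ← hx', ← hy', ← map_add]; rfl
  · rintro a x _ ⟨hx, hx'⟩
    refine ⟨Submodule.smul_mem _ a hx, ?_⟩
    rw [smul_assoc, ← hx', ← map_smul]; rfl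

end GroupRing

noncomputable section

section GrpRing

variable {π : Type} [CommGroup π]

/-- The integral group ring of a commutative group. -/
def GrpRing (π : Type) : Type := MonoidAlgebra ℤ π

instance : CommRing (GrpRing π) := inferInstanceAs (CommRing (MonoidAlgebra ℤ π))

namespace GrpRing

/-- The inclusion of the group into its group ring. -/
def of : π →* GrpRing π := MonoidAlgebra.of ℤ π

/-- The universal property of the group ring. -/
def lift {R : Type} [Ring R] (f : π →* R) : GrpRing π →+* R :=
  (MonoidAlgebra.lift ℤ R π f : MonoidAlgebra ℤ π →ₐ[ℤ] R).toRingHom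

@[simp] theorem lift_of {R : Type} [Ring R] (f : π →* R) (g : π) : lift f (of g) = f g :=
  MonoidAlgebra.lift_of f g

theorem closure_range_of : AddSubgroup.closure (Set.range (of : π → GrpRing π)) = ⊤ := by
  rw [eq_top_iff]
  intro x _
  refine MonoidAlgebra.induction_on (motive := fun x =>
    (x : GrpRing π) ∈ AddSubgroup.closure (Set.range (of : π → GrpRing π))) x ?_ ?_ ?_
  · intro g
    exact AddSubgroup.subset_closure ⟨_, rfl⟩
  · intro x y hx hy
    exact add_mem hx hy
  · intro r x hx
    exact zsmul_mem hx r

theorem induction {p : GrpRing π → Prop} (x : GrpRing π) (h0 : p 0) (hof : ∀ g, p (of g))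
    (hadd : ∀ x y, p x → p y → p (x + y)) (hneg : ∀ x, p x → p (-x)) : p x := by
  have hx : x ∈ AddSubgroup.closure (Set.range (of : π → GrpRing π)) := by
    rw [closure_range_of]; trivial
  refine AddSubgroup.closure_induction (p := fun x _ => p x) ?_ h0
    (fun x y _ _ => hadd x y) (fun x _ => hneg x) hx
  rintro _ ⟨g, rfl⟩
  exact hof g

end GrpRing

open GrpRing

/-- An abelian group with an action of `π`, as a module over the group ring. -/
def ActMod {A : Type} [AddCommGroup A] (_ : π →* AddMonoid.End A) : Type := A

variable {A : Type} [AddCommGroup A] (ρ : π →* AddMonoid.End A)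

instance : AddCommGroup (ActMod ρ) := inferInstanceAs (AddCommGroup A)

instance : Module (GrpRing π) (ActMod ρ) :=
  Module.compHom A (GrpRing.lift ρ)

theorem ActMod.of_smul (g : π) (x : A) :
    of g • (show ActMod ρ from x) = (show ActMod ρ from ρ g x) := by
  change GrpRing.lift ρ (of g) x = ρ g x
  rw [lift_of]

/-- An equivariant additive map is linear over the group ring. -/
def equivariantHom {M N : Type} [AddCommGroup M] [AddCommGroup N]
    [Module (GrpRing π) M] [Module (GrpRing π) N] (f : M →+ N)
    (hf : ∀ (g : π) (x : M), f (of g • x) = of g • f x) : M →ₗ[GrpRing π] N where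
  toFun := f
  map_add' := f.map_add
  map_smul' r x := by
    refine GrpRing.induction (p := fun r => f (r • x) = r • f x) r ?_ (fun g => hf g x) ?_ ?_
    · simp
    · intro a b ha hb
      rw [add_smul, map_add, ha, hb, add_smul]
    · intro a ha
      rw [neg_smul, map_neg, ha, neg_smul]

@[simp] theorem equivariantHom_apply {M N : Type} [AddCommGroup M] [AddCommGroup N]
    [Module (GrpRing π) M] [Module (GrpRing π) N] (f : M →+ N)
    (hf : ∀ (g : π) (x : M), f (of g • x) = of g • f x) (x : M) :
    equivariantHom f hf x = f x := rfl

/-- A stable subgroup is a submodule over the group ring. -/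
def stableSubmodule {M : Type} [AddCommGroup M] [Module (GrpRing π) M] (S : AddSubgroup M)
    (hS : ∀ (g : π), ∀ x ∈ S, of g • x ∈ S) : Submodule (GrpRing π) M where
  toAddSubmonoid := S.toAddSubmonoid
  smul_mem' r x hx := by
    change r • x ∈ S
    refine GrpRing.induction (p := fun r => r • x ∈ S) r ?_ (fun g => hS g x hx) ?_ ?_
    · rw [zero_smul]; exact zero_mem _
    · intro a b ha hb
      rw [add_smul]; exact add_mem ha hb
    · intro a ha
      rw [neg_smul]; exact neg_mem ha

end GrpRing

section Units

open GrpRing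

variable {π F : Type} [CommGroup π] [Field F] (ρ : π →* RingAut F)

/-- The action of `π` on the multiplicative group of a field, written additively. -/
def unitsAct : π →* AddMonoid.End (Additive Fˣ) where
  toFun g := MonoidHom.toAdditive (Units.map ((ρ g : F ≃+* F) : F →* F))
  map_one' := by
    refine AddMonoidHom.ext fun x => congrArg Additive.ofMul (Units.ext ?_)
    change ρ 1 ((Additive.toMul x : Fˣ) : F) = _
    rw [map_one]; rfl
  map_mul' g h := by
    refine AddMonoidHom.ext fun x => congrArg Additive.ofMul (Units.ext ?_)
    change ρ (g * h) ((Additive.toMul x : Fˣ) : F) = _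
    rw [map_mul]; rfl

/-- The multiplicative group of `F` as a module over the group ring. -/
abbrev UMod : Type := ActMod (unitsAct ρ)

variable {ρ}

/-- The underlying field element. -/
def UMod.val (u : UMod ρ) : F := ((Additive.toMul (show Additive Fˣ from u) : Fˣ) : F)

/-- The module element given by a nonzero field element. -/
def UMod.mk (x : F) (hx : x ≠ 0) : UMod ρ := Additive.ofMul (Units.mk0 x hx)

namespace UMod

@[simp] theorem val_mk (x : F) (hx : x ≠ 0) : (mk x hx : UMod ρ).val = x := rfl

theorem val_ne_zero (u : UMod ρ) : u.val ≠ 0 :=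
  Units.ne_zero (Additive.toMul (show Additive Fˣ from u) : Fˣ)

theorem ext {u v : UMod ρ} (h : u.val = v.val) : u = v := by
  have : (Additive.toMul (show Additive Fˣ from u) : Fˣ) =
    (Additive.toMul (show Additive Fˣ from v) : Fˣ) := Units.ext h
  exact this

@[simp] theorem val_zero : (0 : UMod ρ).val = 1 := rfl

@[simp] theorem val_add (u v : UMod ρ) : (u + v).val = u.val * v.val := rfl

@[simp] theorem val_neg (u : UMod ρ) : (-u).val = u.val⁻¹ := by
  have h : (-u).val * u.val = 1 := by rw [← val_add, neg_add_cancel, val_zero]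
  exact eq_inv_of_mul_eq_one_left h

@[simp] theorem val_sub (u v : UMod ρ) : (u - v).val = u.val / v.val := by
  rw [sub_eq_add_neg, val_add, val_neg, div_eq_mul_inv]

@[simp] theorem val_of_smul (g : π) (u : UMod ρ) : (of g • u).val = ρ g u.val := by
  have := ActMod.of_smul (unitsAct ρ) g u
  change (of g • (show ActMod (unitsAct ρ) from u)).val = _
  rw [this]
  rfl

/-- `u.val` as a map to a multiplicative monoid. -/
def valHom (ρ : π →* RingAut F) : Multiplicative (UMod ρ) →* F where
  toFun u := u.toAdd.val
  map_one' := rfl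
  map_mul' _ _ := rfl

theorem val_sum {ι : Type} (s : Finset ι) (f : ι → UMod ρ) :
    (∑ i ∈ s, f i).val = ∏ i ∈ s, (f i).val :=
  map_prod (valHom ρ) (fun i => Multiplicative.ofAdd (f i)) s

end UMod

variable (F0 : Subfield F) (hF0 : ∀ g, ∀ x ∈ F0, ρ g x ∈ F0)

/-- The field generated over `F0` by a submodule of units. -/
def genField (N : Submodule (GrpRing π) (UMod ρ)) : Subfield F :=
  Subfield.closure ((F0 : Set F) ∪ UMod.val '' (N : Set (UMod ρ)))

variable {F0}

theorem genField_le {N : Submodule (GrpRing π) (UMod ρ)} {K : Subfield F} (h : F0 ≤ K)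
    (h' : ∀ u ∈ N, u.val ∈ K) : genField F0 N ≤ K := by
  rw [genField, Subfield.closure_le]
  rintro y (hy | ⟨u, hu, rfl⟩)
  · exact h hy
  · exact h' u hu

theorem le_genField (N : Submodule (GrpRing π) (UMod ρ)) : F0 ≤ genField F0 N :=
  fun _ hx => Subfield.subset_closure (Or.inl hx)

theorem val_mem_genField {N : Submodule (GrpRing π) (UMod ρ)} {u : UMod ρ} (hu : u ∈ N) :
    u.val ∈ genField F0 N :=
  Subfield.subset_closure (Or.inr ⟨u, hu, rfl⟩)

variable (F0)

include hF0 in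
theorem apply_mem_genField (N : Submodule (GrpRing π) (UMod ρ)) (g : π) {y : F}
    (hy : y ∈ genField F0 N) : ρ g y ∈ genField F0 N := by
  have : genField F0 N ≤ (genField F0 N).comap ((ρ g : F ≃+* F) : F →+* F) := by
    refine genField_le (K := (genField F0 N).comap ((ρ g : F ≃+* F) : F →+* F))
      (fun y hy => le_genField N (hF0 g y hy)) fun u hu => ?_
    change ρ g u.val ∈ genField F0 N
    rw [← UMod.val_of_smul]
    exact val_mem_genField (N.smul_mem _ hu)
  exact this hy

/-- The units of the field generated over `F0` by a submodule of units. -/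
def fieldUnits (N : Submodule (GrpRing π) (UMod ρ)) : Submodule (GrpRing π) (UMod ρ) :=
  stableSubmodule
    { carrier := {u | u.val ∈ genField F0 N}
      zero_mem' := one_mem (genField F0 N)
      add_mem' := fun {u v} hu hv => by
        change (u + v).val ∈ genField F0 N
        rw [UMod.val_add]
        exact mul_mem hu hv
      neg_mem' := fun {u} hu => by
        change (-u).val ∈ genField F0 N
        rw [UMod.val_neg]
        exact inv_mem hu }
    (by
      intro g x hx
      change (of g • x).val ∈ genField F0 N
      rw [UMod.val_of_smul]
      exact apply_mem_genField F0 hF0 N g hx)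

/-- The closure operator attached to generation of subfields. -/
def unitsClosure : ClosureOperator (Submodule (GrpRing π) (UMod ρ)) :=
  ClosureOperator.mk₂ (fieldUnits F0 hF0)
    (fun N u hu => Subfield.subset_closure (Or.inr ⟨u, hu, rfl⟩))
    (by
      intro N M h u hu
      exact genField_le (le_genField M) (fun v hv => h hv) hu)

theorem mem_unitsClosure (N : Submodule (GrpRing π) (UMod ρ)) (u : UMod ρ) :
    u ∈ unitsClosure F0 hF0 N ↔
      u.val ∈ genField F0 N := Iff.rfl

/-- Hilbert 90 for a group acting faithfully on `F0`. -/
theorem h1Vanish_unitsClosure [Finite π] (hfaith : ∀ g, (∀ x ∈ F0, ρ g x = x) → g = 1) :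
    H1Vanish (of : π →* GrpRing π) (unitsClosure F0 hF0) := by
  intro H N c hc
  cases nonempty_fintype π
  classical
  have : Fintype H := Fintype.ofFinite H
  let χ : H → (F0 →* F) := fun h => ((ρ h : F ≃+* F) : F →* F).comp (F0.subtype : F0 →* F)
  have hχ : Function.Injective χ := by
    intro g h hgh
    have : (h : π)⁻¹ * g = 1 := by
      refine hfaith _ fun x hx => ?_
      have h1 : ρ g x = ρ h x := DFunLike.congr_fun hgh (⟨x, hx⟩ : F0)
      rw [map_mul, RingAut.mul_apply, h1, ← RingAut.mul_apply, ← map_mul, inv_mul_cancel, map_one,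
        RingAut.one_apply]
    exact Subtype.ext (inv_mul_eq_one.1 this).symm
  have hli := (linearIndependent_monoidHom F0 F).comp χ hχ
  rw [Fintype.linearIndependent_iff] at hli
  obtain ⟨x, hx⟩ : ∃ x : F0, ∑ h : H, (c h : UMod ρ).val * ρ h x ≠ 0 := by
    by_contra! hcon
    have := hli (fun h => (c h : UMod ρ).val) (by
      funext x
      rw [Finset.sum_apply]
      exact hcon x) 1
    exact (c 1 : UMod ρ).val_ne_zero this
  set θ : F := ∑ h : H, (c h : UMod ρ).val * ρ h x with hθ
  have hθmem : (UMod.mk θ hx : UMod ρ) ∈ unitsClosure F0 hF0 N := by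
    rw [mem_unitsClosure, UMod.val_mk, hθ]
    refine sum_mem fun h _ => mul_mem ((mem_unitsClosure F0 hF0 N _).1 (c h).2) ?_
    exact le_genField N (hF0 _ _ x.2)
  refine ⟨-⟨_, hθmem⟩, fun g => ?_⟩
  have key : (c g : UMod ρ).val * ρ g θ = θ := by
    rw [hθ, map_sum, Finset.mul_sum]
    refine Eq.trans ?_ (Equiv.sum_comp (Equiv.mulLeft g) _)
    refine Finset.sum_congr rfl fun h _ => ?_
    have := congrArg (fun z : unitsClosure F0 hF0 N => (z : UMod ρ).val) (hc g h)
    simp only [Submodule.coe_add, Submodule.coe_smul, UMod.val_add, UMod.val_of_smul] at this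
    rw [Equiv.coe_mulLeft, this, Subgroup.coe_mul, map_mul, map_mul, RingAut.mul_apply]
    ring
  apply Subtype.ext
  apply UMod.ext
  have hg : ρ (g : π) θ ≠ 0 := by
    rw [Ne, map_eq_zero_iff _ (ρ (g : π)).injective]
    exact hx
  simp only [AddSubgroupClass.coe_sub, Submodule.coe_smul, NegMemClass.coe_neg, UMod.val_sub,
    UMod.val_of_smul, UMod.val_neg, UMod.val_mk, map_inv₀]
  rw [div_inv_eq_mul, eq_inv_mul_iff_mul_eq₀ hg, mul_comm]
  exact key

end Units

end

section Repl

variable {Λ U : Type} [CommRing Λ] [AddCommGroup U] [Module Λ U]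
  (cl : ClosureOperator (Submodule Λ U))

/-- A direct factor `A` may be replaced by `B` in statements about generation. -/
def Repl (A B : Type) [AddCommGroup A] [Module Λ A] [AddCommGroup B] [Module Λ B] : Prop :=
  ∀ (D : Type) [AddCommGroup D] [Module Λ D], Gen cl (A × D) → Gen cl (B × D)

variable {cl}

variable {A B C D : Type} [AddCommGroup A] [Module Λ A] [AddCommGroup B] [Module Λ B]
  [AddCommGroup C] [Module Λ C] [AddCommGroup D] [Module Λ D]

theorem Gen.of_equiv (h : Gen cl A) (e : A ≃ₗ[Λ] B) : Gen cl B :=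
  h.of_surjective e.symm.toLinearMap e.symm.surjective

theorem Repl.of_equiv (e : A ≃ₗ[Λ] B) : Repl cl A B := by
  intro D _ _ h
  exact Gen.of_equiv h (e.prodCongr (LinearEquiv.refl Λ D))

theorem Repl.trans (h : Repl cl A B) (h' : Repl cl B C) : Repl cl A C := by
  intro D _ _ hD
  exact h' D (h D hD)

theorem Repl.prod (h : Repl cl A C) (h' : Repl cl B D) : Repl cl (A × B) (C × D) := by
  intro E _ _ hE
  have h1 := h (B × E) (hE.of_equiv (LinearEquiv.prodAssoc Λ A B E))
  have h2 : Gen cl (B × (E × C)) := h1.of_equiv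
    ((LinearEquiv.prodComm Λ C (B × E)).trans (LinearEquiv.prodAssoc Λ B E C))
  have h3 := h' (E × C) h2
  exact h3.of_equiv ((LinearEquiv.prodAssoc Λ D E C).symm.trans
    ((LinearEquiv.prodComm Λ (D × E) C).trans (LinearEquiv.prodAssoc Λ C D E).symm))

/-- Functions on `Option ι` as a product. -/
def piOptionEquiv {ι : Type} (A : Option ι → Type) [∀ i, AddCommGroup (A i)]
    [∀ i, Module Λ (A i)] : (∀ i, A i) ≃ₗ[Λ] A none × ∀ i, A (some i) where
  toFun x := (x none, fun i => x (some i))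
  invFun y := fun o => match o with
    | none => y.1
    | some i => y.2 i
  left_inv x := by
    funext o
    cases o <;> rfl
  right_inv y := rfl
  map_add' _ _ := rfl
  map_smul' _ _ := rfl

theorem Repl.pi {ι : Type} [Finite ι] : ∀ {A B : ι → Type} [∀ i, AddCommGroup (A i)]
    [∀ i, Module Λ (A i)] [∀ i, AddCommGroup (B i)] [∀ i, Module Λ (B i)],
    (∀ i, Repl cl (A i) (B i)) → Repl cl (∀ i, A i) (∀ i, B i) := by
  refine Finite.induction_empty_option (P := fun ι => ∀ {A B : ι → Type} [∀ i, AddCommGroup (A i)]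
    [∀ i, Module Λ (A i)] [∀ i, AddCommGroup (B i)] [∀ i, Module Λ (B i)],
    (∀ i, Repl cl (A i) (B i)) → Repl cl (∀ i, A i) (∀ i, B i)) ?_ ?_ ?_ ι
  · intro α β e h A B _ _ _ _ hAB
    exact ((Repl.of_equiv (LinearEquiv.piCongrLeft Λ A e).symm).trans
      (h fun i => hAB (e i))).trans (Repl.of_equiv (LinearEquiv.piCongrLeft Λ B e))
  · intro A B _ _ _ _ _
    exact Repl.of_equiv { toFun := fun _ i => i.elim, invFun := fun _ i => i.elim,
                          left_inv := fun _ => Subsingleton.elim _ _,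
                          right_inv := fun _ => Subsingleton.elim _ _,
                          map_add' := fun _ _ => Subsingleton.elim _ _,
                          map_smul' := fun _ _ => Subsingleton.elim _ _ }
  · intro α _ h A B _ _ _ _ hAB
    exact ((Repl.of_equiv (piOptionEquiv A)).trans
      ((hAB none).prod (h fun i => hAB (some i)))).trans (Repl.of_equiv (piOptionEquiv B).symm)

end Repl

section Step

variable {Λ U S : Type} [CommRing Λ] [AddCommGroup U] [Module Λ U]
  {cl : ClosureOperator (Submodule Λ U)} [CommRing S] [Algebra Λ S]

open Ideal

/-- Replacing an ideal by the unit ideal, along the filtration by a principal ideal. -/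
theorem repl_ideal_top (f α : S) (I : Ideal S) (hmem : α * f ∈ I)
    (hle : ∀ y, f * y ∈ I → ∃ z, f * y = α * f * z)
    (hinj : ∀ y, α * f * y = 0 → f * y = 0)
    (h1 : ExtVanish cl (I.map (Ideal.Quotient.mk (span {f}))))
    (h2 : ExtVanish cl (S ⧸ span {f}))
    (h3 : Repl cl (I.map (Ideal.Quotient.mk (span {f}))) (S ⧸ span {f})) :
    Repl cl I S := by
  intro D _ _ hD
  have hJI : span {α * f} ≤ I := by
    rw [span_le]; simpa using hmem
  let i : span {α * f} →ₗ[Λ] I := (Submodule.inclusion hJI).restrictScalars Λ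
  let p : I →ₗ[Λ] I.map (Ideal.Quotient.mk (span {f})) :=
    LinearMap.codRestrict ((I.map (Ideal.Quotient.mk (span {f}))).restrictScalars Λ)
      ((Ideal.Quotient.mkₐ Λ (span {f})).toLinearMap ∘ₗ I.subtype.restrictScalars Λ)
      (fun x => Ideal.mem_map_of_mem _ x.2)
  have hpv : ∀ x : I, ((p x : I.map (Ideal.Quotient.mk (span {f}))) : S ⧸ span {f}) =
    Ideal.Quotient.mk (span {f}) (x : S) := fun _ => rfl
  have hp : Function.Surjective p := by
    rintro ⟨y, hy⟩
    obtain ⟨x, hx, rfl⟩ := (Ideal.mem_map_iff_of_surjective _ Ideal.Quotient.mk_surjective).1 hy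
    exact ⟨⟨x, hx⟩, rfl⟩
  have hi : Function.Injective i := Submodule.inclusion_injective hJI
  have hex : Function.Exact i p := by
    intro x
    constructor
    · intro hx
      have h0 : Ideal.Quotient.mk (span {f}) (x : S) = 0 := by rw [← hpv, hx]; rfl
      rw [Ideal.Quotient.eq_zero_iff_mem, mem_span_singleton'] at h0
      obtain ⟨y, hy⟩ := h0
      obtain ⟨z, hz⟩ := hle y (by rw [mul_comm, hy]; exact x.2)
      refine ⟨⟨(x : S), ?_⟩, rfl⟩
      rw [mem_span_singleton']
      exact ⟨z, by rw [← hy, mul_comm y, hz, mul_comm]⟩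
    · rintro ⟨⟨z, hz⟩, rfl⟩
      apply Subtype.ext
      rw [hpv]
      rw [mem_span_singleton'] at hz
      obtain ⟨y, rfl⟩ := hz
      change Ideal.Quotient.mk (span {f}) (y * (α * f)) = 0
      rw [Ideal.Quotient.eq_zero_iff_mem, mem_span_singleton']
      exact ⟨y * α, by ring⟩
  have g1 := (gen_prod_iff_of_exact (D := D) h1 i p hi hp hex).1 hD
  have g2 := h3 _ (g1.of_equiv (LinearEquiv.prodComm Λ _ _))
  let j : span {f} →ₗ[Λ] S := (Submodule.subtype (span {f})).restrictScalars Λ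
  let q : S →ₗ[Λ] S ⧸ span {f} := (Ideal.Quotient.mkₐ Λ (span {f})).toLinearMap
  let m : span {f} →ₗ[Λ] span {α * f} :=
    LinearMap.codRestrict ((span {α * f}).restrictScalars Λ)
      (LinearMap.mulLeft Λ α ∘ₗ j) (by
        rintro ⟨z, hz⟩
        rw [mem_span_singleton'] at hz
        obtain ⟨y, rfl⟩ := hz
        change α * (y * f) ∈ span {α * f}
        rw [mem_span_singleton']
        exact ⟨y, by ring⟩)
  have hm : Function.Bijective m := by
    constructor
    · rw [injective_iff_map_eq_zero]
      rintro ⟨z, hz⟩ h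
      have h' : α * z = 0 := congrArg Subtype.val h
      obtain ⟨y, rfl⟩ := mem_span_singleton'.1 hz
      apply Subtype.ext
      change y * f = 0
      rw [mul_comm]
      exact hinj y (by rw [← h']; ring)
    · rintro ⟨z, hz⟩
      obtain ⟨y, rfl⟩ := mem_span_singleton'.1 hz
      refine ⟨⟨y * f, mem_span_singleton'.2 ⟨y, rfl⟩⟩, Subtype.ext ?_⟩
      change α * (y * f) = y * (α * f)
      ring
  have g3 : Gen cl ((span {f} × D) × (S ⧸ span {f})) :=
    g2.of_equiv ((LinearEquiv.prodComm Λ _ _).trans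
      (((LinearEquiv.ofBijective m hm).symm.prodCongr (LinearEquiv.refl Λ D)).prodCongr
        (LinearEquiv.refl Λ (S ⧸ span {f}))))
  refine (gen_prod_iff_of_exact (D := D) h2 j q Subtype.val_injective
    Ideal.Quotient.mk_surjective ?_).2 g3
  intro x
  constructor
  · intro hx
    exact ⟨⟨x, Ideal.Quotient.eq_zero_iff_mem.1 hx⟩, rfl⟩
  · rintro ⟨z, rfl⟩
    exact Ideal.Quotient.eq_zero_iff_mem.2 z.2

/-- A principal ideal generated by a regular element is free. -/
noncomputable def principalEquiv (b : S) (hb : ∀ y, b * y = 0 → y = 0) : S ≃ₗ[Λ] span {b} :=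
  LinearEquiv.ofBijective
    (LinearMap.codRestrict ((span {b}).restrictScalars Λ) (LinearMap.mulLeft Λ b)
      (fun x => mem_span_singleton'.2 ⟨x, mul_comm _ _⟩) : S →ₗ[Λ] span {b}) (by
    constructor
    · rw [injective_iff_map_eq_zero]
      intro x hx
      exact hb x (congrArg Subtype.val hx)
    · rintro ⟨z, hz⟩
      obtain ⟨y, rfl⟩ := mem_span_singleton'.1 hz
      exact ⟨y, Subtype.ext (mul_comm _ _)⟩)

/-- Variant of `repl_ideal_top` where the image of the ideal is principal. -/
theorem repl_ideal_top_of_principal (f α β : S) (I : Ideal S) (hmem : α * f ∈ I)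
    (hle : ∀ y, f * y ∈ I → ∃ z, f * y = α * f * z)
    (hinj : ∀ y, α * f * y = 0 → f * y = 0)
    (hβ : I ⊔ span {f} = span {β} ⊔ span {f})
    (hβ' : ∀ y, β * y ∈ span {f} → y ∈ span {f})
    (h2 : ExtVanish cl (S ⧸ span {f})) :
    Repl cl I S := by
  have hI : I.map (Ideal.Quotient.mk (span {f})) = span {Ideal.Quotient.mk (span {f}) β} := by
    have h := congrArg (Ideal.map (Ideal.Quotient.mk (span {f}))) hβ
    rw [Ideal.map_sup, Ideal.map_sup, Ideal.map_quotient_self, sup_bot_eq, sup_bot_eq,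
      Ideal.map_span, Set.image_singleton] at h
    exact h
  have e : (S ⧸ span {f}) ≃ₗ[Λ] I.map (Ideal.Quotient.mk (span {f})) := by
    rw [hI]
    refine principalEquiv _ fun y => ?_
    obtain ⟨y, rfl⟩ := Ideal.Quotient.mk_surjective y
    rw [← map_mul, Ideal.Quotient.eq_zero_iff_mem, Ideal.Quotient.eq_zero_iff_mem]
    exact hβ' y
  exact repl_ideal_top f α I hmem hle hinj (h2.of_equiv e) h2 (Repl.of_equiv e.symm)

/-- A quotient by an element that factors compatibly through comaximal cofactors is a retract. -/
theorem extVanish_quotient_of_cofactors {ι : Type} [Fintype ι] (F : S) (h f g : ι → S)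
    (hf : ∀ r, h r * f r = F) (hg : ∑ r, g r * f r = 1)
    (hext : ∀ r, ExtVanish cl (S ⧸ span {h r})) : ExtVanish cl (S ⧸ span {F}) := by
  have hle : ∀ r, span {F} ≤ span {h r} := fun r => by
    rw [span_singleton_le_span_singleton]
    exact ⟨f r, (hf r).symm⟩
  let i : (S ⧸ span {F}) →ₗ[Λ] ∀ r, S ⧸ span {h r} :=
    LinearMap.pi fun r => (Ideal.Quotient.factorₐ Λ (hle r)).toLinearMap
  let s : ∀ r, (S ⧸ span {h r}) →ₗ[S] S ⧸ span {F} := fun r =>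
    Submodule.liftQ _ (Submodule.mkQ (span {F}) ∘ₗ LinearMap.mulLeft S (g r * f r)) (by
      rw [Ideal.span, Submodule.span_le, Set.singleton_subset_iff]
      change Ideal.Quotient.mk (span {F}) (g r * f r * h r) = 0
      rw [Ideal.Quotient.eq_zero_iff_mem, mem_span_singleton']
      exact ⟨g r, by rw [← hf r]; ring⟩)
  let ρ : (∀ r, S ⧸ span {h r}) →ₗ[Λ] S ⧸ span {F} :=
    ∑ r, (s r).restrictScalars Λ ∘ₗ LinearMap.proj r
  refine (ExtVanish.pi hext).of_retract i ρ ?_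
  apply LinearMap.ext
  intro y
  obtain ⟨y, rfl⟩ := Ideal.Quotient.mk_surjective y
  have : ρ (i (Ideal.Quotient.mk (span {F}) y)) =
      ∑ r, Ideal.Quotient.mk (span {F}) (g r * f r * y) := by
    simp only [ρ, LinearMap.sum_apply]
    rfl
  rw [LinearMap.comp_apply, this, ← map_sum, ← Finset.sum_mul, hg, one_mul]
  rfl

end Step

section CyclicRing

open Polynomial

variable {S : Type} [CommRing S]

/-- `S` is presented as `ℤ[X]/(X ^ m - 1)` by the element `x`. -/
structure IsCyclicRing (x : S) (m : ℕ) : Prop where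
  pos : 0 < m
  surj : ∀ s : S, ∃ P : ℤ[X], aeval x P = s
  ker : ∀ P : ℤ[X], aeval x P = 0 ↔ (X ^ m - 1 : ℤ[X]) ∣ P

theorem Monic.dvd_of_dvd_int_mul {F P : ℤ[X]} (hF : F.Monic) {p : ℤ} (hp : p ≠ 0)
    (h : F ∣ (p : ℤ[X]) * P) : F ∣ P := by
  have h' : F ∣ p • P := by rwa [zsmul_eq_mul]
  rw [← modByMonic_eq_zero_iff_dvd hF, smul_modByMonic] at h'
  rw [← modByMonic_eq_zero_iff_dvd hF]
  exact (smul_eq_zero.1 h').resolve_left hp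

theorem exists_eq_X_sub_mul_add (P : ℤ[X]) (t : ℤ) :
    ∃ Q : ℤ[X], P = (X - (t : ℤ[X])) * Q + ((P.eval t : ℤ) : ℤ[X]) := by
  have h : (X - C t) ∣ P - C (P.eval t) := by
    rw [dvd_iff_isRoot]; simp
  obtain ⟨Q, hQ⟩ := h
  refine ⟨Q, ?_⟩
  rw [eq_intCast, eq_intCast] at hQ
  rw [← hQ]; ring

namespace IsCyclicRing

variable {x : S} {m : ℕ} (hx : IsCyclicRing x m)
include hx

theorem pow_eq_one : x ^ m = 1 := by
  have := (hx.ker (X ^ m - 1)).2 dvd_rfl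
  simpa [sub_eq_zero] using this

theorem torsionFree {p : ℤ} (hp : p ≠ 0) {s : S} (h : (p : S) * s = 0) : s = 0 := by
  obtain ⟨P, rfl⟩ := hx.surj s
  rw [hx.ker]
  refine Monic.dvd_of_dvd_int_mul (monic_X_pow_sub_C 1 hx.pos.ne') hp ?_
  rw [← hx.ker, map_mul, map_intCast, h]

theorem mem_ideal_iff {q t : ℤ} (ht : q ∣ t ^ m - 1) (P : ℤ[X]) :
    aeval x P ∈ Ideal.span {(q : S), x - (t : S)} ↔ q ∣ P.eval t := by
  rw [Ideal.mem_span_pair]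
  constructor
  · rintro ⟨a, b, hab⟩
    obtain ⟨A, rfl⟩ := hx.surj a
    obtain ⟨B, rfl⟩ := hx.surj b
    have h0 : aeval x (P - (A * (q : ℤ[X]) + B * (X - (t : ℤ[X])))) = 0 := by
      simp [← hab]
    obtain ⟨E, hE⟩ := (hx.ker _).1 h0
    have := congrArg (eval t) hE
    simp only [eval_sub, eval_add, eval_mul, eval_intCast, eval_X, eval_pow, eval_one,
      Int.cast_id, sub_self, mul_zero, add_zero] at this
    rw [sub_eq_iff_eq_add.1 this]
    exact dvd_add (dvd_mul_of_dvd_left ht _) (dvd_mul_left _ _)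
  · rintro ⟨b, hb⟩
    obtain ⟨Q, hQ⟩ := exists_eq_X_sub_mul_add P t
    refine ⟨b, aeval x Q, ?_⟩
    conv_rhs => rw [hQ, hb]
    simp
    ring

theorem mem_span_iff {f : ℤ[X]} (hf : f ∣ X ^ m - 1) (P : ℤ[X]) :
    aeval x P ∈ Ideal.span {aeval x f} ↔ f ∣ P := by
  rw [Ideal.mem_span_singleton']
  constructor
  · rintro ⟨a, ha⟩
    obtain ⟨A, rfl⟩ := hx.surj a
    have : aeval x (P - A * f) = 0 := by rw [map_sub, map_mul, ha, sub_self]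
    have := hf.trans ((hx.ker _).1 this)
    simpa using dvd_add this (dvd_mul_left f A)
  · rintro ⟨A, rfl⟩
    exact ⟨aeval x A, by rw [map_mul, mul_comm]⟩

end IsCyclicRing

variable {Λ U : Type} [CommRing Λ] [AddCommGroup U] [Module Λ U]
  {cl : ClosureOperator (Submodule Λ U)} [Algebra Λ S]

/-- Data exhibiting stable freeness of the ideal `(p * q', X - t)` of `ℤ[X]/(X ^ m - 1)`
at the level of `f`. -/
structure LevelData (m : ℕ) (p q' t : ℤ) (f Φ α : ℤ[X]) : Prop where
  hp : p ≠ 0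
  hq : q' ≠ 0
  hfac : f * Φ = X ^ m - 1
  ht : p * q' ∣ t ^ m - 1
  hft : ∃ c, f.eval t = q' * c ∧ IsCoprime c p
  hαt : p ∣ α.eval t
  hαp : ∃ u v, (p : ℤ[X]) = α * u + Φ * v
  hαX : ∃ u v, X - (t : ℤ[X]) = α * u + Φ * v

variable {m : ℕ} {p q' t : ℤ} {f Φ α : ℤ[X]} {x : S}

theorem LevelData.inter (h : LevelData m p q' t f Φ α) (hx : IsCyclicRing x m) :
    (aeval x α * aeval x f ∈ Ideal.span {((p * q' : ℤ) : S), x - (t : S)}) ∧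
    (∀ y, aeval x f * y ∈ Ideal.span {((p * q' : ℤ) : S), x - (t : S)} →
      ∃ z, aeval x f * y = aeval x α * aeval x f * z) ∧
    (∀ y, aeval x α * aeval x f * y = 0 → aeval x f * y = 0) := by
  obtain ⟨hp, hq, hfac, ht, ⟨c, hc, hcp⟩, ⟨b, hb⟩, ⟨u, v, huv⟩, ⟨u', v', huv'⟩⟩ := h
  have h0 : aeval x f * aeval x Φ = 0 := by
    rw [← map_mul, hx.ker, hfac]
  have hp1 : (p : S) * aeval x f = aeval x α * aeval x f * aeval x u := by
    have := congrArg (aeval x) huv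
    simp only [map_intCast, map_add, map_mul] at this
    rw [this]
    linear_combination aeval x v * h0
  have hX1 : (x - (t : S)) * aeval x f = aeval x α * aeval x f * aeval x u' := by
    have := congrArg (aeval x) huv'
    simp only [map_intCast, map_add, map_mul, map_sub, aeval_X] at this
    rw [this]
    linear_combination aeval x v' * h0
  refine ⟨?_, ?_, ?_⟩
  · rw [← map_mul, hx.mem_ideal_iff ht, eval_mul, hc, hb]
    exact ⟨b * c, by ring⟩
  · intro y hy
    obtain ⟨Y, rfl⟩ := hx.surj y
    rw [← map_mul, hx.mem_ideal_iff ht, eval_mul, hc] at hy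
    have hY : p ∣ Y.eval t := by
      rw [mul_assoc, mul_comm p, mul_dvd_mul_iff_left hq] at hy
      exact hcp.symm.dvd_of_dvd_mul_left hy
    obtain ⟨d, hd⟩ := hY
    obtain ⟨Q, hQ⟩ := exists_eq_X_sub_mul_add Y t
    refine ⟨aeval x u' * aeval x Q + aeval x u * d, ?_⟩
    conv_lhs => rw [hQ, hd]
    simp only [map_add, map_mul, map_sub, aeval_X, map_intCast, Int.cast_mul]
    linear_combination (d : S) * hp1 + aeval x Q * hX1
  · intro y hy
    apply hx.torsionFree hp
    linear_combination y * hp1 + aeval x u * hy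

theorem LevelData.repl (h : LevelData m p q' t f Φ α) (hx : IsCyclicRing x m)
    (β : ℤ[X]) (hβt : q' ∣ β.eval t) (hβp : ∃ u v, (p : ℤ[X]) = β * u + f * v)
    (hβX : ∃ u v, X - (t : ℤ[X]) = β * u + f * v)
    (h2 : ExtVanish cl (S ⧸ Ideal.span {aeval x f})) :
    Repl cl (Ideal.span {((p * q' : ℤ) : S), x - (t : S)}) S := by
  obtain ⟨hm, hle, hinj⟩ := h.inter hx
  obtain ⟨hp, hq0, hfac, ht, ⟨c, hc, ⟨a, b, hab⟩⟩, -, -, -⟩ := h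
  obtain ⟨u, v, huv⟩ := hβp
  obtain ⟨u', v', huv'⟩ := hβX
  obtain ⟨w, hw⟩ := hβt
  have huv1 := congrArg (aeval x) huv
  simp only [map_intCast, map_add, map_mul] at huv1
  refine repl_ideal_top_of_principal (aeval x f) (aeval x α) (aeval x β) _ hm hle hinj ?_ ?_ h2
  · apply le_antisymm
    · refine sup_le ?_ le_sup_right
      have huv2 := congrArg (aeval x) huv'
      simp only [map_intCast, map_add, map_mul, map_sub, aeval_X] at huv2
      rw [Ideal.span_le, ← Ideal.span_union, Set.singleton_union]
      rintro _ (rfl | rfl)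
      · rw [SetLike.mem_coe, Ideal.mem_span_pair]
        exact ⟨q' * aeval x u, q' * aeval x v, by push_cast; rw [huv1]; ring⟩
      · rw [SetLike.mem_coe, Ideal.mem_span_pair]
        exact ⟨aeval x u', aeval x v', by rw [huv2]; ring⟩
    · refine sup_le ?_ le_sup_right
      rw [Ideal.span_singleton_le_iff_mem]
      set J := Ideal.span {((p * q' : ℤ) : S), x - (t : S)} ⊔ Ideal.span {aeval x f}
      have hJX : x - (t : S) ∈ J := Ideal.mem_sup_left (Ideal.subset_span (by simp))
      have hJq : ((p * q' : ℤ) : S) ∈ J := Ideal.mem_sup_left (Ideal.subset_span (by simp))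
      have hJf : aeval x f ∈ J := Ideal.mem_sup_right (Ideal.subset_span (by simp))
      have hq' : (q' : S) ∈ J := by
        obtain ⟨Q, hQ⟩ := exists_eq_X_sub_mul_add f t
        have h1 := congrArg (aeval x) hQ
        rw [hc] at h1
        simp only [map_add, map_mul, map_sub, aeval_X, map_intCast, Int.cast_mul] at h1
        have h2 : (a : S) * c + b * p = 1 := by exact_mod_cast congrArg (Int.cast : ℤ → S) hab
        have h3 : (q' : S) = (a * aeval x f - a * aeval x Q * (x - (t : S))) +
            b * ((p * q' : ℤ) : S) := by
          rw [h1]; push_cast; linear_combination (-(q' : S)) * h2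
        rw [h3]
        exact add_mem (sub_mem (J.mul_mem_left _ hJf) (J.mul_mem_left _ hJX))
          (J.mul_mem_left _ hJq)
      obtain ⟨Q, hQ⟩ := exists_eq_X_sub_mul_add β t
      rw [hQ, hw]
      simp only [map_add, map_mul, map_sub, aeval_X, map_intCast, Int.cast_mul]
      refine add_mem (J.mul_mem_right _ hJX) ?_
      exact J.mul_mem_right _ hq'
  · intro y hy
    obtain ⟨Y, rfl⟩ := hx.surj y
    have hfd : f ∣ X ^ m - 1 := ⟨Φ, hfac.symm⟩
    rw [← map_mul, hx.mem_span_iff hfd] at hy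
    rw [hx.mem_span_iff hfd]
    have hX1 : (X ^ m - 1 : ℤ[X]).Monic := monic_X_pow_sub_C 1 hx.pos.ne'
    have hunit : IsUnit f.leadingCoeff := by
      refine IsUnit.of_mul_eq_one Φ.leadingCoeff ?_
      rw [← leadingCoeff_mul, hfac, hX1]
    rcases Int.isUnit_iff.1 hunit with h1 | h1
    · refine Monic.dvd_of_dvd_int_mul h1 hp ?_
      rw [huv, add_mul]
      exact dvd_add (by rw [mul_right_comm]; exact hy.mul_right _)
        (by rw [mul_assoc]; exact dvd_mul_right _ _)
    · rw [← neg_dvd] at hy ⊢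
      refine Monic.dvd_of_dvd_int_mul (by rw [Monic, leadingCoeff_neg, h1, neg_neg]) hp ?_
      rw [huv, add_mul]
      exact dvd_add (by rw [mul_right_comm]; exact hy.mul_right _)
        (by rw [mul_assoc, neg_dvd]; exact dvd_mul_right _ _)

end CyclicRing

section Cofactors

open Polynomial

theorem prime_pow_dvd_of_cyclotomic_root {k : Type} [Field k] {μ : k} {d d' r j : ℕ}
    (hd0 : 0 < d) (hd0' : 0 < d') (hr : r.Prime) (hrk : (r : k) ≠ 0)
    (hd : (cyclotomic d k).IsRoot μ) (hd' : (cyclotomic d' k).IsRoot μ) (h : r ^ j ∣ d) :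
    r ^ j ∣ d' := by
  obtain ⟨ℓ, hℓ⟩ := CharP.exists k
  rcases CharP.char_is_prime_or_zero k ℓ with hp | rfl
  · have : Fact ℓ.Prime := ⟨hp⟩
    have key : ∀ d : ℕ, 0 < d → (cyclotomic d k).IsRoot μ → ∃ a e, d = ℓ ^ a * e ∧
        IsPrimitiveRoot μ e := by
      intro d hd0 hd
      obtain ⟨a, e, he, rfl⟩ := Nat.exists_eq_pow_mul_and_not_dvd hd0.ne' ℓ hp.ne_one
      have : NeZero (e : k) := ⟨fun h => he ((CharP.cast_eq_zero_iff k ℓ e).1 h)⟩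
      exact ⟨a, e, rfl, (isRoot_cyclotomic_prime_pow_mul_iff_of_charP).1 hd⟩
    obtain ⟨a, e, rfl, he⟩ := key d hd0 hd
    obtain ⟨a', e', rfl, he'⟩ := key d' hd0' hd'
    have : e = e' := he.unique he'
    subst this
    refine Dvd.dvd.mul_left ?_ _
    refine Nat.Coprime.dvd_of_dvd_mul_left ?_ h
    refine Nat.Coprime.pow _ _ ((Nat.coprime_primes hr hp).2 ?_)
    rintro rfl
    exact hrk (CharP.cast_eq_zero k r)
  · have : CharZero k := CharP.charP_to_charZero k
    have : NeZero (d : k) := ⟨by exact_mod_cast hd0.ne'⟩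
    have : NeZero (d' : k) := ⟨by exact_mod_cast hd0'.ne'⟩
    rw [isRoot_cyclotomic_iff] at hd hd'
    rwa [← hd.unique hd']

/-- The product of the cyclotomic polynomials of level `d ∣ m`, `d ∤ m / r`, `d ≠ m`. -/
noncomputable def cofactor (m r : ℕ) : ℤ[X] :=
  ∏ d ∈ m.properDivisors \ (m / r).divisors, cyclotomic d ℤ

theorem X_pow_sub_one_mul_cofactor {m r : ℕ} (hr : r ∈ m.primeFactors) :
    (X ^ (m / r) - 1) * cofactor m r = ∏ d ∈ m.properDivisors, cyclotomic d ℤ := by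
  have hrp := Nat.prime_of_mem_primeFactors hr
  have hrd := Nat.dvd_of_mem_primeFactors hr
  have hm : 0 < m := Nat.pos_of_mem_primeFactors hr |> fun _ => by
    rcases Nat.eq_zero_or_pos m with rfl | h
    · simp at hr
    · exact h
  have hmr : 0 < m / r := Nat.div_pos (Nat.le_of_dvd hm hrd) hrp.pos
  rw [← prod_cyclotomic_eq_X_pow_sub_one hmr, cofactor, mul_comm]
  refine Finset.prod_sdiff fun d hd => ?_
  rw [Nat.mem_divisors] at hd
  rw [Nat.mem_properDivisors]
  exact ⟨hd.1.trans (Nat.div_dvd_of_dvd hrd),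
    (Nat.le_of_dvd hmr hd.1).trans_lt (Nat.div_lt_self hm hrp.one_lt)⟩

theorem prime_pow_dvd_of_not_dvd_div {m d r j : ℕ} (hm : 0 < m) (hr : r.Prime) (hrm : r ∣ m)
    (hd : d ∣ m) (hd' : ¬ d ∣ m / r) (hj : r ^ j ∣ m) : r ^ j ∣ d := by
  have : Fact r.Prime := ⟨hr⟩
  have hd0 : d ≠ 0 := ne_zero_of_dvd_ne_zero hm.ne' hd
  obtain ⟨c, rfl⟩ := hd
  have hc : ¬ r ∣ c := by
    rintro ⟨c, rfl⟩
    apply hd'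
    rw [show d * (r * c) = d * c * r by ring, Nat.mul_div_cancel _ hr.pos]
    exact dvd_mul_right _ _
  exact ((Nat.Prime.coprime_iff_not_dvd hr).2 hc).pow_left j |>.dvd_of_dvd_mul_right hj

theorem span_cofactor {m : ℕ} (hm : 1 < m) :
    Ideal.span (Set.range fun r : m.primeFactors => cofactor m r) = ⊤ := by
  by_contra hcon
  obtain ⟨M, hM, hle⟩ := Ideal.exists_le_maximal _ hcon
  let k := ℤ[X] ⧸ M
  let _ : Field k := Ideal.Quotient.field M
  let φ : ℤ[X] →+* k := Ideal.Quotient.mk M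
  let μ : k := φ X
  have hroot : ∀ d, φ (cyclotomic d ℤ) = 0 → (cyclotomic d k).IsRoot μ := by
    intro d hd
    have hφ : φ = eval₂RingHom (Int.castRingHom k) μ := by
      refine Polynomial.ringHom_ext (fun a => ?_) ?_
      · rw [coe_eval₂RingHom, eval₂_C]; simp
      · rw [coe_eval₂RingHom, eval₂_X]
    rw [IsRoot.def, ← map_cyclotomic_int, eval_map]
    rw [hφ] at hd
    exact hd
  have hm0 : 0 < m := by omega
  have key : ∀ r ∈ m.primeFactors, ∃ d, d ∣ m ∧ d ≠ m ∧ (cyclotomic d k).IsRoot μ ∧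
      ∀ j, r ^ j ∣ m → r ^ j ∣ d := by
    intro r hr
    have h0 : φ (cofactor m r) = 0 := by
      rw [Ideal.Quotient.eq_zero_iff_mem]
      exact hle (Ideal.subset_span ⟨⟨r, hr⟩, rfl⟩)
    rw [cofactor, map_prod, Finset.prod_eq_zero_iff] at h0
    obtain ⟨d, hd, hd0⟩ := h0
    rw [Finset.mem_sdiff, Nat.mem_properDivisors, Nat.mem_divisors] at hd
    have hrm := Nat.dvd_of_mem_primeFactors hr
    have hrp := Nat.prime_of_mem_primeFactors hr
    have hmr : m / r ≠ 0 := (Nat.div_pos (Nat.le_of_dvd hm0 hrm) hrp.pos).ne'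
    exact ⟨d, hd.1.1, hd.1.2.ne, hroot d hd0, fun j hj =>
      prime_pow_dvd_of_not_dvd_div hm0 hrp hrm hd.1.1 (fun h => hd.2 ⟨h, hmr⟩) hj⟩
  obtain ⟨d0, hd0, hne, hroot0, hd0'⟩ : ∃ d, d ∣ m ∧ d ≠ m ∧ (cyclotomic d k).IsRoot μ ∧
      ∀ r ∈ m.primeFactors, (r : k) = 0 → ∀ j, r ^ j ∣ m → r ^ j ∣ d := by
    by_cases h : ∃ r ∈ m.primeFactors, (r : k) = 0
    · obtain ⟨r, hr, hrk⟩ := h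
      obtain ⟨d, h1, h2, h3, h4⟩ := key r hr
      refine ⟨d, h1, h2, h3, fun r' hr' hrk' => ?_⟩
      have : r = r' := by
        by_contra hne
        have hco := (Nat.coprime_primes (Nat.prime_of_mem_primeFactors hr)
          (Nat.prime_of_mem_primeFactors hr')).2 hne
        have hb := Nat.isCoprime_iff_coprime.2 hco
        obtain ⟨a, b, hab⟩ := hb
        have := congrArg (Int.cast : ℤ → k) hab
        push_cast at this
        rw [hrk, hrk'] at this
        simp at this
      subst this
      exact h4
    · obtain ⟨r, hr⟩ := Nat.nonempty_primeFactors.2 hm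
      obtain ⟨d, h1, h2, h3, -⟩ := key r hr
      exact ⟨d, h1, h2, h3, fun r' hr' hrk' => (h ⟨r', hr', hrk'⟩).elim⟩
  apply hne
  refine Nat.dvd_antisymm hd0 ?_
  rw [Nat.dvd_iff_prime_pow_dvd_dvd]
  intro r j hr hj
  rcases Nat.eq_zero_or_pos j with rfl | hj0
  · simp
  have hrm : r ∈ m.primeFactors := Nat.mem_primeFactors.2
    ⟨hr, (dvd_pow_self r hj0.ne').trans hj, hm0.ne'⟩
  by_cases hrk : (r : k) = 0
  · exact hd0' r hrm hrk j hj
  · obtain ⟨d, h1, h2, h3, h4⟩ := key r hrm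
    exact prime_pow_dvd_of_cyclotomic_root (Nat.pos_of_dvd_of_pos h1 hm0)
      (Nat.pos_of_dvd_of_pos hd0 hm0) hr hrk h3 hroot0 (h4 j hj)

variable {Λ U S : Type} [CommRing Λ] [AddCommGroup U] [Module Λ U]
  {cl : ClosureOperator (Submodule Λ U)} [CommRing S] [Algebra Λ S]

theorem extVanish_quotient_properDivisors {x : S} {m : ℕ} (hm : 1 < m)
    (hext : ∀ e, e ∣ m → ExtVanish cl (S ⧸ Ideal.span {x ^ e - 1})) :
    ExtVanish cl (S ⧸ Ideal.span {aeval x (∏ d ∈ m.properDivisors, cyclotomic d ℤ)}) := by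
  have h1 : (1 : ℤ[X]) ∈ Ideal.span (Set.range fun r : m.primeFactors => cofactor m r) := by
    rw [span_cofactor hm]; trivial
  obtain ⟨g, hg⟩ := (Ideal.mem_span_range_iff_exists_fun).1 h1
  refine extVanish_quotient_of_cofactors _ (fun r : m.primeFactors => x ^ (m / r) - 1)
    (fun r => aeval x (cofactor m r)) (fun r => aeval x (g r)) ?_ ?_
    (fun r => hext _ (Nat.div_dvd_of_dvd (Nat.dvd_of_mem_primeFactors r.2)))
  · intro r
    rw [← X_pow_sub_one_mul_cofactor r.2]
    simp
  · rw [← map_one (aeval x : ℤ[X] →ₐ[ℤ] S), ← hg, map_sum]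
    simp

end Cofactors

section Certificates

open Polynomial

theorem cyclotomic_eq_of_mul_eq {m : ℕ} (hm : 0 < m) (g B : ℤ[X]) (l : List ℕ)
    (hl : ∀ a ∈ l, ¬ m ∣ a) (h : g * (l.map fun a => (X ^ a - 1 : ℤ[X])).prod = (X ^ m - 1) * B)
    (hg : g.Monic) (hdeg : g.natDegree = m.totient) : cyclotomic m ℤ = g := by
  have hprime : Prime (cyclotomic m ℤ) := (cyclotomic.irreducible hm).prime
  have hdvd : cyclotomic m ℤ ∣ g := by
    have h1 : cyclotomic m ℤ ∣ g * (l.map fun a => (X ^ a - 1 : ℤ[X])).prod := by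
      rw [h]
      exact (cyclotomic.dvd_X_pow_sub_one m ℤ).mul_right B
    refine (hprime.dvd_or_dvd h1).resolve_right fun h2 => ?_
    rw [hprime.dvd_prod_iff] at h2
    obtain ⟨_, ha, h3⟩ := h2
    rw [List.mem_map] at ha
    obtain ⟨a, ha, rfl⟩ := ha
    apply hl a ha
    have hζ := Complex.isPrimitiveRoot_exp m hm.ne'
    obtain ⟨c, hc⟩ := h3
    have h4 := congrArg (aeval (Complex.exp (2 * Real.pi * Complex.I / m))) hc
    have h5 : aeval (Complex.exp (2 * Real.pi * Complex.I / m)) (cyclotomic m ℤ) = 0 := by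
      rw [aeval_def, ← eval_map, map_cyclotomic]
      exact hζ.isRoot_cyclotomic hm
    rw [map_mul, h5, zero_mul] at h4
    simp only [map_sub, map_pow, aeval_X, map_one, sub_eq_zero] at h4
    exact hζ.dvd_of_pow_eq_one a h4
  refine (eq_of_monic_of_dvd_of_natDegree_le (cyclotomic.monic m ℤ) hg hdvd ?_).symm
  rw [hdeg, natDegree_cyclotomic]

variable {Λ U S : Type} [CommRing Λ] [AddCommGroup U] [Module Λ U]
  {cl : ClosureOperator (Submodule Λ U)} [CommRing S] [Algebra Λ S]

theorem repl_of_certificate {x : S} {m : ℕ} (hx : IsCyclicRing x m) (hm : 1 < m)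
    (hext : ∀ e, e ∣ m → ExtVanish cl (S ⧸ Ideal.span {x ^ e - 1}))
    (p q' t c G : ℤ) (g α β F : ℤ[X]) (hg : cyclotomic m ℤ = g) (hF : F * g = X ^ m - 1)
    (hp : p ≠ 0) (hq : q' ≠ 0) (hG : g.eval t = G) (hG0 : G ≠ 0) (hc : t ^ m - 1 = q' * c * G)
    (hpG : p ∣ G) (hcp : IsCoprime c p) (hαt : p ∣ α.eval t)
    (hαp : ∃ u v, (p : ℤ[X]) = α * u + g * v)
    (hαX : ∃ u v, X - (t : ℤ[X]) = α * u + g * v)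
    (hβt : q' ∣ β.eval t) (hβp : ∃ u v, (p : ℤ[X]) = β * u + F * v)
    (hβX : ∃ u v, X - (t : ℤ[X]) = β * u + F * v) :
    Repl cl (Ideal.span {((p * q' : ℤ) : S), x - (t : S)}) S := by
  have hm0 : 0 < m := by omega
  have hfac : (∏ d ∈ m.properDivisors, cyclotomic d ℤ) * g = X ^ m - 1 := by
    rw [← hg, ← prod_cyclotomic_eq_X_pow_sub_one hm0,
      ← Nat.insert_self_properDivisors hm0.ne', Finset.prod_insert Nat.self_notMem_properDivisors,
      mul_comm]
  have hgne : g ≠ 0 := by rw [← hg]; exact cyclotomic_ne_zero m ℤ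
  have hFeq : (∏ d ∈ m.properDivisors, cyclotomic d ℤ) = F :=
    mul_right_cancel₀ hgne (hfac.trans hF.symm)
  have h2 := extVanish_quotient_properDivisors (cl := cl) hm hext
  rw [hFeq] at h2
  have hFt : F.eval t = q' * c := by
    have := congrArg (eval t) hF
    simp only [eval_mul, hG, eval_sub, eval_pow, eval_X, eval_one, hc] at this
    exact mul_right_cancel₀ hG0 this
  have data : LevelData m p q' t F g α :=
    { hp := hp
      hq := hq
      hfac := hF
      ht := by
        obtain ⟨G, rfl⟩ := hpG
        exact ⟨c * G, by rw [hc]; ring⟩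
      hft := ⟨c, hFt, hcp⟩
      hαt := hαt
      hαp := hαp
      hαX := hαX }
  exact data.repl hx β hβt hβp hβX h2

theorem repl_of_certificate_prime {x : S} {m : ℕ} (hx : IsCyclicRing x m) (hm : 1 < m)
    (hext : ∀ e, e ∣ m → ExtVanish cl (S ⧸ Ideal.span {x ^ e - 1}))
    (p t c G : ℤ) (g α : ℤ[X]) (hg : cyclotomic m ℤ = g)
    (hp : p ≠ 0) (hG : g.eval t = G) (hG0 : G ≠ 0) (hc : t ^ m - 1 = c * G)
    (hpG : p ∣ G) (hcp : IsCoprime c p) (hαt : p ∣ α.eval t)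
    (hαp : ∃ u v, (p : ℤ[X]) = α * u + g * v)
    (hαX : ∃ u v, X - (t : ℤ[X]) = α * u + g * v) :
    Repl cl (Ideal.span {(p : S), x - (t : S)}) S := by
  have hm0 : 0 < m := by omega
  have hfac : (∏ d ∈ m.properDivisors, cyclotomic d ℤ) * g = X ^ m - 1 := by
    rw [← hg, ← prod_cyclotomic_eq_X_pow_sub_one hm0, ← Nat.insert_self_properDivisors hm0.ne',
      Finset.prod_insert Nat.self_notMem_properDivisors, mul_comm]
  have := repl_of_certificate (cl := cl) hx hm hext p 1 t c G g α 1 _ hg hfac hp one_ne_zero hG hG0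
    (by rw [hc, one_mul]) hpG hcp hαt hαp hαX (one_dvd _) ⟨p, 0, by ring⟩
    ⟨X - (t : ℤ[X]), 0, by ring⟩
  rwa [mul_one] at this

end Certificates

section Certificates

open Polynomial

variable {Λ U S : Type} [CommRing Λ] [AddCommGroup U] [Module Λ U]
  {cl : ClosureOperator (Submodule Λ U)} [CommRing S] [Algebra Λ S]

theorem cyclotomic_int_4 : cyclotomic 4 ℤ =
      X ^ 2 + 1 := by
  refine cyclotomic_eq_of_mul_eq (by norm_num) _ (1) [2] (by decide) ?_
    ?_ ?_
  · simp only [List.map_cons, List.map_nil, List.prod_cons, List.prod_nil]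
    ring
  · monicity!
  · rw [show Nat.totient 4 = 2 by decide +kernel]
    compute_degree!

theorem repl_5 {x : S} (hx : IsCyclicRing x 4)
    (hext : ∀ e, e ∣ 4 → ExtVanish cl (S ⧸ Ideal.span {x ^ e - 1})) :
    Repl cl (Ideal.span {((5 : ℤ) : S), x - ((2 : ℤ) : S)}) S := by
  refine repl_of_certificate_prime hx (by norm_num) hext 5 2 (3) 5 _
    (-X + 2) cyclotomic_int_4 (by norm_num) (by simp) (by norm_num) (by norm_num) (by norm_num)
    (by norm_num) (by simp) ?_ ?_
  · refine ⟨X + 2,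
      1, ?_⟩
    push_cast
    ring
  · refine ⟨-1,
      0, ?_⟩
    push_cast
    ring

theorem cyclotomic_int_6 : cyclotomic 6 ℤ =
      X ^ 2 - X + 1 := by
  refine cyclotomic_eq_of_mul_eq (by norm_num) _ ((X - 1)) [3, 2] (by decide) ?_
    ?_ ?_
  · simp only [List.map_cons, List.map_nil, List.prod_cons, List.prod_nil]
    ring
  · monicity!
  · rw [show Nat.totient 6 = 2 by decide +kernel]
    compute_degree!

theorem repl_7 {x : S} (hx : IsCyclicRing x 6)
    (hext : ∀ e, e ∣ 6 → ExtVanish cl (S ⧸ Ideal.span {x ^ e - 1})) :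
    Repl cl (Ideal.span {((7 : ℤ) : S), x - ((3 : ℤ) : S)}) S := by
  refine repl_of_certificate_prime hx (by norm_num) hext 7 3 (104) 7 _
    (-X ^ 2 + 2) cyclotomic_int_6 (by norm_num) (by simp) (by norm_num) (by norm_num) (by norm_num)
    (by norm_num) (by simp) ?_ ?_
  · refine ⟨X + 2,
      X + 3, ?_⟩
    push_cast
    ring
  · refine ⟨-1,
      -1, ?_⟩
    push_cast
    ring

theorem cyclotomic_int_10 : cyclotomic 10 ℤ =
      X ^ 4 - X ^ 3 + X ^ 2 - X + 1 := by
  refine cyclotomic_eq_of_mul_eq (by norm_num) _ ((X - 1)) [5, 2] (by decide) ?_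
    ?_ ?_
  · simp only [List.map_cons, List.map_nil, List.prod_cons, List.prod_nil]
    ring
  · monicity!
  · rw [show Nat.totient 10 = 4 by decide +kernel]
    compute_degree!

theorem repl_11 {x : S} (hx : IsCyclicRing x 10)
    (hext : ∀ e, e ∣ 10 → ExtVanish cl (S ⧸ Ideal.span {x ^ e - 1})) :
    Repl cl (Ideal.span {((11 : ℤ) : S), x - ((2 : ℤ) : S)}) S := by
  refine repl_of_certificate_prime hx (by norm_num) hext 11 2 (93) 11 _
    (-X ^ 3 - X ^ 2 + 1) cyclotomic_int_10 (by norm_num) (by simp)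
    (by norm_num) (by norm_num) (by norm_num)
    (by norm_num) (by simp) ?_ ?_
  · refine ⟨3 * X ^ 3 + 3 * X ^ 2 - 2 * X + 4,
      3 * X ^ 2 + 9 * X + 7, ?_⟩
    push_cast
    ring
  · refine ⟨-X ^ 2 + X - 1,
      -X - 1, ?_⟩
    push_cast
    ring

theorem cyclotomic_int_12 : cyclotomic 12 ℤ =
      X ^ 4 - X ^ 2 + 1 := by
  refine cyclotomic_eq_of_mul_eq (by norm_num) _ ((X ^ 2 - 1)) [6, 4] (by decide) ?_
    ?_ ?_
  · simp only [List.map_cons, List.map_nil, List.prod_cons, List.prod_nil]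
    ring
  · monicity!
  · rw [show Nat.totient 12 = 4 by decide +kernel]
    compute_degree!

theorem repl_13 {x : S} (hx : IsCyclicRing x 12)
    (hext : ∀ e, e ∣ 12 → ExtVanish cl (S ⧸ Ideal.span {x ^ e - 1})) :
    Repl cl (Ideal.span {((13 : ℤ) : S), x - ((2 : ℤ) : S)}) S := by
  refine repl_of_certificate_prime hx (by norm_num) hext 13 2 (315) 13 _
    (X ^ 3 + X ^ 2 + 1) cyclotomic_int_12 (by norm_num) (by simp)
    (by norm_num) (by norm_num) (by norm_num)
    (by norm_num) (by simp) ?_ ?_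
  · refine ⟨-X ^ 3 - 2 * X ^ 2 - 3 * X + 7,
      X ^ 2 + 3 * X + 6, ?_⟩
    push_cast
    ring
  · refine ⟨X - 1,
      -1, ?_⟩
    push_cast
    ring

theorem cyclotomic_int_16 : cyclotomic 16 ℤ =
      X ^ 8 + 1 := by
  refine cyclotomic_eq_of_mul_eq (by norm_num) _ (1) [8] (by decide) ?_
    ?_ ?_
  · simp only [List.map_cons, List.map_nil, List.prod_cons, List.prod_nil]
    ring
  · monicity!
  · rw [show Nat.totient 16 = 8 by decide +kernel]
    compute_degree!

theorem repl_17 {x : S} (hx : IsCyclicRing x 16)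
    (hext : ∀ e, e ∣ 16 → ExtVanish cl (S ⧸ Ideal.span {x ^ e - 1})) :
    Repl cl (Ideal.span {((17 : ℤ) : S), x - ((3 : ℤ) : S)}) S := by
  refine repl_of_certificate_prime hx (by norm_num) hext 17 3 (6560) 6562 _
    (-X ^ 3 + X ^ 2 + 1) cyclotomic_int_16 (by norm_num) (by simp)
    (by norm_num) (by norm_num) (by norm_num)
    (by norm_num) (by simp) ?_ ?_
  · refine ⟨-3 * X ^ 7 - 9 * X ^ 6 + 7 * X ^ 5 + 4 * X ^ 4 - 5 * X ^ 3 + 2 * X ^ 2 + 6 * X + 1,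
      -3 * X ^ 2 - 6 * X + 16, ?_⟩
    push_cast
    ring
  · refine ⟨2 * X ^ 6 - X ^ 5 - X ^ 4 + X ^ 3 - X,
      2 * X - 3, ?_⟩
    push_cast
    ring

theorem cyclotomic_int_18 : cyclotomic 18 ℤ =
      X ^ 6 - X ^ 3 + 1 := by
  refine cyclotomic_eq_of_mul_eq (by norm_num) _ ((X ^ 3 - 1)) [9, 6] (by decide) ?_
    ?_ ?_
  · simp only [List.map_cons, List.map_nil, List.prod_cons, List.prod_nil]
    ring
  · monicity!
  · rw [show Nat.totient 18 = 6 by decide +kernel]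
    compute_degree!

theorem repl_19 {x : S} (hx : IsCyclicRing x 18)
    (hext : ∀ e, e ∣ 18 → ExtVanish cl (S ⧸ Ideal.span {x ^ e - 1})) :
    Repl cl (Ideal.span {((19 : ℤ) : S), x - ((2 : ℤ) : S)}) S := by
  refine repl_of_certificate_prime hx (by norm_num) hext 19 2 (4599) 57 _
    (X ^ 4 + X + 1) cyclotomic_int_18 (by norm_num) (by simp)
    (by norm_num) (by norm_num) (by norm_num)
    (by norm_num) (by simp) ?_ ?_
  · refine ⟨-15 * X ^ 5 + 8 * X ^ 4 - 3 * X ^ 3 + 9 * X ^ 2 - X - 2,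
      15 * X ^ 3 - 8 * X ^ 2 + 3 * X + 21, ?_⟩
    push_cast
    ring
  · refine ⟨2 * X ^ 5 - X ^ 4 - X ^ 2 + 1,
      -2 * X ^ 3 + X ^ 2 - 3, ?_⟩
    push_cast
    ring

theorem cyclotomic_int_22 : cyclotomic 22 ℤ =
      X ^ 10 - X ^ 9 + X ^ 8 - X ^ 7 + X ^ 6 - X ^ 5 + X ^ 4 - X ^ 3 + X ^ 2 - X + 1 := by
  refine cyclotomic_eq_of_mul_eq (by norm_num) _ ((X - 1)) [11, 2] (by decide) ?_
    ?_ ?_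
  · simp only [List.map_cons, List.map_nil, List.prod_cons, List.prod_nil]
    ring
  · monicity!
  · rw [show Nat.totient 22 = 10 by decide +kernel]
    compute_degree!

theorem repl_23 {x : S} (hx : IsCyclicRing x 22)
    (hext : ∀ e, e ∣ 22 → ExtVanish cl (S ⧸ Ideal.span {x ^ e - 1})) :
    Repl cl (Ideal.span {((23 : ℤ) : S), x - ((5 : ℤ) : S)}) S := by
  refine repl_of_certificate_prime hx (by norm_num) hext 23 5 (292968744) 8138021 _
    (-X ^ 9 + X ^ 3 + 1) cyclotomic_int_22 (by norm_num) (by simp)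
    (by norm_num) (by norm_num) (by norm_num)
    (by norm_num) (by simp) ?_ ?_
  · refine ⟨20 * X ^ 9 - 12 * X ^ 8 + 6 * X ^ 7 - 13 * X ^ 6 + X ^ 5 - 15 * X ^ 4 + 14 * X ^ 3 +
      4 * X ^ 2 + 17 * X - 4,
      20 * X ^ 8 + 8 * X ^ 7 - 6 * X ^ 6 - 7 * X ^ 5 - 12 * X ^ 4 - 14 * X ^ 3 - 21 * X ^
      2 + 10 * X + 27, ?_⟩
    push_cast
    ring
  · refine ⟨-4 * X ^ 9 + 2 * X ^ 8 - X ^ 7 + 2 * X ^ 6 + 3 * X ^ 4 - 2 * X ^ 3 - X ^ 2 - 3 * X,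
      -4 * X ^ 8 - 2 * X ^ 7 + X ^ 6 + X ^ 5 + 2 * X ^ 4 + 3 * X ^ 3 + 5 * X ^ 2 - X - 5, ?_⟩
    push_cast
    ring

theorem cyclotomic_int_28 : cyclotomic 28 ℤ =
      X ^ 12 - X ^ 10 + X ^ 8 - X ^ 6 + X ^ 4 - X ^ 2 + 1 := by
  refine cyclotomic_eq_of_mul_eq (by norm_num) _ ((X ^ 2 - 1)) [14, 4] (by decide) ?_
    ?_ ?_
  · simp only [List.map_cons, List.map_nil, List.prod_cons, List.prod_nil]
    ring
  · monicity!
  · rw [show Nat.totient 28 = 12 by decide +kernel]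
    compute_degree!

theorem repl_29 {x : S} (hx : IsCyclicRing x 28)
    (hext : ∀ e, e ∣ 28 → ExtVanish cl (S ⧸ Ideal.span {x ^ e - 1})) :
    Repl cl (Ideal.span {((29 : ℤ) : S), x - ((2 : ℤ) : S)}) S := by
  refine repl_of_certificate_prime hx (by norm_num) hext 29 2 (81915) 3277 _
    (X ^ 7 + X ^ 4 + 1) cyclotomic_int_28 (by norm_num) (by simp)
    (by norm_num) (by norm_num) (by norm_num)
    (by norm_num) (by simp) ?_ ?_
  · refine ⟨17 * X ^ 11 + 5 * X ^ 10 - 7 * X ^ 9 - 14 * X ^ 8 - 11 * X ^ 7 + 7 * X ^ 6 - 3 * X ^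
      5 - 6 * X ^ 4 + 5 * X ^ 3 + 10 * X ^ 2 + 3 * X + 6,
      -17 * X ^ 6 - 5 * X ^ 5 - 10 * X ^ 4 - 8 * X ^ 3 + 13 * X ^ 2 - 3 * X + 23, ?_⟩
    push_cast
    ring
  · refine ⟨-X ^ 11 + X ^ 7 - 1,
      X ^ 6 + X ^ 4 + X ^ 3 - X ^ 2 + X - 1, ?_⟩
    push_cast
    ring

theorem cyclotomic_int_30 : cyclotomic 30 ℤ =
      X ^ 8 + X ^ 7 - X ^ 5 - X ^ 4 - X ^ 3 + X + 1 := by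
  refine cyclotomic_eq_of_mul_eq (by norm_num) _
    ((X ^ 5 - 1) * (X ^ 3 - 1) * (X ^ 2 - 1)) [15, 10, 6, 1] (by decide) ?_
    ?_ ?_
  · simp only [List.map_cons, List.map_nil, List.prod_cons, List.prod_nil]
    ring
  · monicity!
  · rw [show Nat.totient 30 = 8 by decide +kernel]
    compute_degree!

theorem repl_31 {x : S} (hx : IsCyclicRing x 30)
    (hext : ∀ e, e ∣ 30 → ExtVanish cl (S ⧸ Ideal.span {x ^ e - 1})) :
    Repl cl (Ideal.span {((31 : ℤ) : S), x - ((3 : ℤ) : S)}) S := by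
  refine repl_of_certificate_prime hx (by norm_num) hext 31 3 (24507931448) 8401 _
    (-X ^ 8 + X ^ 4 + 1) cyclotomic_int_30 (by norm_num) (by simp)
    (by norm_num) (by norm_num) (by norm_num)
    (by norm_num) (by simp) ?_ ?_
  · refine ⟨3 * X ^ 7 - 19 * X ^ 6 + 5 * X ^ 5 + 12 * X ^ 4 + 2 * X ^ 3 + 3 * X ^ 2 + 9 * X - 1,
      3 * X ^ 7 - 22 * X ^ 6 + 27 * X ^ 5 - 12 * X ^ 4 - 8 * X ^ 3 + 38 * X ^ 2 - 41 * X +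
      32, ?_⟩
    push_cast
    ring
  · refine ⟨-X ^ 7 + 2 * X ^ 6 - X ^ 4 - X,
      -X ^ 7 + 3 * X ^ 6 - 3 * X ^ 5 + X ^ 4 + 2 * X ^ 3 - 5 * X ^ 2 + 5 * X - 3, ?_⟩
    push_cast
    ring

theorem cyclotomic_int_36 : cyclotomic 36 ℤ =
      X ^ 12 - X ^ 6 + 1 := by
  refine cyclotomic_eq_of_mul_eq (by norm_num) _ ((X ^ 6 - 1)) [18, 12] (by decide) ?_
    ?_ ?_
  · simp only [List.map_cons, List.map_nil, List.prod_cons, List.prod_nil]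
    ring
  · monicity!
  · rw [show Nat.totient 36 = 12 by decide +kernel]
    compute_degree!

theorem repl_37 {x : S} (hx : IsCyclicRing x 36)
    (hext : ∀ e, e ∣ 36 → ExtVanish cl (S ⧸ Ideal.span {x ^ e - 1})) :
    Repl cl (Ideal.span {((37 : ℤ) : S), x - ((2 : ℤ) : S)}) S := by
  refine repl_of_certificate_prime hx (by norm_num) hext 37 2 (17039295) 4033 _
    (X ^ 14 - X ^ 9 + 1) cyclotomic_int_36 (by norm_num) (by simp)
    (by norm_num) (by norm_num) (by norm_num)
    (by norm_num) (by simp) ?_ ?_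
  · refine ⟨5 * X ^ 11 + 10 * X ^ 10 + 20 * X ^ 9 + 3 * X ^ 8 + 6 * X ^ 7 + 12 * X ^ 6 + 19 * X
      ^ 5 + X ^ 4 + 2 * X ^ 3 + 4 * X ^ 2 + 8 * X + 16,
      -5 * X ^ 13 - 10 * X ^ 12 - 20 * X ^ 11 - 3 * X ^ 10 - 6 * X ^ 9 - 7 * X ^ 8 - 14 *
      X ^ 7 + 9 * X ^ 6 - 19 * X ^ 5 - X ^ 4 - 2 * X ^ 3 - 4 * X ^ 2 - 8 * X + 21, ?_⟩
    push_cast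
    ring
  · refine ⟨-X ^ 9 - X ^ 5 - 1,
      X ^ 11 + X ^ 7 - X ^ 6 + X ^ 5 + X - 1, ?_⟩
    push_cast
    ring

theorem cyclotomic_int_40 : cyclotomic 40 ℤ =
      X ^ 16 - X ^ 12 + X ^ 8 - X ^ 4 + 1 := by
  refine cyclotomic_eq_of_mul_eq (by norm_num) _ ((X ^ 4 - 1)) [20, 8] (by decide) ?_
    ?_ ?_
  · simp only [List.map_cons, List.map_nil, List.prod_cons, List.prod_nil]
    ring
  · monicity!
  · rw [show Nat.totient 40 = 16 by decide +kernel]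
    compute_degree!

theorem repl_41 {x : S} (hx : IsCyclicRing x 40)
    (hext : ∀ e, e ∣ 40 → ExtVanish cl (S ⧸ Ideal.span {x ^ e - 1})) :
    Repl cl (Ideal.span {((41 : ℤ) : S), x - ((6 : ℤ) : S)}) S := by
  refine repl_of_certificate_prime hx (by norm_num) hext 41 6 (4742037496761678575) 2818934803441 _
    (X ^ 13 - X ^ 4 + 1) cyclotomic_int_40 (by norm_num) (by simp)
    (by norm_num) (by norm_num) (by norm_num)
    (by norm_num) (by simp) ?_ ?_
  · refine ⟨X ^ 15 + 6 * X ^ 14 - 5 * X ^ 13 + 11 * X ^ 12 - 17 * X ^ 11 - 20 * X ^ 10 + 3 * X ^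
      9 - 23 * X ^ 8 - 14 * X ^ 7 - 2 * X ^ 6 - 12 * X ^ 5 + 10 * X ^ 4 - 23 * X ^ 3 - 15
      * X ^ 2 - 8 * X - 7,
      -X ^ 12 - 6 * X ^ 11 + 5 * X ^ 10 - 11 * X ^ 9 + 16 * X ^ 8 + 14 * X ^ 7 + 2 * X ^ 6
      + 12 * X ^ 5 + 31 * X ^ 4 + 23 * X ^ 3 + 15 * X ^ 2 + 8 * X + 48, ?_⟩
    push_cast
    ring
  · refine ⟨-X ^ 14 + X ^ 13 - 2 * X ^ 12 + 2 * X ^ 11 + 3 * X ^ 10 - X ^ 9 + 3 * X ^ 8 + 2 * X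
      ^ 7 + 2 * X ^ 5 - 2 * X ^ 4 + 3 * X ^ 3 + 2 * X ^ 2 + X + 1,
      X ^ 11 - X ^ 10 + 2 * X ^ 9 - 2 * X ^ 8 - 2 * X ^ 7 - X ^ 5 - 4 * X ^ 4 - 3 * X ^ 3
      - 2 * X ^ 2 - 7, ?_⟩
    push_cast
    ring

theorem cyclotomic_int_42 : cyclotomic 42 ℤ =
      X ^ 12 + X ^ 11 - X ^ 9 - X ^ 8 + X ^ 6 - X ^ 4 - X ^ 3 + X + 1 := by
  refine cyclotomic_eq_of_mul_eq (by norm_num) _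
    ((X ^ 7 - 1) * (X ^ 3 - 1) * (X ^ 2 - 1)) [21, 14, 6, 1] (by decide) ?_
    ?_ ?_
  · simp only [List.map_cons, List.map_nil, List.prod_cons, List.prod_nil]
    ring
  · monicity!
  · rw [show Nat.totient 42 = 12 by decide +kernel]
    compute_degree!

theorem repl_43 {x : S} (hx : IsCyclicRing x 42)
    (hext : ∀ e, e ∣ 42 → ExtVanish cl (S ⧸ Ideal.span {x ^ e - 1})) :
    Repl cl (Ideal.span {((43 : ℤ) : S), x - ((3 : ℤ) : S)}) S := by
  refine repl_of_certificate_prime hx (by norm_num) hext 43 3 (160210769641832) 682969 _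
    (-X ^ 18 - X ^ 2 + 1) cyclotomic_int_42 (by norm_num) (by simp)
    (by norm_num) (by norm_num) (by norm_num)
    (by norm_num) (by simp) ?_ ?_
  · refine ⟨-42 * X ^ 11 + 4 * X ^ 10 + 12 * X ^ 9 + 35 * X ^ 8 + 18 * X ^ 7 - 32 * X ^ 6 - 9 *
      X ^ 5 + 16 * X ^ 4 + 47 * X ^ 3 + 11 * X ^ 2 - 10 * X - 29,
      -42 * X ^ 17 + 46 * X ^ 16 - 34 * X ^ 15 + 27 * X ^ 14 - 5 * X ^ 13 - 15 * X ^ 12 +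
      41 * X ^ 11 - 49 * X ^ 10 + 68 * X ^ 9 - 54 * X ^ 8 + 53 * X ^ 7 - 13 * X ^ 6 + 4 *
      X ^ 5 + 12 * X ^ 4 - 7 * X ^ 3 + 22 * X ^ 2 - 62 * X + 72, ?_⟩
    push_cast
    ring
  · refine ⟨4 * X ^ 11 - X ^ 9 - 3 * X ^ 8 - 2 * X ^ 7 + 3 * X ^ 6 + X ^ 5 - X ^ 4 - 4 * X ^ 3 -
      X ^ 2 + X + 3,
      4 * X ^ 17 - 4 * X ^ 16 + 3 * X ^ 15 - 2 * X ^ 14 + 2 * X ^ 12 - 4 * X ^ 11 + 5 * X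
      ^ 10 - 6 * X ^ 9 + 5 * X ^ 8 - 4 * X ^ 7 + X ^ 6 - X ^ 4 + X ^ 3 - 2 * X ^ 2 + 6 * X
      - 6, ?_⟩
    push_cast
    ring

theorem cyclotomic_int_60 : cyclotomic 60 ℤ =
      X ^ 16 + X ^ 14 - X ^ 10 - X ^ 8 - X ^ 6 + X ^ 2 + 1 := by
  refine cyclotomic_eq_of_mul_eq (by norm_num) _
    ((X ^ 10 - 1) * (X ^ 6 - 1) * (X ^ 4 - 1)) [30, 20, 12, 2] (by decide) ?_
    ?_ ?_
  · simp only [List.map_cons, List.map_nil, List.prod_cons, List.prod_nil]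
    ring
  · monicity!
  · rw [show Nat.totient 60 = 16 by decide +kernel]
    compute_degree!

theorem repl_61 {x : S} (hx : IsCyclicRing x 60)
    (hext : ∀ e, e ∣ 60 → ExtVanish cl (S ⧸ Ideal.span {x ^ e - 1})) :
    Repl cl (Ideal.span {((61 : ℤ) : S), x - ((2 : ℤ) : S)}) S := by
  refine repl_of_certificate_prime hx (by norm_num) hext 61 2 (14307609791475) 80581 _
    (X ^ 15 - X ^ 8 + 1) cyclotomic_int_60 (by norm_num) (by simp)
    (by norm_num) (by norm_num) (by norm_num)
    (by norm_num) (by simp) ?_ ?_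
  · refine ⟨-31 * X ^ 15 - X ^ 14 - 33 * X ^ 13 - 5 * X ^ 12 - 10 * X ^ 11 - 20 * X ^ 10 - 9 * X
      ^ 9 - 18 * X ^ 8 - 5 * X ^ 7 - 10 * X ^ 6 + 11 * X ^ 5 + 22 * X ^ 4 + 44 * X ^ 3 +
      27 * X ^ 2 + 23 * X + 46,
      31 * X ^ 14 + X ^ 13 + 2 * X ^ 12 + 4 * X ^ 11 + 8 * X ^ 10 + 16 * X ^ 9 + 32 * X ^
      8 - 28 * X ^ 7 + 5 * X ^ 6 + 10 * X ^ 5 + 20 * X ^ 4 - 21 * X ^ 3 - 42 * X ^ 2 - 23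
      * X + 15, ?_⟩
    push_cast
    ring
  · refine ⟨X ^ 15 + X ^ 13 - X ^ 3 - 1,
      -X ^ 14 - X ^ 8 + X ^ 7 - X ^ 4 + X ^ 2 + X - 1, ?_⟩
    push_cast
    ring

theorem cyclotomic_int_66 : cyclotomic 66 ℤ =
      X ^ 20 + X ^ 19 - X ^ 17 - X ^ 16 + X ^ 14 + X ^ 13 - X ^ 11 - X ^ 10 - X ^ 9 + X ^
      7 + X ^ 6 - X ^ 4 - X ^ 3 + X + 1 := by
  refine cyclotomic_eq_of_mul_eq (by norm_num) _
    ((X ^ 11 - 1) * (X ^ 3 - 1) * (X ^ 2 - 1)) [33, 22, 6, 1] (by decide) ?_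
    ?_ ?_
  · simp only [List.map_cons, List.map_nil, List.prod_cons, List.prod_nil]
    ring
  · monicity!
  · rw [show Nat.totient 66 = 20 by decide +kernel]
    compute_degree!

theorem repl_67 {x : S} (hx : IsCyclicRing x 66)
    (hext : ∀ e, e ∣ 66 → ExtVanish cl (S ⧸ Ideal.span {x ^ e - 1})) :
    Repl cl (Ideal.span {((67 : ℤ) : S), x - ((2 : ℤ) : S)}) S := by
  refine repl_of_certificate_prime hx (by norm_num) hext 67 2 (52802327930877) 1397419 _
    (X ^ 23 - X ^ 3 + 1) cyclotomic_int_66 (by norm_num) (by simp)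
    (by norm_num) (by norm_num) (by norm_num)
    (by norm_num) (by simp) ?_ ?_
  · refine ⟨20 * X ^ 19 - 7 * X ^ 18 - 14 * X ^ 17 + 19 * X ^ 16 + 18 * X ^ 15 - 31 * X ^ 14 -
      42 * X ^ 13 + 3 * X ^ 12 + 6 * X ^ 11 - 8 * X ^ 10 + 31 * X ^ 9 - 25 * X ^ 8 - 50 *
      X ^ 7 - 13 * X ^ 6 - 6 * X ^ 5 - 12 * X ^ 4 + 23 * X ^ 3 + 26 * X ^ 2 - 15 * X - 10,
      -20 * X ^ 22 + 27 * X ^ 21 - 13 * X ^ 20 - 26 * X ^ 19 + 15 * X ^ 18 + 30 * X ^ 17 -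
      7 * X ^ 16 - 14 * X ^ 15 + 39 * X ^ 14 + 11 * X ^ 13 - 45 * X ^ 12 + 44 * X ^ 11 +
      21 * X ^ 10 - 25 * X ^ 9 + 17 * X ^ 8 + 34 * X ^ 7 + X ^ 6 + 2 * X ^ 5 + 4 * X ^ 4 +
      8 * X ^ 3 + 36 * X ^ 2 - 62 * X + 77, ?_⟩
    push_cast
    ring
  · refine ⟨-X ^ 19 + X ^ 17 - X ^ 15 + X ^ 13 + X ^ 10 - X ^ 9 + X ^ 7 + X ^ 4 - X ^ 2,
      X ^ 22 - X ^ 21 + X ^ 19 - X ^ 17 + X ^ 15 - X ^ 14 - X ^ 13 + 2 * X ^ 12 - X ^ 11 -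
      X ^ 10 + X ^ 9 - X ^ 7 - 2 * X ^ 2 + 3 * X - 2, ?_⟩
    push_cast
    ring

theorem cyclotomic_int_70 : cyclotomic 70 ℤ =
      X ^ 24 + X ^ 23 - X ^ 19 - X ^ 18 - X ^ 17 - X ^ 16 + X ^ 14 + X ^ 13 + X ^ 12 + X ^
      11 + X ^ 10 - X ^ 8 - X ^ 7 - X ^ 6 - X ^ 5 + X + 1 := by
  refine cyclotomic_eq_of_mul_eq (by norm_num) _
    ((X ^ 7 - 1) * (X ^ 5 - 1) * (X ^ 2 - 1)) [35, 14, 10, 1] (by decide) ?_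
    ?_ ?_
  · simp only [List.map_cons, List.map_nil, List.prod_cons, List.prod_nil]
    ring
  · monicity!
  · rw [show Nat.totient 70 = 24 by decide +kernel]
    compute_degree!

theorem repl_71 {x : S} (hx : IsCyclicRing x 70)
    (hext : ∀ e, e ∣ 70 → ExtVanish cl (S ⧸ Ideal.span {x ^ e - 1})) :
    Repl cl (Ideal.span {((71 : ℤ) : S), x - ((7 : ℤ) : S)}) S := by
  refine repl_of_certificate_prime hx (by norm_num) hext 71 7
    (655457082177895972265801321535973519248) 218936686339625940001 _
    (-X ^ 15 - X ^ 2 + 1) cyclotomic_int_70 (by norm_num) (by simp)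
    (by norm_num) (by norm_num) (by norm_num)
    (by norm_num) (by simp) ?_ ?_
  · refine ⟨-47 * X ^ 23 + 50 * X ^ 22 - 5 * X ^ 21 + 36 * X ^ 20 + 39 * X ^ 19 + 36 * X ^ 18 +
      15 * X ^ 17 + 10 * X ^ 16 - 25 * X ^ 15 - 33 * X ^ 14 - 65 * X ^ 13 - 5 * X ^ 12 -
      11 * X ^ 11 + 18 * X ^ 10 + 8 * X ^ 9 + 56 * X ^ 8 + 13 * X ^ 7 - 4 * X ^ 6 + 19 * X
      ^ 5 - 33 * X ^ 4 - 18 * X ^ 3 + 16 * X ^ 2 - 30 * X + 27,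
      -47 * X ^ 14 + 97 * X ^ 13 - 102 * X ^ 12 + 138 * X ^ 11 - 99 * X ^ 10 + 88 * X ^ 9
      - 23 * X ^ 8 - 19 * X ^ 7 + 80 * X ^ 6 - 79 * X ^ 5 + 86 * X ^ 4 - 37 * X ^ 3 + 25 *
      X ^ 2 - 14 * X + 44, ?_⟩
    push_cast
    ring
  · refine ⟨6 * X ^ 23 - 5 * X ^ 22 + X ^ 21 - 3 * X ^ 20 - 4 * X ^ 19 - 4 * X ^ 18 - 2 * X ^ 17
      - 2 * X ^ 16 + 2 * X ^ 15 + 3 * X ^ 14 + 7 * X ^ 13 + X ^ 12 + 2 * X ^ 11 - X ^ 10 -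
      6 * X ^ 8 - 2 * X ^ 7 - 3 * X ^ 5 + 3 * X ^ 4 + 2 * X ^ 3 - 2 * X ^ 2 + 4 * X - 2,
      6 * X ^ 14 - 11 * X ^ 13 + 12 * X ^ 12 - 15 * X ^ 11 + 11 * X ^ 10 - 9 * X ^ 9 + 2 *
      X ^ 8 + 3 * X ^ 7 - 9 * X ^ 6 + 9 * X ^ 5 - 9 * X ^ 4 + 4 * X ^ 3 - 2 * X ^ 2 + 2 *
      X - 5, ?_⟩
    push_cast
    ring

theorem cyclotomic_int_20 : cyclotomic 20 ℤ =
      X ^ 8 - X ^ 6 + X ^ 4 - X ^ 2 + 1 := by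
  refine cyclotomic_eq_of_mul_eq (by norm_num) _ ((X ^ 2 - 1)) [10, 4] (by decide) ?_
    ?_ ?_
  · simp only [List.map_cons, List.map_nil, List.prod_cons, List.prod_nil]
    ring
  · monicity!
  · rw [show Nat.totient 20 = 8 by decide +kernel]
    compute_degree!

theorem repl_25 {x : S} (hx : IsCyclicRing x 20)
    (hext : ∀ e, e ∣ 20 → ExtVanish cl (S ⧸ Ideal.span {x ^ e - 1})) :
    Repl cl (Ideal.span {((25 : ℤ) : S), x - ((2 : ℤ) : S)}) S := by
  refine repl_of_certificate hx (by norm_num) hext 5 5 2 (1023) 205 _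
    (-X ^ 9 - X ^ 2 + 1) (-X ^ 10 - X + 1)
    (X ^ 12 + X ^ 10 - X ^ 2 - 1)
    cyclotomic_int_20 (by ring) (by norm_num) (by norm_num) (by simp) (by norm_num) (by norm_num)
    (by norm_num) (by norm_num) (by simp) ?_ ?_ (by simp) ?_ ?_
  · refine ⟨-3 * X ^ 7 + 4 * X ^ 6 + X ^ 5 - 3 * X ^ 4 + X ^ 3 + 2 * X ^ 2 + 2 * X - 1,
      -3 * X ^ 8 + 4 * X ^ 7 - 2 * X ^ 6 + X ^ 5 + 2 * X ^ 4 - X ^ 3 + 3 * X ^ 2 - 2 * X +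
      6, ?_⟩
    push_cast
    ring
  · refine ⟨2 * X ^ 7 - 2 * X ^ 6 - X ^ 5 + 2 * X ^ 4 - X ^ 2 - X + 1,
      2 * X ^ 8 - 2 * X ^ 7 + X ^ 6 - X ^ 4 + X ^ 3 - X ^ 2 + 2 * X - 3, ?_⟩
    push_cast
    ring
  · refine ⟨-3 * X ^ 11 - X ^ 10 - 5 * X ^ 9 + 3 * X + 1,
      -3 * X ^ 9 - X ^ 8 - 2 * X ^ 7 + X ^ 6 + 2 * X ^ 5 - X ^ 4 - 2 * X ^ 3 + X ^ 2 + 2 *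
      X - 4, ?_⟩
    push_cast
    ring
  · refine ⟨X ^ 11 + 2 * X ^ 9 - X - 1,
      X ^ 9 + X ^ 7 - X ^ 5 + X ^ 3 - X + 1, ?_⟩
    push_cast
    ring

theorem repl_49 {x : S} (hx : IsCyclicRing x 42)
    (hext : ∀ e, e ∣ 42 → ExtVanish cl (S ⧸ Ideal.span {x ^ e - 1})) :
    Repl cl (Ideal.span {((49 : ℤ) : S), x - ((3 : ℤ) : S)}) S := by
  refine repl_of_certificate hx (by norm_num) hext 7 7 3 (22887252805976) 682969 _
    (X ^ 6 - X ^ 2 + 1) (-X ^ 28 + X ^ 7 + 1)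
    (X ^ 30 - X ^ 29 + X ^ 28 + X ^ 23 - X ^ 22 + X ^ 21 - X ^ 9 + X ^ 8 - X ^ 7 - X ^ 2
      + X - 1)
    cyclotomic_int_42 (by ring) (by norm_num) (by norm_num) (by simp) (by norm_num) (by norm_num)
    (by norm_num) (by norm_num) (by simp) ?_ ?_ (by simp) ?_ ?_
  · refine ⟨-5 * X ^ 11 - 6 * X ^ 10 + 3 * X ^ 9 + 5 * X ^ 7 - 6 * X ^ 6 - 2 * X ^ 5 + X ^ 4 + 8
      * X ^ 3 + X ^ 2 + 3 * X - 3,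
      5 * X ^ 5 + X ^ 4 - 4 * X ^ 3 + 9 * X ^ 2 - 13 * X + 10, ?_⟩
    push_cast
    ring
  · refine ⟨2 * X ^ 11 + 3 * X ^ 10 - 2 * X ^ 9 - 3 * X ^ 7 + 3 * X ^ 6 + X ^ 5 - 4 * X ^ 3 - X
      + 2,
      -2 * X ^ 5 - X ^ 4 + 3 * X ^ 3 - 5 * X ^ 2 + 7 * X - 5, ?_⟩
    push_cast
    ring
  · refine ⟨2 * X ^ 29 - 3 * X ^ 28 + 2 * X ^ 22 + 4 * X ^ 21 - 2 * X ^ 8 + 3 * X ^ 7 - 2 * X +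
      3,
      2 * X ^ 27 - X ^ 26 - 3 * X ^ 25 - 2 * X ^ 24 + X ^ 23 + 3 * X ^ 22 + 2 * X ^ 21 - X
      ^ 20 + 4 * X ^ 19 + 5 * X ^ 18 + X ^ 17 - 4 * X ^ 16 - 5 * X ^ 15 - X ^ 14 + 4 * X ^
      13 - 2 * X ^ 12 - 6 * X ^ 11 - 4 * X ^ 10 + 2 * X ^ 9 + 6 * X ^ 8 + 4 * X ^ 7 - 4 *
      X ^ 6 + 2 * X ^ 5 + 6 * X ^ 4 + 4 * X ^ 3 - 2 * X ^ 2 - 6 * X - 4, ?_⟩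
    push_cast
    ring
  · refine ⟨-X ^ 29 + X ^ 28 - 2 * X ^ 21 + X ^ 8 - X ^ 7 + X - 1,
      -X ^ 27 + X ^ 25 + X ^ 24 - X ^ 22 - X ^ 21 + X ^ 20 - X ^ 19 - 2 * X ^ 18 - X ^ 17
      + X ^ 16 + 2 * X ^ 15 + X ^ 14 - 2 * X ^ 13 + 2 * X ^ 11 + 2 * X ^ 10 - 2 * X ^ 8 -
      2 * X ^ 7 + 2 * X ^ 6 - 2 * X ^ 4 - 2 * X ^ 3 + 2 * X + 2, ?_⟩
    push_cast
    ring

end Certificates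

section Three

open Polynomial

variable {Λ U : Type} [CommRing Λ] [AddCommGroup U] [Module Λ U]
  {cl : ClosureOperator (Submodule Λ U)}

theorem IsCyclicRing.extVanish_self {S : Type} [CommRing S] [Algebra Λ S] {x : S} {m : ℕ}
    (hx : IsCyclicRing x m) (h : ExtVanish cl (S ⧸ Ideal.span {x ^ m - 1})) : ExtVanish cl S := by
  have h0 : Ideal.span {x ^ m - 1} = ⊥ := by
    rw [hx.pow_eq_one, sub_self, Ideal.span_singleton_eq_bot]
  exact h.of_equiv ((Submodule.quotEquivOfEqBot _ h0).restrictScalars Λ)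

theorem IsCyclicRing.extVanish_ideal {S : Type} [CommRing S] [Algebra Λ S] {x : S} {m : ℕ}
    (hx : IsCyclicRing x m) (h : ExtVanish cl S) {q t r : ℤ} (hqr : t ^ m - 1 = q * r)
    (h0 : t ^ m - 1 ≠ 0) (hco : IsCoprime r q) :
    ExtVanish cl (Ideal.span {(q : S), x - (t : S)}) := by
  obtain ⟨s, s', hs⟩ := hco
  have hs' : (s : S) * r + s' * q = 1 := by exact_mod_cast congrArg (Int.cast : ℤ → S) hs
  obtain ⟨w, hw⟩ := sub_dvd_pow_sub_pow x (t : S) m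
  have hqr' : (t : S) ^ m - 1 = q * r := by exact_mod_cast congrArg (Int.cast : ℤ → S) hqr
  rw [hx.pow_eq_one] at hw
  have hw' : (q : S) * r = (x - (t : S)) * (-w) := by rw [← hqr']; linear_combination -hw
  let M : S →ₗ[S] S := LinearMap.mulLeft S (x - (t : S))
  have hM : Function.Injective M := by
    rw [injective_iff_map_eq_zero]
    intro y hy
    change (x - (t : S)) * y = 0 at hy
    apply hx.torsionFree h0
    push_cast
    rw [hqr']
    linear_combination y * hw' - w * hy
  let e := LinearEquiv.ofInjective M hM
  have he : ∀ y, ((e y : LinearMap.range M) : S) = (x - (t : S)) * y := fun _ => rfl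
  let N : Ideal.span {(q : S), x - (t : S)} →ₗ[S] LinearMap.range M :=
    LinearMap.codRestrict _ (LinearMap.mulLeft S (r : S) ∘ₗ Submodule.subtype _) (by
      rintro ⟨z, hz⟩
      obtain ⟨a, b, rfl⟩ := Ideal.mem_span_pair.1 hz
      refine ⟨-(a * w) + r * b, ?_⟩
      change (x - (t : S)) * (-(a * w) + r * b) = r * (a * q + b * (x - t))
      linear_combination -a * hw')
  let φ := e.symm.toLinearMap ∘ₗ N
  have hφ : ∀ z : Ideal.span {(q : S), x - (t : S)}, (x - (t : S)) * φ z = r * (z : S) := by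
    intro z
    rw [← he]
    change ((e (e.symm (N z)) : LinearMap.range M) : S) = _
    rw [LinearEquiv.apply_symm_apply]
    rfl
  let i : Ideal.span {(q : S), x - (t : S)} →ₗ[S] S × S := φ.prod (Submodule.subtype _)
  let ρ : S × S →ₗ[S] Ideal.span {(q : S), x - (t : S)} :=
    LinearMap.codRestrict _ (LinearMap.coprod (LinearMap.mulLeft S (s * (x - (t : S))))
      (LinearMap.mulLeft S (s' * (q : S)))) (by
      rintro ⟨a, b⟩
      rw [Ideal.mem_span_pair]
      refine ⟨s' * b, s * a, ?_⟩
      change _ = s * (x - (t : S)) * a + s' * (q : S) * b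
      ring)
  refine (h.prod h).of_retract (i.restrictScalars Λ) (ρ.restrictScalars Λ) ?_
  apply LinearMap.ext
  intro z
  apply Subtype.ext
  change s * (x - (t : S)) * φ z + s' * (q : S) * z = z
  linear_combination (s : S) * hφ z + (z : S) * hs'

theorem four_pow_three_pow (k : ℕ) : ∃ u : ℤ, (4 : ℤ) ^ 3 ^ k = 1 + 3 ^ (k + 1) * (1 + 3 * u) := by
  induction k with
  | zero => exact ⟨0, by norm_num⟩
  | succ k ih =>
    obtain ⟨u, hu⟩ := ih
    rw [pow_succ 3 k, pow_mul, hu]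
    refine ⟨u + 3 ^ k * (1 + 3 * u) ^ 2 + 3 ^ (2 * k) * (1 + 3 * u) ^ 3, ?_⟩
    ring

theorem levelData_three (k : ℕ) : LevelData (2 * 3 ^ (k + 1)) 3 (3 ^ (k + 1)) 2
    (X ^ (2 * 3 ^ k) - 1) ((X ^ (2 * 3 ^ k)) ^ 2 + X ^ (2 * 3 ^ k) + 1)
    (X ^ 2 + X ^ 3 ^ (k + 1)) := by
  obtain ⟨j, hj⟩ : Odd (3 ^ k) := Odd.pow (by decide)
  set F : ℤ[X] := (X ^ (2 * 3 ^ k)) ^ 2 + X ^ (2 * 3 ^ k) + 1 with hF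
  set A : ℤ[X] := X ^ 2 + X ^ 3 ^ (k + 1) with hA
  let φ := Ideal.Quotient.mk (Ideal.span {A, F})
  have hmem : ∀ P : ℤ[X], φ P = 0 → ∃ u v, P = A * u + F * v := by
    intro P hP
    obtain ⟨u, v, h⟩ := Ideal.mem_span_pair.1 (Ideal.Quotient.eq_zero_iff_mem.1 hP)
    exact ⟨u, v, by rw [← h]; ring⟩
  have h1 : φ X ^ 2 + φ X ^ 3 ^ (k + 1) = 0 := by
    rw [← map_pow, ← map_pow, ← map_add]
    exact Ideal.Quotient.eq_zero_iff_mem.2 (Ideal.subset_span (by simp [hA]))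
  have h2 : (φ X ^ (2 * 3 ^ k)) ^ 2 + φ X ^ (2 * 3 ^ k) + 1 = 0 := by
    rw [← map_pow, ← map_pow, ← map_add, ← map_one φ, ← map_add]
    exact Ideal.Quotient.eq_zero_iff_mem.2 (Ideal.subset_span (by simp [hF]))
  set x := φ X
  set c := x ^ 3 ^ (k + 1) with hc
  have h3 : (x ^ (2 * 3 ^ k)) ^ 3 = 1 := by linear_combination (x ^ (2 * 3 ^ k) - 1) * h2
  have hc2 : c ^ 2 = 1 := by
    rw [← h3, hc]; ring
  have hx2 : x ^ 2 = -c := by linear_combination h1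
  have hY : x ^ (2 * 3 ^ k) = -c := by
    have hn : (-c) ^ 2 = 1 := by linear_combination hc2
    rw [pow_mul, hx2, hj, pow_succ, pow_mul, hn, one_pow, one_mul]
  rw [hY] at h2
  have hc' : c = 2 := by linear_combination hc2 - h2
  have h30 : (3 : _ ⧸ Ideal.span {A, F}) = 0 := by
    rw [hc'] at hc2; linear_combination hc2
  have hx : x = 2 := by
    have h4 : x ^ 2 = 1 := by rw [hx2, hc']; linear_combination -h30
    have h5 : c = x := by
      rw [hc, pow_succ, hj, show (2 * j + 1) * 3 = 2 * (3 * j + 1) + 1 by ring, pow_succ, pow_mul,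
        h4, one_pow, one_mul]
    rw [← h5, hc']
  obtain ⟨u, hu⟩ := four_pow_three_pow k
  obtain ⟨u', hu'⟩ := four_pow_three_pow (k + 1)
  refine ⟨by norm_num, by positivity, ?_, ?_, ?_, ?_, hmem _ ?_, hmem _ ?_⟩
  · rw [hF]; ring
  · rw [pow_mul]
    norm_num only at hu' ⊢
    rw [hu']
    exact ⟨1 + 3 * u', by ring⟩
  · refine ⟨1 + 3 * u, ?_, ⟨1, -u, by ring⟩⟩
    rw [pow_mul]
    simp only [eval_sub, eval_pow, eval_X, eval_one]
    norm_num only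
    rw [hu]; ring
  · rw [hA]
    simp only [eval_add, eval_pow, eval_X]
    have h6 : (3 : ℤ) ∣ 2 ^ 3 ^ (k + 1) + 1 ^ 3 ^ (k + 1) :=
      Dvd.dvd.trans (by norm_num) (Odd.add_dvd_pow_add_pow (2 : ℤ) 1 (Odd.pow (by decide)))
    rw [one_pow] at h6
    have : (2 : ℤ) ^ 2 + 2 ^ 3 ^ (k + 1) = 3 + (2 ^ 3 ^ (k + 1) + 1) := by ring
    rw [this]
    exact dvd_add dvd_rfl h6
  · rw [map_intCast]; exact_mod_cast h30
  · rw [map_sub, map_intCast, sub_eq_zero]; exact_mod_cast hx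

theorem repl_three_pow (k : ℕ) : ∀ {S : Type} [CommRing S] [Algebra Λ S] {x : S},
    IsCyclicRing x (2 * 3 ^ k) →
    (∀ e, e ∣ 2 * 3 ^ k → ExtVanish cl (S ⧸ Ideal.span {x ^ e - 1})) →
    Repl cl (Ideal.span {((3 ^ (k + 1) : ℤ) : S), x - ((2 : ℤ) : S)}) S := by
  induction k with
  | zero =>
    intro S _ _ x hx hext
    have h1 := hx.pow_eq_one
    simp only [pow_zero, mul_one] at h1
    have hI : Ideal.span {((3 ^ (0 + 1) : ℤ) : S), x - ((2 : ℤ) : S)} =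
        Ideal.span {x - ((2 : ℤ) : S)} := by
      apply le_antisymm
      · rw [Ideal.span_le]
        rintro _ (rfl | rfl)
        · rw [SetLike.mem_coe, Ideal.mem_span_singleton']
          exact ⟨-(x + 2), by push_cast; linear_combination -h1⟩
        · exact Ideal.subset_span rfl
      · exact Ideal.span_mono (by simp)
    rw [hI]
    refine Repl.of_equiv (principalEquiv _ fun y hy => ?_).symm
    apply hx.torsionFree (p := 3) (by norm_num)
    push_cast at hy ⊢
    linear_combination -(x + 2) * hy + y * h1
  | succ k ih =>
    intro S _ _ x hx hext
    have L := levelData_three k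
    obtain ⟨hm, hle, hinj⟩ := L.inter hx
    have hfd : (X ^ (2 * 3 ^ k) - 1 : ℤ[X]) ∣ X ^ (2 * 3 ^ (k + 1)) - 1 := ⟨_, L.hfac.symm⟩
    have hfx : aeval x (X ^ (2 * 3 ^ k) - 1 : ℤ[X]) = x ^ (2 * 3 ^ k) - 1 := by simp
    set f := aeval x (X ^ (2 * 3 ^ k) - 1 : ℤ[X])
    have hx' : IsCyclicRing (Ideal.Quotient.mk (Ideal.span {f}) x) (2 * 3 ^ k) := by
      have hae : ∀ P : ℤ[X], aeval (Ideal.Quotient.mk (Ideal.span {f}) x) P =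
          Ideal.Quotient.mk (Ideal.span {f}) (aeval x P) := fun P =>
        aeval_algHom_apply (Ideal.Quotient.mkₐ ℤ (Ideal.span {f})) x P
      refine ⟨by positivity, fun s => ?_, fun P => ?_⟩
      · obtain ⟨s, rfl⟩ := Ideal.Quotient.mk_surjective s
        obtain ⟨P, rfl⟩ := hx.surj s
        exact ⟨P, hae P⟩
      · rw [← hx.mem_span_iff hfd P, ← Ideal.Quotient.eq_zero_iff_mem]
        exact ⟨(hae P).symm.trans, (hae P).trans⟩
    have hext' : ∀ e, e ∣ 2 * 3 ^ k → ExtVanish cl ((S ⧸ Ideal.span {f}) ⧸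
        Ideal.span {(Ideal.Quotient.mk (Ideal.span {f}) x) ^ e - 1}) := by
      intro e he
      have hle : Ideal.span {f} ≤ Ideal.span {x ^ e - 1} := by
        rw [Ideal.span_singleton_le_span_singleton, hfx]
        obtain ⟨c, hc⟩ := he
        rw [hc, pow_mul]
        exact sub_one_dvd_pow_sub_one _ _
      have h1 := hext e (he.trans (mul_dvd_mul_left 2 (pow_dvd_pow 3 k.le_succ)))
      have hI : (Ideal.span {x ^ e - 1}).map (Ideal.Quotient.mkₐ Λ (Ideal.span {f})) =
          Ideal.span {(Ideal.Quotient.mk (Ideal.span {f}) x) ^ e - 1} := by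
        rw [Ideal.map_span, Set.image_singleton]; simp
      rw [← hI]
      exact h1.of_equiv (DoubleQuot.quotQuotEquivQuotOfLEₐ Λ hle).symm.toLinearEquiv
    have hself := hext' _ dvd_rfl
    have hSf : ExtVanish cl (S ⧸ Ideal.span {f}) := hx'.extVanish_self hself
    obtain ⟨u, hu⟩ := four_pow_three_pow k
    have hpow : (2 : ℤ) ^ (2 * 3 ^ k) - 1 = 3 ^ (k + 1) * (1 + 3 * u) := by
      rw [pow_mul]; norm_num only; rw [hu]; ring
    have hI : (Ideal.span {((3 * 3 ^ (k + 1) : ℤ) : S), x - ((2 : ℤ) : S)}).map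
        (Ideal.Quotient.mk (Ideal.span {f})) = Ideal.span {((3 ^ (k + 1) : ℤ) : S ⧸ Ideal.span {f}),
          (Ideal.Quotient.mk (Ideal.span {f}) x) - ((2 : ℤ) : S ⧸ Ideal.span {f})} := by
      rw [Ideal.map_span, Set.image_pair, map_intCast, map_sub, map_intCast]
      apply le_antisymm
      · rw [Ideal.span_le]
        rintro _ (rfl | rfl)
        · push_cast
          exact Ideal.mul_mem_left _ _ (Ideal.subset_span (by simp))
        · exact Ideal.subset_span (by simp)
      · rw [Ideal.span_le]
        rintro _ (rfl | rfl)
        · obtain ⟨w, hw⟩ := sub_dvd_pow_sub_pow (Ideal.Quotient.mk (Ideal.span {f}) x)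
            ((2 : ℤ) : S ⧸ Ideal.span {f}) (2 * 3 ^ k)
          rw [hx'.pow_eq_one] at hw
          have hpow' := congrArg (Int.cast : ℤ → S ⧸ Ideal.span {f}) hpow
          rw [SetLike.mem_coe, Ideal.mem_span_pair]
          refine ⟨-(u : S ⧸ Ideal.span {f}), -w, ?_⟩
          push_cast at hpow' hw ⊢
          linear_combination hw + hpow'
        · exact Ideal.subset_span (by simp)
    have key := repl_ideal_top (cl := cl) f _ _ hm hle hinj
    rw [hI] at key
    rw [pow_succ' 3 (k + 1)]
    refine key ?_ hSf (ih hx' hext')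
    refine hx'.extVanish_ideal hSf (r := 1 + 3 * u) hpow ?_ ?_
    · rw [hpow]
      have : 1 + 3 * u ≠ 0 := by omega
      positivity
    · exact IsCoprime.pow_right ⟨1, -u, by ring⟩

end Three

open GrpRing

section Perm

variable (π : Type) [CommGroup π] (Ω : Type) [MulAction π Ω]

/-- The action of `π` on integer-valued functions on a `π`-set. -/
def permAct : π →* AddMonoid.End (Ω → ℤ) where
  toFun g := { toFun := fun x ω => x (g⁻¹ • ω), map_zero' := rfl, map_add' := fun _ _ => rfl }
  map_one' := by
    refine AddMonoidHom.ext fun x => funext fun ω => ?_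
    change x ((1 : π)⁻¹ • ω) = x ω
    rw [inv_one, one_smul]
  map_mul' g h := by
    refine AddMonoidHom.ext fun x => funext fun ω => ?_
    change x ((g * h)⁻¹ • ω) = x (h⁻¹ • g⁻¹ • ω)
    rw [mul_inv_rev, mul_smul]

/-- The permutation module of a `π`-set. -/
abbrev PermMod : Type := ActMod (permAct π Ω)

variable {π Ω}

/-- The coordinates of an element of a permutation module. -/
def PermMod.coord (x : PermMod π Ω) : Ω → ℤ := x

/-- The element of a permutation module with given coordinates. -/
def PermMod.ofFun (x : Ω → ℤ) : PermMod π Ω := x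

namespace PermMod

theorem of_smul_coord (g : π) (x : PermMod π Ω) (ω : Ω) :
    (of g • x).coord ω = x.coord (g⁻¹ • ω) :=
  congrFun (ActMod.of_smul (permAct π Ω) g x) ω

@[simp] theorem coord_ofFun (x : Ω → ℤ) : (ofFun x : PermMod π Ω).coord = x := rfl
@[simp] theorem coord_add (x y : PermMod π Ω) (ω : Ω) :
    (x + y).coord ω = x.coord ω + y.coord ω := rfl
@[simp] theorem coord_neg (x : PermMod π Ω) (ω : Ω) : (-x).coord ω = -x.coord ω := rfl
@[simp] theorem coord_sub (x y : PermMod π Ω) (ω : Ω) :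
    (x - y).coord ω = x.coord ω - y.coord ω := rfl
@[simp] theorem coord_zero (ω : Ω) : (0 : PermMod π Ω).coord ω = 0 := rfl

@[ext] theorem ext {x y : PermMod π Ω} (h : ∀ ω, x.coord ω = y.coord ω) : x = y := funext h

/-- Coordinates as an additive map. -/
def coordHom (ω : Ω) : PermMod π Ω →+ ℤ where
  toFun x := x.coord ω
  map_zero' := rfl
  map_add' _ _ := rfl

@[simp] theorem coord_zsmul (k : ℤ) (x : PermMod π Ω) (ω : Ω) :
    (k • x).coord ω = k * x.coord ω := by
  rw [← smul_eq_mul]; exact map_zsmul (coordHom ω) k x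

@[simp] theorem coord_sum {ι : Type} (s : Finset ι) (f : ι → PermMod π Ω) (ω : Ω) :
    (∑ i ∈ s, f i).coord ω = ∑ i ∈ s, (f i).coord ω :=
  map_sum (coordHom ω) f s

open Classical in
/-- The basis vectors of a permutation module. -/
noncomputable def single (ω : Ω) : PermMod π Ω := ofFun (Pi.single ω 1)

open Classical in
theorem single_coord (ω ω' : Ω) :
    (single ω : PermMod π Ω).coord ω' = if ω' = ω then 1 else 0 := by
  rw [single, coord_ofFun, Pi.single_apply]

theorem of_smul_single (g : π) (ω : Ω) : of g • (single ω : PermMod π Ω) = single (g • ω) := by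
  classical
  ext ω'
  rw [of_smul_coord, single_coord, single_coord]
  congr 1
  rw [inv_smul_eq_iff]

theorem eq_sum_single [Fintype Ω] (x : PermMod π Ω) : x = ∑ ω, x.coord ω • single ω := by
  classical
  ext ω
  rw [coord_sum]
  simp [single_coord]

end PermMod

section Orbit

variable (ω₀ : Ω)

/-- The quotient of the group ring attached to a point of a `π`-set. -/
abbrev OrbRing : Type := GrpRing π ⧸ augIdeal (of : π →* GrpRing π) (MulAction.stabilizer π ω₀)

theorem mk_of_eq {H : Subgroup π} {g h : π} (hgh : h⁻¹ * g ∈ H) :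
    Ideal.Quotient.mk (augIdeal (of : π →* GrpRing π) H) (of g) =
      Ideal.Quotient.mk (augIdeal (of : π →* GrpRing π) H) (of h) := by
  rw [Ideal.Quotient.eq]
  have : (of g - of h : GrpRing π) = of h * (of (h⁻¹ * g) - 1) := by
    rw [mul_sub, ← map_mul, mul_inv_cancel_left, mul_one]
  rw [this]
  exact Ideal.mul_mem_left _ _ (Ideal.subset_span ⟨_, hgh, rfl⟩)

/-- The orbit map from the quotient of the group ring to the permutation module. -/
noncomputable def orbMap : OrbRing (π := π) ω₀ →ₗ[GrpRing π] PermMod π Ω :=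
  Submodule.liftQ _ (LinearMap.toSpanSingleton (GrpRing π) (PermMod π Ω) (PermMod.single ω₀)) (by
    rw [augIdeal, Ideal.span, Submodule.span_le]
    rintro _ ⟨h, hh, rfl⟩
    change (of h - 1) • (PermMod.single ω₀ : PermMod π Ω) = 0
    rw [sub_smul, one_smul, PermMod.of_smul_single, MulAction.mem_stabilizer_iff.1 hh, sub_self])

theorem orbMap_mk_of (g : π) : orbMap ω₀ (Ideal.Quotient.mk _ (of g)) =
    (PermMod.single (g • ω₀) : PermMod π Ω) :=
  PermMod.of_smul_single g ω₀

variable {ω₀}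

/-- The orbit-stabilizer isomorphism for permutation modules. -/
noncomputable def orbEquiv [Finite Ω] (h : ∀ ω, ∃ g : π, g • ω₀ = ω) :
    OrbRing (π := π) ω₀ ≃ₗ[GrpRing π] PermMod π Ω :=
  LinearEquiv.ofBijective (orbMap ω₀) (by
    classical
    cases nonempty_fintype Ω
    choose s hs using h
    let J := augIdeal (of : π →* GrpRing π) (MulAction.stabilizer π ω₀)
    let ψ : PermMod π Ω →+ OrbRing (π := π) ω₀ :=
      { toFun := fun x => ∑ ω, x.coord ω • Ideal.Quotient.mk J (of (s ω))
        map_zero' := by simp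
        map_add' := fun x y => by simp [add_smul, Finset.sum_add_distrib] }
    have hψs : ∀ ω, ψ (PermMod.single ω) = Ideal.Quotient.mk J (of (s ω)) := by
      intro ω
      change ∑ ω', (PermMod.single ω : PermMod π Ω).coord ω' • Ideal.Quotient.mk J (of (s ω')) = _
      simp [PermMod.single_coord]
    constructor
    · refine Function.LeftInverse.injective (g := ψ) fun y => ?_
      obtain ⟨r, rfl⟩ := Ideal.Quotient.mk_surjective y
      refine GrpRing.induction (p := fun r => ψ (orbMap ω₀ (Ideal.Quotient.mk J r)) =
        Ideal.Quotient.mk J r) r (by simp) (fun g => ?_) (fun x y hx hy => ?_) fun x hx => ?_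
      · rw [orbMap_mk_of, hψs]
        apply mk_of_eq
        rw [MulAction.mem_stabilizer_iff, mul_smul, hs, inv_smul_smul]
      · rw [map_add, map_add, map_add, hx, hy]
      · rw [map_neg, map_neg, map_neg, hx]
    · intro x
      refine ⟨ψ x, ?_⟩
      change orbMap ω₀ (∑ ω, x.coord ω • Ideal.Quotient.mk J (of (s ω))) = x
      conv_rhs => rw [x.eq_sum_single]
      rw [map_sum]
      refine Finset.sum_congr rfl fun ω _ => ?_
      rw [map_zsmul, orbMap_mk_of, hs])

theorem orbEquiv_mk_of [Finite Ω] (h : ∀ ω, ∃ g : π, g • ω₀ = ω) (g : π) :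
    orbEquiv h (Ideal.Quotient.mk _ (of g)) = (PermMod.single (g • ω₀) : PermMod π Ω) :=
  orbMap_mk_of ω₀ g

open Polynomial in
theorem orbEquiv_aeval [Finite Ω] (h : ∀ ω, ∃ g : π, g • ω₀ = ω) (τ : π) (P : ℤ[X]) :
    orbEquiv h (aeval (Ideal.Quotient.mk _ (of τ) : OrbRing (π := π) ω₀) P) =
      P.sum fun i c => c • (PermMod.single (τ ^ i • ω₀) : PermMod π Ω) := by
  rw [aeval_eq_sum_range, Polynomial.sum_over_range _ (by simp), map_sum]
  refine Finset.sum_congr rfl fun i _ => ?_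
  rw [map_zsmul, ← map_pow, ← map_pow, orbEquiv_mk_of]

open Polynomial in
theorem isCyclicRing_orbRing [Finite Ω] (h : ∀ ω, ∃ g : π, g • ω₀ = ω) (τ : π) (m : ℕ)
    (hm : 0 < m) (hτ : ∀ ω, ∃ i : ℕ, τ ^ i • ω₀ = ω) (hper : ∀ i, τ ^ i • ω₀ = ω₀ ↔ m ∣ i) :
    IsCyclicRing (Ideal.Quotient.mk _ (of τ) : OrbRing (π := π) ω₀) m := by
  have hinj : ∀ i < m, ∀ j < m, τ ^ i • ω₀ = τ ^ j • ω₀ → i = j := by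
    have key : ∀ i j, i ≤ j → j < m → τ ^ i • ω₀ = τ ^ j • ω₀ → i = j := by
      intro i j hij hj hh
      have h1 : τ ^ (j - i) • ω₀ = ω₀ := by
        have h2 : τ ^ j = τ ^ i * τ ^ (j - i) := by rw [← pow_add]; congr 1; omega
        rw [h2, mul_smul] at hh
        exact (smul_left_cancel _ hh).symm
      have := Nat.eq_zero_of_dvd_of_lt ((hper _).1 h1) (by omega)
      omega
    intro i hi j hj hh
    rcases le_total i j with hij | hij
    · exact key i j hij hj hh
    · exact (key j i hij hi hh.symm).symm
  refine ⟨hm, fun s => ?_, fun P => ?_⟩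
  · obtain ⟨r, rfl⟩ := Ideal.Quotient.mk_surjective s
    refine GrpRing.induction (p := fun r => ∃ P : ℤ[X], aeval (Ideal.Quotient.mk
      (augIdeal (of : π →* GrpRing π) (MulAction.stabilizer π ω₀)) (of τ)) P =
        Ideal.Quotient.mk _ r) r ⟨0, by simp⟩ (fun g => ?_) ?_ ?_
    · obtain ⟨i, hi⟩ := hτ (g • ω₀)
      refine ⟨X ^ i, ?_⟩
      rw [map_pow, aeval_X, ← map_pow, ← map_pow]
      apply mk_of_eq
      rw [MulAction.mem_stabilizer_iff, mul_smul, hi, inv_smul_smul]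
    · rintro x y ⟨P, hP⟩ ⟨Q, hQ⟩
      exact ⟨P + Q, by rw [map_add, hP, hQ, map_add]⟩
    · rintro x ⟨P, hP⟩
      exact ⟨-P, by rw [map_neg, hP, map_neg]⟩
  · have hmon : (X ^ m - 1 : ℤ[X]).Monic := monic_X_pow_sub_C 1 hm.ne'
    have hx : (Ideal.Quotient.mk _ (of τ) : OrbRing (π := π) ω₀) ^ m = 1 := by
      rw [← map_pow, ← map_pow, ← map_one (Ideal.Quotient.mk _), ← map_one of]
      apply mk_of_eq
      rw [MulAction.mem_stabilizer_iff, inv_one, one_mul, (hper m).2 dvd_rfl]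
    constructor
    · intro h0
      rw [← modByMonic_eq_zero_iff_dvd hmon]
      have h1 : aeval (Ideal.Quotient.mk _ (of τ) : OrbRing (π := π) ω₀)
          (P %ₘ (X ^ m - 1)) = 0 := by
        have h2 := congrArg (aeval (Ideal.Quotient.mk _ (of τ) : OrbRing (π := π) ω₀))
          (modByMonic_add_div P (X ^ m - 1 : ℤ[X]))
        rw [map_add, map_mul, map_sub, map_pow, map_one, aeval_X, hx, sub_self, zero_mul,
            add_zero] at h2
        exact h2.trans h0
      set Q := P %ₘ (X ^ m - 1)
      have hdeg : Q.natDegree < m := by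
        have hne : (X ^ m - 1 : ℤ[X]) ≠ 1 := by
          intro h
          have := congrArg natDegree h
          rw [natDegree_one, show (X ^ m - 1 : ℤ[X]) = X ^ m - C 1 by simp,
            natDegree_X_pow_sub_C] at this
          omega
        have := natDegree_modByMonic_lt P hmon hne
        rwa [show (X ^ m - 1 : ℤ[X]) = X ^ m - C 1 by simp, natDegree_X_pow_sub_C] at this
      have h2 := congrArg (orbEquiv h) h1
      rw [orbEquiv_aeval, map_zero, Polynomial.sum_over_range' _ (by simp) m hdeg] at h2
      ext j
      rw [coeff_zero]
      rcases lt_or_ge j m with hj | hj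
      · have h3 := congrArg (fun y => PermMod.coord y (τ ^ j • ω₀)) h2
        simp only [PermMod.coord_sum, PermMod.coord_zsmul, PermMod.coord_zero] at h3
        rw [Finset.sum_eq_single j] at h3
        · simpa [PermMod.single_coord] using h3
        · intro i hi hij
          rw [PermMod.single_coord, if_neg, mul_zero]
          intro hh
          exact hij (hinj j hj i (Finset.mem_range.1 hi) hh).symm
        · intro hh
          exact absurd (Finset.mem_range.2 hj) hh
      · exact coeff_eq_zero_of_natDegree_lt (hdeg.trans_le hj)
    · rintro ⟨Q, rfl⟩
      rw [map_mul, map_sub, map_pow, map_one, aeval_X, hx, sub_self, zero_mul]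

end Orbit

theorem of_sub_one_mem_subgroup (I : Ideal (GrpRing π)) {K : Subgroup π} {s : Set π}
    (hK : K ≤ Subgroup.closure s) (h : ∀ g ∈ s, of g - 1 ∈ I) {g : π} (hg : g ∈ K) :
    of g - 1 ∈ I := by
  refine Subgroup.closure_induction (p := fun g _ => of g - 1 ∈ I) h ?_ ?_ ?_ (hK hg)
  · rw [map_one, sub_self]; exact zero_mem _
  · intro x y _ _ hx hy
    have : (of (x * y) - 1 : GrpRing π) = of x * (of y - 1) + (of x - 1) := by
      rw [map_mul]; ring
    rw [this]
    exact add_mem (Ideal.mul_mem_left _ _ hy) hx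
  · intro x _ hx
    have h1 : (of x⁻¹ - 1 : GrpRing π) = -(of x⁻¹ * (of x - 1)) := by
      rw [mul_sub, ← map_mul, inv_mul_cancel, map_one]; ring
    rw [h1]
    exact neg_mem (Ideal.mul_mem_left _ _ hx)

variable {U : Type} [AddCommGroup U] [Module (GrpRing π) U]
  {cl : ClosureOperator (Submodule (GrpRing π) U)}

theorem H1Vanish.extVanish_quot (h1 : H1Vanish (of : π →* GrpRing π) cl) (H : Subgroup π) (τ : π) :
    ExtVanish cl ((GrpRing π ⧸ augIdeal (of : π →* GrpRing π) H) ⧸ Ideal.span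
      {(Ideal.Quotient.mk (augIdeal (of : π →* GrpRing π) H) (of τ)) - 1}) := by
  have hI : (Ideal.span {(of τ - 1 : GrpRing π)}).map
      (Ideal.Quotient.mkₐ (GrpRing π) (augIdeal (of : π →* GrpRing π) H)) = Ideal.span
      {(Ideal.Quotient.mk (augIdeal (of : π →* GrpRing π) H) (of τ)) - 1} := by
    rw [Ideal.map_span, Set.image_singleton]; simp
  have hJ : augIdeal (of : π →* GrpRing π) H ⊔ Ideal.span {(of τ - 1 : GrpRing π)} =
      augIdeal (of : π →* GrpRing π) (H ⊔ Subgroup.zpowers τ) := by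
    apply le_antisymm
    · refine sup_le (Ideal.span_mono ?_) ?_
      · rintro _ ⟨h, hh, rfl⟩
        exact ⟨h, Subgroup.mem_sup_left hh, rfl⟩
      · rw [Ideal.span_singleton_le_iff_mem]
        exact Ideal.subset_span ⟨τ, Subgroup.mem_sup_right (Subgroup.mem_zpowers τ), rfl⟩
    · rw [augIdeal, Ideal.span_le]
      rintro _ ⟨h, hh, rfl⟩
      refine of_sub_one_mem_subgroup _ (s := (H : Set π) ∪ {τ}) ?_ ?_ hh
      · rw [Subgroup.closure_union, Subgroup.closure_eq, Subgroup.zpowers_eq_closure]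
      · rintro g (hg | rfl)
        · exact Ideal.mem_sup_left (Ideal.subset_span ⟨g, hg, rfl⟩)
        · exact Ideal.mem_sup_right (Ideal.subset_span rfl)
  rw [← hI]
  have h2 := h1.extVanish _ (H ⊔ Subgroup.zpowers τ)
  rw [← hJ] at h2
  exact h2.of_equiv (DoubleQuot.quotQuotEquivQuotSupₐ (GrpRing π) _ _).symm.toLinearEquiv

section Fiber

variable {ι : Type} (c : Ω → ι) (hc : ∀ (g : π) ω, c (g • ω) = c ω)

/-- A fibre of an invariant function on a `π`-set. -/
def fib (i : ι) : SubMulAction π Ω where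
  carrier := {ω | c ω = i}
  smul_mem' g ω hω := (hc g ω).trans hω

/-- Decomposition of a permutation module along an invariant function. -/
def fibEquiv : PermMod π Ω ≃ₗ[GrpRing π] ∀ i, PermMod π (fib c hc i) where
  toFun x i := PermMod.ofFun fun ω => x.coord ω
  invFun y := PermMod.ofFun fun ω => (y (c ω)).coord ⟨ω, rfl⟩
  left_inv x := rfl
  right_inv y := by
    funext i
    ext ⟨ω, hω⟩
    change c ω = i at hω
    subst hω
    rfl
  map_add' x y := rfl
  map_smul' r x := by
    refine (equivariantHom (M := PermMod π Ω) (N := ∀ i, PermMod π (fib c hc i))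
      { toFun := fun x i => PermMod.ofFun fun ω => x.coord ω, map_zero' := rfl,
        map_add' := fun _ _ => rfl } (fun g x => ?_)).map_smul r x
    funext i
    ext ω
    change (of g • x).coord ω = (of g • (PermMod.ofFun fun ω : fib c hc i => x.coord ω)).coord ω
    rw [PermMod.of_smul_coord, PermMod.of_smul_coord]
    rfl

end Fiber

theorem H1Vanish.extVanish_perm [Finite Ω] (h1 : H1Vanish (of : π →* GrpRing π) cl) :
    ExtVanish cl (PermMod π Ω) := by
  let c : Ω → MulAction.orbitRel.Quotient π Ω := fun ω => Quotient.mk'' ω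
  have hc : ∀ (g : π) ω, c (g • ω) = c ω := fun g ω =>
    Quotient.sound (MulAction.orbitRel_apply.2 ⟨g, rfl⟩)
  refine ExtVanish.of_equiv (ExtVanish.pi fun i => ?_) (fibEquiv c hc).symm
  obtain ⟨ω₀, h0⟩ := Quotient.exists_rep i
  have htr : ∀ ω : fib c hc i, ∃ g : π, g • (⟨ω₀, h0⟩ : fib c hc i) = ω := by
    rintro ⟨ω, hω⟩
    obtain ⟨g, hg⟩ := MulAction.orbitRel_apply.1 (Quotient.exact (hω.trans h0.symm))
    exact ⟨g, Subtype.ext hg⟩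
  exact (h1.extVanish _ _).of_equiv (orbEquiv htr)

end Perm

section Weights

variable {n : ℕ}

/-- The multiplication action of the unit group on `ZMod n`. -/
def weightAct (n : ℕ) : (ZMod n)ˣ →* AddMonoid.End (ZMod n) where
  toFun g := AddMonoidHom.mulLeft (g : ZMod n)
  map_one' := by
    refine AddMonoidHom.ext fun x => ?_
    change ((1 : (ZMod n)ˣ) : ZMod n) * x = x
    rw [Units.val_one, one_mul]
  map_mul' g h := by
    refine AddMonoidHom.ext fun x => ?_
    change ((g * h : (ZMod n)ˣ) : ZMod n) * x = g * (h * x)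
    rw [Units.val_mul, mul_assoc]

/-- `ZMod n` as a module over the group ring of its unit group. -/
abbrev WeightMod (n : ℕ) : Type := ActMod (weightAct n)

noncomputable instance {π Ω : Type} [CommGroup π] [MulAction π Ω] [Finite Ω]
    (p : SubMulAction π Ω) : Fintype p := Fintype.ofFinite p

/-- The weighted coordinate sum on a set of residues, as an additive map. -/
def wsumHom (p : SubMulAction (ZMod n)ˣ (ZMod n)) [Fintype p] : PermMod (ZMod n)ˣ p →+ ZMod n where
  toFun x := ∑ a : p, (x.coord a : ZMod n) * a
  map_zero' := by simp
  map_add' x y := by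
    simp only [PermMod.coord_add, Int.cast_add, add_mul, Finset.sum_add_distrib]

/-- The weighted coordinate sum on a set of residues stable under units. -/
noncomputable def wsum (p : SubMulAction (ZMod n)ˣ (ZMod n)) [Fintype p] :
    PermMod (ZMod n)ˣ p →ₗ[GrpRing (ZMod n)ˣ] WeightMod n :=
  equivariantHom (N := WeightMod n) (wsumHom p) (by
    intro g x
    refine Eq.trans ?_ (ActMod.of_smul (weightAct n) g (wsumHom p x)).symm
    change (∑ a : p, ((of g • x).coord a : ZMod n) * a : ZMod n) =
      (g : ZMod n) * (∑ a : p, (x.coord a : ZMod n) * a : ZMod n)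
    rw [Finset.mul_sum]
    refine (Fintype.sum_equiv (MulAction.toPerm g) _ _ fun a => ?_).symm
    rw [PermMod.of_smul_coord, MulAction.toPerm_apply, inv_smul_smul, SubMulAction.val_smul,
      Units.smul_def, smul_eq_mul]
    ring)

/-- The weighted coordinate sum on all residues, as an additive map. -/
def wsumAllHom (n : ℕ) [NeZero n] : PermMod (ZMod n)ˣ (ZMod n) →+ ZMod n where
  toFun x := ∑ a : ZMod n, (x.coord a : ZMod n) * a
  map_zero' := by simp
  map_add' x y := by
    simp only [PermMod.coord_add, Int.cast_add, add_mul, Finset.sum_add_distrib]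

/-- The weighted coordinate sum on all residues. -/
noncomputable def wsumAll (n : ℕ) [NeZero n] :
    PermMod (ZMod n)ˣ (ZMod n) →ₗ[GrpRing (ZMod n)ˣ] WeightMod n :=
  equivariantHom (N := WeightMod n) (wsumAllHom n) (by
    intro g x
    refine Eq.trans ?_ (ActMod.of_smul (weightAct n) g (wsumAllHom n x)).symm
    change (∑ a, ((of g • x).coord a : ZMod n) * a : ZMod n) =
      (g : ZMod n) * (∑ a, (x.coord a : ZMod n) * a : ZMod n)
    rw [Finset.mul_sum]
    refine (Fintype.sum_equiv (MulAction.toPerm g) _ _ fun a => ?_).symm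
    rw [PermMod.of_smul_coord, MulAction.toPerm_apply, inv_smul_smul, Units.smul_def, smul_eq_mul]
    ring)

theorem wsumHom_single (p : SubMulAction (ZMod n)ˣ (ZMod n)) [Fintype p] (a : p) :
    wsumHom p (PermMod.single a) = a := by
  classical
  change (∑ b : p, (((PermMod.single a : PermMod (ZMod n)ˣ p).coord b : ℤ) : ZMod n) * b : ZMod n) =
      a
  simp [PermMod.single_coord]

variable [NeZero n] {ι : Type} (c : ZMod n → Option ι)
  (hc : ∀ (g : (ZMod n)ˣ) a, c (g • a) = c a)

/-- The colour classes of a partial colouring of residues. -/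
abbrev cfib (o : Option ι) : SubMulAction (ZMod n)ˣ (ZMod n) := fib (π := (ZMod n)ˣ) c hc o

/-- Decomposition of the permutation module on all residues along a partial colouring. -/
noncomputable def colorEquiv : PermMod (ZMod n)ˣ (ZMod n) ≃ₗ[GrpRing (ZMod n)ˣ]
    PermMod (ZMod n)ˣ (cfib c hc none) × ∀ i, PermMod (ZMod n)ˣ (cfib c hc (some i)) :=
  (fibEquiv c hc).trans (piOptionEquiv fun o => PermMod (ZMod n)ˣ (cfib c hc o))

theorem wsumAll_eq [Fintype ι] (x : PermMod (ZMod n)ˣ (ZMod n)) :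
    wsumAll n x = wsum (cfib c hc none) (colorEquiv c hc x).1 +
      ∑ i, wsum (cfib c hc (some i)) ((colorEquiv c hc x).2 i) := by
  classical
  have h1 : (∑ a : ZMod n, (x.coord a : ZMod n) * a : ZMod n) =
      ∑ o : Option ι, ∑ a : cfib c hc o, (x.coord a : ZMod n) * a := by
    have h0 := Fintype.sum_sigma' fun (o : Option ι) (a : cfib c hc o) =>
      ((x.coord a : ZMod n) * (a : ZMod n) : ZMod n)
    rw [← h0]
    let e : (Σ o, cfib c hc o) ≃ ZMod n := Equiv.sigmaFiberEquiv c
    exact (Fintype.sum_equiv e (fun s => ((x.coord s.2 : ZMod n) * (s.2 : ZMod n) : ZMod n))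
      (fun a => (x.coord a : ZMod n) * a) fun _ => rfl).symm
  rw [Fintype.sum_option] at h1
  exact h1

theorem wsumAll_symm [Fintype ι] (a) (y) :
    wsumAll n ((colorEquiv c hc).symm (a, y)) = wsum (cfib c hc none) a +
      ∑ i, wsum (cfib c hc (some i)) (y i) := by
  rw [wsumAll_eq c hc, LinearEquiv.apply_symm_apply]

omit [NeZero n] in
theorem sum_eq_zero_of_coprime [Fintype ι] (q : ι → ℕ) (hcop : Pairwise (Nat.Coprime.onFun q))
    (e : ι → ZMod n) (he : ∀ i, (q i : ZMod n) * e i = 0)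
    (hsum : ∑ i, e i = 0) (i : ι) : e i = 0 := by
  classical
  have h1 : ((∏ j ∈ Finset.univ.erase i, q j : ℕ) : ZMod n) * e i = 0 := by
    have := congrArg (((∏ j ∈ Finset.univ.erase i, q j : ℕ) : ZMod n) * ·) hsum
    simp only [mul_zero, Finset.mul_sum] at this
    rwa [Finset.sum_eq_single i _ (fun h => absurd (Finset.mem_univ i) h)] at this
    intro j _ hj
    obtain ⟨k, hk⟩ := Finset.dvd_prod_of_mem q (Finset.mem_erase.2 ⟨hj, Finset.mem_univ j⟩)
    rw [hk, Nat.cast_mul, mul_comm (q j : ZMod n), mul_assoc, he, mul_zero]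
  have h2 : Nat.Coprime (q i) (∏ j ∈ Finset.univ.erase i, q j) :=
    Nat.Coprime.prod_right fun j hj => hcop (Finset.ne_of_mem_erase hj).symm
  obtain ⟨u, v, huv⟩ := Nat.isCoprime_iff_coprime.2 h2
  have h3 := congrArg (Int.cast : ℤ → ZMod n) huv
  push_cast at h3 h1
  linear_combination (u : ZMod n) * he i + (v : ZMod n) * h1 - e i * h3

theorem exists_sum_eq_of_coprime [Fintype ι] (q : ι → ℕ) (hcop : Pairwise (Nat.Coprime.onFun q))
    (hpos : ∀ i, q i ≠ 0)
    (hprod : ∏ i, q i = n) (b : ZMod n) :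
    ∃ k : ι → ℤ, ∑ i, (k i : ZMod n) * ((n / q i : ℕ) : ZMod n) = b := by
  classical
  rcases isEmpty_or_nonempty ι with hι | hι
  · have : n = 1 := by rw [← hprod]; simp
    subst this
    exact ⟨fun _ => 0, Subsingleton.elim _ _⟩
  · have h1 : Pairwise (Function.onFun IsCoprime fun i => (q i : ℤ)) :=
      fun i j hij => Nat.isCoprime_iff_coprime.2 (hcop hij)
    obtain ⟨μ, hμ⟩ := (exists_sum_eq_one_iff_pairwise_coprime' (s := fun i => (q i : ℤ))).2 h1
    have h2 : ∀ i, n / q i = ∏ j ∈ ({i}ᶜ : Finset ι), q j := by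
      intro i
      rw [← hprod, Fintype.prod_eq_mul_prod_compl i q,
        Nat.mul_div_cancel_left _ (Nat.pos_of_ne_zero (hpos i))]
    refine ⟨fun i => b.val * μ i, ?_⟩
    have h3 := congrArg (Int.cast : ℤ → ZMod n) hμ
    push_cast at h3
    simp_rw [h2]
    push_cast
    simp_rw [mul_assoc]
    rw [← Finset.mul_sum, h3, mul_one, ZMod.natCast_zmod_val]

variable {U : Type} [AddCommGroup U] [Module (GrpRing (ZMod n)ˣ) U]
  {cl : ClosureOperator (Submodule (GrpRing (ZMod n)ˣ) U)}

theorem gen_perm_of_gen_ker [Fintype ι] (h1 : H1Vanish (of : (ZMod n)ˣ →* GrpRing (ZMod n)ˣ) cl)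
    (q : ι → ℕ) (hcop : Pairwise (Nat.Coprime.onFun q)) (hpos : ∀ i, q i ≠ 0)
    (hprod : ∏ i, q i = n) (hq : ∀ i a, c a = some i → (q i : ZMod n) * a = 0)
    (hgen : ∀ i, c ((n / q i : ℕ) : ZMod n) = some i)
    (hrepl : ∀ i, Repl cl (LinearMap.ker (wsum (cfib c hc (some i))))
      (PermMod (ZMod n)ˣ (cfib c hc (some i))))
    (hM : Gen cl (LinearMap.ker (wsumAll n))) : Gen cl (PermMod (ZMod n)ˣ (ZMod n)) := by
  classical
  let e := colorEquiv c hc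
  let K := fun i => LinearMap.ker (wsum (cfib c hc (some i)))
  let j : (∀ i, K i) →ₗ[GrpRing (ZMod n)ˣ] ∀ i, PermMod (ZMod n)ˣ (cfib c hc (some i)) :=
    LinearMap.pi fun i => (K i).subtype ∘ₗ LinearMap.proj i
  let f0 := e.symm.toLinearMap ∘ₗ LinearMap.inr (GrpRing (ZMod n)ˣ)
    (PermMod (ZMod n)ˣ (cfib c hc none)) _ ∘ₗ j
  have hf0 : ∀ y, f0 y ∈ LinearMap.ker (wsumAll n) := by
    intro y
    rw [LinearMap.mem_ker]
    change wsumAll n (e.symm (0, j y)) = 0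
    rw [wsumAll_symm, map_zero, zero_add]
    exact Finset.sum_eq_zero fun i _ => (y i).2
  let f : (∀ i, K i) →ₗ[GrpRing (ZMod n)ˣ] LinearMap.ker (wsumAll n) :=
    LinearMap.codRestrict _ f0 hf0
  let r : LinearMap.ker (wsumAll n) →ₗ[GrpRing (ZMod n)ˣ] PermMod (ZMod n)ˣ (cfib c hc none) :=
    LinearMap.fst _ _ _ ∘ₗ e.toLinearMap ∘ₗ Submodule.subtype _
  have hwq : ∀ i (y : PermMod (ZMod n)ˣ (cfib c hc (some i))),
      (q i : ZMod n) * wsumHom (cfib c hc (some i)) y = 0 := by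
    intro i y
    change (q i : ZMod n) * (∑ a : cfib c hc (some i), (y.coord a : ZMod n) * a : ZMod n) = 0
    rw [Finset.mul_sum]
    refine Finset.sum_eq_zero fun a _ => ?_
    rw [mul_left_comm, hq i a a.2, mul_zero]
  have hf : Function.Injective f := by
    intro y z hyz
    have h2 : e.symm (0, j y) = e.symm (0, j z) := congrArg Subtype.val hyz
    have h3 : j y = j z := congrArg Prod.snd (e.symm.injective h2)
    funext i
    exact Subtype.ext (congrFun h3 i)
  have hr : Function.Surjective r := by
    intro a
    obtain ⟨k, hk⟩ := exists_sum_eq_of_coprime q hcop hpos hprod (-wsum (cfib c hc none) a)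
    let y : ∀ i, PermMod (ZMod n)ˣ (cfib c hc (some i)) :=
      fun i => k i • PermMod.single ⟨((n / q i : ℕ) : ZMod n), hgen i⟩
    refine ⟨⟨e.symm (a, y), ?_⟩, ?_⟩
    · rw [LinearMap.mem_ker, wsumAll_symm]
      have : ∀ i, wsumHom (cfib c hc (some i)) (y i) =
          (k i : ZMod n) * ((n / q i : ℕ) : ZMod n) := by
        intro i
        change wsumHom (cfib c hc (some i)) (k i • _) = _
        rw [map_zsmul, wsumHom_single, zsmul_eq_mul]
      change wsumHom (cfib c hc none) a + ∑ i, wsumHom (cfib c hc (some i)) (y i) = 0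
      rw [Finset.sum_congr rfl fun i _ => this i, hk]
      exact add_neg_cancel _
    · change (e (e.symm (a, y))).1 = a
      rw [LinearEquiv.apply_symm_apply]
  have hex : Function.Exact f r := by
    intro x
    constructor
    · intro hx
      have hx' : (e x.1).1 = 0 := hx
      have h2 : (∑ i, wsum (cfib c hc (some i)) ((e x.1).2 i) : ZMod n) = 0 := by
        have h3 : wsumAll n x.1 = 0 := x.2
        rw [wsumAll_eq c hc] at h3
        change wsum (cfib c hc none) (e x.1).1 + _ = _ at h3
        rw [hx', map_zero, zero_add] at h3
        exact h3
      have h4 := sum_eq_zero_of_coprime q hcop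
        (fun i => wsum (cfib c hc (some i)) ((e x.1).2 i)) (fun i => hwq i _) h2
      refine ⟨fun i => ⟨(e x.1).2 i, h4 i⟩, Subtype.ext ?_⟩
      change e.symm (0, (e x.1).2) = x.1
      rw [← hx', Prod.mk.eta, LinearEquiv.symm_apply_apply]
    · rintro ⟨y, rfl⟩
      change (e (e.symm (0, j y))).1 = 0
      rw [LinearEquiv.apply_symm_apply]
  have h5 := (gen_iff_of_exact h1.extVanish_perm f r hf hr hex).1 hM
  have h6 := Repl.pi hrepl _ h5
  exact h6.of_equiv ((LinearEquiv.prodComm _ _ _).trans e.symm)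

end Weights

section Fibers

variable {n : ℕ} [NeZero n] {U : Type} [AddCommGroup U] [Module (GrpRing (ZMod n)ˣ) U]
  {cl : ClosureOperator (Submodule (GrpRing (ZMod n)ˣ) U)}

open Polynomial in
theorem repl_ker_wsum (h1 : H1Vanish (of : (ZMod n)ˣ →* GrpRing (ZMod n)ˣ) cl)
    (p : SubMulAction (ZMod n)ˣ (ZMod n)) [Fintype p] (a₀ : p) (τ : (ZMod n)ˣ)
    {m : ℕ} {q t : ℤ} (hm : 0 < m)
    (hdvd : q ∣ t ^ m - 1)
    (ha : ∀ k : ℤ, (k : ZMod n) * (a₀ : ZMod n) = 0 ↔ q ∣ k)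
    (ht : (τ : ZMod n) * (a₀ : ZMod n) = (t : ZMod n) * (a₀ : ZMod n))
    (hτ : ∀ a : p, ∃ i : ℕ, τ ^ i • a₀ = a) (hper : ∀ i, τ ^ i • a₀ = a₀ ↔ m ∣ i)
    (hrepl : ∀ {S : Type} [CommRing S] [Algebra (GrpRing (ZMod n)ˣ) S] {x : S},
      IsCyclicRing x m → (∀ e, e ∣ m → ExtVanish cl (S ⧸ Ideal.span {x ^ e - 1})) →
        Repl cl (Ideal.span {(q : S), x - (t : S)}) S) :
    Repl cl (LinearMap.ker (wsum p)) (PermMod (ZMod n)ˣ p) := by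
  have htr : ∀ a : p, ∃ g : (ZMod n)ˣ, g • a₀ = a := fun a => (hτ a).imp' (τ ^ ·) fun _ h => h
  have hx := isCyclicRing_orbRing (π := (ZMod n)ˣ) (Ω := p) htr τ m hm hτ hper
  set x : OrbRing (π := (ZMod n)ˣ) a₀ := Ideal.Quotient.mk _ (of τ) with hxdef
  let e := orbEquiv (π := (ZMod n)ˣ) (Ω := p) htr
  have hpow : ∀ i : ℕ, ((τ ^ i • a₀ : p) : ZMod n) = (t : ZMod n) ^ i * (a₀ : ZMod n) := by
    intro i
    induction i with
    | zero => simp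
    | succ i ih =>
      rw [pow_succ', mul_smul, SubMulAction.val_smul, ih, Units.smul_def, smul_eq_mul,
        mul_left_comm, ht]
      ring
  have hw : ∀ P : ℤ[X], wsumHom p (e (aeval x P)) =
      ((P.eval t : ℤ) : ZMod n) * (a₀ : ZMod n) := by
    intro P
    rw [orbEquiv_aeval, Polynomial.sum_over_range _ (by simp), map_sum, eval_eq_sum_range,
      Int.cast_sum, Finset.sum_mul]
    refine Finset.sum_congr rfl fun i _ => ?_
    rw [map_zsmul, wsumHom_single, hpow, zsmul_eq_mul]
    push_cast
    ring
  have hmem : ∀ s, s ∈ Ideal.span {(q : OrbRing (π := (ZMod n)ˣ) a₀), x - (t : OrbRing a₀)} ↔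
      e s ∈ LinearMap.ker (wsum p) := by
    intro s
    obtain ⟨P, rfl⟩ := hx.surj s
    rw [hx.mem_ideal_iff hdvd, ← ha, ← hw]
    rfl
  have hmap :
      ((Ideal.span {(q : OrbRing (π := (ZMod n)ˣ) a₀), x - (t : OrbRing a₀)}).restrictScalars
      (GrpRing (ZMod n)ˣ)).map (e : _ →ₗ[GrpRing (ZMod n)ˣ] _) = LinearMap.ker (wsum p) := by
    ext y
    rw [Submodule.mem_map]
    constructor
    · rintro ⟨s, hs, rfl⟩
      exact (hmem s).1 hs
    · intro hy
      refine ⟨e.symm y, (hmem _).2 ?_, e.apply_symm_apply y⟩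
      rwa [e.apply_symm_apply]
  have h2 : Repl cl (Ideal.span {(q : OrbRing (π := (ZMod n)ˣ) a₀), x - (t : OrbRing a₀)})
      (OrbRing (π := (ZMod n)ˣ) a₀) := by
    refine hrepl hx fun k _ => ?_
    rw [hxdef, ← map_pow, ← map_pow]
    exact h1.extVanish_quot _ (τ ^ k)
  exact ((Repl.of_equiv (e.ofSubmodules _ _ hmap).symm).trans h2).trans (Repl.of_equiv e)

omit [NeZero n] in
theorem ZMod.intCast_mul_eq_zero_iff {q r : ℕ} (hn : q * r = n) (hr : r ≠ 0) (k : ℤ) :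
    (k : ZMod n) * (r : ZMod n) = 0 ↔ (q : ℤ) ∣ k := by
  have h : (k : ZMod n) * (r : ZMod n) = ((k * r : ℤ) : ZMod n) := by push_cast; rfl
  rw [h, ZMod.intCast_zmod_eq_zero_iff_dvd, ← hn]
  push_cast
  exact mul_dvd_mul_iff_right (by exact_mod_cast hr)

omit [NeZero n] in
theorem ZMod.mul_natCast_eq_iff {q r : ℕ} (hn : q * r = n) (hr : r ≠ 0) (y z : ZMod n) :
    y * (r : ZMod n) = z * (r : ZMod n) ↔
      ZMod.castHom (Dvd.intro r hn) (ZMod q) y = ZMod.castHom (Dvd.intro r hn) (ZMod q) z := by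
  obtain ⟨y, rfl⟩ := ZMod.intCast_surjective y
  obtain ⟨z, rfl⟩ := ZMod.intCast_surjective z
  rw [← sub_eq_zero, ← sub_mul, ← Int.cast_sub, ZMod.intCast_mul_eq_zero_iff hn hr, map_intCast,
    map_intCast, ← sub_eq_zero, ← Int.cast_sub, ZMod.intCast_zmod_eq_zero_iff_dvd]

theorem repl_ker_wsum_orbit (h1 : H1Vanish (of : (ZMod n)ˣ →* GrpRing (ZMod n)ˣ) cl)
    (p : SubMulAction (ZMod n)ˣ (ZMod n)) [Fintype p] {q r : ℕ} (hn : q * r = n)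
    (hp : ∀ a, a ∈ p ↔ ∃ g : (ZMod n)ˣ, g * (r : ZMod n) = a) {t : ℤ}
    (ht : orderOf (t : ZMod q) = q.totient)
    (hrepl : ∀ {S : Type} [CommRing S] [Algebra (GrpRing (ZMod n)ˣ) S] {x : S},
      IsCyclicRing x q.totient →
        (∀ e, e ∣ q.totient → ExtVanish cl (S ⧸ Ideal.span {x ^ e - 1})) →
        Repl cl (Ideal.span {((q : ℤ) : S), x - (t : S)}) S) :
    Repl cl (LinearMap.ker (wsum p)) (PermMod (ZMod n)ˣ p) := by
  have hn0 : n ≠ 0 := NeZero.ne n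
  have hr : r ≠ 0 := by rintro rfl; exact hn0 (by rw [← hn, mul_zero])
  have hq : q ≠ 0 := by rintro rfl; exact hn0 (by rw [← hn, zero_mul])
  have : NeZero q := ⟨hq⟩
  have hm : 0 < q.totient := Nat.totient_pos.2 (Nat.pos_of_ne_zero hq)
  have hpow : (t : ZMod q) ^ q.totient = 1 := by rw [← ht]; exact pow_orderOf_eq_one _
  obtain ⟨u, hu⟩ : IsUnit (t : ZMod q) := IsUnit.of_pow_eq_one hpow hm.ne'
  have hgen : ∀ v : (ZMod q)ˣ, ∃ i : ℕ, u ^ i = v := by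
    have hcard : Nat.card (Subgroup.zpowers u) = Nat.card (ZMod q)ˣ := by
      rw [Nat.card_zpowers, ← orderOf_units, hu, ht, Nat.card_eq_fintype_card,
        ZMod.card_units_eq_totient]
    have htop := Subgroup.eq_top_of_card_eq _ hcard
    intro v
    have hv : v ∈ Subgroup.zpowers u := by rw [htop]; trivial
    exact (mem_powers_iff_mem_zpowers.2 hv)
  obtain ⟨τ, hτ⟩ := ZMod.unitsMap_surjective (Dvd.intro r hn) u
  have hτ' : ZMod.castHom (Dvd.intro r hn) (ZMod q) (τ : ZMod n) = u := congrArg Units.val hτ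
  have hτt : ZMod.castHom (Dvd.intro r hn) (ZMod q) (τ : ZMod n) = t := hτ'.trans hu
  let a₀ : p := ⟨r, (hp _).2 ⟨1, by simp⟩⟩
  have hsm : ∀ i : ℕ, ((τ ^ i • a₀ : p) : ZMod n) = (τ : ZMod n) ^ i * (r : ZMod n) := by
    intro i
    rw [SubMulAction.val_smul, Units.smul_def, Units.val_pow_eq_pow_val, smul_eq_mul]
  refine repl_ker_wsum h1 p a₀ τ (m := q.totient) (q := q) (t := t) hm ?_ ?_ ?_ ?_ ?_ hrepl
  · rw [← ZMod.intCast_zmod_eq_zero_iff_dvd]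
    push_cast
    rw [hpow, sub_self]
  · exact fun k => ZMod.intCast_mul_eq_zero_iff hn hr k
  · rw [ZMod.mul_natCast_eq_iff hn hr, hτt, map_intCast]
  · rintro ⟨a, ha⟩
    obtain ⟨g, rfl⟩ := (hp a).1 ha
    obtain ⟨i, hi⟩ := hgen (ZMod.unitsMap (Dvd.intro r hn) g)
    refine ⟨i, Subtype.ext ?_⟩
    rw [hsm, ZMod.mul_natCast_eq_iff hn hr, map_pow, hτ', ← Units.val_pow_eq_pow_val, hi]
    rfl
  · intro i
    rw [← ht, orderOf_dvd_iff_pow_eq_one, ← hτt, ← map_pow,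
      ← map_one (ZMod.castHom (Dvd.intro r hn) (ZMod q)), ← ZMod.mul_natCast_eq_iff hn hr, ← hsm,
      one_mul]
    exact Subtype.ext_iff

omit [NeZero n] in
theorem ZMod.units_mul_of_four {r : ℕ} (hn : 4 * r = n) (hr : r ≠ 0) (g : (ZMod n)ˣ) :
    (g : ZMod n) * r = (1 : ℤ) * (r : ZMod n) ∨ (g : ZMod n) * r = (3 : ℤ) * (r : ZMod n) := by
  have hcast : ∀ k l : ℤ, (k : ZMod n) * (r : ZMod n) = (l : ZMod n) * (r : ZMod n) ↔
      (4 : ℤ) ∣ k - l := by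
    intro k l
    rw [← sub_eq_zero, ← sub_mul, ← Int.cast_sub, ZMod.intCast_mul_eq_zero_iff hn hr]
    rfl
  obtain ⟨k, hk⟩ := ZMod.intCast_surjective (g : ZMod n)
  obtain ⟨l, hl⟩ := ZMod.intCast_surjective ((g⁻¹ : (ZMod n)ˣ) : ZMod n)
  have h1 : ((k * l : ℤ) : ZMod n) * (r : ZMod n) = (1 : ℤ) * (r : ZMod n) := by
    rw [Int.cast_mul, hk, hl, Units.mul_inv, Int.cast_one]
  rw [hcast] at h1
  rw [← hk, hcast, hcast]
  have h2 : k % 2 = 1 := by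
    rcases Int.emod_two_eq_zero_or_one k with h | h
    · exfalso
      obtain ⟨j, rfl⟩ := Int.dvd_of_emod_eq_zero h
      rw [mul_assoc] at h1
      omega
    · exact h
  omega

theorem repl_ker_wsum_four (p : SubMulAction (ZMod n)ˣ (ZMod n)) [Fintype p] {r : ℕ}
    (hn : 4 * r = n)
    (hp : ∀ a, a ∈ p ↔ (∃ g : (ZMod n)ˣ, g * (r : ZMod n) = a) ∨ a = ((2 * r : ℕ) : ZMod n)) :
    Repl cl (LinearMap.ker (wsum p)) (PermMod (ZMod n)ˣ p) := by
  classical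
  have hn0 : n ≠ 0 := NeZero.ne n
  have hr : r ≠ 0 := by rintro rfl; exact hn0 (by rw [← hn, mul_zero])
  have hcast : ∀ k l : ℤ, (k : ZMod n) * (r : ZMod n) = (l : ZMod n) * (r : ZMod n) ↔
      (4 : ℤ) ∣ k - l := by
    intro k l
    rw [← sub_eq_zero, ← sub_mul, ← Int.cast_sub, ZMod.intCast_mul_eq_zero_iff hn hr]
    rfl
  have hunit := fun g => ZMod.units_mul_of_four hn hr g
  let a₁ : p := ⟨(1 : ℤ) * (r : ZMod n), (hp _).2 (Or.inl ⟨1, by simp⟩)⟩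
  let a₂ : p := ⟨(2 : ℤ) * (r : ZMod n), (hp _).2 (Or.inr (by push_cast; ring))⟩
  let a₃ : p := ⟨(3 : ℤ) * (r : ZMod n), (hp _).2 (Or.inl ⟨-1, by
    have := (hcast (-1) 3).2 (by norm_num)
    rw [← this]; simp⟩)⟩
  have hall : ∀ a : p, a = a₁ ∨ a = a₂ ∨ a = a₃ := by
    rintro ⟨a, ha⟩
    rcases (hp a).1 ha with ⟨g, rfl⟩ | rfl
    · rcases hunit g with h | h
      · exact Or.inl (Subtype.ext h)
      · exact Or.inr (Or.inr (Subtype.ext h))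
    · exact Or.inr (Or.inl (Subtype.ext (by
        change _ = ((2 : ℤ) : ZMod n) * (r : ZMod n); push_cast; ring)))
  have h12 : a₁ ≠ a₂ := fun h => absurd ((hcast _ _).1 (congrArg Subtype.val h)) (by norm_num)
  have h13 : a₁ ≠ a₃ := fun h => absurd ((hcast _ _).1 (congrArg Subtype.val h)) (by norm_num)
  have h23 : a₂ ≠ a₃ := fun h => absurd ((hcast _ _).1 (congrArg Subtype.val h)) (by norm_num)
  have huniv : (Finset.univ : Finset p) = {a₁, a₂, a₃} := by
    ext a
    simpa using hall a
  have hwsum : ∀ x : PermMod (ZMod n)ˣ p, wsumHom p x = 0 ↔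
      (4 : ℤ) ∣ x.coord a₁ + 2 * x.coord a₂ + 3 * x.coord a₃ := by
    intro x
    have h : wsumHom p x = ((x.coord a₁ + 2 * x.coord a₂ + 3 * x.coord a₃ : ℤ) : ZMod n) *
        (r : ZMod n) := by
      change ∑ a : p, (x.coord a : ZMod n) * (a : ZMod n) = _
      rw [huniv, Finset.sum_insert (by simp [h12, h13]), Finset.sum_insert (by simp [h23]),
        Finset.sum_singleton]
      change (x.coord a₁ : ZMod n) * ((1 : ℤ) * (r : ZMod n)) + ((x.coord a₂ : ZMod n) *
        ((2 : ℤ) * (r : ZMod n)) + (x.coord a₃ : ZMod n) * ((3 : ℤ) * (r : ZMod n))) = _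
      push_cast
      ring
    rw [h, ZMod.intCast_mul_eq_zero_iff hn hr]
    rfl
  have hact : ∀ g : (ZMod n)ˣ, g • a₂ = a₂ ∧ ((g • a₁ = a₁ ∧ g • a₃ = a₃) ∨
      (g • a₁ = a₃ ∧ g • a₃ = a₁)) := by
    intro g
    have hk : ∀ k l : ℤ, (g : ZMod n) * r = (l : ZMod n) * (r : ZMod n) →
        g • ((k : ZMod n) * (r : ZMod n)) = ((k * l : ℤ) : ZMod n) * (r : ZMod n) := by
      intro k l h
      rw [Units.smul_def, smul_eq_mul, mul_left_comm, h]
      push_cast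
      ring
    rcases hunit g with h | h
    · refine ⟨Subtype.ext ?_, Or.inl ⟨Subtype.ext ?_, Subtype.ext ?_⟩⟩ <;>
      · refine (hk _ _ h).trans ?_
        rw [hcast]
        norm_num
    · refine ⟨Subtype.ext ?_, Or.inr ⟨Subtype.ext ?_, Subtype.ext ?_⟩⟩ <;>
      · refine (hk _ _ h).trans ?_
        rw [hcast]
        norm_num
  let f0 : (p → ℤ) → p → ℤ := fun x a => if a = a₁ then 2 * x a₁ + x a₂ else
    if a = a₂ then x a₁ + x a₃ else 2 * x a₃ + x a₂
  have f1 : ∀ x, f0 x a₁ = 2 * x a₁ + x a₂ := fun x => if_pos rfl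
  have f2 : ∀ x, f0 x a₂ = x a₁ + x a₃ := fun x => by simp [f0, h12.symm]
  have f3 : ∀ x, f0 x a₃ = 2 * x a₃ + x a₂ := fun x => by simp [f0, h13.symm, h23.symm]
  let F : PermMod (ZMod n)ˣ p →+ PermMod (ZMod n)ˣ p :=
    AddMonoidHom.mk' (fun x => PermMod.ofFun (f0 x.coord)) (by
      intro x y
      ext a
      rw [PermMod.coord_add, PermMod.coord_ofFun, PermMod.coord_ofFun, PermMod.coord_ofFun]
      rcases hall a with rfl | rfl | rfl <;> simp only [f1, f2, f3, PermMod.coord_add] <;> ring)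
  have F1 : ∀ x, (F x).coord a₁ = 2 * x.coord a₁ + x.coord a₂ := fun x => f1 _
  have F2 : ∀ x, (F x).coord a₂ = x.coord a₁ + x.coord a₃ := fun x => f2 _
  have F3 : ∀ x, (F x).coord a₃ = 2 * x.coord a₃ + x.coord a₂ := fun x => f3 _
  have hF : ∀ (g : (ZMod n)ˣ) x, F (of g • x) = of g • F x := by
    intro g x
    obtain ⟨h2, ⟨h1, h3⟩ | ⟨h1, h3⟩⟩ := hact g⁻¹ <;>
    · ext a
      rcases hall a with rfl | rfl | rfl <;>
      simp only [F1, F2, F3, PermMod.of_smul_coord, h1, h2, h3]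
      all_goals ring
  let ψ : PermMod (ZMod n)ˣ p →ₗ[GrpRing (ZMod n)ˣ] LinearMap.ker (wsum p) :=
    LinearMap.codRestrict _ (equivariantHom F hF) (by
      intro x
      rw [LinearMap.mem_ker]
      refine (hwsum _).2 ?_
      rw [equivariantHom_apply, F1, F2, F3]
      omega)
  have hψ : Function.Bijective ψ := by
    constructor
    · intro x y hxy
      have h : F x = F y := congrArg Subtype.val hxy
      have e1 := congrArg (fun z => PermMod.coord z a₁) h
      have e2 := congrArg (fun z => PermMod.coord z a₂) h
      have e3 := congrArg (fun z => PermMod.coord z a₃) h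
      simp only [F1, F2, F3] at e1 e2 e3
      ext a
      rcases hall a with rfl | rfl | rfl <;> omega
    · rintro ⟨y, hy⟩
      have hy' := (hwsum y).1 hy
      obtain ⟨j, hj⟩ := hy'
      have h21 := h12.symm
      let x : PermMod (ZMod n)ˣ p := PermMod.ofFun fun a =>
        if a = a₁ then j - y.coord a₃ else
        if a = a₂ then y.coord a₁ - 2 * j + 2 * y.coord a₃ else y.coord a₂ - j + y.coord a₃
      have x1 : x.coord a₁ = j - y.coord a₃ := if_pos rfl
      have x2 : x.coord a₂ = y.coord a₁ - 2 * j + 2 * y.coord a₃ :=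
        (if_neg h12.symm).trans (if_pos rfl)
      have x3 : x.coord a₃ = y.coord a₂ - j + y.coord a₃ :=
        (if_neg h13.symm).trans (if_neg h23.symm)
      refine ⟨x, Subtype.ext ?_⟩
      change F x = y
      ext a
      rcases hall a with rfl | rfl | rfl
      · rw [F1, x1, x2]; ring
      · rw [F2, x1, x3]; ring
      · rw [F3, x3, x2]; linarith
  exact Repl.of_equiv (LinearEquiv.ofBijective ψ hψ).symm

end Fibers

section Orders

theorem orderOf_eq_of_forall_lt {G : Type*} [Monoid G] {x : G} {m : ℕ} (hm : 0 < m)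
    (h1 : x ^ m = 1) (h2 : ∀ k < m, 0 < k → x ^ k ≠ 1) : orderOf x = m :=
  (orderOf_eq_iff hm).2 ⟨h1, h2⟩

theorem orderOf_two_three_pow (k : ℕ) :
    orderOf (((2 : ℤ)) : ZMod (3 ^ (k + 1))) = (3 ^ (k + 1)).totient := by
  rw [Nat.totient_prime_pow_succ Nat.prime_three, show 3 - 1 = 2 from rfl]
  have hz : ∀ e : ℕ, (((2 : ℤ)) : ZMod (3 ^ (k + 1))) ^ e = 1 ↔
      ((3 ^ (k + 1) : ℕ) : ℤ) ∣ 2 ^ e - 1 := by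
    intro e
    rw [← ZMod.intCast_zmod_eq_zero_iff_dvd]
    push_cast
    rw [sub_eq_zero]
  have hpow : ∀ j : ℕ, (2 : ℤ) ^ (3 ^ j * 2) = 4 ^ 3 ^ j := by
    intro j
    rw [mul_comm, pow_mul]
    norm_num
  refine orderOf_eq_of_pow_and_pow_div_prime (by positivity) ?_ ?_
  · rw [hz, hpow]
    obtain ⟨u, hu⟩ := four_pow_three_pow k
    rw [hu]
    exact ⟨1 + 3 * u, by push_cast; ring⟩
  · intro p hp hdvd
    rw [Ne, hz]
    rcases (hp.dvd_mul).1 hdvd with h | h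
    · have hp3 : p = 3 := (Nat.prime_dvd_prime_iff_eq hp Nat.prime_three).1 (hp.dvd_of_dvd_pow h)
      subst hp3
      obtain _ | k := k
      · norm_num at h
      · rw [show 3 ^ (k + 1) * 2 / 3 = 3 ^ k * 2 by omega, hpow]
        obtain ⟨u, hu⟩ := four_pow_three_pow k
        rw [hu]
        rintro ⟨v, hv⟩
        have h3 : (3 : ℤ) ^ (k + 1) ≠ 0 := by positivity
        have : (3 : ℤ) ^ (k + 1) * (1 + 3 * u) = 3 ^ (k + 1) * (3 * v) := by
          push_cast at hv
          linear_combination hv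
        have := mul_left_cancel₀ h3 this
        omega
    · have hp2 : p = 2 := (Nat.prime_dvd_prime_iff_eq hp Nat.prime_two).1 h
      subst hp2
      rw [Nat.mul_div_cancel _ two_pos]
      intro h'
      have h3 : (3 : ℤ) ∣ 2 ^ 3 ^ k - 1 := (Dvd.intro (3 ^ k) (by push_cast; ring)).trans h'
      have h4 : (3 : ℤ) ∣ 2 ^ 3 ^ k - (-1) ^ 3 ^ k := by
        refine dvd_trans ?_ (sub_dvd_pow_sub_pow (2 : ℤ) (-1) (3 ^ k))
        norm_num
      rw [Odd.neg_one_pow (Odd.pow (by decide))] at h4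
      omega

end Orders

section Concrete

variable {Λ : Type} [CommRing Λ] {U : Type} [AddCommGroup U] [Module Λ U]
  {cl : ClosureOperator (Submodule Λ U)}

/-- The prime powers for which the ideal attached to a primitive root can be replaced by the
whole ring. -/
def IsGoodOddPower (q : ℕ) : Prop :=
  q ∈ [2, 5, 7, 11, 13, 17, 19, 23, 29, 31, 37, 41, 43, 61, 67, 71, 25, 49] ∨ ∃ k, q = 3 ^ (k + 1)

theorem repl_two {S : Type} [CommRing S] [Algebra Λ S] {x : S} (hx : IsCyclicRing x 1) :
    Repl cl (Ideal.span {((2 : ℤ) : S), x - ((1 : ℤ) : S)}) S := by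
  have h1 : x = 1 := by simpa using hx.pow_eq_one
  have h2 : Ideal.span {((2 : ℤ) : S), x - ((1 : ℤ) : S)} = Ideal.span {((2 : ℤ) : S)} := by
    rw [h1, Int.cast_one, sub_self, Set.pair_comm, Ideal.span_insert_zero]
  rw [h2]
  exact Repl.of_equiv (principalEquiv _ fun y hy => hx.torsionFree (by norm_num) hy).symm

theorem exists_repl {q : ℕ} (hq : IsGoodOddPower q) :
    ∃ t : ℤ, orderOf (t : ZMod q) = q.totient ∧
      ∀ {S : Type} [CommRing S] [Algebra Λ S] {x : S}, IsCyclicRing x q.totient →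
        (∀ e, e ∣ q.totient → ExtVanish cl (S ⧸ Ideal.span {x ^ e - 1})) →
        Repl cl (Ideal.span {((q : ℤ) : S), x - (t : S)}) S := by
  rcases hq with hq | ⟨k, rfl⟩
  · simp only [List.mem_cons, List.not_mem_nil, or_false] at hq
    rcases hq with rfl | rfl | rfl | rfl | rfl | rfl | rfl | rfl | rfl | rfl | rfl | rfl | rfl |
      rfl | rfl | rfl | rfl | rfl
    · exact ⟨1, by simp, fun hx _ => repl_two hx⟩
    · exact ⟨2, orderOf_eq_of_forall_lt (by decide) (by decide +kernel) (by decide +kernel),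
        fun hx h => repl_5 hx h⟩
    · exact ⟨3, orderOf_eq_of_forall_lt (by decide) (by decide +kernel) (by decide +kernel),
        fun hx h => repl_7 hx h⟩
    · exact ⟨2, orderOf_eq_of_forall_lt (by decide) (by decide +kernel) (by decide +kernel),
        fun hx h => repl_11 hx h⟩
    · exact ⟨2, orderOf_eq_of_forall_lt (by decide) (by decide +kernel) (by decide +kernel),
        fun hx h => repl_13 hx h⟩
    · exact ⟨3, orderOf_eq_of_forall_lt (by decide) (by decide +kernel) (by decide +kernel),
        fun hx h => repl_17 hx h⟩
    · exact ⟨2, orderOf_eq_of_forall_lt (by decide) (by decide +kernel) (by decide +kernel),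
        fun hx h => repl_19 hx h⟩
    · exact ⟨5, orderOf_eq_of_forall_lt (by decide) (by decide +kernel) (by decide +kernel),
        fun hx h => repl_23 hx h⟩
    · exact ⟨2, orderOf_eq_of_forall_lt (by decide) (by decide +kernel) (by decide +kernel),
        fun hx h => repl_29 hx h⟩
    · exact ⟨3, orderOf_eq_of_forall_lt (by decide) (by decide +kernel) (by decide +kernel),
        fun hx h => repl_31 hx h⟩
    · exact ⟨2, orderOf_eq_of_forall_lt (by decide) (by decide +kernel) (by decide +kernel),
        fun hx h => repl_37 hx h⟩
    · exact ⟨6, orderOf_eq_of_forall_lt (by decide) (by decide +kernel) (by decide +kernel),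
        fun hx h => repl_41 hx h⟩
    · exact ⟨3, orderOf_eq_of_forall_lt (by decide) (by decide +kernel) (by decide +kernel),
        fun hx h => repl_43 hx h⟩
    · exact ⟨2, orderOf_eq_of_forall_lt (by decide) (by decide +kernel) (by decide +kernel),
        fun hx h => repl_61 hx h⟩
    · exact ⟨2, orderOf_eq_of_forall_lt (by decide) (by decide +kernel) (by decide +kernel),
        fun hx h => repl_67 hx h⟩
    · exact ⟨7, orderOf_eq_of_forall_lt (by decide) (by decide +kernel) (by decide +kernel),
        fun hx h => repl_71 hx h⟩
    · exact ⟨2, orderOf_eq_of_forall_lt (by decide) (by decide +kernel) (by decide +kernel),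
        fun hx h => repl_25 hx h⟩
    · exact ⟨3, orderOf_eq_of_forall_lt (by decide) (by decide +kernel) (by decide +kernel),
        fun hx h => repl_49 hx h⟩
  · refine ⟨2, orderOf_two_three_pow k, ?_⟩
    rw [Nat.totient_prime_pow_succ Nat.prime_three, show 3 - 1 = 2 from rfl, mul_comm]
    intro S _ _ x hx h
    have := repl_three_pow k hx h
    rwa [show ((3 ^ (k + 1) : ℕ) : ℤ) = 3 ^ (k + 1) by push_cast; rfl]

end Concrete

section Divisors

theorem good_prime_power {p k m : ℕ} (hp : p.Prime) (hk : k ≠ 0)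
    (h : p ^ k ∣ 2 ^ 2 * 3 ^ m * 5 ^ 2 * 7 ^ 2 * 11 * 13 * 17 * 19 * 23 * 29 * 31 * 37 *
        41 * 43 * 61 * 67 * 71) : p ^ k = 4 ∨ IsGoodOddPower (p ^ k) := by
  by_cases h3 : p = 3
  · subst h3
    obtain ⟨k, rfl⟩ := Nat.exists_eq_succ_of_ne_zero hk
    exact Or.inr (Or.inr ⟨k, rfl⟩)
  have hcop : Nat.Coprime (p ^ k) (3 ^ m) :=
    Nat.Coprime.pow _ _ ((Nat.coprime_primes hp Nat.prime_three).2 h3)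
  have h1 : p ^ k ∣ 2 ^ 2 * 5 ^ 2 * 7 ^ 2 * 11 * 13 * 17 * 19 * 23 * 29 * 31 * 37 *
      41 * 43 * 61 * 67 * 71 := by
    refine hcop.dvd_of_dvd_mul_left (m := 3 ^ m) (h.trans (dvd_of_eq (by ring)))
  have hp1 : p ∣ 2 ^ 2 * 5 ^ 2 * 7 ^ 2 * 11 * 13 * 17 * 19 * 23 * 29 * 31 * 37 *
      41 * 43 * 61 * 67 * 71 := (dvd_pow_self p hk).trans h1
  have hle : ∀ a, ¬ p ^ (a + 1) ∣ 2 ^ 2 * 5 ^ 2 * 7 ^ 2 * 11 * 13 * 17 * 19 * 23 * 29 * 31 * 37 *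
      41 * 43 * 61 * 67 * 71 → k ≤ a := by
    intro a ha
    by_contra hlt
    exact ha ((pow_dvd_pow p (by omega)).trans h1)
  have hprime : ∀ r : ℕ, r.Prime → p ∣ r → p = r := fun r hr h =>
    (Nat.prime_dvd_prime_iff_eq hp hr).1 h
  have hpr : p = 2 ∨ p = 5 ∨ p = 7 ∨ p = 11 ∨ p = 13 ∨ p = 17 ∨ p = 19 ∨ p = 23 ∨ p = 29 ∨ p = 31 ∨
      p = 37 ∨ p = 41 ∨ p = 43 ∨ p = 61 ∨ p = 67 ∨ p = 71 := by
    simp only [hp.dvd_mul] at hp1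
    rcases hp1 with ((((((((((((((h | h) | h) | h) | h) | h) | h) | h) | h) | h) | h) | h) | h) | h) | h) | h
    · simp [hprime 2 (by norm_num) (hp.dvd_of_dvd_pow h)]
    · simp [hprime 5 (by norm_num) (hp.dvd_of_dvd_pow h)]
    · simp [hprime 7 (by norm_num) (hp.dvd_of_dvd_pow h)]
    all_goals simp [hprime _ (by norm_num) h]
  rcases hpr with rfl | rfl | rfl | rfl | rfl | rfl | rfl | rfl | rfl | rfl | rfl | rfl | rfl |
      rfl | rfl | rfl
  iterate 3
    have := hle 2 (by norm_num)
    interval_cases k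
    · omega
    · simp [IsGoodOddPower]
    · simp [IsGoodOddPower]
  all_goals
    have := hle 1 (by norm_num)
    obtain rfl : k = 1 := by omega
    simp [IsGoodOddPower]

end Divisors

section Assembly

variable {n : ℕ} [NeZero n] {U : Type} [AddCommGroup U] [Module (GrpRing (ZMod n)ˣ) U]
  {cl : ClosureOperator (Submodule (GrpRing (ZMod n)ˣ) U)}

/-- The residues attached to a prime power `q`: the elements of order exactly `q`, together with
the involution when `q = 4`. -/
def IsAttached (n q : ℕ) (a : ZMod n) : Prop :=
  (∃ g : (ZMod n)ˣ, g * ((n / q : ℕ) : ZMod n) = a) ∨ (q = 4 ∧ a = ((2 * (n / q) : ℕ) : ZMod n))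

omit [NeZero n] in
theorem IsAttached.mul_eq_zero {q : ℕ} (hq : q ∣ n) {a : ZMod n} (h : IsAttached n q a) :
    (q : ZMod n) * a = 0 := by
  have h0 : (q : ZMod n) * ((n / q : ℕ) : ZMod n) = 0 := by
    rw [← Nat.cast_mul, Nat.mul_div_cancel' hq, ZMod.natCast_self]
  rcases h with ⟨g, rfl⟩ | ⟨-, rfl⟩
  · rw [mul_left_comm, h0, mul_zero]
  · rw [Nat.cast_mul, mul_left_comm, h0, mul_zero]

theorem IsAttached.ne_zero {q : ℕ} (hq : q ∣ n) (hq1 : 1 < q) {a : ZMod n}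
    (h : IsAttached n q a) : a ≠ 0 := by
  obtain ⟨r, hr⟩ := hq
  have hn : 0 < n := Nat.pos_of_ne_zero (NeZero.ne n)
  have hr0 : 0 < r := by
    rcases Nat.eq_zero_or_pos r with rfl | h
    · omega
    · exact h
  have hdiv : n / q = r := by rw [hr, Nat.mul_div_cancel_left _ (by omega)]
  rw [IsAttached, hdiv] at h
  rcases h with ⟨g, rfl⟩ | ⟨rfl, rfl⟩
  · rw [Ne, Units.mul_right_eq_zero, ZMod.natCast_eq_zero_iff]
    intro h
    have := Nat.le_of_dvd hr0 h
    nlinarith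
  · rw [Ne, ZMod.natCast_eq_zero_iff]
    intro h
    have := Nat.le_of_dvd (by omega) h
    omega

theorem IsAttached.smul {q : ℕ} (hq : q ∣ n) {a : ZMod n}
    (h : IsAttached n q a) (g : (ZMod n)ˣ) : IsAttached n q (g • a) := by
  rcases h with ⟨g', rfl⟩ | ⟨h4, ha⟩
  · exact Or.inl ⟨g * g', by rw [Units.val_mul, Units.smul_def, smul_eq_mul, mul_assoc]⟩
  · refine Or.inr ⟨h4, ?_⟩
    subst h4
    have hn : 4 * (n / 4) = n := Nat.mul_div_cancel' hq
    have hr : n / 4 ≠ 0 := fun h => NeZero.ne n (by rw [← hn, h, mul_zero])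
    have h40 : (4 : ZMod n) * ((n / 4 : ℕ) : ZMod n) = 0 := by
      have : ((4 * (n / 4) : ℕ) : ZMod n) = 0 := by rw [hn, ZMod.natCast_self]
      exact_mod_cast this
    rw [ha, Units.smul_def, smul_eq_mul]
    push_cast
    rcases ZMod.units_mul_of_four hn hr g with h | h <;> push_cast at h
    · linear_combination 2 * h
    · linear_combination 2 * h + h40

theorem gen_perm_of_gen_ker_wsumAll {m : ℕ}
    (hdvd : n ∣ 2 ^ 2 * 3 ^ m * 5 ^ 2 * 7 ^ 2 * 11 * 13 * 17 * 19 * 23 * 29 * 31 * 37 *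
        41 * 43 * 61 * 67 * 71)
    (h1 : H1Vanish (of : (ZMod n)ˣ →* GrpRing (ZMod n)ˣ) cl)
    (hM : Gen cl (LinearMap.ker (wsumAll n))) : Gen cl (PermMod (ZMod n)ˣ (ZMod n)) := by
  classical
  have hn : n ≠ 0 := NeZero.ne n
  let q : n.primeFactors → ℕ := fun p => (p : ℕ) ^ n.factorization p
  have hpr : ∀ i : n.primeFactors, (i : ℕ).Prime := fun i => Nat.prime_of_mem_primeFactors i.2
  have hk : ∀ i : n.primeFactors, n.factorization i ≠ 0 := fun i =>
    ((hpr i).factorization_pos_of_dvd hn (Nat.dvd_of_mem_primeFactors i.2)).ne'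
  have hq1 : ∀ i, 1 < q i := fun i => Nat.one_lt_pow (hk i) (hpr i).one_lt
  have hqn : ∀ i, q i ∣ n := fun i => Nat.ordProj_dvd n i
  have hcop : Pairwise (Nat.Coprime.onFun q) := fun i j hij =>
    Nat.Coprime.pow _ _ ((Nat.coprime_primes (hpr i) (hpr j)).2 fun h => hij (Subtype.ext h))
  have hprod : ∏ i, q i = n := by
    rw [Finset.prod_coe_sort n.primeFactors fun p => p ^ n.factorization p]
    exact Nat.prod_factorization_pow_eq_self hn
  have huniq : ∀ i j a, IsAttached n (q i) a → IsAttached n (q j) a → i = j := by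
    intro i j a hi hj
    by_contra hij
    obtain ⟨u, v, huv⟩ := Nat.isCoprime_iff_coprime.2 (hcop hij)
    have h3 := congrArg (Int.cast : ℤ → ZMod n) huv
    push_cast at h3
    refine hi.ne_zero (hqn i) (hq1 i) ?_
    linear_combination (u : ZMod n) * hi.mul_eq_zero (hqn i) +
      (v : ZMod n) * hj.mul_eq_zero (hqn j) - a * h3
  let c : ZMod n → Option n.primeFactors := fun a =>
    if h : ∃ i, IsAttached n (q i) a then some h.choose else none
  have hcsome : ∀ a i, c a = some i ↔ IsAttached n (q i) a := by
    intro a i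
    constructor
    · intro h
      by_cases hex : ∃ i, IsAttached n (q i) a
      · have h2 : c a = some hex.choose := dif_pos hex
        rw [h2, Option.some_inj] at h
        exact h ▸ hex.choose_spec
      · rw [show c a = none from dif_neg hex] at h
        cases h
    · intro h
      have hex : ∃ i, IsAttached n (q i) a := ⟨i, h⟩
      rw [show c a = some hex.choose from dif_pos hex, huniq _ _ _ hex.choose_spec h]
  have hc : ∀ (g : (ZMod n)ˣ) a, c (g • a) = c a := by
    intro g a
    refine Option.ext fun i => ?_
    rw [hcsome, hcsome]
    refine ⟨fun h => ?_, fun h => h.smul (hqn i) g⟩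
    have := h.smul (hqn i) g⁻¹
    rwa [inv_smul_smul] at this
  refine gen_perm_of_gen_ker c hc h1 q hcop (fun i => (zero_lt_one.trans (hq1 i)).ne') hprod
    (fun i a h => ((hcsome _ _).1 h).mul_eq_zero (hqn i))
    (fun i => (hcsome _ _).2 (Or.inl ⟨1, by simp⟩)) (fun i => ?_) hM
  have hmem : ∀ a, a ∈ cfib c hc (some i) ↔ IsAttached n (q i) a := fun a => hcsome a i
  rcases good_prime_power (hpr i) (hk i) ((hqn i).trans hdvd) with h4 | hgood
  · refine repl_ker_wsum_four _ (r := n / q i) ?_ fun a => ?_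
    · rw [← h4]
      exact Nat.mul_div_cancel' (hqn i)
    · rw [hmem, IsAttached]
      simp only [show q i = 4 from h4, true_and]
  · obtain ⟨t, ht, hrepl⟩ := exists_repl (cl := cl) hgood
    refine repl_ker_wsum_orbit h1 _ (Nat.mul_div_cancel' (hqn i)) (fun a => ?_) ht hrepl
    have hne : q i ≠ 4 := by
      rcases hgood with h | ⟨k, h⟩
      · intro h4
        rw [show (i : ℕ) ^ n.factorization i = 4 from h4] at h
        revert h
        decide
      · intro h4
        have h5 : 4 = 3 ^ (k + 1) := h4.symm.trans h
        rw [pow_succ] at h5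
        omega
    rw [hmem, IsAttached]
    simp only [hne, false_and, or_false]

end Assembly

section Descent

variable {n : ℕ} [NeZero n] {F : Type*} [Field F] (e : AddChar (ZMod n) F)
  (ρ : (ZMod n)ˣ →* RingAut F)

/-- The sum of the conjugates of an element. -/
def conjSum (x : F) : F := ∑ s, ρ s x

variable {ρ}

theorem conjSum_apply (t : (ZMod n)ˣ) (x : F) : ρ t (conjSum ρ x) = conjSum ρ x := by
  rw [conjSum, map_sum]
  refine Fintype.sum_equiv (Equiv.mulLeft t) _ _ fun s => ?_
  rw [Equiv.coe_mulLeft, map_mul, RingAut.mul_apply]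

theorem conjSum_conj (t : (ZMod n)ˣ) (x : F) : conjSum ρ (ρ t x) = conjSum ρ x := by
  refine Fintype.sum_equiv (Equiv.mulRight t) _ _ fun s => ?_
  rw [Equiv.coe_mulRight, map_mul, RingAut.mul_apply]

theorem conjSum_mul {y : F} (hy : ∀ s, ρ s y = y) (x : F) :
    conjSum ρ (y * x) = y * conjSum ρ x := by
  simp only [conjSum, map_mul, hy, Finset.mul_sum]

theorem conjSum_sum {ι : Type*} (s : Finset ι) (f : ι → F) :
    conjSum ρ (∑ i ∈ s, f i) = ∑ i ∈ s, conjSum ρ (f i) := by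
  simp only [conjSum, map_sum]
  exact Finset.sum_comm

theorem conjSum_fixed {y : F} (hy : ∀ s, ρ s y = y) :
    conjSum ρ y = (Fintype.card (ZMod n)ˣ : F) * y := by
  simp [conjSum, hy]

variable {e} (he : e.IsPrimitive) (hρ : ∀ s a, ρ s (e a) = e (s * a))
include he hρ

theorem sum_conjSum (x : F) : ∑ j, e (-j) * conjSum ρ (e j * x) = (n : F) * x := by
  classical
  have h1 : ∀ j, e (-j) * conjSum ρ (e j * x) = ∑ s, ρ s x * e (j * ((s : ZMod n) - 1)) := by
    intro j
    rw [conjSum, Finset.mul_sum]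
    refine Finset.sum_congr rfl fun s _ => ?_
    rw [map_mul, hρ, show j * ((s : ZMod n) - 1) = -j + s * j by ring, AddChar.map_add_eq_mul]
    ring
  rw [Finset.sum_congr rfl fun j _ => h1 j, Finset.sum_comm,
    Finset.sum_eq_single (1 : (ZMod n)ˣ)]
  · simp [mul_comm]
  · intro s _ hs
    rw [← Finset.mul_sum, AddChar.sum_mulShift _ he, if_neg, Nat.cast_zero, mul_zero]
    exact fun h => hs (Units.ext (sub_eq_zero.1 h))
  · simp

/-- The elements that are combinations of the values of `e` over a fixed subfield `K`. -/
def conjSubfield [CharZero F] (K : Subfield F) (hK : ∀ x ∈ K, ∀ s, ρ s x = x)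
    (heK : ∀ j, conjSum ρ (e j) ∈ K) : Subfield F := by
  have hn : (n : F) ≠ 0 := Nat.cast_ne_zero.2 (NeZero.ne n)
  have hmul : ∀ x y : F, (∀ j, conjSum ρ (e j * x) ∈ K) → (∀ j, conjSum ρ (e j * y) ∈ K) →
      ∀ j, conjSum ρ (e j * (x * y)) ∈ K := by
    intro x y hx hy j
    have h1 : (n : F) * conjSum ρ (e j * (x * y)) =
        ∑ i, conjSum ρ (e i * x) * conjSum ρ (e (j - i) * y) := by
      rw [← conjSum_mul fun s => map_natCast _ _]
      simp only [← conjSum_mul fun s => conjSum_apply s _]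
      rw [← conjSum_sum]
      congr 1
      calc (n : F) * (e j * (x * y)) = e j * (((n : F) * x) * y) := by ring
        _ = _ := by
          rw [← sum_conjSum he hρ, Finset.sum_mul, Finset.mul_sum]
          refine Finset.sum_congr rfl fun i _ => ?_
          rw [sub_eq_add_neg, AddChar.map_add_eq_mul]
          ring
    have h2 : conjSum ρ (e j * (x * y)) =
        (n : F)⁻¹ * ∑ i, conjSum ρ (e i * x) * conjSum ρ (e (j - i) * y) := by
      rw [← h1, inv_mul_cancel_left₀ hn]
    rw [h2]
    exact mul_mem (inv_mem (natCast_mem K n)) (sum_mem fun i _ => mul_mem (hx _) (hy _))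
  have hone : ∀ j, conjSum ρ (e j * 1) ∈ K := fun j => by rw [mul_one]; exact heK j
  have hfix : ∀ x, (∀ s, ρ s x = x) → (∀ j, conjSum ρ (e j * x) ∈ K) → x ∈ K := by
    intro x hx h
    have h0 := h 0
    rw [AddChar.map_zero_eq_one, one_mul, conjSum_fixed hx] at h0
    have hc : (Fintype.card (ZMod n)ˣ : F) ≠ 0 := Nat.cast_ne_zero.2 Fintype.card_ne_zero
    rw [← inv_mul_cancel_left₀ hc x]
    exact mul_mem (inv_mem (natCast_mem K _)) h0
  have hconj : ∀ x, (∀ j, conjSum ρ (e j * x) ∈ K) → ∀ s, ∀ j, conjSum ρ (e j * ρ s x) ∈ K := by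
    intro x hx s j
    have h1 : e j * ρ s x = ρ s (e ((s⁻¹ : (ZMod n)ˣ) * j) * x) := by
      rw [map_mul, hρ, Units.mul_inv_cancel_left]
    rw [h1, conjSum_conj]
    exact hx _
  have hprod : ∀ (S : Finset (ZMod n)ˣ) (x : F), (∀ j, conjSum ρ (e j * x) ∈ K) →
      ∀ j, conjSum ρ (e j * ∏ s ∈ S, ρ s x) ∈ K := by
    classical
    intro S x hx
    induction S using Finset.induction_on with
    | empty => simpa using heK
    | insert a S ha ih =>
      rw [Finset.prod_insert ha]
      exact hmul _ _ (hconj x hx a) ih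
  have hadd : ∀ x y : F, (∀ j, conjSum ρ (e j * x) ∈ K) → (∀ j, conjSum ρ (e j * y) ∈ K) →
      ∀ j, conjSum ρ (e j * (x + y)) ∈ K := by
    intro x y hx hy j
    have : conjSum ρ (e j * (x + y)) = conjSum ρ (e j * x) + conjSum ρ (e j * y) := by
      simp only [conjSum, mul_add, map_add, Finset.sum_add_distrib]
    rw [this]
    exact add_mem (hx j) (hy j)
  have hKS : ∀ y ∈ K, ∀ j, conjSum ρ (e j * y) ∈ K := by
    intro y hy j
    rw [mul_comm, conjSum_mul (hK y hy)]
    exact mul_mem hy (heK j)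
  exact
    { carrier := {x | ∀ j, conjSum ρ (e j * x) ∈ K}
      mul_mem' := fun {x y} => hmul x y
      one_mem' := hone
      add_mem' := fun {x y} => hadd x y
      zero_mem' := fun j => by simp [conjSum]
      neg_mem' := fun {x} hx => by
        rw [← neg_one_mul]
        exact hmul _ _ (hKS _ (neg_mem (one_mem K))) hx
      inv_mem' := by
        classical
        intro x hx
        by_cases hx0 : x = 0
        · rwa [hx0, inv_zero, ← hx0]
        have h1 : x * ∏ s ∈ Finset.univ.erase (1 : (ZMod n)ˣ), ρ s x = ∏ s, ρ s x := by
          rw [← Finset.mul_prod_erase Finset.univ (fun s => ρ s x) (Finset.mem_univ 1), map_one]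
          rfl
        have h2 : ∏ s, ρ s x ≠ 0 := Finset.prod_ne_zero_iff.2 fun s _ => by
          rwa [Ne, EmbeddingLike.map_eq_zero_iff]
        have h3 : ∏ s, ρ s x ∈ K := by
          refine hfix _ (fun t => ?_) (hprod _ x hx)
          rw [map_prod]
          refine Fintype.prod_equiv (Equiv.mulLeft t) _ _ fun s => ?_
          rw [Equiv.coe_mulLeft, map_mul, RingAut.mul_apply]
        have h4 : x⁻¹ = (∏ s, ρ s x)⁻¹ * ∏ s ∈ Finset.univ.erase (1 : (ZMod n)ˣ), ρ s x := by
          rw [eq_inv_mul_iff_mul_eq₀ h2, ← h1]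
          field_simp
        rw [h4]
        exact hmul _ _ (hKS _ (inv_mem h3)) (hprod _ x hx) }

/-- Galois descent for generators: if `z` consists of fixed elements and generates `F` over a stable
subfield `F0`, then it generates the fixed field over the fixed field of `F0`. -/
theorem mem_closure_of_fixed [CharZero F] {F0 k : Subfield F} (heF0 : ∀ a, e a ∈ F0)
    (hF0 : ∀ s, ∀ x ∈ F0, ρ s x ∈ F0) (hk : ∀ x ∈ k, ∀ s, ρ s x = x)
    (hkF : ∀ x ∈ F0, (∀ s, ρ s x = x) → x ∈ k) {z : Set F} (hz : ∀ x ∈ z, ∀ s, ρ s x = x)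
    (hgen : ∀ x, x ∈ Subfield.closure ((F0 : Set F) ∪ z)) {x : F} (hx : ∀ s, ρ s x = x) :
    x ∈ Subfield.closure ((k : Set F) ∪ z) := by
  set K := Subfield.closure ((k : Set F) ∪ z) with hKdef
  have hkK : ∀ y ∈ k, y ∈ K := fun y hy => Subfield.subset_closure (Or.inl hy)
  have hzK : ∀ y ∈ z, y ∈ K := fun y hy => Subfield.subset_closure (Or.inr hy)
  have hF0k : ∀ y ∈ F0, conjSum ρ y ∈ k := fun y hy =>
    hkF _ (sum_mem fun s _ => hF0 s y hy) fun s => conjSum_apply s y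
  have hK : ∀ y ∈ K, ∀ s, ρ s y = y := by
    intro y hy s
    have : K ≤ (RingHom.eqLocusField ((ρ s : F ≃+* F) : F →+* F) (RingHom.id F)) := by
      rw [hKdef, Subfield.closure_le]
      rintro y (hy | hy)
      · exact hk y hy s
      · exact hz y hy s
    exact this hy
  have heK : ∀ j, conjSum ρ (e j) ∈ K := fun j => hkK _ (hF0k _ (heF0 j))
  have hle : Subfield.closure ((F0 : Set F) ∪ z) ≤ conjSubfield he hρ K hK heK := by
    rw [Subfield.closure_le]
    rintro y (hy | hy) j
    · exact hkK _ (hF0k _ (mul_mem (heF0 j) hy))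
    · rw [mul_comm, conjSum_mul (hz y hy)]
      exact mul_mem (hzK y hy) (heK j)
  have h0 : conjSum ρ (e 0 * x) ∈ K := hle (hgen x) 0
  rw [AddChar.map_zero_eq_one, one_mul, conjSum_fixed hx] at h0
  have hc : (Fintype.card (ZMod n)ˣ : F) ≠ 0 := Nat.cast_ne_zero.2 Fintype.card_ne_zero
  rw [← inv_mul_cancel_left₀ hc x]
  exact mul_mem (inv_mem (natCast_mem K _)) h0

end Descent

section Transcendence

open Cardinal
open scoped IntermediateField.algebraAdjoinAdjoin

theorem isAlgebraic_of_forall_fixed_mem {F : Type*} [Field F] {n : ℕ} (hn : n ≠ 0) {σ : RingAut F}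
    (hσ : σ ^ n = 1) (K : Subfield F) (hK : ∀ x, σ x = x → x ∈ K) : Algebra.IsAlgebraic K F := by
  have hfin : Finite (Subgroup.zpowers σ) :=
    (isOfFinOrder_iff_pow_eq_one.2 ⟨n, Nat.pos_of_ne_zero hn, hσ⟩ : IsOfFinOrder σ).finite_zpowers
  have hle : FixedPoints.subfield (Subgroup.zpowers σ) F ≤ K := fun x hx =>
    hK x (hx ⟨σ, Subgroup.mem_zpowers σ⟩)
  refine ⟨fun x => ?_⟩
  obtain ⟨p, hp0, hp⟩ := Algebra.IsAlgebraic.isAlgebraic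
    (R := FixedPoints.subfield (Subgroup.zpowers σ) F) x
  refine ⟨p.map (Subfield.inclusion hle), ?_, ?_⟩
  · rwa [Polynomial.map_ne_zero_iff (Subfield.inclusion hle).injective]
  · rw [Polynomial.aeval_def, Polynomial.eval₂_map]
    exact hp

theorem algebraicIndependent_of_isAlgebraic {k F : Type*} [Field k] [Field F] [Algebra k F] {n : ℕ}
    (htr : (n : Cardinal) ≤ Algebra.trdeg k F) (t : Fin n → F) (K : Subfield F)
    (hK : K ≤ Subfield.closure (Set.range (algebraMap k F) ∪ Set.range t))
    [Algebra.IsAlgebraic K F] : AlgebraicIndependent k t := by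
  have h1 : Algebra.IsAlgebraic (Algebra.adjoin k (Set.range t)) F := by
    have : Algebra.IsAlgebraic (IntermediateField.adjoin k (Set.range t)) F := by
      refine ⟨fun x => ?_⟩
      obtain ⟨p, hp0, hp⟩ := Algebra.IsAlgebraic.isAlgebraic (R := K) x
      let f : K →+* IntermediateField.adjoin k (Set.range t) := Subfield.inclusion hK
      refine ⟨p.map f, (Polynomial.map_ne_zero_iff f.injective).2 hp0, ?_⟩
      rw [Polynomial.aeval_def, Polynomial.eval₂_map]
      exact hp
    exact (IsFractionRing.comap_isAlgebraic_iff (A := Algebra.adjoin k (Set.range t))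
      (K := IntermediateField.adjoin k (Set.range t)) (C := F)).2 this
  exact (Algebra.IsAlgebraic.isTranscendenceBasis_of_lift_le_trdeg_of_finite k t
    (by simpa using htr)).1

theorem rational_iff_exists_closure {F : Type} [Field F] [Algebra ℚ F] {n : ℕ}
    (htr : (n : Cardinal) ≤ Algebra.trdeg ℚ F) :
    Nonempty (F ≃ₐ[ℚ] FractionRing (MvPolynomial (Fin n) ℚ)) ↔
      ∃ t : Fin n → F, Subfield.closure (Set.range t) = ⊤ := by
  constructor
  · rintro ⟨φ⟩
    refine ⟨fun i => φ.symm (algebraMap (MvPolynomial (Fin n) ℚ) _ (MvPolynomial.X i)),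
      top_unique fun x _ => ?_⟩
    set K := Subfield.closure (Set.range fun i : Fin n => φ.symm
      (algebraMap (MvPolynomial (Fin n) ℚ) (FractionRing (MvPolynomial (Fin n) ℚ))
        (MvPolynomial.X i)))
    have hp : ∀ p : MvPolynomial (Fin n) ℚ, φ.symm (algebraMap _ _ p) ∈ K := by
      intro p
      induction p using MvPolynomial.induction_on with
      | C a =>
        rw [← MvPolynomial.algebraMap_eq, ← IsScalarTower.algebraMap_apply, AlgEquiv.commutes]
        rw [eq_ratCast (algebraMap ℚ F)]
        exact SubfieldClass.ratCast_mem K a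
      | add p q hp hq => rw [map_add, map_add]; exact add_mem hp hq
      | mul_X p i hp =>
        rw [map_mul, map_mul]
        exact mul_mem hp (Subfield.subset_closure ⟨i, rfl⟩)
    obtain ⟨a, b, hb, hab⟩ := IsFractionRing.div_surjective (A := MvPolynomial (Fin n) ℚ) (φ x)
    rw [← φ.symm_apply_apply x, ← hab, map_div₀]
    exact div_mem (hp _) (hp _)
  · rintro ⟨t, ht⟩
    have hK : (⊤ : Subfield F) ≤ Subfield.closure (Set.range (algebraMap ℚ F) ∪ Set.range t) := by
      rw [← ht]
      exact Subfield.closure_mono Set.subset_union_right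
    have halg : Algebra.IsAlgebraic (⊤ : Subfield F) F :=
      ⟨fun x => isAlgebraic_algebraMap (⟨x, trivial⟩ : (⊤ : Subfield F))⟩
    have hind := algebraicIndependent_of_isAlgebraic htr t ⊤ hK
    have hinj : Function.Injective
        (MvPolynomial.aeval t : MvPolynomial (Fin n) ℚ →ₐ[ℚ] F) := hind
    let ψ : FractionRing (MvPolynomial (Fin n) ℚ) →ₐ[ℚ] F :=
      IsFractionRing.liftAlgHom (K := FractionRing (MvPolynomial (Fin n) ℚ)) hinj
    have hsurj : Function.Surjective ψ := by
      have : (⊤ : Subfield F) ≤ (ψ : FractionRing (MvPolynomial (Fin n) ℚ) →+* F).fieldRange := by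
        rw [← ht, Subfield.closure_le]
        rintro _ ⟨i, rfl⟩
        refine ⟨algebraMap (MvPolynomial (Fin n) ℚ) _ (MvPolynomial.X i), ?_⟩
        simp [ψ]
      exact fun x => this (Subfield.mem_top x)
    exact ⟨(AlgEquiv.ofBijective ψ ⟨ψ.toRingHom.injective, hsurj⟩).symm⟩

end Transcendence

noncomputable section Setup

variable (n : ℕ) [NeZero n]

/-- The `n`-th cyclotomic field. -/
abbrev Cyc : Type := CyclotomicField n ℚ

/-- The polynomial ring in variables of all weights modulo `n` over the cyclotomic field. -/
abbrev WPoly : Type := MvPolynomial (ZMod n) (Cyc n)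

/-- The rational function field in variables of all weights modulo `n` over the cyclotomic field. -/
abbrev WField : Type := FractionRing (WPoly n)

instance isCyclotomicExtension_cyc : IsCyclotomicExtension {n} ℚ (Cyc n) :=
  CyclotomicField.isCyclotomicExtension n ℚ

theorem cyc_zeta_spec : IsPrimitiveRoot (IsCyclotomicExtension.zeta n ℚ (Cyc n)) n :=
  IsCyclotomicExtension.zeta_spec n ℚ (Cyc n)

/-- The standard additive character of `ZMod n` with values in the cyclotomic field. -/
def cycChar : AddChar (ZMod n) (Cyc n) := AddChar.zmodChar n (cyc_zeta_spec n).pow_eq_one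

theorem cycChar_isPrimitive : (cycChar n).IsPrimitive :=
  AddChar.zmodChar_primitive_of_primitive_root n (cyc_zeta_spec n)

/-- The cyclotomic character as an isomorphism of groups. -/
def cycGal : (ZMod n)ˣ ≃* (Cyc n ≃ₐ[ℚ] Cyc n) :=
  (IsCyclotomicExtension.autEquivPow (Cyc n)
    (Polynomial.cyclotomic.irreducible_rat (NeZero.pos n))).symm

variable {n}

theorem cycGal_cycChar (s : (ZMod n)ˣ) (a : ZMod n) :
    cycGal n s (cycChar n a) = cycChar n (s * a) := by
  have h1 : cycGal n s (IsCyclotomicExtension.zeta n ℚ (Cyc n)) =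
      IsCyclotomicExtension.zeta n ℚ (Cyc n) ^ (s : ZMod n).val := by
    have h := IsPrimitiveRoot.autToPow_spec ℚ (cyc_zeta_spec n) (cycGal n s)
    rw [← h]
    congr 3
    exact (IsCyclotomicExtension.autEquivPow (Cyc n)
      (Polynomial.cyclotomic.irreducible_rat (NeZero.pos n))).apply_symm_apply s
  have h2 : cycChar n a = IsCyclotomicExtension.zeta n ℚ (Cyc n) ^ a.val :=
    AddChar.zmodChar_apply _ _
  have h3 : cycChar n ((a.val * (s : ZMod n).val : ℕ) : ZMod n) =
      IsCyclotomicExtension.zeta n ℚ (Cyc n) ^ (a.val * (s : ZMod n).val) :=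
    AddChar.zmodChar_apply' _ _
  rw [h2, map_pow, h1, ← pow_mul, mul_comm (s : ZMod n).val, ← h3, Nat.cast_mul,
    ZMod.natCast_zmod_val, ZMod.natCast_zmod_val, mul_comm]

theorem cycGal_fixed {x : Cyc n} (hx : ∀ s, cycGal n s x = x) : ∃ q : ℚ, algebraMap ℚ _ q = x := by
  have : IsGalois ℚ (Cyc n) := IsCyclotomicExtension.isGalois {n} ℚ (Cyc n)
  have : FiniteDimensional ℚ (Cyc n) := IsCyclotomicExtension.finiteDimensional {n} ℚ (Cyc n)
  have h := (IsGalois.mem_bot_iff_fixed (F := ℚ) (E := Cyc n) x).2 fun f => by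
    obtain ⟨s, rfl⟩ := (cycGal n).surjective f
    exact hx s
  exact IntermediateField.mem_bot.1 h

variable (n) in
/-- The action of the units on the polynomial ring, permuting the weights. -/
def actPoly : (ZMod n)ˣ →* RingAut (WPoly n) where
  toFun s := (MvPolynomial.mapEquiv (ZMod n) (cycGal n s).toRingEquiv).trans
    (MvPolynomial.renameEquiv (Cyc n) (Units.mulLeft s)).toRingEquiv
  map_one' := by
    apply RingEquiv.toRingHom_injective
    ext <;> simp
  map_mul' s t := by
    apply RingEquiv.toRingHom_injective
    ext <;> simp [mul_assoc]

theorem actPoly_C (s : (ZMod n)ˣ) (x : Cyc n) :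
    actPoly n s (MvPolynomial.C x) = MvPolynomial.C (cycGal n s x) := by
  simp [actPoly]

theorem actPoly_X (s : (ZMod n)ˣ) (a : ZMod n) :
    actPoly n s (MvPolynomial.X a) = MvPolynomial.X (s * a) := by
  simp [actPoly]

/-- The substitution scaling each variable according to its weight. -/
def scaleHom (c : ZMod n) : WPoly n →ₐ[Cyc n] WPoly n :=
  MvPolynomial.aeval fun a => MvPolynomial.C (cycChar n (c * a)) * MvPolynomial.X a

theorem scaleHom_comp (c d : ZMod n) : (scaleHom c).comp (scaleHom d) = scaleHom (c + d) := by
  refine MvPolynomial.algHom_ext fun a => ?_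
  rw [AlgHom.comp_apply]
  simp only [scaleHom, MvPolynomial.aeval_X]
  rw [map_mul, MvPolynomial.aeval_C, MvPolynomial.aeval_X, add_mul, AddChar.map_add_eq_mul,
    MvPolynomial.C_mul, MvPolynomial.algebraMap_eq]
  ring

theorem scaleHom_zero : scaleHom (0 : ZMod n) = AlgHom.id _ _ := by
  refine MvPolynomial.algHom_ext fun a => ?_
  simp [scaleHom]

variable (n) in
/-- The action of `ZMod n` on the polynomial ring, scaling each variable according to its weight. -/
def scalePoly : Multiplicative (ZMod n) →* RingAut (WPoly n) where
  toFun c := (AlgEquiv.ofAlgHom (scaleHom c.toAdd) (scaleHom (-c.toAdd))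
    (by rw [scaleHom_comp, add_neg_cancel, scaleHom_zero])
    (by rw [scaleHom_comp, neg_add_cancel, scaleHom_zero])).toRingEquiv
  map_one' := by
    ext x : 1
    exact congrArg (fun f : WPoly n →ₐ[Cyc n] WPoly n => f x) scaleHom_zero
  map_mul' c d := by
    ext x : 1
    exact congrArg (fun f : WPoly n →ₐ[Cyc n] WPoly n => f x) (scaleHom_comp c.toAdd d.toAdd).symm

theorem scalePoly_C (c : Multiplicative (ZMod n)) (x : Cyc n) :
    scalePoly n c (MvPolynomial.C x) = MvPolynomial.C x :=
  (scaleHom c.toAdd).commutes x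

theorem scalePoly_X (c : Multiplicative (ZMod n)) (a : ZMod n) :
    scalePoly n c (MvPolynomial.X a) =
      MvPolynomial.C (cycChar n (c.toAdd * a)) * MvPolynomial.X a :=
  MvPolynomial.aeval_X _ _

variable (n)

/-- The action of the units on the rational function field. -/
def act : (ZMod n)ˣ →* RingAut (WField n) :=
  (IsFractionRing.ringEquivOfRingEquivHom (WPoly n) (WField n)).comp (actPoly n)

/-- The action of `ZMod n` on the rational function field. -/
def scale : Multiplicative (ZMod n) →* RingAut (WField n) :=
  (IsFractionRing.ringEquivOfRingEquivHom (WPoly n) (WField n)).comp (scalePoly n)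

variable {n}

/-- The variable of weight `a`. -/
def wvar (a : ZMod n) : WField n := algebraMap (WPoly n) _ (MvPolynomial.X a)

theorem act_algebraMap (s : (ZMod n)ˣ) (p : WPoly n) :
    act n s (algebraMap _ _ p) = algebraMap _ _ (actPoly n s p) :=
  IsFractionRing.ringEquivOfRingEquiv_algebraMap _ _

theorem scale_algebraMap (c : Multiplicative (ZMod n)) (p : WPoly n) :
    scale n c (algebraMap _ _ p) = algebraMap _ _ (scalePoly n c p) :=
  IsFractionRing.ringEquivOfRingEquiv_algebraMap _ _

omit [NeZero n] in
theorem algebraMap_C_wField (x : Cyc n) :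
    algebraMap (WPoly n) (WField n) (MvPolynomial.C x) = algebraMap (Cyc n) (WField n) x := by
  rw [← MvPolynomial.algebraMap_eq, ← IsScalarTower.algebraMap_apply]

theorem act_const (s : (ZMod n)ˣ) (x : Cyc n) :
    act n s (algebraMap _ _ x) = algebraMap _ _ (cycGal n s x) := by
  rw [← algebraMap_C_wField, act_algebraMap, actPoly_C, algebraMap_C_wField]

theorem act_wvar (s : (ZMod n)ˣ) (a : ZMod n) : act n s (wvar a) = wvar ((s : ZMod n) * a) := by
  rw [wvar, act_algebraMap, actPoly_X, wvar]

theorem scale_const (c : Multiplicative (ZMod n)) (x : Cyc n) :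
    scale n c (algebraMap _ _ x) = algebraMap _ _ x := by
  rw [← algebraMap_C_wField, scale_algebraMap, scalePoly_C]

theorem scale_wvar (c : Multiplicative (ZMod n)) (a : ZMod n) :
    scale n c (wvar a) = algebraMap (Cyc n) _ (cycChar n (c.toAdd * a)) * wvar a := by
  rw [wvar, scale_algebraMap, scalePoly_X, map_mul, algebraMap_C_wField]

omit [NeZero n] in
theorem wvar_ne_zero (a : ZMod n) : wvar a ≠ 0 := by
  rw [wvar, Ne, IsFractionRing.to_map_eq_zero_iff]
  exact MvPolynomial.X_ne_zero a

omit [NeZero n] in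
/-- The constants and the variables generate the rational function field. -/
theorem mem_closure_wvar (x : WField n) :
    x ∈ Subfield.closure (Set.range (algebraMap (Cyc n) (WField n)) ∪ Set.range wvar) := by
  have hp : ∀ p : WPoly n, algebraMap _ (WField n) p ∈
      Subfield.closure (Set.range (algebraMap (Cyc n) (WField n)) ∪ Set.range wvar) := by
    intro p
    induction p using MvPolynomial.induction_on with
    | C a =>
      rw [algebraMap_C_wField]
      exact Subfield.subset_closure (Or.inl ⟨a, rfl⟩)
    | add p q hp hq => rw [map_add]; exact add_mem hp hq
    | mul_X p i hp =>
      rw [map_mul]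
      exact mul_mem hp (Subfield.subset_closure (Or.inr ⟨i, rfl⟩))
  obtain ⟨a, b, hb, rfl⟩ := IsFractionRing.div_surjective (A := WPoly n) x
  exact div_mem (hp _) (hp _)

omit [NeZero n] in
theorem ringHom_ext_wField {K : Type*} [Field K] {f g : WField n →+* K}
    (h1 : ∀ x : Cyc n, f (algebraMap _ _ x) = g (algebraMap _ _ x))
    (h2 : ∀ a, f (wvar a) = g (wvar a)) : f = g := by
  ext x
  have : Subfield.closure (Set.range (algebraMap (Cyc n) (WField n)) ∪ Set.range wvar) ≤
      RingHom.eqLocusField f g := by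
    rw [Subfield.closure_le]
    rintro _ (⟨x, rfl⟩ | ⟨a, rfl⟩)
    · exact h1 x
    · exact h2 a
  exact this (mem_closure_wvar x)

theorem act_scale_comm (s : (ZMod n)ˣ) (c : Multiplicative (ZMod n)) (x : WField n) :
    act n s (scale n c x) = scale n c (act n s x) := by
  have : ((act n s : WField n ≃+* WField n) : WField n →+* WField n).comp
      ((scale n c : WField n ≃+* WField n) : WField n →+* WField n) =
      ((scale n c : WField n ≃+* WField n) : WField n →+* WField n).comp
      ((act n s : WField n ≃+* WField n) : WField n →+* WField n) := by
    refine ringHom_ext_wField (fun x => ?_) fun a => ?_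
    · change act n s (scale n c _) = scale n c (act n s _)
      rw [scale_const, act_const, scale_const]
    · change act n s (scale n c _) = scale n c (act n s _)
      rw [scale_wvar, map_mul, act_wvar, act_const, cycGal_cycChar, scale_wvar]
      congr 3
      ring
  exact congrArg (fun f : WField n →+* WField n => f x) this

variable (n) in
/-- The additive character with values in the rational function field. -/
def wChar : AddChar (ZMod n) (WField n) :=
  (algebraMap (Cyc n) (WField n)).toMonoidHom.compAddChar (cycChar n)

theorem wChar_apply (a : ZMod n) : wChar n a = algebraMap (Cyc n) (WField n) (cycChar n a) := rfl

theorem wChar_isPrimitive : (wChar n).IsPrimitive := by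
  refine AddChar.zmod_char_primitive_of_eq_one_only_at_zero n _ fun a ha => ?_
  rw [wChar_apply, ← map_one (algebraMap (Cyc n) (WField n))] at ha
  have h1 := (algebraMap (Cyc n) (WField n)).injective ha
  by_contra h
  exact (AddChar.IsPrimitive.zmod_char_eq_one_iff n (cycChar_isPrimitive n) a).not.2 h h1

theorem act_wChar (s : (ZMod n)ˣ) (a : ZMod n) : act n s (wChar n a) = wChar n (s * a) := by
  rw [wChar_apply, act_const, cycGal_cycChar, wChar_apply]

end Setup

noncomputable section Reduction

theorem trdeg_fractionRing_mvPolynomial (k ι : Type) [Field k] [Finite ι] :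
    Algebra.trdeg k (FractionRing (MvPolynomial ι k)) = Nat.card ι := by
  have : Algebra.IsAlgebraic (MvPolynomial ι k) (FractionRing (MvPolynomial ι k)) :=
    (IsFractionRing.comap_isAlgebraic_iff (K := FractionRing (MvPolynomial ι k))).2 inferInstance
  have h := trdeg_add_eq k (MvPolynomial ι k) (A := FractionRing (MvPolynomial ι k))
  rw [trdeg_eq_zero (R := MvPolynomial ι k), add_zero, MvPolynomial.trdeg_of_isDomain,
    Cardinal.lift_id] at h
  rw [← h, Nat.cast_card]

variable {n : ℕ} [NeZero n]

/-- The discrete Fourier transform of the variables. -/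
def fourierVar (b : ZMod n) : WField n := ∑ a, wChar n (b * a) * wvar a

theorem sum_fourierVar (a : ZMod n) :
    ∑ b, wChar n (-b * a) * fourierVar b = (n : WField n) * wvar a := by
  have h1 : ∀ b, wChar n (-b * a) * fourierVar b =
      ∑ c, wvar c * wChar n (b * (c - a)) := by
    intro b
    rw [fourierVar, Finset.mul_sum]
    refine Finset.sum_congr rfl fun c _ => ?_
    rw [show b * (c - a) = -b * a + b * c by ring, AddChar.map_add_eq_mul]
    ring
  rw [Finset.sum_congr rfl fun j _ => h1 j, Finset.sum_comm, Finset.sum_eq_single a]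
  · simp
  · intro c _ hc
    rw [← Finset.mul_sum, AddChar.sum_mulShift _ wChar_isPrimitive, if_neg, Nat.cast_zero,
      mul_zero]
    exact fun h => hc (sub_eq_zero.1 h)
  · simp

theorem act_fourierVar (s : (ZMod n)ˣ) (b : ZMod n) : act n s (fourierVar b) = fourierVar b := by
  rw [fourierVar, map_sum]
  refine Fintype.sum_equiv (Units.mulLeft s) _ _ fun a => ?_
  rw [map_mul, act_wvar, act_wChar, Units.mulLeft_apply, mul_left_comm]

theorem scale_fourierVar (c : Multiplicative (ZMod n)) (b : ZMod n) :
    scale n c (fourierVar b) = fourierVar (b + c.toAdd) := by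
  rw [fourierVar, map_sum, fourierVar]
  refine Finset.sum_congr rfl fun a _ => ?_
  rw [map_mul, scale_wvar, wChar_apply, scale_const, ← wChar_apply, ← wChar_apply, add_mul,
    AddChar.map_add_eq_mul]
  ring

theorem natCast_mem_range_zmod (b : ZMod n) : ∃ i : Fin n, ((i : ℕ) : ZMod n) = b :=
  ⟨⟨b.val, b.val_lt⟩, ZMod.natCast_zmod_val b⟩

theorem mem_closure_fourierVar (x : WField n) :
    x ∈ Subfield.closure (Set.range (algebraMap (Cyc n) (WField n)) ∪
      Set.range fun i : Fin n => fourierVar ((i : ℕ) : ZMod n)) := by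
  have hle : Subfield.closure (Set.range (algebraMap (Cyc n) (WField n)) ∪ Set.range wvar) ≤
      Subfield.closure (Set.range (algebraMap (Cyc n) (WField n)) ∪
      Set.range fun i : Fin n => fourierVar ((i : ℕ) : ZMod n)) := by
    rw [Subfield.closure_le]
    rintro _ (hx | ⟨a, rfl⟩)
    · exact Subfield.subset_closure (Or.inl hx)
    · have hn : (n : WField n) ≠ 0 := Nat.cast_ne_zero.2 (NeZero.ne n)
      rw [← inv_mul_cancel_left₀ hn (wvar a), ← sum_fourierVar]
      refine mul_mem (inv_mem (natCast_mem _ n)) (sum_mem fun b _ => mul_mem ?_ ?_)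
      · exact Subfield.subset_closure (Or.inl ⟨_, rfl⟩)
      · obtain ⟨i, rfl⟩ := natCast_mem_range_zmod b
        exact Subfield.subset_closure (Or.inr ⟨i, rfl⟩)
  exact hle (mem_closure_wvar x)

theorem trdeg_wField : Algebra.trdeg (Cyc n) (WField n) = n := by
  rw [trdeg_fractionRing_mvPolynomial, Nat.card_zmod]

theorem algebraicIndependent_fourierVar :
    AlgebraicIndependent ℚ fun i : Fin n => fourierVar ((i : ℕ) : ZMod n) := by
  have halg : Algebra.IsAlgebraic (⊤ : Subfield (WField n)) (WField n) :=
    ⟨fun x => isAlgebraic_algebraMap (⟨x, trivial⟩ : (⊤ : Subfield (WField n)))⟩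
  have h : AlgebraicIndependent (Cyc n) fun i : Fin n => fourierVar ((i : ℕ) : ZMod n) :=
    algebraicIndependent_of_isAlgebraic trdeg_wField.ge _ ⊤ fun x _ => mem_closure_fourierVar x
  exact h.restrictScalars (algebraMap ℚ (Cyc n)).injective

variable (n) in
/-- The embedding of the rational function field over `ℚ` given by the Fourier transform. -/
def fourierHom : FractionRing (MvPolynomial (Fin n) ℚ) →ₐ[ℚ] WField n :=
  IsFractionRing.liftAlgHom (K := FractionRing (MvPolynomial (Fin n) ℚ))
    (show Function.Injective (MvPolynomial.aeval fun i : Fin n =>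
      fourierVar ((i : ℕ) : ZMod n)) from
      algebraicIndependent_fourierVar)

theorem fourierHom_X (i : Fin n) :
    fourierHom n (algebraMap (MvPolynomial (Fin n) ℚ) _ (MvPolynomial.X i)) =
      fourierVar ((i : ℕ) : ZMod n) := by
  simp [fourierHom]

theorem ringHom_ext_fractionRing {ι : Type} {K : Type*} [Field K]
    {f g : FractionRing (MvPolynomial ι ℚ) →+* K}
    (h : ∀ i, f (algebraMap (MvPolynomial ι ℚ) _ (MvPolynomial.X i)) =
      g (algebraMap (MvPolynomial ι ℚ) _ (MvPolynomial.X i))) : f = g := by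
  refine IsLocalization.ringHom_ext (nonZeroDivisors (MvPolynomial ι ℚ)) ?_
  refine MvPolynomial.ringHom_ext (fun q => ?_) h
  exact congrArg (fun φ : ℚ →+* K => φ q) (Subsingleton.elim
    ((f.comp (algebraMap (MvPolynomial ι ℚ) _)).comp MvPolynomial.C)
    ((g.comp (algebraMap (MvPolynomial ι ℚ) _)).comp MvPolynomial.C))

theorem act_fourierHom (s : (ZMod n)ˣ) (x : FractionRing (MvPolynomial (Fin n) ℚ)) :
    act n s (fourierHom n x) = fourierHom n x := by
  have : ((act n s : WField n ≃+* WField n) : WField n →+* WField n).comp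
      (fourierHom n : FractionRing (MvPolynomial (Fin n) ℚ) →+* WField n) =
        (fourierHom n : FractionRing (MvPolynomial (Fin n) ℚ) →+* WField n) := by
    refine ringHom_ext_fractionRing fun i => ?_
    change act n s (fourierHom n _) = fourierHom n _
    rw [fourierHom_X, act_fourierVar]
  exact congrArg (fun f : FractionRing (MvPolynomial (Fin n) ℚ) →+* WField n => f x) this

theorem natCast_finRotate (i : Fin n) :
    ((finRotate n i : ℕ) : ZMod n) = ((i : ℕ) : ZMod n) + 1 := by
  obtain ⟨k, rfl⟩ := Nat.exists_eq_succ_of_ne_zero (NeZero.ne n)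
  rw [finRotate_apply, Fin.val_add, ZMod.natCast_mod, Nat.cast_add]
  congr 1
  rcases k with _ | k
  · exact Subsingleton.elim _ _
  · simp

variable (n) in
/-- The elements of the rational function field fixed by all actions. -/
def IsInv (x : WField n) : Prop := (∀ s, act n s x = x) ∧ ∀ c, scale n c x = x

theorem scale_eq_self {x : WField n} (h : scale n (Multiplicative.ofAdd 1) x = x)
    (c : Multiplicative (ZMod n)) : scale n c x = x := by
  have h1 : ∀ k : ℕ, scale n (Multiplicative.ofAdd 1 ^ k) x = x := by
    intro k
    induction k with
    | zero => rw [pow_zero, map_one]; rfl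
    | succ k ih => rw [pow_succ, map_mul, RingAut.mul_apply, h, ih]
  have h2 : c = Multiplicative.ofAdd 1 ^ c.toAdd.val := by
    rw [← ofAdd_nsmul, nsmul_one, ZMod.natCast_zmod_val, ofAdd_toAdd]
  rw [h2, h1]

theorem exists_fourierHom_eq {x : WField n} (hx : ∀ s, act n s x = x) :
    ∃ y, fourierHom n y = x := by
  have h := mem_closure_of_fixed wChar_isPrimitive act_wChar
    (F0 := (algebraMap (Cyc n) (WField n)).fieldRange) (k := (algebraMap ℚ (WField n)).fieldRange)
    (fun a => ⟨_, rfl⟩)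
    (by rintro s _ ⟨y, rfl⟩; exact ⟨_, (act_const s y).symm⟩)
    (by
      rintro _ ⟨q, rfl⟩ s
      exact RingHom.map_rat_algebraMap
        ((act n s : WField n ≃+* WField n) : WField n →+* WField n) q)
    (by
      rintro _ ⟨y, rfl⟩ hy
      obtain ⟨q, rfl⟩ := cycGal_fixed (n := n) (x := y) fun s => by
        have := hy s
        rw [act_const] at this
        exact (algebraMap (Cyc n) (WField n)).injective this
      exact ⟨q, IsScalarTower.algebraMap_apply ℚ (Cyc n) (WField n) q⟩)
    (z := Set.range fun i : Fin n => fourierVar ((i : ℕ) : ZMod n))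
    (by rintro _ ⟨i, rfl⟩ s; exact act_fourierVar s _) mem_closure_fourierVar hx
  have hle : Subfield.closure (((algebraMap ℚ (WField n)).fieldRange : Set (WField n)) ∪
      Set.range fun i : Fin n => fourierVar ((i : ℕ) : ZMod n)) ≤
      (fourierHom n : FractionRing (MvPolynomial (Fin n) ℚ) →+* WField n).fieldRange := by
    rw [Subfield.closure_le]
    rintro _ (⟨q, rfl⟩ | ⟨i, rfl⟩)
    · exact ⟨algebraMap ℚ _ q, (fourierHom n).commutes q⟩
    · exact ⟨_, fourierHom_X i⟩
  exact hle h

theorem fixedField_rational_iff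
    (σ : FractionRing (MvPolynomial (Fin n) ℚ) ≃ₐ[ℚ] FractionRing (MvPolynomial (Fin n) ℚ))
    (hσ : ∀ i : Fin n,
      σ (algebraMap (MvPolynomial (Fin n) ℚ) (FractionRing (MvPolynomial (Fin n) ℚ))
          (MvPolynomial.X i)) =
        algebraMap (MvPolynomial (Fin n) ℚ) (FractionRing (MvPolynomial (Fin n) ℚ))
          (MvPolynomial.X (finRotate n i))) :
    Nonempty ((IntermediateField.fixedField (Subgroup.zpowers σ)) ≃ₐ[ℚ]
        FractionRing (MvPolynomial (Fin n) ℚ)) ↔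
      ∃ t : Fin n → WField n, (∀ i, IsInv n (t i)) ∧
        ∀ x, IsInv n x → x ∈ Subfield.closure (Set.range t) := by
  have hcomm : ∀ x, scale n (Multiplicative.ofAdd 1) (fourierHom n x) = fourierHom n (σ x) := by
    intro x
    have : ((scale n (Multiplicative.ofAdd 1) : WField n ≃+* WField n) :
        WField n →+* WField n).comp
          (fourierHom n : FractionRing (MvPolynomial (Fin n) ℚ) →+* WField n) =
        (fourierHom n : FractionRing (MvPolynomial (Fin n) ℚ) →+* WField n).comp
          (σ : FractionRing (MvPolynomial (Fin n) ℚ) →+*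
            FractionRing (MvPolynomial (Fin n) ℚ)) := by
      refine ringHom_ext_fractionRing fun i => ?_
      change scale n _ (fourierHom n _) = fourierHom n (σ _)
      rw [hσ, fourierHom_X, fourierHom_X, scale_fourierVar, natCast_finRotate, toAdd_ofAdd]
    exact congrArg (fun f : FractionRing (MvPolynomial (Fin n) ℚ) →+* WField n => f x) this
  have hinj : Function.Injective (fourierHom n) := (fourierHom n).toRingHom.injective
  have hfix : ∀ x, x ∈ IntermediateField.fixedField (Subgroup.zpowers σ) ↔ σ x = x := by
    intro x
    rw [IntermediateField.mem_fixedField_iff]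
    refine ⟨fun h => h σ (Subgroup.mem_zpowers σ), fun h f hf => ?_⟩
    have : Subgroup.zpowers σ ≤ MulAction.stabilizer _ x := by
      rw [Subgroup.zpowers_le]
      exact h
    exact this hf
  have hinv : ∀ x, IsInv n (fourierHom n x) ↔
      x ∈ IntermediateField.fixedField (Subgroup.zpowers σ) := by
    intro x
    rw [hfix]
    refine ⟨fun h => hinj ?_, fun h => ⟨fun s => act_fourierHom s x, scale_eq_self ?_⟩⟩
    · rw [← hcomm, h.2]
    · rw [hcomm, h]
  have hσn : (σ : RingAut (FractionRing (MvPolynomial (Fin n) ℚ))) ^ n = 1 := by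
    ext x : 1
    apply hinj
    have h1 : ∀ k : ℕ,
        fourierHom n (((σ : RingAut (FractionRing (MvPolynomial (Fin n) ℚ))) ^ k) x) =
        scale n (Multiplicative.ofAdd 1 ^ k) (fourierHom n x) := by
      intro k
      induction k with
      | zero => rw [pow_zero, pow_zero, map_one]; rfl
      | succ k ih =>
        rw [pow_succ', pow_succ', map_mul, RingAut.mul_apply, RingAut.mul_apply, ← ih, hcomm]
        rfl
    rw [h1, ← ofAdd_nsmul, nsmul_one, ZMod.natCast_self, ofAdd_zero, map_one]
    rfl
  have htr : (n : Cardinal) ≤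
      Algebra.trdeg ℚ (IntermediateField.fixedField (Subgroup.zpowers σ)) := by
    have halg : Algebra.IsAlgebraic (IntermediateField.fixedField (Subgroup.zpowers σ))
        (FractionRing (MvPolynomial (Fin n) ℚ)) :=
      isAlgebraic_of_forall_fixed_mem (NeZero.ne n) hσn
        (IntermediateField.fixedField (Subgroup.zpowers σ)).toSubfield fun x hx => (hfix x).2 hx
    have h := trdeg_add_eq ℚ (IntermediateField.fixedField (Subgroup.zpowers σ))
      (A := FractionRing (MvPolynomial (Fin n) ℚ))
    rw [trdeg_eq_zero (R := IntermediateField.fixedField (Subgroup.zpowers σ)), add_zero] at h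
    have h2 : Algebra.trdeg ℚ (FractionRing (MvPolynomial (Fin n) ℚ)) = Nat.card (Fin n) := by
      convert! trdeg_fractionRing_mvPolynomial ℚ (Fin n)
      exact Subsingleton.elim _ _
    rw [h, h2, Nat.card_fin]
  let f : IntermediateField.fixedField (Subgroup.zpowers σ) →+* WField n :=
    (fourierHom n : FractionRing (MvPolynomial (Fin n) ℚ) →+* WField n).comp
      (algebraMap _ (FractionRing (MvPolynomial (Fin n) ℚ)))
  have hf : ∀ x, IsInv n x ↔ ∃ y, f y = x := by
    intro x
    constructor
    · intro h
      obtain ⟨y, rfl⟩ := exists_fourierHom_eq h.1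
      exact ⟨⟨y, (hinv y).1 h⟩, rfl⟩
    · rintro ⟨y, rfl⟩
      exact (hinv y).2 y.2
  have hmap : ∀ t : Fin n → IntermediateField.fixedField (Subgroup.zpowers σ),
      Subfield.closure (Set.range fun i => f (t i)) = (Subfield.closure (Set.range t)).map f := by
    intro t
    rw [RingHom.map_field_closure, ← Set.range_comp]
    rfl
  rw [rational_iff_exists_closure htr]
  constructor
  · rintro ⟨t, ht⟩
    refine ⟨fun i => f (t i), fun i => (hf _).2 ⟨_, rfl⟩, fun x hx => ?_⟩
    rw [hmap, ht]
    obtain ⟨y, rfl⟩ := (hf x).1 hx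
    exact ⟨y, trivial, rfl⟩
  · rintro ⟨t, hinvt, ht⟩
    choose u hu using fun i => (hf (t i)).1 (hinvt i)
    refine ⟨u, top_unique fun x _ => ?_⟩
    have h := ht (f x) ((hf _).2 ⟨x, rfl⟩)
    rw [← funext hu, hmap] at h
    obtain ⟨y, hy, hxy⟩ := h
    rwa [← f.injective hxy]

end Reduction

noncomputable section Backward

section Span

variable {n : ℕ} [NeZero n] {F : Type*} [Field F] [CharZero F] {e : AddChar (ZMod n) F}
  {ρ : (ZMod n)ˣ →* RingAut F}

/-- A permuted generating family can be replaced by a generating family of fixed elements. -/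
theorem exists_fixed_generators (he : e.IsPrimitive) (hρ : ∀ s a, ρ s (e a) = e (s * a))
    {F0 k : Subfield F} (heF0 : ∀ a, e a ∈ F0)
    (hF0 : ∀ s, ∀ x ∈ F0, ρ s x ∈ F0) (hk : ∀ x ∈ k, ∀ s, ρ s x = x)
    (hkF : ∀ x ∈ F0, (∀ s, ρ s x = x) → x ∈ k) (b : ZMod n → F)
    (hb : ∀ s a, ρ s (b a) = b (s * a))
    (hgen : ∀ x, x ∈ Subfield.closure ((F0 : Set F) ∪ Set.range b)) :
    ∃ t : Fin n → F, (∀ i s, ρ s (t i) = t i) ∧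
      ∀ x, (∀ s, ρ s x = x) → x ∈ Subfield.closure ((k : Set F) ∪ Set.range t) := by
  have hn : (n : F) ≠ 0 := Nat.cast_ne_zero.2 (NeZero.ne n)
  let S : Set F := Set.range fun p : ZMod n × ZMod n => conjSum ρ (e p.1 * b p.2)
  have hSb : Submodule.span F0 S ≤ Submodule.span F0 (Set.range b) := by
    rw [Submodule.span_le]
    rintro _ ⟨⟨j, a⟩, rfl⟩
    refine Submodule.sum_mem _ fun s _ => ?_
    rw [map_mul, hρ, hb]
    exact Submodule.smul_mem _ (⟨_, heF0 (s * j)⟩ : F0) (Submodule.subset_span ⟨_, rfl⟩)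
  have hbS : ∀ a, b a ∈ Submodule.span F0 S := by
    intro a
    have h1 : b a = (n : F)⁻¹ * ∑ j, e (-j) * conjSum ρ (e j * b a) := by
      rw [sum_conjSum he hρ, inv_mul_cancel_left₀ hn]
    rw [h1]
    refine Submodule.smul_mem _ (⟨_, inv_mem (natCast_mem F0 n)⟩ : F0)
      (Submodule.sum_mem _ fun j _ => ?_)
    exact Submodule.smul_mem _ (⟨_, heF0 (-j)⟩ : F0) (Submodule.subset_span ⟨(j, a), rfl⟩)
  have hfinb : FiniteDimensional F0 (Submodule.span F0 (Set.range b)) :=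
    FiniteDimensional.span_of_finite F0 (Set.finite_range b)
  have hfin : Module.finrank F0 (Submodule.span F0 S) ≤ n := by
    refine (Submodule.finrank_mono hSb).trans ((finrank_range_le_card b).trans ?_)
    rw [ZMod.card]
  have hfinS : FiniteDimensional F0 (Submodule.span F0 S) := Submodule.finiteDimensional_of_le hSb
  obtain ⟨f, hfS, hf, -⟩ := Submodule.exists_fun_fin_finrank_span_eq F0 S
  let t : Fin n → F := fun i =>
    if h : (i : ℕ) < Module.finrank F0 (Submodule.span F0 S) then f ⟨i, h⟩ else 0
  have ht : ∀ i s, ρ s (t i) = t i := by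
    intro i s
    by_cases h : (i : ℕ) < Module.finrank F0 (Submodule.span F0 S)
    · obtain ⟨p, hp⟩ := hfS ⟨i, h⟩
      simp only [t, dif_pos h, ← hp, conjSum_apply]
    · simp only [t, dif_neg h, map_zero]
  have hft : ∀ i, f i ∈ Set.range t := fun i =>
    ⟨⟨i, i.2.trans_le hfin⟩, by simp only [t, dif_pos i.2]⟩
  refine ⟨t, ht, fun x hx => mem_closure_of_fixed he hρ heF0 hF0 hk hkF
    (by rintro _ ⟨i, rfl⟩ s; exact ht i s) (fun x => ?_) hx⟩
  have hle : Subfield.closure ((F0 : Set F) ∪ Set.range b) ≤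
      Subfield.closure ((F0 : Set F) ∪ Set.range t) := by
    rw [Subfield.closure_le]
    rintro _ (hy | ⟨a, rfl⟩)
    · exact Subfield.subset_closure (Or.inl hy)
    · have h2 := hbS a
      rw [← hf] at h2
      generalize b a = y at h2
      induction h2 using Submodule.span_induction with
      | mem y hy =>
        obtain ⟨i, rfl⟩ := hy
        exact Subfield.subset_closure (Or.inr (hft i))
      | zero => exact zero_mem _
      | add y z _ _ hy hz => exact add_mem hy hz
      | smul c y _ hy => exact mul_mem (Subfield.subset_closure (Or.inl c.2)) hy
  exact hle (hgen x)

end Span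

section Monomials

variable {n : ℕ} [NeZero n]

omit [NeZero n] in
/-- The weight of an exponent vector. -/
def monWeight [Fintype (ZMod n)] (m : ZMod n →₀ ℕ) : ZMod n := ∑ a, (m a : ZMod n) * a

omit [NeZero n] in
theorem addChar_map_sum {ι M : Type*} [CommMonoid M] (e : AddChar (ZMod n) M) (s : Finset ι)
    (f : ι → ZMod n) : e (∑ i ∈ s, f i) = ∏ i ∈ s, e (f i) :=
  map_prod e.toMonoidHom (fun i => Multiplicative.ofAdd (f i)) s

theorem scalePoly_monomial (c : Multiplicative (ZMod n)) (m : ZMod n →₀ ℕ) (x : Cyc n) :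
    scalePoly n c (MvPolynomial.monomial m x) =
      MvPolynomial.C (cycChar n (c.toAdd * monWeight m)) * MvPolynomial.monomial m x := by
  rw [MvPolynomial.monomial_eq, Finsupp.prod_fintype _ _ fun _ => pow_zero _, map_mul,
    scalePoly_C, map_prod]
  simp only [map_pow, scalePoly_X, mul_pow]
  rw [Finset.prod_mul_distrib, monWeight, Finset.mul_sum, addChar_map_sum, map_prod]
  rw [mul_left_comm]
  congr 1
  refine Finset.prod_congr rfl fun a _ => ?_
  rw [← map_pow, ← AddChar.map_nsmul_eq_pow, nsmul_eq_mul, mul_left_comm]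

theorem mem_of_forall_monomial_mem (S : AddSubgroup (WField n))
    (hS : ∀ m x, monWeight m = 0 → algebraMap _ _ (MvPolynomial.monomial m x : WPoly n) ∈ S)
    {p : WPoly n} (hp : ∀ c, scalePoly n c p = p) : algebraMap _ _ p ∈ S := by
  have key : ∀ q : WPoly n, algebraMap _ _ (∑ c, scalePoly n c q) ∈ S := by
    intro q
    induction q using MvPolynomial.induction_on' with
    | add p q hp hq =>
      simp only [map_add, Finset.sum_add_distrib] at hp hq ⊢
      exact add_mem hp hq
    | monomial m x =>
      have h1 : ∑ c, scalePoly n c (MvPolynomial.monomial m x) =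
          MvPolynomial.C (∑ d : ZMod n, cycChar n (d * (monWeight m - 0))) *
            MvPolynomial.monomial m x := by
        rw [map_sum, Finset.sum_mul]
        refine Fintype.sum_equiv Multiplicative.toAdd _ _ fun c => ?_
        rw [scalePoly_monomial, sub_zero]
      rw [h1, AddChar.sum_mulShift _ (cycChar_isPrimitive n), MvPolynomial.C_mul_monomial]
      split_ifs with h
      · exact hS _ _ (by simpa using h)
      · simp
  have hn : (n : Cyc n) ≠ 0 := Nat.cast_ne_zero.2 (NeZero.ne n)
  have h2 : p = ∑ c, scalePoly n c (MvPolynomial.C (n : Cyc n)⁻¹ * p) := by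
    simp only [map_mul, scalePoly_C, hp]
    rw [Finset.sum_const, Finset.card_univ, Fintype.card_multiplicative, ZMod.card, nsmul_eq_mul,
      ← mul_assoc, ← map_natCast (MvPolynomial.C : Cyc n →+* WPoly n), ← map_mul,
      mul_inv_cancel₀ hn, map_one, one_mul]
  rw [h2]
  exact key _

theorem algebraMap_monomial (m : ZMod n →₀ ℕ) (x : Cyc n) :
    algebraMap _ (WField n) (MvPolynomial.monomial m x : WPoly n) =
      algebraMap (Cyc n) _ x * ∏ a, wvar a ^ m a := by
  rw [MvPolynomial.monomial_eq, Finsupp.prod_fintype _ _ fun _ => pow_zero _, map_mul,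
    algebraMap_C_wField, map_prod]
  simp only [map_pow, wvar]

/-- A fixed rational function is a quotient of fixed polynomials. -/
theorem exists_fixed_num_den {x : WField n} (hx : ∀ c, scale n c x = x) :
    ∃ p q : WPoly n, (∀ c, scalePoly n c p = p) ∧ (∀ c, scalePoly n c q = q) ∧ q ≠ 0 ∧
      x = algebraMap _ _ p / algebraMap _ _ q := by
  obtain ⟨p, q, hq, rfl⟩ := IsFractionRing.div_surjective (A := WPoly n) x
  have hq0 : q ≠ 0 := nonZeroDivisors.ne_zero hq
  have hinj : Function.Injective (algebraMap (WPoly n) (WField n)) :=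
    IsFractionRing.injective _ _
  classical
  let N : WPoly n := ∏ c, scalePoly n c q
  have hN : ∀ c, scalePoly n c N = N := by
    intro c
    simp only [N, map_prod]
    refine Fintype.prod_equiv (Equiv.mulLeft c) _ _ fun d => ?_
    rw [Equiv.coe_mulLeft, map_mul, RingAut.mul_apply]
  have hN0 : N ≠ 0 := Finset.prod_ne_zero_iff.2 fun c _ => by
    rwa [Ne, EmbeddingLike.map_eq_zero_iff]
  have hNq : N = q * ∏ c ∈ Finset.univ.erase 1, scalePoly n c q := by
    have h := Finset.mul_prod_erase Finset.univ (fun c => scalePoly n c q) (Finset.mem_univ 1)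
    rw [map_one, RingAut.one_apply] at h
    exact h.symm
  have hq1 : algebraMap (WPoly n) (WField n) q ≠ 0 := by
    rwa [Ne, IsFractionRing.to_map_eq_zero_iff]
  have hN1 : algebraMap (WPoly n) (WField n) N ≠ 0 := by
    rwa [Ne, IsFractionRing.to_map_eq_zero_iff]
  have h1 : algebraMap (WPoly n) (WField n) (p * ∏ c ∈ Finset.univ.erase 1, scalePoly n c q) =
      algebraMap _ _ p / algebraMap _ _ q * algebraMap _ _ N := by
    rw [hNq, map_mul, map_mul]
    field_simp
  refine ⟨p * ∏ c ∈ Finset.univ.erase 1, scalePoly n c q, N, fun c => hinj ?_, hN, hN0, ?_⟩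
  · rw [← scale_algebraMap, h1, map_mul, hx, scale_algebraMap, hN]
  · rw [h1, mul_div_cancel_right₀ _ hN1]

end Monomials

end Backward

noncomputable section Descent

variable (n : ℕ) [NeZero n]

/-- The field of rational functions of weight zero. -/
def invField : Subfield (WField n) where
  carrier := {x | ∀ c, scale n c x = x}
  mul_mem' ha hb c := by rw [map_mul, ha, hb]
  one_mem' c := map_one _
  add_mem' ha hb c := by rw [map_add, ha, hb]
  zero_mem' c := map_zero _
  neg_mem' ha c := by rw [map_neg, ha]
  inv_mem' x ha c := by rw [map_inv₀, ha]

variable {n}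

theorem act_mem_invField (s : (ZMod n)ˣ) {x : WField n} (hx : x ∈ invField n) :
    act n s x ∈ invField n := fun c => by
  rw [← act_scale_comm, hx]

theorem const_mem_invField (x : Cyc n) : algebraMap _ (WField n) x ∈ invField n :=
  fun c => scale_const c x

variable (n)

/-- The action of the units on the field of rational functions of weight zero. -/
def actInv : (ZMod n)ˣ →* RingAut (invField n) where
  toFun s :=
    { toFun := fun x => ⟨act n s x, act_mem_invField s x.2⟩
      invFun := fun x => ⟨act n s⁻¹ x, act_mem_invField s⁻¹ x.2⟩
      left_inv := fun x => by
        ext1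
        change act n s⁻¹ (act n s x) = x
        rw [← RingAut.mul_apply, ← map_mul, inv_mul_cancel, map_one, RingAut.one_apply]
      right_inv := fun x => by
        ext1
        change act n s (act n s⁻¹ x) = x
        rw [← RingAut.mul_apply, ← map_mul, mul_inv_cancel, map_one, RingAut.one_apply]
      map_mul' := fun x y => Subtype.ext (map_mul _ _ _)
      map_add' := fun x y => Subtype.ext (map_add _ _ _) }
  map_one' := by
    ext x : 2
    change act n 1 x = x
    rw [map_one, RingAut.one_apply]
  map_mul' s t := by
    ext x : 2
    change act n (s * t) x = act n s (act n t x)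
    rw [map_mul, RingAut.mul_apply]

/-- Constants as functions of weight zero. -/
def constInv : Cyc n →+* invField n :=
  (algebraMap (Cyc n) (WField n)).codRestrict (invField n) const_mem_invField

variable {n}

@[simp] theorem coe_actInv (s : (ZMod n)ˣ) (x : invField n) :
    (actInv n s x : WField n) = act n s x := rfl

@[simp] theorem coe_constInv (x : Cyc n) :
    (constInv n x : WField n) = algebraMap _ _ x := rfl

theorem actInv_constInv (s : (ZMod n)ˣ) (x : Cyc n) :
    actInv n s (constInv n x) = constInv n (cycGal n s x) := by
  ext1
  rw [coe_actInv, coe_constInv, coe_constInv, act_const]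

/-- The Laurent monomial with the given exponents. -/
def lmon (x : PermMod (ZMod n)ˣ (ZMod n)) : WField n := ∏ a, wvar a ^ x.coord a

theorem lmon_ne_zero (x : PermMod (ZMod n)ˣ (ZMod n)) : lmon x ≠ 0 :=
  Finset.prod_ne_zero_iff.2 fun a _ => zpow_ne_zero _ (wvar_ne_zero a)

theorem lmon_add (x y : PermMod (ZMod n)ˣ (ZMod n)) : lmon (x + y) = lmon x * lmon y := by
  simp only [lmon, PermMod.coord_add, zpow_add₀ (wvar_ne_zero _), Finset.prod_mul_distrib]

theorem lmon_zero : lmon (0 : PermMod (ZMod n)ˣ (ZMod n)) = 1 := by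
  simp [lmon]

theorem act_lmon (s : (ZMod n)ˣ) (x : PermMod (ZMod n)ˣ (ZMod n)) :
    act n s (lmon x) = lmon (of s • x) := by
  simp only [lmon, map_prod, map_zpow₀, act_wvar]
  refine Fintype.prod_equiv (MulAction.toPerm s) _ _ fun a => ?_
  rw [PermMod.of_smul_coord, MulAction.toPerm_apply, inv_smul_smul, Units.smul_def, smul_eq_mul]

omit [NeZero n] in
theorem map_addChar_zsmul {K : Type*} [Field K] (e : AddChar (ZMod n) K) (k : ℤ) (a : ZMod n) :
    e (k * a) = e a ^ k := by
  have h := AddChar.map_zsmul_eq_zpow e k a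
  rwa [zsmul_eq_mul] at h

theorem scale_lmon (c : Multiplicative (ZMod n)) (x : PermMod (ZMod n)ˣ (ZMod n)) :
    scale n c (lmon x) =
      algebraMap _ _ (cycChar n (c.toAdd * ∑ a, (x.coord a : ZMod n) * a)) * lmon x := by
  simp only [lmon, map_prod, map_zpow₀, scale_wvar, mul_zpow]
  rw [Finset.prod_mul_distrib, Finset.mul_sum, addChar_map_sum, map_prod]
  congr 1
  refine Finset.prod_congr rfl fun a _ => ?_
  rw [mul_left_comm, map_addChar_zsmul, map_zpow₀]

theorem lmon_mem_invField {x : PermMod (ZMod n)ˣ (ZMod n)}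
    (hx : ∑ a, (x.coord a : ZMod n) * a = 0) : lmon x ∈ invField n := fun c => by
  rw [scale_lmon, hx, mul_zero, AddChar.map_zero_eq_one, map_one, one_mul]

variable (n)

/-- Laurent monomials of weight zero as units of the field of functions of weight zero. -/
def lmonHom : LinearMap.ker (wsumAll n) →+ UMod (actInv n) where
  toFun x := UMod.mk ⟨lmon x.1, lmon_mem_invField x.2⟩ fun h =>
    lmon_ne_zero x.1 (congrArg Subtype.val h)
  map_zero' := UMod.ext (Subtype.ext lmon_zero)
  map_add' x y := UMod.ext (Subtype.ext (lmon_add x.1 y.1))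

/-- The equivariant map sending exponents to Laurent monomials. -/
def lmonMod : LinearMap.ker (wsumAll n) →ₗ[GrpRing (ZMod n)ˣ] UMod (actInv n) :=
  equivariantHom (lmonHom n) (by
    intro s x
    refine UMod.ext ?_
    rw [UMod.val_of_smul]
    exact Subtype.ext (act_lmon s x.1).symm)

/-- The subfield of constants. -/
abbrev constField : Subfield (invField n) := (constInv n).fieldRange

variable {n}

theorem actInv_mem_constField (s : (ZMod n)ˣ) : ∀ x ∈ constField n,
    actInv n s x ∈ constField n := by
  rintro _ ⟨x, rfl⟩
  exact ⟨_, (actInv_constInv s x).symm⟩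

theorem actInv_faithful (s : (ZMod n)ˣ) (h : ∀ x ∈ constField n, actInv n s x = x) : s = 1 := by
  refine (cycGal n).injective ?_
  rw [map_one]
  ext x
  have h1 := h _ ⟨x, rfl⟩
  rw [actInv_constInv] at h1
  exact (constInv n).injective h1

theorem genField_lmonMod : genField (constField n) (LinearMap.range (lmonMod n)) = ⊤ := by
  set K := genField (constField n) (LinearMap.range (lmonMod n)) with hK
  let S : Subfield (WField n) := K.map (invField n).subtype
  have hpoly : ∀ p : WPoly n, (∀ c, scalePoly n c p = p) → algebraMap _ _ p ∈ S := by
    intro p hp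
    refine mem_of_forall_monomial_mem S.toSubring.toAddSubgroup (fun m x hm => ?_) hp
    rw [algebraMap_monomial]
    refine S.mul_mem ⟨constInv n x, le_genField _ ⟨x, rfl⟩, rfl⟩ ?_
    let y : PermMod (ZMod n)ˣ (ZMod n) := PermMod.ofFun fun a => (m a : ℤ)
    have hy : y ∈ LinearMap.ker (wsumAll n) := by
      have h1 : ∑ a, (y.coord a : ZMod n) * a = 0 := by simpa [y, monWeight] using hm
      exact h1
    refine ⟨(lmonMod n ⟨y, hy⟩).val, val_mem_genField ⟨_, rfl⟩, ?_⟩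
    change lmon y = _
    simp [lmon, y]
  rw [eq_top_iff]
  rintro ⟨x, hx⟩ -
  obtain ⟨p, q, hp, hq, -, h⟩ := exists_fixed_num_den hx
  have : x ∈ S := by rw [h]; exact div_mem (hpoly p hp) (hpoly q hq)
  obtain ⟨z, hz, hzx⟩ := this
  have : z = ⟨x, hx⟩ := Subtype.ext hzx
  exact this ▸ hz

theorem gen_ker_wsumAll :
    Gen (unitsClosure (constField n) actInv_mem_constField) (LinearMap.ker (wsumAll n)) := by
  refine ⟨lmonMod n, ?_⟩
  rw [eq_top_iff]
  intro u _
  rw [mem_unitsClosure, genField_lmonMod]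
  trivial

theorem exists_generators_of_dvd {m : ℕ}
    (hdvd : n ∣ 2 ^ 2 * 3 ^ m * 5 ^ 2 * 7 ^ 2 * 11 * 13 * 17 * 19 * 23 * 29 * 31 * 37 *
        41 * 43 * 61 * 67 * 71) :
    ∃ t : Fin n → WField n, (∀ i, IsInv n (t i)) ∧
      ∀ x, IsInv n x → x ∈ Subfield.closure (Set.range t) := by
  obtain ⟨φ, hφ⟩ := gen_perm_of_gen_ker_wsumAll hdvd
    (h1Vanish_unitsClosure (constField n) actInv_mem_constField actInv_faithful) gen_ker_wsumAll
  let b : ZMod n → invField n := fun a => (φ (PermMod.single a)).val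
  let e : AddChar (ZMod n) (invField n) := (constInv n).toMonoidHom.compAddChar (cycChar n)
  have hb : ∀ s a, actInv n s (b a) = b (s * a) := by
    intro s a
    change _ = (φ (PermMod.single (s • a))).val
    rw [← PermMod.of_smul_single, map_smul, UMod.val_of_smul]
  have he : e.IsPrimitive := by
    intro a ha h
    refine cycChar_isPrimitive n ha ?_
    ext x
    have h1 := DFunLike.congr_fun h x
    exact (constInv n).injective (h1.trans (map_one _).symm)
  obtain ⟨t, ht, htgen⟩ := exists_fixed_generators (ρ := actInv n) (e := e)
    (F0 := constField n) (k := ((constInv n).comp (algebraMap ℚ (Cyc n))).fieldRange) he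
    (fun s a => by
      change actInv n s (constInv n (cycChar n a)) = constInv n (cycChar n (s * a))
      rw [actInv_constInv, cycGal_cycChar])
    (fun a => ⟨_, rfl⟩) actInv_mem_constField
    (by
      rintro _ ⟨q, rfl⟩ s
      rw [RingHom.comp_apply, actInv_constInv, AlgEquiv.commutes])
    (by
      rintro _ ⟨x, rfl⟩ h
      obtain ⟨q, rfl⟩ := cycGal_fixed (x := x) fun s =>
        (constInv n).injective ((actInv_constInv s x).symm.trans (h s))
      exact ⟨q, rfl⟩)
    b hb (fun x => by
      by_cases hx : x = 0
      · rw [hx]; exact zero_mem _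
      have h1 : UMod.mk x hx ∈ unitsClosure (constField n) actInv_mem_constField
          (LinearMap.range φ) := by rw [hφ]; trivial
      rw [mem_unitsClosure, UMod.val_mk] at h1
      suffices h3 : genField (constField n) (LinearMap.range φ) ≤
          Subfield.closure ((constField n : Set (invField n)) ∪ Set.range b) from h3 h1
      refine genField_le (fun y hy => Subfield.subset_closure (Or.inl hy)) ?_
      rintro _ ⟨z, rfl⟩
      rw [PermMod.eq_sum_single z, map_sum, UMod.val_sum]
      refine prod_mem fun a _ => ?_
      rw [map_zsmul]
      have h2 : ((z.coord a) • φ (PermMod.single a)).val = b a ^ z.coord a :=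
        map_zpow' (UMod.valHom (actInv n)) (fun u => by
          refine eq_inv_of_mul_eq_one_left ?_
          rw [← map_mul, inv_mul_cancel, map_one])
          (Multiplicative.ofAdd (φ (PermMod.single a))) (z.coord a)
      rw [h2]
      have hba : b a ∈ Subfield.closure ((constField n : Set (invField n)) ∪ Set.range b) :=
        Subfield.subset_closure (Or.inr ⟨a, rfl⟩)
      exact zpow_mem hba _)
  refine ⟨fun i => (t i : WField n), fun i => ⟨fun s => congrArg Subtype.val (ht i s), (t i).2⟩,
    fun x hx => ?_⟩
  have h1 := htgen ⟨x, hx.2⟩ fun s => Subtype.ext (hx.1 s)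
  have h2 : Subfield.closure
      ((((constInv n).comp (algebraMap ℚ (Cyc n))).fieldRange : Set (invField n)) ∪ Set.range t) ≤
      (Subfield.closure (Set.range fun i => (t i : WField n))).comap (invField n).subtype := by
    rw [Subfield.closure_le]
    rintro _ (⟨q, rfl⟩ | ⟨i, rfl⟩)
    · rw [eq_ratCast]
      exact SubfieldClass.ratCast_mem _ q
    · exact Subfield.subset_closure ⟨i, rfl⟩
  exact h2 h1

end Descent

noncomputable section Factor

variable {L E : Type} [Field L] [Field E] [Algebra L E]

variable (L) in
/-- Equality up to a nonzero constant. -/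
def ConstEq (x y : E) : Prop := ∃ c : L, c ≠ 0 ∧ x = algebraMap L E c * y

namespace ConstEq

theorem refl (x : E) : ConstEq L x x := ⟨1, one_ne_zero, by rw [map_one, one_mul]⟩

theorem of_eq {x y : E} (h : x = y) : ConstEq L x y := h ▸ refl x

theorem symm {x y : E} : ConstEq L x y → ConstEq L y x := by
  rintro ⟨c, hc, rfl⟩
  refine ⟨c⁻¹, inv_ne_zero hc, ?_⟩
  rw [← mul_assoc, ← map_mul, inv_mul_cancel₀ hc, map_one, one_mul]

theorem trans {x y z : E} : ConstEq L x y → ConstEq L y z → ConstEq L x z := by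
  rintro ⟨c, hc, rfl⟩ ⟨d, hd, rfl⟩
  exact ⟨c * d, mul_ne_zero hc hd, by rw [map_mul, mul_assoc]⟩

theorem mul {x y x' y' : E} : ConstEq L x y → ConstEq L x' y' → ConstEq L (x * x') (y * y') := by
  rintro ⟨c, hc, rfl⟩ ⟨d, hd, rfl⟩
  exact ⟨c * d, mul_ne_zero hc hd, by rw [map_mul]; ring⟩

theorem inv {x y : E} : ConstEq L x y → ConstEq L x⁻¹ y⁻¹ := by
  rintro ⟨c, hc, rfl⟩
  exact ⟨c⁻¹, inv_ne_zero hc, by rw [mul_inv, map_inv₀]⟩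

theorem pow {x y : E} (h : ConstEq L x y) (k : ℕ) : ConstEq L (x ^ k) (y ^ k) := by
  obtain ⟨c, hc, rfl⟩ := h
  exact ⟨c ^ k, pow_ne_zero k hc, by rw [map_pow, mul_pow]⟩

theorem zpow {x y : E} (h : ConstEq L x y) (k : ℤ) : ConstEq L (x ^ k) (y ^ k) := by
  obtain ⟨c, hc, rfl⟩ := h
  exact ⟨c ^ k, zpow_ne_zero k hc, by rw [map_zpow₀, mul_zpow]⟩

theorem prod {ι : Type*} (s : Finset ι) {f g : ι → E} (h : ∀ i ∈ s, ConstEq L (f i) (g i)) :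
    ConstEq L (∏ i ∈ s, f i) (∏ i ∈ s, g i) := by
  classical
  induction s using Finset.induction_on with
  | empty => exact refl _
  | insert a s ha ih =>
    rw [Finset.prod_insert ha, Finset.prod_insert ha]
    exact (h a (Finset.mem_insert_self _ _)).mul
      (ih fun i hi => h i (Finset.mem_insert_of_mem hi))

end ConstEq

variable (R : Subalgebra L E)

/-- The functions whose denominators are powers of a given one. -/
def Loc {h : E} (hh : h ∈ R) : Subalgebra L E where
  carrier := {f | ∃ k : ℕ, h ^ k * f ∈ R}
  mul_mem' := by
    rintro a b ⟨k, hk⟩ ⟨l, hl⟩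
    refine ⟨k + l, ?_⟩
    have : h ^ (k + l) * (a * b) = (h ^ k * a) * (h ^ l * b) := by ring
    rw [this]
    exact mul_mem hk hl
  add_mem' := by
    rintro a b ⟨k, hk⟩ ⟨l, hl⟩
    refine ⟨k + l, ?_⟩
    have : h ^ (k + l) * (a + b) = h ^ l * (h ^ k * a) + h ^ k * (h ^ l * b) := by ring
    rw [this]
    exact add_mem (mul_mem (pow_mem hh _) hk) (mul_mem (pow_mem hh _) hl)
  algebraMap_mem' c := ⟨0, by rw [pow_zero, one_mul]; exact R.algebraMap_mem c⟩

variable {R}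

theorem le_loc {h : E} (hh : h ∈ R) : R ≤ Loc R hh := fun x hx => ⟨0, by simpa using hx⟩

theorem inv_mem_loc {h : E} (hh : h ∈ R) {x : E} (hxh : h * x⁻¹ ∈ R) :
    x⁻¹ ∈ Loc R hh := ⟨1, by simpa using hxh⟩

/-- A family of representatives of the primes dividing a given element. -/
structure PrimeReps (R : Subalgebra L E) (h : R) (T : Type) where
  /-- The representatives. -/
  p : T → R
  prime : ∀ t, Prime (p t)
  dvd : ∀ t, p t ∣ h
  exists_associated : ∀ q, Prime q → q ∣ h → ∃ t, Associated q (p t)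
  injective : ∀ t t', Associated (p t) (p t') → t = t'
  isUnit : ∀ u : R, IsUnit u → ∃ c : L, algebraMap L E c = u

theorem exists_primeReps [UniqueFactorizationMonoid R]
    (hunit : ∀ u : R, IsUnit u → ∃ c : L, algebraMap L E c = u) {h : R} (h0 : h ≠ 0) :
    ∃ (T : Type) (_ : Fintype T), Nonempty (PrimeReps R h T) := by
  classical
  let S : Finset (Associates R) :=
    ((UniqueFactorizationMonoid.factors h).map Associates.mk).toFinset
  have hS : ∀ t : S, ∃ q ∈ UniqueFactorizationMonoid.factors h, Associates.mk q = t.1 := fun t =>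
    Multiset.mem_map.1 (Multiset.mem_toFinset.1 t.2)
  choose p hp hpt using hS
  refine ⟨S, inferInstance, ⟨⟨p, fun t => UniqueFactorizationMonoid.prime_of_factor _ (hp t),
    fun t => UniqueFactorizationMonoid.dvd_of_mem_factors (hp t), fun q hq hqh => ?_,
    fun t t' htt => ?_, hunit⟩⟩⟩
  · obtain ⟨r, hr, hqr⟩ := UniqueFactorizationMonoid.exists_mem_factors_of_dvd h0 hq.irreducible hqh
    refine ⟨⟨Associates.mk r, Multiset.mem_toFinset.2 (Multiset.mem_map_of_mem _ hr)⟩, ?_⟩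
    rw [← Associates.mk_eq_mk_iff_associated, hpt, Associates.mk_eq_mk_iff_associated]
    exact hqr
  · rw [← Associates.mk_eq_mk_iff_associated, hpt, hpt] at htt
    exact Subtype.ext htt

namespace PrimeReps

variable {h : R} {T : Type} (D : PrimeReps R h T)
include D

theorem constEq_of_associated {a b : R} (hab : Associated a b) : ConstEq L (a : E) b := by
  obtain ⟨u, rfl⟩ := hab.symm
  obtain ⟨c, hc⟩ := D.isUnit u u.isUnit
  refine ⟨c, ?_, ?_⟩
  · rintro rfl
    rw [map_zero] at hc
    exact u.ne_zero (Subtype.ext hc.symm)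
  · rw [hc, Subalgebra.coe_mul, mul_comm]

omit D in
theorem associated_of_constEq {a b : R} : ConstEq L (a : E) b → Associated a b := by
  rintro ⟨c, hc, hab⟩
  have h1 : IsUnit (algebraMap L R c) := (Ne.isUnit hc).map _
  have h2 : a = algebraMap L R c * b := Subtype.ext hab
  rw [h2]
  exact associated_unit_mul_left _ _ h1

theorem ne_zero (t : T) : (D.p t : E) ≠ 0 := fun h =>
  (D.prime t).ne_zero (Subtype.ext h)

theorem inv_mem_loc (t : T) : (D.p t : E)⁻¹ ∈ Loc R h.2 := by
  refine NoetherCn.inv_mem_loc h.2 ?_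
  obtain ⟨r, hr⟩ := D.dvd t
  have h1 : (h : E) = D.p t * r := congrArg Subtype.val hr
  rw [h1, mul_comm, inv_mul_cancel_left₀ (D.ne_zero t)]
  exact r.2

variable [Fintype T]

theorem exists_pow_of_dvd [UniqueFactorizationMonoid R] {r : R} (k : ℕ) (hr : r ∣ h ^ k)
    (h0 : h ≠ 0) : ∃ m : T → ℕ, Associated r (∏ t, D.p t ^ m t) := by
  classical
  induction r using UniqueFactorizationMonoid.induction_on_prime with
  | h₁ => exact absurd (zero_dvd_iff.1 hr) (pow_ne_zero _ h0)
  | h₂ x hx => exact ⟨0, by simpa using associated_one_iff_isUnit.2 hx⟩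
  | h₃ a q ha hq ih =>
    obtain ⟨m, hm⟩ := ih ((dvd_mul_left a q).trans hr)
    obtain ⟨t, ht⟩ := D.exists_associated q hq
      (hq.dvd_of_dvd_pow ((dvd_mul_right q a).trans hr))
    refine ⟨m + Pi.single t 1, ?_⟩
    simp only [Pi.add_apply, pow_add, Finset.prod_mul_distrib]
    rw [mul_comm]
    refine hm.mul_mul ?_
    have : ∏ i, D.p i ^ (Pi.single t 1 : T → ℕ) i = D.p t := by
      rw [Finset.prod_eq_single t (fun i _ hi => by rw [Pi.single_eq_of_ne hi, pow_zero])
        (by simp), Pi.single_eq_same, pow_one]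
    rwa [this]

/-- The product of prime representatives with given exponents. -/
def val (m : T → ℤ) : E := ∏ t, (D.p t : E) ^ m t

theorem val_add (m m' : T → ℤ) : D.val (m + m') = D.val m * D.val m' := by
  simp only [val, Pi.add_apply, zpow_add₀ (D.ne_zero _), Finset.prod_mul_distrib]

theorem val_neg (m : T → ℤ) : D.val (-m) = (D.val m)⁻¹ := by
  simp only [val, Pi.neg_apply, zpow_neg, Finset.prod_inv_distrib]

theorem val_natCast (m : T → ℕ) : D.val (fun t => m t) = ((∏ t, D.p t ^ m t : R) : E) := by
  simp [val]

theorem val_single [DecidableEq T] (t : T) : D.val (Pi.single t 1) = D.p t := by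
  rw [val, Finset.prod_eq_single t (fun i _ hi => by rw [Pi.single_eq_of_ne hi, zpow_zero])
        (by simp), Pi.single_eq_same, zpow_one]

theorem val_ne_zero (m : T → ℤ) : D.val m ≠ 0 :=
  Finset.prod_ne_zero_iff.2 fun t _ => zpow_ne_zero _ (D.ne_zero t)

theorem val_mem_loc (m : T → ℤ) : D.val m ∈ Loc R h.2 := by
  refine prod_mem fun t _ => ?_
  obtain ⟨k, hk | hk⟩ := (m t).eq_nat_or_neg
  · rw [hk, zpow_natCast]
    exact pow_mem (le_loc _ (D.p t).2) _
  · rw [hk, zpow_neg, zpow_natCast, ← inv_pow]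
    exact pow_mem (D.inv_mem_loc t) _

theorem exists_val [UniqueFactorizationMonoid R] (h0 : h ≠ 0) {f : E} (hf0 : f ≠ 0)
    (hf : f ∈ Loc R h.2) (hf' : f⁻¹ ∈ Loc R h.2) : ∃ m, ConstEq L f (D.val m) := by
  obtain ⟨k, hk⟩ := hf
  obtain ⟨l, hl⟩ := hf'
  obtain ⟨m, hm⟩ := D.exists_pow_of_dvd (r := ⟨_, hk⟩) (k + l) ⟨⟨_, hl⟩, Subtype.ext (by
    change (h : E) ^ (k + l) = (h : E) ^ k * f * ((h : E) ^ l * f⁻¹)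
    field_simp; ring)⟩ h0
  obtain ⟨m', hm'⟩ := D.exists_pow_of_dvd (r := h) 1 (by rw [pow_one]) h0
  refine ⟨(fun t => (m t : ℤ)) + -(fun t => ((k * m' t : ℕ) : ℤ)), ?_⟩
  rw [val_add, val_neg, val_natCast, val_natCast]
  have h1 := D.constEq_of_associated hm
  have h2 := (D.constEq_of_associated hm').pow k
  have hh0 : (h : E) ≠ 0 := fun h' => h0 (Subtype.ext h')
  have h3 : f = (h : E) ^ k * f * ((h : E) ^ k)⁻¹ := by field_simp
  rw [h3]
  refine h1.mul ?_
  have h4 : ((∏ t, D.p t ^ (k * m' t) : R) : E) = ((∏ t, D.p t ^ m' t : R) : E) ^ k := by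
    rw [← Subalgebra.coe_pow, ← Finset.prod_pow]
    simp only [← pow_mul, mul_comm k]
  rw [h4]
  exact h2.inv

theorem nonpos_of_val_constEq {m : T → ℤ} (hm : ConstEq L (D.val m) 1) (t : T) : m t ≤ 0 := by
  by_contra! ht
  have h1 : m = (fun t => ((m t).toNat : ℤ)) + -(fun t => ((-m t).toNat : ℤ)) := by
    funext t
    simp only [Pi.add_apply, Pi.neg_apply]
    omega
  have h2 : ConstEq L (D.val fun t => ((m t).toNat : ℤ)) (D.val fun t => ((-m t).toNat : ℤ)) := by
    rw [h1, val_add, val_neg] at hm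
    have h3 := hm.mul (ConstEq.refl (D.val fun t => ((-m t).toNat : ℤ)))
    rwa [inv_mul_cancel_right₀ (D.val_ne_zero _), one_mul] at h3
  rw [val_natCast, val_natCast] at h2
  have h3 : D.p t ∣ ∏ t, D.p t ^ (-m t).toNat := by
    refine Dvd.dvd.trans ?_ (associated_of_constEq h2).dvd
    exact (dvd_pow_self _ (by omega)).trans (Finset.dvd_prod_of_mem _ (Finset.mem_univ t))
  obtain ⟨i, -, hi⟩ := (D.prime t).exists_mem_finset_dvd h3
  have h4 : t = i := D.injective t i
    (((D.prime t).dvd_prime_iff_associated (D.prime i)).1 ((D.prime t).dvd_of_dvd_pow hi))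
  subst h4
  rw [show (-m t).toNat = 0 by omega, pow_zero] at hi
  exact (D.prime t).not_isUnit (isUnit_of_dvd_one hi)

theorem val_injective {m m' : T → ℤ} (hm : ConstEq L (D.val m) (D.val m')) : m = m' := by
  have h1 : ConstEq L (D.val (m + -m')) 1 := by
    have := hm.mul (ConstEq.refl (D.val m')⁻¹)
    rwa [mul_inv_cancel₀ (D.val_ne_zero _), ← val_neg, ← val_add] at this
  have h2 : ConstEq L (D.val (-(m + -m'))) 1 := by
    have := h1.inv
    rwa [← val_neg, inv_one] at this
  funext t
  have h3 := D.nonpos_of_val_constEq h1 t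
  have h4 := D.nonpos_of_val_constEq h2 t
  simp only [Pi.add_apply, Pi.neg_apply] at h3 h4
  omega

end PrimeReps

end Factor

noncomputable section PrimeAction

variable {L E : Type} [Field L] [Field E] [Algebra L E] {R : Subalgebra L E} {G : Type} [Group G]

/-- A semilinear group action preserving a subalgebra and one of its elements. -/
structure Compat (R : Subalgebra L E) (h : R) (ρ : G →* RingAut E) : Prop where
  mem : ∀ g, ∀ x ∈ R, ρ g x ∈ R
  const : ∀ g (c : L), ∃ c' : L, ρ g (algebraMap L E c) = algebraMap L E c'
  fixed : ∀ g, ρ g h = h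

namespace Compat

variable {h : R} {ρ : G →* RingAut E} (C : Compat R h ρ)
include C

theorem constEq (g : G) {x y : E} : ConstEq L x y → ConstEq L (ρ g x) (ρ g y) := by
  rintro ⟨c, hc, rfl⟩
  obtain ⟨c', hc'⟩ := C.const g c
  refine ⟨c', ?_, by rw [map_mul, hc']⟩
  rintro rfl
  rw [map_zero, EmbeddingLike.map_eq_zero_iff] at hc'
  exact hc ((map_eq_zero _).1 hc')

/-- The automorphisms of the subalgebra. -/
def aut (g : G) : R ≃+* R where
  toFun x := ⟨ρ g x, C.mem g x x.2⟩
  invFun x := ⟨ρ g⁻¹ x, C.mem g⁻¹ x x.2⟩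
  left_inv x := Subtype.ext (by
    change ρ g⁻¹ (ρ g x) = x
    rw [← RingAut.mul_apply, ← map_mul, inv_mul_cancel, map_one, RingAut.one_apply])
  right_inv x := Subtype.ext (by
    change ρ g (ρ g⁻¹ x) = x
    rw [← RingAut.mul_apply, ← map_mul, mul_inv_cancel, map_one, RingAut.one_apply])
  map_mul' x y := Subtype.ext (map_mul _ _ _)
  map_add' x y := Subtype.ext (map_add _ _ _)

variable {T : Type} (D : PrimeReps R h T)

theorem exists_perm (g : G) (t : T) : ∃ t', ConstEq L (ρ g (D.p t)) (D.p t') := by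
  have h1 : Prime (C.aut g (D.p t)) := (MulEquiv.prime_iff (C.aut g)).2 (D.prime t)
  have h2 : C.aut g (D.p t) ∣ h := by
    have : C.aut g h = h := Subtype.ext (C.fixed g)
    exact (map_dvd (C.aut g) (D.dvd t)).trans this.dvd
  obtain ⟨t', ht'⟩ := D.exists_associated _ h1 h2
  exact ⟨t', D.constEq_of_associated ht'⟩

omit C in
theorem eq_of_constEq {t t' : T} (htt : ConstEq L (D.p t : E) (D.p t')) : t = t' :=
  D.injective _ _ (PrimeReps.associated_of_constEq htt)

/-- The permutation action on the primes. -/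
@[reducible] def mulAction : MulAction G T where
  smul g t := (C.exists_perm D g t).choose
  one_smul t := by
    have h1 := (C.exists_perm D 1 t).choose_spec
    have h2 : ρ 1 (D.p t) = D.p t := by rw [map_one, RingAut.one_apply]
    replace h1 := (ConstEq.of_eq h2.symm).trans h1
    exact (eq_of_constEq D h1).symm
  mul_smul g g' t := by
    have h1 := (C.exists_perm D (g * g') t).choose_spec
    have h2 := (C.exists_perm D g' t).choose_spec
    have h3 := (C.exists_perm D g (C.exists_perm D g' t).choose).choose_spec
    have h4 : ρ (g * g') (D.p t) = ρ g (ρ g' (D.p t)) := by rw [map_mul, RingAut.mul_apply]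
    exact eq_of_constEq D ((h1.symm.trans (ConstEq.of_eq h4)).trans ((C.constEq g h2).trans h3))

theorem constEq_smul (g : G) (t : T) :
    ConstEq L (ρ g (D.p t)) (D.p ((C.mulAction D).smul g t)) :=
  (C.exists_perm D g t).choose_spec

omit C in
theorem constEq_val [Fintype T] [MulAction G T]
    (hT : ∀ (g : G) t, ConstEq L (ρ g (D.p t)) (D.p (g • t))) (g : G) (m : T → ℤ) :
    ConstEq L (ρ g (D.val m)) (D.val fun t => m (g⁻¹ • t)) := by
  have h1 : D.val (fun t => m (g⁻¹ • t)) = ∏ t, (D.p (g • t) : E) ^ m t := by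
    refine (Fintype.prod_equiv (MulAction.toPerm g) _ _ fun t => ?_).symm
    simp only [MulAction.toPerm_apply, inv_smul_smul]
  rw [h1, PrimeReps.val, map_prod]
  simp only [map_zpow₀]
  exact ConstEq.prod _ fun t _ => (hT g t).zpow _

end Compat

end PrimeAction

noncomputable section Weights

variable {n : ℕ} [NeZero n]

/-- Being an eigenvector of the scaling action with a given weight. -/
def HasWeight (f : WField n) (w : ZMod n) : Prop :=
  ∀ c, scale n c f = algebraMap _ _ (cycChar n (c.toAdd * w)) * f

namespace HasWeight

variable {f g : WField n} {v w : ZMod n}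

theorem mul (hf : HasWeight f v) (hg : HasWeight g w) : HasWeight (f * g) (v + w) := fun c => by
  rw [map_mul, hf, hg, mul_add, AddChar.map_add_eq_mul, map_mul (algebraMap (Cyc n) (WField n))]
  ring

theorem one : HasWeight (1 : WField n) 0 := fun c => by simp

theorem inv (hf : HasWeight f v) : HasWeight f⁻¹ (-v) := fun c => by
  rw [map_inv₀, hf, mul_neg, AddChar.map_neg_eq_inv, map_inv₀, mul_inv]

theorem pow (hf : HasWeight f v) (k : ℕ) : HasWeight (f ^ k) (k * v) := by
  induction k with
  | zero => simpa using one
  | succ k ih =>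
    rw [pow_succ, Nat.cast_succ, add_mul, one_mul]
    exact ih.mul hf

theorem zpow (hf : HasWeight f v) (k : ℤ) : HasWeight (f ^ k) (k * v) := by
  obtain ⟨m, rfl | rfl⟩ := k.eq_nat_or_neg
  · simpa using hf.pow m
  · simpa using (hf.pow m).inv

theorem prod {ι : Type*} (s : Finset ι) {f : ι → WField n} {w : ι → ZMod n}
    (h : ∀ i ∈ s, HasWeight (f i) (w i)) : HasWeight (∏ i ∈ s, f i) (∑ i ∈ s, w i) := by
  classical
  induction s using Finset.induction_on with
  | empty => simpa using one
  | insert a s ha ih =>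
    rw [Finset.prod_insert ha, Finset.sum_insert ha]
    exact (h a (Finset.mem_insert_self _ _)).mul
      (ih fun i hi => h i (Finset.mem_insert_of_mem hi))

theorem constEq (hf : HasWeight f v) (h : ConstEq (Cyc n) g f) : HasWeight g v := by
  obtain ⟨x, hx, rfl⟩ := h
  intro c
  rw [map_mul, scale_const, hf]
  ring

theorem eq (hf : HasWeight f v) (hg : HasWeight f w) (h0 : f ≠ 0) : v = w := by
  have h1 := (hf (Multiplicative.ofAdd 1)).symm.trans (hg (Multiplicative.ofAdd 1))
  have h2 := (algebraMap (Cyc n) (WField n)).injective (mul_right_cancel₀ h0 h1)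
  rw [toAdd_ofAdd, one_mul, one_mul] at h2
  have h3 : cycChar n (v - w) = 1 := by
    rw [AddChar.map_sub_eq_div, h2, div_self]
    exact (AddChar.val_isUnit (cycChar n) w).ne_zero
  by_contra! hvw
  refine cycChar_isPrimitive n (sub_ne_zero.2 hvw) (DFunLike.ext _ _ fun x => ?_)
  rw [AddChar.mulShift_apply, ← ZMod.natCast_zmod_val x, mul_comm, ← nsmul_eq_mul,
    AddChar.map_nsmul_eq_pow, h3, one_pow, AddChar.one_apply]

theorem act (hf : HasWeight f v) (s : (ZMod n)ˣ) : HasWeight (act n s f) (s * v) := fun c => by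
  rw [← act_scale_comm, hf, map_mul, act_const, cycGal_cycChar, mul_left_comm]

theorem mem_invField_iff (hf : HasWeight f v) (h0 : f ≠ 0) : f ∈ invField n ↔ v = 0 := by
  constructor
  · intro h
    refine hf.eq (fun c => ?_) h0
    rw [h c, mul_zero, AddChar.map_zero_eq_one, map_one, one_mul]
  · rintro rfl c
    rw [hf, mul_zero, AddChar.map_zero_eq_one, map_one, one_mul]

theorem wvar (a : ZMod n) : HasWeight (wvar a) a := fun c => scale_wvar c a

end HasWeight

theorem exists_hasWeight {f : WField n} (h0 : f ≠ 0)
    (h : ConstEq (Cyc n) (scale n (Multiplicative.ofAdd 1) f) f) : ∃ w, HasWeight f w := by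
  obtain ⟨x, -, hx⟩ := h
  have h1 : ∀ k : ℕ, scale n (Multiplicative.ofAdd 1 ^ k) f = algebraMap _ _ (x ^ k) * f := by
    intro k
    induction k with
    | zero => simp
    | succ k ih => 
      rw [pow_succ, map_mul, RingAut.mul_apply, hx, map_mul, scale_const, ih, pow_succ, map_mul]
      ring
  have h2 : x ^ n = 1 := by
    have h3 := h1 n
    have h4 : (Multiplicative.ofAdd (1 : ZMod n)) ^ n = 1 := by
      rw [← ofAdd_nsmul, nsmul_one, ZMod.natCast_self, ofAdd_zero]
    rw [h4, map_one, RingAut.one_apply] at h3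
    refine (algebraMap (Cyc n) (WField n)).injective (mul_right_cancel₀ h0 ?_)
    rw [← h3, map_one, one_mul]
  obtain ⟨i, -, hi⟩ := (cyc_zeta_spec n).eq_pow_of_pow_eq_one h2
  refine ⟨i, fun c => ?_⟩
  have h3 : c = Multiplicative.ofAdd 1 ^ c.toAdd.val := by
    rw [← ofAdd_nsmul, nsmul_one, ZMod.natCast_zmod_val, ofAdd_toAdd]
  have h4 : cycChar n i = x := (AddChar.zmodChar_apply' _ _).trans hi
  have h5 : c.toAdd * (i : ZMod n) = c.toAdd.val • (i : ZMod n) := by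
    rw [nsmul_eq_mul, ZMod.natCast_zmod_val]
  rw [h5, AddChar.map_nsmul_eq_pow, h4]
  conv_lhs => rw [h3]
  exact h1 _

end Weights

/-- The kernel of an equivariant weight map on a permutation module, presented as a permutation
module. -/
structure PermPresentation (n : ℕ) where
  Ω : Type
  T : Type
  [fintypeΩ : Fintype Ω]
  [fintypeT : Fintype T]
  [actionΩ : MulAction (ZMod n)ˣ Ω]
  [actionT : MulAction (ZMod n)ˣ T]
  w : Ω → ZMod n
  y : ZMod n → Ω
  Φ : T → Ω → ℤ
  w_smul : ∀ (s : (ZMod n)ˣ) ω, w (s • ω) = s * w ω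
  y_smul : ∀ (s : (ZMod n)ˣ) a, s • y a = y (s * a)
  w_y : ∀ a, w (y a) = a
  Φ_smul : ∀ (s : (ZMod n)ˣ) t ω, Φ (s • t) (s • ω) = Φ t ω
  injective : ∀ z : T → ℤ, (∀ ω, ∑ t, z t * Φ t ω = 0) → z = 0
  exact : ∀ x : Ω → ℤ, ∑ ω, (x ω : ZMod n) * w ω = 0 ↔ ∃ z : T → ℤ, ∀ ω, x ω = ∑ t, z t * Φ t ω

noncomputable section Presentation

variable {n : ℕ} [NeZero n] {P : Subalgebra (Cyc n) (WField n)} {h : P} {W : Type} [Fintype W]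
  (D : PrimeReps P h W) [MulAction (Multiplicative (ZMod n)) W] [MulAction (ZMod n)ˣ W]

/-- The orbits of the scaling action on the primes. -/
abbrev Orb (n : ℕ) (W : Type) [MulAction (Multiplicative (ZMod n)) W] : Type :=
  MulAction.orbitRel.Quotient (Multiplicative (ZMod n)) W

omit [NeZero n] [Fintype W] [MulAction (ZMod n)ˣ W] in
theorem Orb.exists_comp_mk {m : W → ℤ} (hm : ∀ (c : Multiplicative (ZMod n)) t, m (c • t) = m t) :
    ∃ x : Orb n W → ℤ, ∀ t, m t = x (Quotient.mk _ t) := by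
  refine ⟨Quotient.lift m fun t t' htt => ?_, fun t => rfl⟩
  obtain ⟨c, rfl⟩ := htt
  exact hm c t'

omit [NeZero n] [Fintype W] [MulAction (ZMod n)ˣ W] in
theorem Orb.sound (c : Multiplicative (ZMod n)) (t : W) :
    (Quotient.mk _ (c • t) : Orb n W) = Quotient.mk _ t := Quotient.sound ⟨c, rfl⟩

omit [Fintype W] in
theorem smul_comm_of_constEq (hc : ∀ (c : Multiplicative (ZMod n)) t,
      ConstEq (Cyc n) (scale n c (D.p t)) (D.p (c • t)))
    (hs : ∀ (s : (ZMod n)ˣ) t, ConstEq (Cyc n) (act n s (D.p t)) (D.p (s • t)))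
    (Cc : Compat P h (scale n)) (Cs : Compat P h (act n)) (s : (ZMod n)ˣ)
    (c : Multiplicative (ZMod n)) (t : W) : s • c • t = c • s • t := by
  refine Compat.eq_of_constEq D ?_
  refine (hs s _).symm.trans ((Cs.constEq s (hc c t).symm).trans ?_)
  rw [act_scale_comm]
  exact (Cc.constEq c (hs s t)).trans (hc c _)

/-- The action of the units on the orbits of the scaling action. -/
@[reducible] def orbAction
    (hcomm : ∀ (s : (ZMod n)ˣ) (c : Multiplicative (ZMod n)) (t : W), s • c • t = c • s • t) :
    MulAction (ZMod n)ˣ (Orb n W) where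
  smul s := Quotient.map (s • ·) (by
    rintro _ t ⟨c, rfl⟩
    exact ⟨c, (hcomm s c t).symm⟩)
  one_smul := by
    rintro ⟨t⟩
    exact congrArg (Quotient.mk _) (one_smul _ t)
  mul_smul s s' := by
    rintro ⟨t⟩
    exact congrArg (Quotient.mk _) (mul_smul s s' t)

theorem exists_permPresentation (hc : ∀ (c : Multiplicative (ZMod n)) t,
      ConstEq (Cyc n) (scale n c (D.p t)) (D.p (c • t)))
    (hs : ∀ (s : (ZMod n)ˣ) t, ConstEq (Cyc n) (act n s (D.p t)) (D.p (s • t)))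
    (Cc : Compat P h (scale n)) (Cs : Compat P h (act n)) [UniqueFactorizationMonoid P]
    (h0 : h ≠ 0) {Y : ZMod n → W} (hY : ∀ a, ConstEq (Cyc n) (wvar a) (D.p (Y a)))
    {B : Subalgebra (Cyc n) (WField n)} {b : B} {T : Type} [Fintype T] (D' : PrimeReps B b T)
    [MulAction (ZMod n)ˣ T] [UniqueFactorizationMonoid B] (b0 : b ≠ 0)
    (hs' : ∀ (s : (ZMod n)ˣ) t, ConstEq (Cyc n) (act n s (D'.p t)) (D'.p (s • t)))
    (hloc : ∀ f, f ∈ Loc B b.2 ↔ f ∈ Loc P h.2 ∧ f ∈ invField n) :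
    Nonempty (PermPresentation n) := by
  classical
  have hcomm := smul_comm_of_constEq D hc hs Cc Cs
  let _ : MulAction (ZMod n)ˣ (Orb n W) := orbAction hcomm
  let _ : Fintype (Orb n W) := Fintype.ofFinite _
  let val : (Orb n W → ℤ) → WField n := fun x => D.val fun t => x (Quotient.mk _ t)
  have val_add : ∀ x x', val (x + x') = val x * val x' := fun x x' => D.val_add _ _
  have val_ne_zero : ∀ x, val x ≠ 0 := fun x => D.val_ne_zero _
  have val_act : ∀ s x, ConstEq (Cyc n) (act n s (val x)) (val fun ω => x (s⁻¹ • ω)) :=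
    fun s x => Compat.constEq_val D hs s _
  have val_inj : ∀ x x', ConstEq (Cyc n) (val x) (val x') → x = x' := by
    intro x x' hx
    have h1 := D.val_injective hx
    funext ω
    obtain ⟨t, rfl⟩ := Quotient.exists_rep ω
    exact congrFun h1 t
  have val_weight : ∀ x, ∃ w, HasWeight (val x) w := by
    intro x
    refine exists_hasWeight (val_ne_zero x) ?_
    have h1 := Compat.constEq_val D hc (Multiplicative.ofAdd 1) fun t => x (Quotient.mk _ t)
    simp only [Orb.sound] at h1
    exact h1
  let valHom : Multiplicative (Orb n W → ℤ) →* WField n :=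
    { toFun := fun x => val x.toAdd
      map_one' := by
        change D.val (fun _ => 0) = 1
        simp [PrimeReps.val]
      map_mul' := fun x x' => val_add _ _ }
  have val_zsmul : ∀ (k : ℤ) x, val (k • x) = val x ^ k := fun k x =>
    map_zpow' valHom (fun u => by
          refine eq_inv_of_mul_eq_one_left ?_
          rw [← map_mul, inv_mul_cancel, map_one]) (Multiplicative.ofAdd x) k
  have val_sum : ∀ {ι : Type} (s : Finset ι) (f : ι → Orb n W → ℤ),
      val (∑ i ∈ s, f i) = ∏ i ∈ s, val (f i) := fun s f =>
    map_prod valHom (fun i => Multiplicative.ofAdd (f i)) s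
  choose w hw using fun ω : Orb n W => val_weight (Pi.single ω 1)
  have hwx : ∀ x, HasWeight (val x) (∑ ω, (x ω : ZMod n) * w ω) := by
    intro x
    have h1 : x = ∑ ω, x ω • (Pi.single ω 1 : Orb n W → ℤ) := by
      funext ω
      simp [Finset.sum_apply, Pi.single_apply]
    conv => enter [1]; rw [h1, val_sum]
    refine HasWeight.prod _ fun ω _ => ?_
    rw [val_zsmul]
    exact (hw ω).zpow _
  have single_smul : ∀ (s : (ZMod n)ˣ) (ω : Orb n W), (fun ω' =>
      (Pi.single ω 1 : Orb n W → ℤ) (s⁻¹ • ω')) = Pi.single (s • ω) 1 := by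
    intro s ω
    funext ω'
    simp only [Pi.single_apply, inv_smul_eq_iff]
  have hD' : ∀ t, ∃ x, ConstEq (Cyc n) (D'.p t : WField n) (val x) := by
    intro t
    have h1 := (hloc _).1 (le_loc b.2 (D'.p t).2)
    have h2 := (hloc _).1 (D'.inv_mem_loc t)
    obtain ⟨m, hm⟩ := D.exists_val h0 (D'.ne_zero t) h1.1 h2.1
    have h3 : ∀ c : Multiplicative (ZMod n), (fun t => m (c⁻¹ • t)) = m := by
      intro c
      refine D.val_injective ((Compat.constEq_val D hc c m).symm.trans ?_)
      refine (Cc.constEq c hm.symm).trans ?_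
      rw [h1.2 c]
      exact hm
    obtain ⟨x, hx⟩ := Orb.exists_comp_mk (m := m) fun c t => by
      have := congrFun (h3 c⁻¹) t
      rwa [inv_inv] at this
    refine ⟨x, hm.trans (ConstEq.of_eq ?_)⟩
    exact congrArg D.val (funext hx)
  choose Φ hΦ using hD'
  have hval' : ∀ z : T → ℤ, ConstEq (Cyc n) (D'.val z) (val (∑ t, z t • Φ t)) := by
    intro z
    rw [val_sum]
    refine ConstEq.prod _ fun t _ => ?_
    rw [val_zsmul]
    exact (hΦ t).zpow _
  have hsum : ∀ (z : T → ℤ) ω, (∑ t, z t • Φ t) ω = ∑ t, z t * Φ t ω := by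
    intro z ω
    simp [Finset.sum_apply]
  refine ⟨⟨Orb n W, T, w, fun a => Quotient.mk _ (Y a), Φ, ?_, ?_, ?_, ?_, ?_, ?_⟩⟩
  · intro s ω
    refine (hw (s • ω)).eq ?_ (val_ne_zero _)
    refine ((hw ω).act s).constEq ?_
    rw [← single_smul]
    exact (val_act s _).symm
  · intro s a
    refine congrArg (Quotient.mk _) (?_ : s • Y a = Y (s * a))
    refine Compat.eq_of_constEq D ((hs s _).symm.trans ((Cs.constEq s (hY a).symm).trans ?_))
    rw [act_wvar]
    exact hY _
  · intro a
    refine (hw _).eq ?_ (val_ne_zero _)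
    refine (HasWeight.wvar a).constEq ((ConstEq.of_eq ?_).trans (hY a).symm)
    rw [← D.val_single]
    refine congrArg D.val (funext fun t => ?_)
    rw [Pi.single_apply, Pi.single_apply]
    refine if_congr ⟨fun ht => ?_, fun ht => by rw [ht]⟩ rfl rfl
    obtain ⟨c, rfl⟩ := Quotient.exact ht
    refine Compat.eq_of_constEq D ((hc c _).symm.trans ((Cc.constEq c (hY a).symm).trans ?_))
    refine ConstEq.trans ?_ (hY a)
    rw [scale_wvar]
    exact ⟨_, (AddChar.val_isUnit (cycChar n) _).ne_zero, rfl⟩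
  · intro s t ω
    have h1 : Φ (s • t) = fun ω => Φ t (s⁻¹ • ω) := by
      refine val_inj _ _ ((hΦ _).symm.trans ((hs' s t).symm.trans ?_))
      exact (Cs.constEq s (hΦ t)).trans (val_act s _)
    simp only [h1, inv_smul_smul]
  · intro z hz
    refine D'.val_injective ((hval' z).trans (ConstEq.of_eq ?_))
    have h1 : ∑ t, z t • Φ t = 0 := funext fun ω => (hsum z ω).trans (hz ω)
    rw [h1]
    simp [val, PrimeReps.val]
  · intro x
    rw [← (hwx x).mem_invField_iff (val_ne_zero x)]
    constructor
    · intro hx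
      have h1 : val x ∈ Loc B b.2 := (hloc _).2 ⟨D.val_mem_loc _, hx⟩
      have h2 : (val x)⁻¹ ∈ Loc B b.2 := (hloc _).2 ⟨by
        rw [← D.val_neg]; exact D.val_mem_loc _, inv_mem hx⟩
      obtain ⟨z, hz⟩ := D'.exists_val b0 (val_ne_zero x) h1 h2
      have h3 := val_inj _ _ (hz.trans (hval' z))
      exact ⟨z, fun ω => by rw [h3, hsum]⟩
    · rintro ⟨z, hz⟩
      have h1 : x = ∑ t, z t • Φ t := funext fun ω => (hz ω).trans (hsum z ω).symm
      obtain ⟨u, -, hu⟩ := (hval' z).symm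
      rw [h1, hu]
      exact ((hloc _).1 (mul_mem (Subalgebra.algebraMap_mem _ u) (D'.val_mem_loc z))).2

end Presentation

noncomputable section Necessity

section General

variable {L E : Type} [Field L] [Field E] [Algebra L E]

theorem exists_invariant_denominator {G : Type} [Group G] [Fintype G] (ρ : G →* RingAut E)
    {R : Subalgebra L E} (hR : ∀ g, ∀ x ∈ R, ρ g x ∈ R) {ι : Type} [Fintype ι] (u : ι → E)
    (hu : ∀ i, ∃ z ∈ R, z ≠ 0 ∧ z * u i ∈ R) :
    ∃ N ∈ R, N ≠ 0 ∧ (∀ g, ρ g N = N) ∧ ∀ i, N * u i ∈ R := by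
  classical
  choose z hz hz0 hzu using hu
  have hq : ∏ i, z i ∈ R := prod_mem fun i _ => hz i
  refine ⟨∏ g, ρ g (∏ i, z i), prod_mem fun g _ => hR g _ hq, ?_, fun g => ?_, fun i => ?_⟩
  · refine Finset.prod_ne_zero_iff.2 fun g _ => ?_
    rw [Ne, EmbeddingLike.map_eq_zero_iff]
    exact Finset.prod_ne_zero_iff.2 fun i _ => hz0 i
  · rw [map_prod]
    refine Fintype.prod_equiv (Equiv.mulLeft g) _ _ fun s => ?_
    rw [Equiv.coe_mulLeft, map_mul, RingAut.mul_apply]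
  · rw [← Finset.mul_prod_erase _ _ (Finset.mem_univ 1), map_one, RingAut.one_apply,
      ← Finset.mul_prod_erase _ _ (Finset.mem_univ i)]
    have : ∀ a b c d : E, a * b * c * d = a * d * b * c := fun a b c d => by ring
    rw [this]
    refine mul_mem (mul_mem (hzu i) (prod_mem fun j _ => hz j)) (prod_mem fun g _ => hR g _ ?_)
    exact mul_mem (hz i) (prod_mem fun j _ => hz j)

variable {ι : Type} {f : MvPolynomial ι L →ₐ[L] E}

theorem uniqueFactorizationMonoid_range (hf : Function.Injective f) :
    UniqueFactorizationMonoid f.range :=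
  (AlgEquiv.ofInjective f hf).toMulEquiv.uniqueFactorizationMonoid inferInstance

theorem exists_const_of_isUnit_range (hf : Function.Injective f) (u : f.range) (hu : IsUnit u) :
    ∃ c : L, algebraMap L E c = u := by
  have h1 : IsUnit ((AlgEquiv.ofInjective f hf).symm u) := hu.map _
  obtain ⟨c, -, hc⟩ := MvPolynomial.isUnit_iff_eq_C_of_isReduced.1 h1
  refine ⟨c, ?_⟩
  have h2 := congrArg (fun x => ((AlgEquiv.ofInjective f hf x : f.range) : E)) hc
  simp only [AlgEquiv.apply_symm_apply] at h2
  rw [h2, AlgEquiv.ofInjective_apply, ← MvPolynomial.algebraMap_eq, AlgHom.commutes]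

theorem prime_range_X (hf : Function.Injective f) (a : ι) :
    Prime (⟨f (MvPolynomial.X a), MvPolynomial.X a, rfl⟩ : f.range) :=
  (MulEquiv.prime_iff (AlgEquiv.ofInjective f hf).toMulEquiv).2 (MvPolynomial.X_prime (i := a))

end General

variable {n : ℕ} [NeZero n]

variable (n) in
/-- The embedding of the polynomial ring into the field of rational functions. -/
def polyHom : WPoly n →ₐ[Cyc n] WField n := IsScalarTower.toAlgHom _ _ _

omit [NeZero n] in
theorem polyHom_apply (p : WPoly n) : polyHom n p = algebraMap _ _ p := rfl

omit [NeZero n] in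
theorem polyHom_injective : Function.Injective (polyHom n) :=
  IsFractionRing.injective (WPoly n) (WField n)

omit [NeZero n] in
theorem exists_mul_mem_polyHom_range (x : WField n) :
    ∃ z ∈ (polyHom n).range, z ≠ 0 ∧ z * x ∈ (polyHom n).range := by
  obtain ⟨a, b, hb, rfl⟩ := IsFractionRing.div_surjective (A := WPoly n) x
  have hb0 : algebraMap (WPoly n) (WField n) b ≠ 0 :=
    IsFractionRing.to_map_ne_zero_of_mem_nonZeroDivisors hb
  exact ⟨_, ⟨b, rfl⟩, hb0, a, (mul_div_cancel₀ _ hb0).symm⟩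

theorem act_mem_polyHom_range (s : (ZMod n)ˣ) (x : WField n) (hx : x ∈ (polyHom n).range) :
    act n s x ∈ (polyHom n).range := by
  obtain ⟨p, rfl⟩ := hx
  exact ⟨actPoly n s p, (act_algebraMap s p).symm⟩

theorem scale_mem_polyHom_range (c : Multiplicative (ZMod n)) (x : WField n)
    (hx : x ∈ (polyHom n).range) : scale n c x ∈ (polyHom n).range := by
  obtain ⟨p, rfl⟩ := hx
  exact ⟨scalePoly n c p, (scale_algebraMap c p).symm⟩

variable {t : Fin n → WField n} (hinv : ∀ i, IsInv n (t i))
  (hgen : ∀ x, IsInv n x → x ∈ Subfield.closure (Set.range t))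

include hgen in
theorem invField_le_closure : invField n ≤
    Subfield.closure (Set.range (algebraMap (Cyc n) (WField n)) ∪ Set.range t) := by
  intro x hx
  set S := Subfield.closure (Set.range (algebraMap (Cyc n) (WField n)) ∪ Set.range t)
  have hS : ∀ c, algebraMap (Cyc n) (WField n) c ∈ S :=
    fun c => Subfield.subset_closure (Or.inl ⟨c, rfl⟩)
  have h1 : ∀ y ∈ invField n, conjSum (act n) y ∈ S := fun y hy =>
    Subfield.closure_mono Set.subset_union_right (hgen _ ⟨fun s => conjSum_apply s y,
      fun c => by
        rw [conjSum, map_sum]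
        refine Finset.sum_congr rfl fun s _ => ?_
        rw [← act_scale_comm, hy c]⟩)
  have h2 : (n : WField n) * x ∈ S := by
    rw [← sum_conjSum wChar_isPrimitive act_wChar x]
    exact sum_mem fun j _ => mul_mem (hS _) (h1 _ (mul_mem (const_mem_invField _) hx))
  have hn : (n : WField n) ≠ 0 := Nat.cast_ne_zero.2 (NeZero.ne n)
  have h3 := mul_mem (inv_mem (natCast_mem S n)) h2
  rwa [inv_mul_cancel_left₀ hn] at h3

include hgen in
theorem algebraicIndependent_of_generates : AlgebraicIndependent (Cyc n) t := by
  have hpow : (scale n (Multiplicative.ofAdd 1)) ^ n = 1 := by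
    rw [← map_pow, ← ofAdd_nsmul, nsmul_one, ZMod.natCast_self, ofAdd_zero, map_one]
  have : Algebra.IsAlgebraic (invField n) (WField n) :=
    isAlgebraic_of_forall_fixed_mem (NeZero.ne n) hpow _ fun x hx c => scale_eq_self hx c
  exact algebraicIndependent_of_isAlgebraic trdeg_wField.ge t _ (invField_le_closure hgen)

include hinv in
theorem act_mem_adjoin (s : (ZMod n)ˣ) (x : WField n)
    (hx : x ∈ Algebra.adjoin (Cyc n) (Set.range t)) :
    act n s x ∈ Algebra.adjoin (Cyc n) (Set.range t) := by
  induction hx using Algebra.adjoin_induction with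
  | mem x hx =>
    obtain ⟨i, rfl⟩ := hx
    rw [(hinv i).1 s]
    exact Algebra.subset_adjoin ⟨i, rfl⟩
  | algebraMap c => rw [act_const]; exact Subalgebra.algebraMap_mem _ _
  | add x y _ _ hx hy => rw [map_add]; exact add_mem hx hy
  | mul x y _ _ hx hy => rw [map_mul]; exact mul_mem hx hy

include hinv in
theorem adjoin_le_invField {x : WField n} (hx : x ∈ Algebra.adjoin (Cyc n) (Set.range t)) :
    x ∈ invField n := by
  induction hx using Algebra.adjoin_induction with
  | mem x hx =>
    obtain ⟨i, rfl⟩ := hx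
    exact (hinv i).2
  | algebraMap c => exact const_mem_invField c
  | add x y _ _ hx hy => exact add_mem hx hy
  | mul x y _ _ hx hy => exact mul_mem hx hy

include hgen in
theorem exists_mul_mem_adjoin {x : WField n} (hx : x ∈ invField n) :
    ∃ z ∈ Algebra.adjoin (Cyc n) (Set.range t), z ≠ 0 ∧
      z * x ∈ Algebra.adjoin (Cyc n) (Set.range t) := by
  obtain ⟨y, hy, z, hz, rfl⟩ := Subfield.mem_closure_iff.1 (invField_le_closure hgen hx)
  rw [← Algebra.adjoin_eq_ring_closure] at hy hz
  by_cases h0 : z = 0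
  · exact ⟨1, one_mem _, one_ne_zero, by simp [h0, zero_mem]⟩
  · exact ⟨z, hz, h0, by rwa [mul_div_cancel₀ _ h0]⟩

/-- The weight zero element attached to a variable. -/
def unitVar (a : ZMod n) : WField n := wvar a * (wvar 1 ^ a.val)⁻¹

theorem unitVar_mem_invField (a : ZMod n) : unitVar a ∈ invField n := by
  intro c
  rw [unitVar, map_mul, map_inv₀, map_pow, scale_wvar, scale_wvar, mul_pow, ← map_pow,
    ← AddChar.map_nsmul_eq_pow, nsmul_eq_mul, ZMod.natCast_zmod_val, mul_one, mul_comm a]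
  have : algebraMap (Cyc n) (WField n) (cycChar n (c.toAdd * a)) ≠ 0 := by
    rw [Ne, map_eq_zero]
    intro h
    have h1 := AddChar.map_add_eq_mul (cycChar n) (c.toAdd * a) (-(c.toAdd * a))
    rw [h, zero_mul, add_neg_cancel, AddChar.map_zero_eq_one] at h1
    exact one_ne_zero h1
  field_simp

theorem wvar_pow_mem_invField : (wvar 1 : WField n) ^ n ∈ invField n := by
  intro c
  rw [map_pow, scale_wvar, mul_pow, ← map_pow, ← AddChar.map_nsmul_eq_pow, nsmul_eq_mul,
    ZMod.natCast_self, zero_mul, AddChar.map_zero_eq_one, map_one, one_mul]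

include hgen hinv in
theorem exists_common_denominator : ∃ b ∈ Algebra.adjoin (Cyc n) (Set.range t), b ≠ 0 ∧
    (∀ s, act n s b = b) ∧ (∀ a, b * unitVar a ∈ Algebra.adjoin (Cyc n) (Set.range t)) ∧
    b * (wvar 1 : WField n) ^ n ∈ Algebra.adjoin (Cyc n) (Set.range t) := by
  obtain ⟨b, hb, hb0, hs, hu⟩ := exists_invariant_denominator (act n) (act_mem_adjoin hinv)
    (ι := Option (ZMod n)) (fun o => o.elim (wvar 1 ^ n) unitVar) (by
      rintro (_ | a)
      · exact exists_mul_mem_adjoin hgen wvar_pow_mem_invField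
      · exact exists_mul_mem_adjoin hgen (unitVar_mem_invField a))
  exact ⟨b, hb, hb0, hs, fun a => hu (some a), hu none⟩

theorem mem_loc_of_mem_invField {B : Subalgebra (Cyc n) (WField n)} {b : WField n} (hb : b ∈ B)
    (hu : ∀ a, b * unitVar a ∈ B) (hv : b * (wvar 1 : WField n) ^ n ∈ B) {f : WField n}
    (hf : f ∈ (polyHom n).range) (hf' : f ∈ invField n) : f ∈ Loc B hb := by
  obtain ⟨p, rfl⟩ := hf
  have hp : ∀ c, scalePoly n c p = p := fun c => polyHom_injective (by
    have := hf' c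
    rw [polyHom_apply, ← scale_algebraMap]
    exact this)
  refine mem_of_forall_monomial_mem (Loc B hb).toSubmodule.toAddSubgroup (fun m x hm => ?_) hp
  change _ ∈ Loc B hb
  rw [algebraMap_monomial]
  refine mul_mem (Subalgebra.algebraMap_mem _ _) ?_
  have hw : ∀ a : ZMod n, wvar a = unitVar a * wvar 1 ^ a.val := fun a => by
    rw [unitVar, inv_mul_cancel_right₀ (pow_ne_zero _ (wvar_ne_zero 1))]
  have hd : n ∣ ∑ a : ZMod n, a.val * m a := by
    rw [← ZMod.natCast_eq_zero_iff, Nat.cast_sum, ← hm, monWeight]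
    refine Finset.sum_congr rfl fun a _ => ?_
    rw [Nat.cast_mul, ZMod.natCast_zmod_val, mul_comm]
  obtain ⟨k, hk⟩ := hd
  have h1 : ∏ a, wvar a ^ m a = (∏ a, unitVar a ^ m a) * (wvar 1 ^ n) ^ k := by
    rw [← pow_mul, ← hk, ← Finset.prod_pow_eq_pow_sum, ← Finset.prod_mul_distrib]
    refine Finset.prod_congr rfl fun a _ => ?_
    rw [hw a, mul_pow, ← pow_mul]
  rw [h1]
  have hu' : ∀ a, unitVar a ∈ Loc B hb := fun a => ⟨1, by simpa using hu a⟩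
  have hv' : (wvar 1 : WField n) ^ n ∈ Loc B hb := ⟨1, by simpa using hv⟩
  exact mul_mem (prod_mem fun a _ => pow_mem (hu' a) _) (pow_mem hv' _)

theorem exists_poly_denominator (t : Fin n → WField n) : ∃ d ∈ (polyHom n).range, d ≠ 0 ∧
    (∀ s, act n s d = d) ∧ d ∈ invField n ∧ (∀ i, d * t i ∈ (polyHom n).range) ∧
    ∀ a, d * (wvar a)⁻¹ ∈ (polyHom n).range := by
  let ρ : (ZMod n)ˣ × Multiplicative (ZMod n) →* RingAut (WField n) :=
    (act n).noncommCoprod (scale n) fun s c => by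
      ext x
      exact act_scale_comm s c x
  have hρ : ∀ g, ρ g = act n g.1 * scale n g.2 := fun g => rfl
  have hρ1 : ∀ s, ρ (s, 1) = act n s := fun s => by rw [hρ, map_one, mul_one]
  have hρ2 : ∀ c, ρ (1, c) = scale n c := fun c => by rw [hρ, map_one, one_mul]
  clear_value ρ
  obtain ⟨d, hd, hd0, hs, hu⟩ := exists_invariant_denominator ρ (R := (polyHom n).range)
    (fun g x hx => by
      rw [hρ, RingAut.mul_apply]
      exact act_mem_polyHom_range _ _ (scale_mem_polyHom_range _ _ hx))
    (ι := Fin n ⊕ ZMod n) (Sum.elim t fun a => (wvar a)⁻¹)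
    (fun i => exists_mul_mem_polyHom_range _)
  exact ⟨d, hd, hd0, fun s => by rw [← hρ1]; exact hs _, fun c => by rw [← hρ2]; exact hs _,
    fun i => hu (Sum.inl i), fun a => hu (Sum.inr a)⟩

include hgen hinv in
theorem exists_permPresentation_of_generates : Nonempty (PermPresentation n) := by
  set B := Algebra.adjoin (Cyc n) (Set.range t) with hB
  obtain ⟨d, hd, hd0, hds, hdi, hdt, hdX⟩ := exists_poly_denominator t
  obtain ⟨b, hb, hb0, hbs, hbu, hbv⟩ := exists_common_denominator hinv hgen
  have hBd : B ≤ Loc (polyHom n).range hd := by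
    refine Algebra.adjoin_le ?_
    rintro _ ⟨i, rfl⟩
    exact ⟨1, by simpa using hdt i⟩
  have hdB : d ∈ Loc B hb := mem_loc_of_mem_invField hb hbu hbv hd hdi
  obtain ⟨i, hi⟩ := hBd hb
  obtain ⟨j, hj⟩ := hdB
  have hbi := adjoin_le_invField hinv hb
  let h : (polyHom n).range := ⟨b * d ^ (i + 1), by
    have : b * d ^ (i + 1) = d ^ i * b * d := by ring
    rw [this]
    exact mul_mem hi hd⟩
  let c : B := ⟨d * b ^ (j + 1), by
    have : d * b ^ (j + 1) = b ^ j * d * b := by ring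
    rw [this]
    exact mul_mem hj hb⟩
  have h0 : h ≠ 0 := fun h => mul_ne_zero hb0 (pow_ne_zero _ hd0) (congrArg Subtype.val h)
  have c0 : c ≠ 0 := fun h => mul_ne_zero hd0 (pow_ne_zero _ hb0) (congrArg Subtype.val h)
  have : UniqueFactorizationMonoid (polyHom n).range :=
    uniqueFactorizationMonoid_range polyHom_injective
  have hinj : Function.Injective (MvPolynomial.aeval t : _ →ₐ[Cyc n] WField n) :=
    algebraicIndependent_of_generates hgen
  have hBr : B = (MvPolynomial.aeval t : _ →ₐ[Cyc n] WField n).range :=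
    Algebra.adjoin_range_eq_range_aeval _ _
  have : UniqueFactorizationMonoid B := by
    rw [hBr]
    exact uniqueFactorizationMonoid_range hinj
  have hBunit : ∀ u : B, IsUnit u → ∃ c : Cyc n, algebraMap (Cyc n) (WField n) c = u := by
    rw [hBr]
    exact exists_const_of_isUnit_range hinj
  obtain ⟨W, _, ⟨D⟩⟩ := exists_primeReps (exists_const_of_isUnit_range polyHom_injective) h0
  obtain ⟨T, _, ⟨D'⟩⟩ := exists_primeReps hBunit c0
  have Cc : Compat (polyHom n).range h (scale n) :=
    ⟨scale_mem_polyHom_range, fun g c => ⟨c, scale_const g c⟩, fun g =>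
      mul_mem hbi (pow_mem hdi (i + 1)) g⟩
  have Cs : Compat (polyHom n).range h (act n) :=
    ⟨act_mem_polyHom_range, fun g c => ⟨_, act_const g c⟩, fun g => by
      change act n g (b * d ^ (i + 1)) = b * d ^ (i + 1)
      rw [map_mul, map_pow, hbs, hds]⟩
  have Cb : Compat B c (act n) :=
    ⟨act_mem_adjoin hinv, fun g c => ⟨_, act_const g c⟩, fun g => by
      change act n g (d * b ^ (j + 1)) = d * b ^ (j + 1)
      rw [map_mul, map_pow, hbs, hds]⟩
  let _ := Cc.mulAction D
  let _ := Cs.mulAction D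
  let _ := Cb.mulAction D'
  have hX : ∀ a, ∃ y, ConstEq (Cyc n) (wvar a : WField n) (D.p y) := by
    intro a
    have hdvd : (⟨polyHom n (MvPolynomial.X a), MvPolynomial.X a, rfl⟩ :
        (polyHom n).range) ∣ h := by
      refine ⟨⟨d ^ i * b * (d * (wvar a)⁻¹), mul_mem hi (hdX a)⟩, Subtype.ext ?_⟩
      change b * d ^ (i + 1) = wvar a * (d ^ i * b * (d * (wvar a)⁻¹))
      have := wvar_ne_zero a
      field_simp
      rw [pow_succ]
    obtain ⟨y, hy⟩ := D.exists_associated _ (prime_range_X polyHom_injective a) hdvd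
    exact ⟨y, D.constEq_of_associated hy⟩
  choose Y hY using hX
  refine exists_permPresentation D (Cc.constEq_smul D) (Cs.constEq_smul D) Cc Cs h0 hY D' c0
    (Cb.constEq_smul D') fun f => ⟨?_, ?_⟩
  · rintro ⟨k, hk⟩
    have hk : (d * b ^ (j + 1)) ^ k * f ∈ B := hk
    have hne : (d * b ^ (j + 1)) ^ k ≠ 0 := pow_ne_zero _ (mul_ne_zero hd0 (pow_ne_zero _ hb0))
    constructor
    · obtain ⟨l, hl⟩ := hBd hk
      refine ⟨(j + 1) * k + (l + k), ?_⟩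
      have h1 : (b * d ^ (i + 1)) ^ ((j + 1) * k + (l + k)) * f =
          d ^ l * ((d * b ^ (j + 1)) ^ k * f) * ((d ^ i * b) ^ (l + k) *
            d ^ ((i + 1) * ((j + 1) * k))) := by ring
      change (b * d ^ (i + 1)) ^ ((j + 1) * k + (l + k)) * f ∈ _
      rw [h1]
      exact mul_mem hl (mul_mem (pow_mem hi _) (pow_mem hd _))
    · have h1 := mul_mem (inv_mem (pow_mem (mul_mem hdi (pow_mem hbi (j + 1))) k))
        (adjoin_le_invField hinv hk)
      rwa [inv_mul_cancel_left₀ hne] at h1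
  · rintro ⟨⟨k, hk⟩, hf⟩
    have hk : (b * d ^ (i + 1)) ^ k * f ∈ (polyHom n).range := hk
    obtain ⟨l, hl⟩ := mem_loc_of_mem_invField hb hbu hbv hk
      (mul_mem (pow_mem (mul_mem hbi (pow_mem hdi _)) _) hf)
    refine ⟨(i + 1) * k + (l + k), ?_⟩
    have h1 : (d * b ^ (j + 1)) ^ ((i + 1) * k + (l + k)) * f =
        b ^ l * ((b * d ^ (i + 1)) ^ k * f) * ((b ^ j * d) ^ (l + k) *
          b ^ ((j + 1) * ((i + 1) * k))) := by ring
    change (d * b ^ (j + 1)) ^ ((i + 1) * k + (l + k)) * f ∈ _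
    rw [h1]
    exact mul_mem hl (mul_mem (pow_mem hj _) (pow_mem hb _))

end Necessity

noncomputable section Eigen

theorem exists_norm_eq_card {O : Type*} [CommRing O] [IsDomain O] [Module.Free ℤ O]
    [Module.Finite ℤ O] {M N : Type*} [AddCommGroup M] [AddCommGroup N] [Module O M] [Module O N]
    [Module.Free O M] [Module.Finite O M] [Module.Free O N] [Module.Finite O N]
    (f : M →ₗ[O] N) (hf : Function.Injective f) (hcard : Nat.card (N ⧸ f.range) ≠ 0) :
    ∃ δ : O, (Algebra.norm ℤ δ).natAbs = Nat.card (N ⧸ f.range) := by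
  have : Module.Finite ℤ N := Module.Finite.trans O N
  have : Module.Finite ℤ M := Module.Finite.trans O M
  have : Module.Free ℤ N := Module.Free.trans (S := O)
  have : Module.Free ℤ M := Module.Free.trans (S := O)
  have : f.range.toAddSubgroup.FiniteIndex := ⟨hcard⟩
  have h1 := f.range.toAddSubgroup.finrank_eq_of_finiteIndex
  have h2 : Module.finrank ℤ M = Module.finrank ℤ f.range.toAddSubgroup :=
    ((LinearEquiv.ofInjective f hf).restrictScalars ℤ).finrank_eq
  have h3 : Module.finrank O M = Module.finrank O N := by
    have h4 := h2.trans h1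
    rw [← Module.finrank_mul_finrank ℤ O M, ← Module.finrank_mul_finrank ℤ O N] at h4
    exact Nat.eq_of_mul_eq_mul_left Module.finrank_pos h4
  let e : N ≃ₗ[O] M := LinearEquiv.ofFinrankEq _ _ h3.symm
  have h5 := Submodule.natAbs_det_equiv (f.range.restrictScalars ℤ)
    ((e.trans (LinearEquiv.ofInjective f hf)).restrictScalars ℤ)
  refine ⟨LinearMap.det (f.comp e.toLinearMap), ?_⟩
  rw [← LinearMap.det_restrictScalars]
  exact h5

variable {O H : Type} [CommRing O] [Group H] (χ : H →* O)

/-- The functions on a set with group action which transform by a given character. -/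
def eigen (X : Type) [MulAction H X] : Submodule O (X → O) where
  carrier := {f | ∀ (h : H) x, f (h • x) = χ h * f x}
  add_mem' ha hb h x := by rw [Pi.add_apply, Pi.add_apply, ha, hb, mul_add]
  zero_mem' h x := by simp
  smul_mem' c f hf h x := by rw [Pi.smul_apply, Pi.smul_apply, hf, smul_eq_mul, smul_eq_mul]; ring

variable {χ} {X : Type} [MulAction H X]

variable (H X) in
/-- The free orbits of a group action. -/
abbrev FreeOrbit : Type :=
  {q : MulAction.orbitRel.Quotient H X // ∀ h : H, h • q.out = q.out → h = 1}

/-- A representative of a free orbit. -/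
def FreeOrbit.rep (q : FreeOrbit H X) : X := q.1.out

theorem FreeOrbit.eq_of_smul_eq {q q' : FreeOrbit H X} {h : H} (hq : h • q.rep = q'.rep) :
    q = q' := by
  refine Subtype.ext ?_
  rw [← Quotient.out_eq q.1, ← Quotient.out_eq q'.1]
  exact (Quotient.sound (show (MulAction.orbitRel H X) q'.1.out q.1.out from ⟨h, hq⟩)).symm

theorem FreeOrbit.exists_smul_eq {x : X} (hx : ∀ h : H, h • x = x → h = 1) :
    ∃ (q : FreeOrbit H X) (h : H), h • q.rep = x := by
  let q : MulAction.orbitRel.Quotient H X := Quotient.mk _ x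
  obtain ⟨g, hg⟩ : (MulAction.orbitRel H X) q.out x := Quotient.exact (Quotient.out_eq q)
  have hg : g • x = q.out := hg
  refine ⟨⟨q, fun h hh => ?_⟩, g⁻¹, ?_⟩
  · rw [← hg] at hh
    have := hx (g⁻¹ * h * g) (by rw [mul_smul, mul_smul, hh, inv_smul_smul])
    rwa [mul_assoc, inv_mul_eq_one, eq_comm, mul_eq_right] at this
  · rw [inv_smul_eq_iff]
    exact hg.symm

variable [Fintype H]

open Classical in
variable (χ) in
/-- The projection of the indicator function of a point to the eigenspace of a character. -/
def eigenFun (x y : X) : O := ∑ h, if y = h • x then χ h else 0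

theorem eigenFun_mem (x : X) : eigenFun χ x ∈ eigen χ X := by
  intro g y
  classical
  rw [eigenFun, eigenFun, Finset.mul_sum]
  refine (Fintype.sum_equiv (Equiv.mulLeft g) _ _ fun h => ?_).symm
  rw [Equiv.coe_mulLeft, mul_smul, map_mul, mul_ite, mul_zero]
  simp only [smul_left_cancel_iff]

theorem sum_mul_eigenFun [Fintype X] {R : Type*} [CommRing R] (φ : O →+* R) (w : X → R) (x : X) :
    ∑ y, w y * φ (eigenFun χ x y) = ∑ h, w (h • x) * φ (χ h) := by
  classical
  simp only [eigenFun, map_sum, Finset.mul_sum]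
  rw [Finset.sum_comm]
  refine Finset.sum_congr rfl fun h _ => ?_
  rw [Finset.sum_eq_single (h • x)]
  · rw [if_pos rfl]
  · intro b _ hb
    rw [if_neg hb, map_zero, mul_zero]
  · simp

variable [IsDomain O] (hχ : Function.Injective χ)

omit [Fintype H] in
include hχ in
theorem eq_zero_of_not_free {f : X → O} (hf : f ∈ eigen χ X) {h : H} {x : X} (hx : h • x = x)
    (h1 : h ≠ 1) : f x = 0 := by
  have h2 := hf h x
  rw [hx] at h2
  have h3 : (χ h - 1) * f x = 0 := by rw [sub_mul, ← h2, one_mul, sub_self]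
  refine (mul_eq_zero.1 h3).resolve_left fun h4 => h1 (hχ ?_)
  rw [map_one]
  exact sub_eq_zero.1 h4

omit [IsDomain O] in
theorem eigenFun_rep [DecidableEq (FreeOrbit H X)] (q q' : FreeOrbit H X) :
    eigenFun χ q.rep q'.rep = if q = q' then 1 else 0 := by
  classical
  split_ifs with hq
  · subst hq
    rw [eigenFun, Finset.sum_eq_single 1]
    · rw [if_pos (one_smul _ _).symm, map_one]
    · intro h _ h1
      rw [if_neg]
      intro h2
      exact h1 (q.2 h h2.symm)
    · simp
  · refine Finset.sum_eq_zero fun h _ => if_neg fun h2 => hq (FreeOrbit.eq_of_smul_eq h2.symm)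

include hχ in
theorem eq_zero_of_rep {f : X → O} (hf : f ∈ eigen χ X)
    (h0 : ∀ q : FreeOrbit H X, f q.rep = 0) : f = 0 := by
  funext x
  by_cases hx : ∀ h : H, h • x = x → h = 1
  · obtain ⟨q, h, rfl⟩ := FreeOrbit.exists_smul_eq hx
    rw [hf, h0, mul_zero, Pi.zero_apply]
  · push Not at hx
    obtain ⟨h, hx, h1⟩ := hx
    exact eq_zero_of_not_free hχ hf hx h1

variable [Fintype (FreeOrbit H X)]

include hχ in
theorem eigen_eq_sum {f : X → O} (hf : f ∈ eigen χ X) :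
    f = ∑ q : FreeOrbit H X, f q.rep • eigenFun χ q.rep := by
  classical
  rw [← sub_eq_zero]
  refine eq_zero_of_rep hχ (sub_mem hf (sum_mem fun q _ =>
    Submodule.smul_mem _ _ (eigenFun_mem _))) fun q => ?_
  rw [Pi.sub_apply, Finset.sum_apply, sub_eq_zero]
  simp [eigenFun_rep]

/-- The values at representatives of the free orbits are coordinates of an eigenfunction. -/
def eigenEquiv : eigen χ X ≃ₗ[O] (FreeOrbit H X → O) :=
  LinearEquiv.ofBijective
    ({ toFun := fun f q => f.1 q.rep
       map_add' := fun _ _ => rfl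
       map_smul' := fun _ _ => rfl } : eigen χ X →ₗ[O] (FreeOrbit H X → O))
    ⟨fun f g hfg => by
      refine Subtype.ext (sub_eq_zero.1 (eq_zero_of_rep hχ (sub_mem f.2 g.2) fun q => ?_))
      exact sub_eq_zero.2 (congrFun hfg q), fun c => by
      classical
      refine ⟨⟨∑ q : FreeOrbit H X, c q • eigenFun χ q.rep, sum_mem fun q _ =>
        Submodule.smul_mem _ _ (eigenFun_mem _)⟩, ?_⟩
      funext q
      change (∑ q : FreeOrbit H X, c q • eigenFun χ q.rep) q.rep = c q
      rw [Finset.sum_apply]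
      simp [eigenFun_rep]⟩

end Eigen

noncomputable section EigenNorm

variable {n : ℕ} (Pr : PermPresentation n)

attribute [local instance] PermPresentation.fintypeΩ PermPresentation.fintypeT
  PermPresentation.actionΩ PermPresentation.actionT

namespace PermPresentation

theorem sum_mul_w_eq_zero (t : Pr.T) : ∑ ω, (Pr.Φ t ω : ZMod n) * Pr.w ω = 0 := by
  classical
  exact (Pr.exact _).2 ⟨Pi.single t 1, fun ω => by simp [Pi.single_apply]⟩

section Extend

variable {O : Type} [CommRing O] [Module.Free ℤ O] [Module.Finite ℤ O]

omit [Module.Finite ℤ O] in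
theorem injective_extend {z : Pr.T → O} (hz : ∀ ω, ∑ t, z t * (Pr.Φ t ω : O) = 0) : z = 0 := by
  let b := Module.Free.chooseBasis ℤ O
  have h1 : ∀ i, (fun t => b.repr (z t) i) = 0 := fun i => Pr.injective _ fun ω => by
    have h2 := congrArg (fun v => b.repr v i) (hz ω)
    simp only [mul_comm (z _), ← zsmul_eq_mul, map_sum, map_zsmul] at h2
    simpa [Finsupp.finsetSum_apply, mul_comm] using h2
  funext t
  refine b.repr.injective (Finsupp.ext fun i => ?_)
  simpa using congrFun (h1 i) t

theorem exact_extend {x : Pr.Ω → O} {y : O}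
    (hx : ∑ ω, ((ZMod.cast (Pr.w ω) : ℤ) : O) * x ω = n * y) :
    ∃ z : Pr.T → O, ∀ ω, x ω = ∑ t, z t * (Pr.Φ t ω : O) := by
  let b := Module.Free.chooseBasis ℤ O
  have h1 : ∀ i, ∃ z : Pr.T → ℤ, ∀ ω, b.repr (x ω) i = ∑ t, z t * Pr.Φ t ω := fun i => by
    refine (Pr.exact _).1 ?_
    have h2 := congrArg (fun v => b.repr v i) hx
    rw [← nsmul_eq_mul] at h2
    simp only [← zsmul_eq_mul, map_sum, map_zsmul, map_nsmul] at h2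
    have h3 : ∑ ω, (ZMod.cast (Pr.w ω) : ℤ) * b.repr (x ω) i = n * b.repr y i := by
      simpa [Finsupp.finsetSum_apply] using h2
    have h4 := congrArg (Int.cast : ℤ → ZMod n) h3
    simpa [mul_comm] using h4
  choose z hz using h1
  refine ⟨fun t => ∑ i, z i t • b i, fun ω => b.repr.injective (Finsupp.ext fun i => ?_)⟩
  rw [hz]
  simp only [mul_comm (∑ i, z i _ • b i), ← zsmul_eq_mul, map_sum, map_zsmul,
    Finsupp.finsetSum_apply, Finsupp.smul_apply, Module.Basis.repr_self]
  refine Finset.sum_congr rfl fun t _ => ?_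
  classical
  simp [Finsupp.single_apply, mul_comm]

end Extend

variable {O H : Type} [CommRing O] [IsDomain O] [Module.Free ℤ O] [Module.Finite ℤ O]
  [Group H] [Fintype H] {χ : H →* O} (hχ : Function.Injective χ) (ψ : H →* (ZMod n)ˣ)
  {R : Type} [CommRing R] (φ : O →+* R) (ι : ZMod n →+* R)

include Pr hχ in
theorem exists_norm_eq (hφ : ∀ x, φ x = 0 → ∃ y, x = n * y) {θ : R}
    (hθ : ∑ h, ι (ψ h) * φ (χ h) = θ) (hcyc : ∀ x : O, ∃ k : ℤ, φ x * θ = k • θ)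
    {p : ℕ} (hp : p ≠ 0) (hpθ : addOrderOf θ = p) :
    ∃ δ : O, (Algebra.norm ℤ δ).natAbs = p := by
  classical
  let _ : MulAction H Pr.Ω := MulAction.compHom _ ψ
  let _ : MulAction H Pr.T := MulAction.compHom _ ψ
  have smulΩ : ∀ (h : H) (ω : Pr.Ω), h • ω = ψ h • ω := fun _ _ => rfl
  have smulT : ∀ (h : H) (t : Pr.T), h • t = ψ h • t := fun _ _ => rfl
  let _ : Fintype (FreeOrbit H Pr.Ω) := Fintype.ofFinite _
  let _ : Fintype (FreeOrbit H Pr.T) := Fintype.ofFinite _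
  have : Module.Free O (eigen χ Pr.Ω) := Module.Free.of_equiv (eigenEquiv hχ).symm
  have : Module.Free O (eigen χ Pr.T) := Module.Free.of_equiv (eigenEquiv hχ).symm
  have : Module.Finite O (eigen χ Pr.Ω) := Module.Finite.equiv (eigenEquiv hχ).symm
  have : Module.Finite O (eigen χ Pr.T) := Module.Finite.equiv (eigenEquiv hχ).symm
  have hΦ : ∀ (h : H) t ω, Pr.Φ (h • t) (h • ω) = Pr.Φ t ω := fun h => Pr.Φ_smul (ψ h)
  have hshift : ∀ (h : H) (z : Pr.T → O) ω,
      ∑ t, z t * (Pr.Φ t (h • ω) : O) = ∑ t, z (h • t) * (Pr.Φ t ω : O) := by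
    intro h z ω
    refine (Fintype.sum_equiv (MulAction.toPerm h) _ _ fun t => ?_).symm
    rw [MulAction.toPerm_apply, hΦ]
  let f : eigen χ Pr.T →ₗ[O] eigen χ Pr.Ω :=
    { toFun := fun z => ⟨fun ω => ∑ t, z.1 t * (Pr.Φ t ω : O), fun h ω => by
        beta_reduce
        rw [hshift, Finset.mul_sum]
        refine Finset.sum_congr rfl fun t _ => ?_
        rw [z.2, mul_assoc]⟩
      map_add' := fun a b => Subtype.ext (funext fun ω => by
        change ∑ t, (a.1 t + b.1 t) * _ = (∑ t, _) + ∑ t, _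
        simp only [add_mul, Finset.sum_add_distrib])
      map_smul' := fun c a => Subtype.ext (funext fun ω => by
        change ∑ t, (c * a.1 t) * _ = c * ∑ t, _
        simp only [mul_assoc, Finset.mul_sum]) }
  have hf : Function.Injective f := (injective_iff_map_eq_zero f).2 fun z hz =>
    Subtype.ext (Pr.injective_extend fun ω => congrFun (congrArg Subtype.val hz) ω)
  let W : eigen χ Pr.Ω →+ R :=
    { toFun := fun x => ∑ ω, ι (Pr.w ω) * φ (x.1 ω)
      map_zero' := by
        change ∑ ω, ι (Pr.w ω) * φ 0 = 0
        simp
      map_add' := fun a b => by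
        change ∑ ω, ι (Pr.w ω) * φ (a.1 ω + b.1 ω) = _
        simp only [map_add, mul_add, Finset.sum_add_distrib] }
  have hι : ∀ a : ZMod n, ι a = φ ((ZMod.cast a : ℤ) : O) := fun a => by
    rw [map_intCast, ← map_intCast ι, ZMod.intCast_zmod_cast]
  have hker : f.range.toAddSubgroup = W.ker := by
    ext x
    constructor
    · rintro ⟨z, rfl⟩
      change ∑ ω, ι (Pr.w ω) * φ (∑ t, z.1 t * (Pr.Φ t ω : O)) = 0
      have h1 : ∀ t, ∑ ω, ι (Pr.w ω) * (Pr.Φ t ω : R) = 0 := fun t => by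
        rw [← map_zero ι, ← Pr.sum_mul_w_eq_zero t, map_sum]
        refine Finset.sum_congr rfl fun ω _ => ?_
        rw [map_mul, map_intCast, mul_comm]
      simp only [map_sum, map_mul, map_intCast, Finset.mul_sum]
      rw [Finset.sum_comm]
      refine Finset.sum_eq_zero fun t _ => ?_
      rw [← mul_zero (φ (z.1 t)), ← h1 t, Finset.mul_sum]
      exact Finset.sum_congr rfl fun ω _ => by ring
    · intro hx
      have hx : ∑ ω, ι (Pr.w ω) * φ (x.1 ω) = 0 := hx
      obtain ⟨y, hy⟩ := hφ (∑ ω, ((ZMod.cast (Pr.w ω) : ℤ) : O) * x.1 ω) (by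
        rw [map_sum, ← hx]
        refine Finset.sum_congr rfl fun ω _ => ?_
        rw [map_mul, hι])
      obtain ⟨z, hz⟩ := Pr.exact_extend hy
      have hz' : z ∈ eigen χ Pr.T := by
        intro h t
        have h0 : (fun t => z (h • t) - χ h * z t) = 0 := Pr.injective_extend fun ω => by
          simp only [sub_mul, Finset.sum_sub_distrib, mul_assoc]
          rw [← Finset.mul_sum, ← hz, ← hshift, ← hz, x.2, sub_self]
        exact sub_eq_zero.1 (congrFun h0 t)
      exact ⟨⟨z, hz'⟩, Subtype.ext (funext fun ω => (hz ω).symm)⟩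
  have hWe : ∀ ω0, ∑ ω, ι (Pr.w ω) * φ (eigenFun χ ω0 ω) = ι (Pr.w ω0) * θ := by
    intro ω0
    rw [sum_mul_eigenFun φ (fun ω => ι (Pr.w ω)), ← hθ, Finset.mul_sum]
    refine Finset.sum_congr rfl fun h _ => ?_
    rw [smulΩ, Pr.w_smul, map_mul]
    ring
  have hrange : W.range = AddSubgroup.zmultiples θ := by
    apply le_antisymm
    · rintro _ ⟨x, rfl⟩
      have h1 : W x = ∑ q : FreeOrbit H Pr.Ω, φ (x.1 q.rep) * (ι (Pr.w q.rep) * θ) := by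
        change ∑ ω, ι (Pr.w ω) * φ (x.1 ω) = _
        have h2 := eigen_eq_sum hχ x.2
        have h3 : ∀ ω, φ (x.1 ω) = ∑ q : FreeOrbit H Pr.Ω, φ (x.1 q.rep) *
            φ (eigenFun χ q.rep ω) := fun ω => by
          conv_lhs => rw [h2]
          simp
        clear h2
        simp only [← hWe]
        rw [Finset.sum_congr rfl fun ω _ => by rw [h3 ω]]
        simp only [Finset.mul_sum]
        rw [Finset.sum_comm]
        exact Finset.sum_congr rfl fun q _ => Finset.sum_congr rfl fun ω _ => by ring
      rw [h1]
      refine sum_mem fun q _ => ?_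
      rw [hι, ← mul_assoc, ← map_mul]
      obtain ⟨k, hk⟩ := hcyc (x.1 q.rep * ((ZMod.cast (Pr.w q.rep) : ℤ) : O))
      rw [hk]
      exact ⟨k, rfl⟩
    · rw [AddSubgroup.zmultiples_le]
      refine ⟨⟨eigenFun χ (Pr.y 1), eigenFun_mem _⟩, ?_⟩
      change ∑ ω, ι (Pr.w ω) * φ (eigenFun χ (Pr.y 1) ω) = θ
      rw [hWe, Pr.w_y, map_one, one_mul]
  have hcard : Nat.card (eigen χ Pr.Ω ⧸ f.range) = p := by
    change f.range.toAddSubgroup.index = p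
    rw [hker, AddSubgroup.index_ker, hrange, Nat.card_zmultiples, hpθ]
  obtain ⟨δ, hδ⟩ := exists_norm_eq_card f hf (by rw [hcard]; exact hp)
  exact ⟨δ, hδ.trans hcard⟩

end PermPresentation
end EigenNorm

section CyclotomicNorm

variable {n m p : ℕ}

theorem exists_zmod_ringHom {R : Type*} [CommRing R] (h : (n : R) = 0) :
    Nonempty (ZMod n →+* R) := by
  obtain ⟨c, hc⟩ := CharP.exists R
  exact ⟨ZMod.castHom ((CharP.cast_eq_zero_iff R c n).1 h) R⟩

theorem geom_sum_mul_range {R : Type*} [CommRing R] (z : R) (M q : ℕ) :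
    ∑ i ∈ Finset.range (M * q), z ^ i =
      (∑ a ∈ Finset.range M, z ^ a) * ∑ b ∈ Finset.range q, (z ^ M) ^ b := by
  induction q with
  | zero => simp
  | succ q ih =>
    rw [Nat.mul_succ, Finset.sum_range_add, ih, Finset.sum_range_succ, mul_add, ← pow_mul]
    congr 1
    rw [Finset.sum_mul]
    exact Finset.sum_congr rfl fun a _ => by rw [pow_add, mul_comm]

theorem PermPresentation.exists_norm_eq_of_pow [NeZero n] [NeZero m] (Pr : PermPresentation n)
    (hp : p.Prime) {O : Type} [CommRing O] [IsDomain O] [CharZero O] [Module.Free ℤ O]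
    [Module.Finite ℤ O]
    {ξ : O} (hξ : IsPrimitiveRoot ξ m) (hξO : Algebra.adjoin ℤ {ξ} = ⊤) {M S : ℕ} (hM : M ∣ m)
    (hMm : M < m) (hSm : (S : ZMod n) ^ m = 1) (hSM : (p : ZMod n) * S ^ M = p)
    (hSp : ¬ p * n ∣ S ^ m - 1) (π : O →+* ZMod p) (hπ : π ξ * S = 1) :
    ∃ δ : O, (Algebra.norm ℤ δ).natAbs = p := by
  have hm : m ≠ 0 := NeZero.ne m
  let R := O ⧸ Ideal.span {(n : O)}
  let φ : O →+* R := Ideal.Quotient.mk _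
  have hφn : ∀ x, φ x = 0 → ∃ y, x = n * y := fun x hx => by
    rwa [Ideal.Quotient.eq_zero_iff_mem, Ideal.mem_span_singleton] at hx
  have hn0 : (n : R) = 0 := by
    rw [← map_natCast φ, Ideal.Quotient.eq_zero_iff_mem]
    exact Ideal.mem_span_singleton_self _
  obtain ⟨ι⟩ := exists_zmod_ringHom hn0
  let s : (ZMod n)ˣ := Units.ofPowEqOne (S : ZMod n) m hSm hm
  have hs : (s : ZMod n) = S := rfl
  have hsm : s ^ m = 1 := Units.pow_ofPowEqOne hSm hm
  let χ : Multiplicative (ZMod m) →* O := (AddChar.zmodChar m hξ.pow_eq_one).toMonoidHom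
  have hχ1 : χ (Multiplicative.ofAdd 1) = ξ := by
    change AddChar.zmodChar m hξ.pow_eq_one 1 = ξ
    have := AddChar.zmodChar_apply' hξ.pow_eq_one 1
    simpa using this
  let ψ : Multiplicative (ZMod m) →* (ZMod n)ˣ := AddMonoidHom.toMultiplicativeLeft
    (ZMod.lift m ⟨zmultiplesHom (Additive (ZMod n)ˣ) (Additive.ofMul s), by
      simp [← ofMul_pow, hsm]⟩)
  have hψ1 : ψ (Multiplicative.ofAdd 1) = s := by
    change Additive.toMul (ZMod.lift m _ 1) = s
    have := ZMod.lift_coe m ⟨zmultiplesHom (Additive (ZMod n)ˣ) (Additive.ofMul s), by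
      simp [← ofMul_pow, hsm]⟩ 1
    rw [Int.cast_one] at this
    rw [this]
    simp
  have hpow : ∀ a : Multiplicative (ZMod m),
      a = Multiplicative.ofAdd (1 : ZMod m) ^ (ZMod.val a.toAdd) := fun a => by
    rw [← ofAdd_nsmul, nsmul_one, ZMod.natCast_zmod_val, ofAdd_toAdd]
  have hχ : Function.Injective χ := by
    intro a b hab
    rw [hpow a, hpow b, map_pow, map_pow, hχ1] at hab
    exact ZMod.val_injective m (hξ.pow_inj (ZMod.val_lt _) (ZMod.val_lt _) hab)
  have hsum : ∑ h : Multiplicative (ZMod m), ι (ψ h) * φ (χ h) =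
      ∑ i ∈ Finset.range m, (ι S * φ ξ) ^ i := by
    refine Finset.sum_nbij (fun h => ZMod.val h.toAdd) (fun h _ => ?_) (fun a _ b _ hab => ?_)
      (fun i hi => ?_) fun h _ => ?_
    · exact Finset.mem_range.2 (ZMod.val_lt _)
    · exact ZMod.val_injective m hab
    · exact ⟨Multiplicative.ofAdd (i : ZMod m), Finset.mem_coe.2 (Finset.mem_univ _),
        ZMod.val_cast_of_lt (Finset.mem_range.1 hi)⟩
    · conv_lhs => rw [hpow h]
      rw [map_pow, map_pow, hχ1, hψ1, Units.val_pow_eq_pow_val, hs, map_pow, map_pow, mul_pow]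
  set z : R := ι S * φ ξ with hz
  set θ := ∑ i ∈ Finset.range m, z ^ i with hθ
  have hzm : z ^ m = 1 := by
    rw [hz, mul_pow, ← map_pow, ← map_pow, hSm, hξ.pow_eq_one, map_one, map_one, one_mul]
  have hzθ : z * θ = θ := by
    have := mul_geom_sum z m
    rw [hzm, sub_self, sub_mul, one_mul] at this
    exact sub_eq_zero.1 this
  have hpz : ∀ b : ℕ, (p : R) * (z ^ M) ^ b = p * φ ((ξ ^ M) ^ b) := by
    intro b
    have h1 : ∀ b : ℕ, (p : R) * (ι S ^ M) ^ b = p := fun b => by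
      induction b with
      | zero => simp
      | succ b ih =>
        rw [pow_succ, ← mul_assoc, ih, ← map_pow, ← map_natCast ι p, ← map_mul, hSM]
    rw [hz, mul_pow, mul_pow, ← mul_assoc, h1, map_pow, map_pow]
  have hpθ : p • θ = 0 := by
    obtain ⟨q, rfl⟩ := hM
    have hM0 : M ≠ 0 := fun h => by simp [h] at hm
    rw [nsmul_eq_mul, hθ, geom_sum_mul_range, mul_left_comm, Finset.mul_sum]
    simp only [hpz]
    rw [← Finset.mul_sum, ← map_sum, (hξ.pow (Nat.pos_of_ne_zero hm) rfl).geom_sum_eq_zero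
      (by by_contra! h; nlinarith [Nat.pos_of_ne_zero hM0]), map_zero, mul_zero, mul_zero]
  have hθ0 : θ ≠ 0 := by
    intro h0
    obtain ⟨y, hy⟩ := hφn (∑ i ∈ Finset.range m, ((S : O) * ξ) ^ i) (by
      rw [map_sum, ← h0, hθ]
      exact Finset.sum_congr rfl fun i _ => by rw [hz, map_pow, map_mul, map_natCast, map_natCast])
    have h1 := mul_geom_sum ((S : O) * ξ) m
    rw [hy, mul_pow, hξ.pow_eq_one, mul_one] at h1
    have hS0 : 1 ≤ S := Nat.pos_of_ne_zero fun h => by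
      have := Fact.mk hp
      simp [h] at hπ
    have hS1 : 1 ≤ S ^ m := Nat.one_le_pow _ _ hS0
    obtain ⟨u, hu⟩ : n ∣ S ^ m - 1 := by
      rw [← CharP.cast_eq_zero_iff (ZMod n) n, Nat.cast_sub hS1, Nat.cast_pow, hSm]
      simp
    have h2 : (n : O) * u = n * ((S * ξ - 1) * y) := by
      rw [← Nat.cast_mul, ← hu, Nat.cast_sub hS1, Nat.cast_pow, Nat.cast_one, ← h1]
      ring
    have h3 := mul_left_cancel₀ (Nat.cast_ne_zero.2 (NeZero.ne n)) h2
    have h4 := congrArg π h3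
    rw [map_mul, map_sub, map_mul, map_natCast, map_natCast, mul_comm (S : ZMod p), hπ, map_one,
      sub_self, zero_mul, CharP.cast_eq_zero_iff (ZMod p) p] at h4
    apply hSp
    rw [hu, mul_comm p]
    exact mul_dvd_mul_left n h4
  have hcyc : ∀ x : O, ∃ k : ℤ, φ x * θ = k • θ := by
    intro x
    have hx : x ∈ Algebra.adjoin ℤ {ξ} := hξO ▸ Algebra.mem_top
    induction hx using Algebra.adjoin_induction with
    | mem x hx =>
      obtain rfl := hx
      refine ⟨ZMod.cast ((s⁻¹ : (ZMod n)ˣ) : ZMod n), ?_⟩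
      have h1 : ((ZMod.cast ((s⁻¹ : (ZMod n)ˣ) : ZMod n) : ℤ) : R) = ι (s⁻¹ : (ZMod n)ˣ) := by
        rw [← map_intCast ι, ZMod.intCast_cast, ZMod.cast_id]
      rw [zsmul_eq_mul, h1]
      conv_rhs => rw [← hzθ]
      rw [hz, ← mul_assoc, ← mul_assoc, ← map_mul, ← hs, Units.inv_mul, map_one, one_mul]
    | algebraMap r => exact ⟨r, by simp⟩
    | add x y _ _ hx hy =>
      obtain ⟨k, hk⟩ := hx
      obtain ⟨l, hl⟩ := hy
      exact ⟨k + l, by rw [map_add, add_mul, hk, hl, add_smul]⟩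
    | mul x y _ _ hx hy =>
      obtain ⟨k, hk⟩ := hx
      obtain ⟨l, hl⟩ := hy
      exact ⟨k * l, by rw [map_mul, mul_assoc, hl, mul_smul_comm, hk, smul_smul, mul_comm]⟩
  have : Fact p.Prime := ⟨hp⟩
  exact Pr.exists_norm_eq hχ ψ φ ι hφn hsum hcyc hp.ne_zero (addOrderOf_eq_prime hpθ hθ0)

end CyclotomicNorm

section CyclotomicPrime

open NumberField

variable {n m p : ℕ}

theorem exists_ringHom_cyclotomic (hp : p.Prime) {j : ℕ} [NeZero m] (hm : m = p ^ j * (p - 1))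
    {K : Type} [Field K] [CharZero K] [IsCyclotomicExtension {m} ℚ K] {ζ : K}
    (hζ : IsPrimitiveRoot ζ m) {u : (ZMod p)ˣ} (hu : orderOf u = p - 1) :
    ∃ π : 𝓞 K →+* ZMod p, π hζ.toInteger = u := by
  have : Fact p.Prime := ⟨hp⟩
  have h1 : minpoly ℤ hζ.integralPowerBasis.gen = Polynomial.cyclotomic m ℤ := by
    rw [hζ.integralPowerBasis_gen, Polynomial.cyclotomic_eq_minpoly hζ (NeZero.pos m)]
    exact (minpoly.algebraMap_eq RingOfIntegers.coe_injective hζ.toInteger).symm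
  have h2 : Polynomial.aeval (u : ZMod p) (minpoly ℤ hζ.integralPowerBasis.gen) = 0 := by
    have hp1 : NeZero ((p - 1 : ℕ) : ZMod p) := ⟨by
      rw [Ne, CharP.cast_eq_zero_iff (ZMod p) p]
      exact fun h => absurd (Nat.le_of_dvd (by have := hp.two_le; omega) h)
        (by have := hp.two_le; omega)⟩
    rw [h1, Polynomial.aeval_def, Polynomial.eval₂_eq_eval_map, Polynomial.map_cyclotomic, hm]
    refine (Polynomial.isRoot_cyclotomic_prime_pow_mul_iff_of_charP (p := p)).2 ?_
    rw [IsPrimitiveRoot.coe_units_iff, ← hu]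
    exact IsPrimitiveRoot.orderOf u
  refine ⟨(hζ.integralPowerBasis.lift (u : ZMod p) h2 : 𝓞 K →ₐ[ℤ] ZMod p), ?_⟩
  have := hζ.integralPowerBasis.lift_gen (u : ZMod p) h2
  rwa [hζ.integralPowerBasis_gen] at this

theorem PermPresentation.exists_norm_eq_prime [NeZero n] (Pr : PermPresentation n)
    (hp : p.Prime) (hp2 : p ≠ 2) {k n' j : ℕ} (hn : n = p ^ k * n') (hn' : ¬ p ∣ n') (hjk : j < k)
    (hj : j = 0 → k = 1) :
    ∃ δ : 𝓞 (CyclotomicField (p ^ j * (p - 1)) ℚ), (Algebra.norm ℤ δ).natAbs = p := by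
  have : Fact p.Prime := ⟨hp⟩
  have hp3 : 3 ≤ p := by have := hp.two_le; omega
  have hm : NeZero (p ^ j * (p - 1)) := ⟨mul_ne_zero (pow_ne_zero _ hp.ne_zero) (by omega)⟩
  have hζ := IsCyclotomicExtension.zeta_spec (p ^ j * (p - 1)) ℚ
    (CyclotomicField (p ^ j * (p - 1)) ℚ)
  have := ZMod.isCyclic_units_of_prime_pow p hp hp2 (k + 1)
  obtain ⟨g, hg⟩ := IsCyclic.exists_generator (α := (ZMod (p ^ (k + 1)))ˣ)
  have hpk : p ∣ p ^ (k + 1) := dvd_pow_self p (by omega)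
  have : NeZero (p ^ (k + 1)) := ⟨pow_ne_zero _ hp.ne_zero⟩
  set u := ZMod.unitsMap hpk g with hu
  have hord : orderOf u = p - 1 := by
    rw [orderOf_eq_card_of_forall_mem_zpowers, Nat.card_eq_fintype_card, ZMod.card_units]
    intro x
    obtain ⟨y, rfl⟩ := ZMod.unitsMap_surjective hpk x
    obtain ⟨i, rfl⟩ := hg y
    exact ⟨i, by simp [hu]⟩
  have hgord : orderOf g = p ^ k * (p - 1) := by
    rw [orderOf_eq_card_of_forall_mem_zpowers hg, Nat.card_eq_fintype_card,
      ZMod.card_units_eq_totient, Nat.totient_prime_pow_succ hp]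
  obtain ⟨π, hπ⟩ := exists_ringHom_cyclotomic hp rfl hζ (u := u⁻¹) (by rw [orderOf_inv, hord])
  set G : ℕ := (g : ZMod (p ^ (k + 1))).val with hG
  have hGg : (G : ZMod (p ^ (k + 1))) = g := ZMod.natCast_zmod_val _
  have hGu : (G : ZMod p) = u := by
    rw [hu, ZMod.unitsMap_val, ← hGg, ZMod.cast_natCast hpk]
  have hcop : (p ^ (k + 1)).Coprime n' :=
    Nat.Coprime.pow_left _ ((Nat.Prime.coprime_iff_not_dvd hp).2 hn')
  obtain ⟨S, hS1, hS2⟩ := Nat.chineseRemainder hcop (G ^ p ^ (k - 1 - j)) 1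
  have hGpow : ∀ i, G ^ (p ^ i * (p - 1)) ≡ 1 [MOD p ^ (i + 1)] := fun i => by
    rw [← Nat.totient_prime_pow_succ hp]
    refine Nat.ModEq.pow_totient (Nat.Coprime.pow_right _ ?_)
    rw [Nat.coprime_comm, Nat.Prime.coprime_iff_not_dvd hp, ← CharP.cast_eq_zero_iff (ZMod p) p,
      hGu]
    exact u.ne_zero
  have hSpow : ∀ i, S ^ (p ^ i * (p - 1)) ≡ G ^ (p ^ (k - 1 - j + i) * (p - 1)) [MOD p ^ (k + 1)] :=
    fun i => by
      have := hS1.pow (p ^ i * (p - 1))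
      rwa [← pow_mul, ← mul_assoc, ← pow_add] at this
  have hkj : k - 1 - j + j = k - 1 := by omega
  have hSm := hSpow j
  rw [hkj] at hSm
  have hSu : (S : ZMod p) = u := by
    rw [← hGu, (ZMod.natCast_eq_natCast_iff S _ p).2 (hS1.of_dvd hpk), Nat.cast_pow,
      ZMod.pow_card_pow]
  have hSm1 : S ^ (p ^ j * (p - 1)) ≡ 1 [MOD n] := by
    rw [hn]
    refine (Nat.modEq_and_modEq_iff_modEq_mul
      (Nat.Coprime.coprime_dvd_left (pow_dvd_pow p k.le_succ) hcop)).1 ⟨?_, ?_⟩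
    · refine (hSm.of_dvd (pow_dvd_pow p k.le_succ)).trans ?_
      have := hGpow (k - 1)
      rwa [Nat.sub_add_cancel (by omega)] at this
    · simpa using hS2.pow (p ^ j * (p - 1))
  have hM : ∃ M, M ∣ p ^ j * (p - 1) ∧ M < p ^ j * (p - 1) ∧ p * S ^ M ≡ p [MOD n] := by
    rcases Nat.eq_zero_or_pos j with rfl | hj0
    · obtain rfl := hj rfl
      refine ⟨1, one_dvd _, by simp; omega, ?_⟩
      rw [hn, pow_one, pow_one]
      simpa using hS2.mul_left' p
    · refine ⟨p ^ (j - 1) * (p - 1), Nat.mul_dvd_mul_right (pow_dvd_pow p (by omega)) _, ?_, ?_⟩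
      · exact Nat.mul_lt_mul_of_pos_right (Nat.pow_lt_pow_right (by omega) (by omega)) (by omega)
      · have h1 : n = p * (p ^ (k - 1) * n') := by
          rw [hn, ← mul_assoc, mul_pow_sub_one (by omega)]
        have h2 : S ^ (p ^ (j - 1) * (p - 1)) ≡ 1 [MOD p ^ (k - 1) * n'] := by
          refine (Nat.modEq_and_modEq_iff_modEq_mul
            (Nat.Coprime.coprime_dvd_left (pow_dvd_pow p (by omega)) hcop)).1 ⟨?_, ?_⟩
          · refine ((hSpow (j - 1)).of_dvd (pow_dvd_pow p (by omega))).trans ?_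
            have := hGpow (k - 1 - j + (j - 1))
            rwa [show k - 1 - j + (j - 1) + 1 = k - 1 by omega] at this
          · simpa using hS2.pow (p ^ (j - 1) * (p - 1))
        rw [h1]
        simpa using h2.mul_left' p
  obtain ⟨M, hM1, hM2, hM3⟩ := hM
  refine Pr.exists_norm_eq_of_pow hp hζ.toInteger_isPrimitiveRoot ?_ hM1 hM2 (S := S) ?_ ?_ ?_ π ?_
  · rw [← hζ.integralPowerBasis_gen, PowerBasis.adjoin_gen_eq_top]
  · have := (ZMod.natCast_eq_natCast_iff _ _ n).2 hSm1
    simpa using this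
  · have := (ZMod.natCast_eq_natCast_iff _ _ n).2 hM3
    simpa using this
  · intro h
    have hS0 : 1 ≤ S := Nat.pos_of_ne_zero fun h => by
      rw [h, Nat.cast_zero] at hSu
      exact u.ne_zero hSu.symm
    have h1 : p ^ (k + 1) ∣ S ^ (p ^ j * (p - 1)) - 1 :=
      Dvd.dvd.trans ⟨n', by rw [hn]; ring⟩ h
    have h2 := ((Nat.modEq_iff_dvd' (Nat.one_le_pow _ _ hS0)).2 h1).trans hSm
    have h3 : g ^ (p ^ (k - 1) * (p - 1)) = 1 := by
      ext
      rw [Units.val_pow_eq_pow_val, ← hGg, Units.val_one, ← Nat.cast_pow]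
      simpa using (ZMod.natCast_eq_natCast_iff _ _ _).2 h2.symm
    have h4 := orderOf_dvd_of_pow_eq_one h3
    rw [hgord] at h4
    have h5 := Nat.le_of_dvd (Nat.mul_pos (pow_pos hp.pos _) (by omega)) h4
    have h6 : p ^ (k - 1) < p ^ k := Nat.pow_lt_pow_right (by omega) (by omega)
    have h7 := Nat.mul_lt_mul_of_pos_right h6 (show 0 < p - 1 by omega)
    omega
  · rw [hπ, hSu, Units.inv_mul]

end CyclotomicPrime

section EightDvd

attribute [local instance] PermPresentation.fintypeΩ PermPresentation.fintypeT
  PermPresentation.actionΩ PermPresentation.actionT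

variable {n : ℕ}

/-- Quadratic weights obstruct a permutation presentation. -/
theorem PermPresentation.mul_sq_one_eq_zero (Pr : PermPresentation n) {N : ℕ} [NeZero N]
    (sq : ZMod n → ZMod N) {ε : ZMod N} {c u : (ZMod n)ˣ} {a : ZMod n}
    (hsqc : ∀ b, sq (c * b) = sq b) (hsqu : ∀ b, sq (u * b) = (1 + ε) * sq b)
    (hε : ∀ x : Pr.Ω → ℤ, ∑ ω, (x ω : ZMod n) * Pr.w ω = 0 → ε * ∑ ω, x ω * sq (Pr.w ω) = 0)
    (hc : c * c = 1) (hu : u * u = 1) (ha : c * a - a + u - 1 = 0) : ε * sq 1 = 0 := by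
  classical
  have hshift : ∀ (s : (ZMod n)ˣ) (F : Pr.Ω → ZMod N), ∑ ω, F (s • ω) = ∑ ω, F ω := fun s F =>
    Fintype.sum_equiv (MulAction.toPerm s) _ _ fun _ => rfl
  set q : Pr.T → ZMod N := fun t => ∑ ω, Pr.Φ t ω * sq (Pr.w ω) with hq
  have hqs : ∀ (s : (ZMod n)ˣ) t, q (s • t) = ∑ ω, Pr.Φ t ω * sq (s * Pr.w ω) := by
    intro s t
    rw [hq]
    simp only
    rw [← hshift s]
    exact Finset.sum_congr rfl fun ω _ => by rw [Pr.Φ_smul, Pr.w_smul]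
  have hqc : ∀ t, q (c • t) = q t := fun t => by
    rw [hqs]
    simp only [hsqc, hq]
  have hqu : ∀ t, q (u • t) = q t := fun t => by
    rw [hqs]
    simp only [hsqu]
    have h0 : ε * q t = 0 := hε (Pr.Φ t) ((Pr.exact _).2 ⟨Pi.single t 1, fun ω => by
      simp [Pi.single_apply]⟩)
    have h1 : ∑ ω, Pr.Φ t ω * ((1 + ε) * sq (Pr.w ω)) = (1 + ε) * q t := by
      rw [hq, Finset.mul_sum]
      exact Finset.sum_congr rfl fun ω _ => by ring
    rw [h1, add_mul, h0, one_mul, add_zero]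
  have hsum : ∀ (α : Pr.Ω) (f : Pr.Ω → ZMod N),
      ∑ ω, ((Pi.single α 1 : Pr.Ω → ℤ) ω : ZMod N) * f ω = f α := fun α f => by
    simp [Pi.single_apply]
  have hsum' : ∀ (α : Pr.Ω) (f : Pr.Ω → ZMod n),
      ∑ ω, ((Pi.single α 1 : Pr.Ω → ℤ) ω : ZMod n) * f ω = f α := fun α f => by
    simp [Pi.single_apply]
  set x : Pr.Ω → ℤ := Pi.single (c • Pr.y a) 1 - Pi.single (Pr.y a) 1 +
    Pi.single (u • Pr.y 1) 1 - Pi.single (Pr.y 1) 1 with hx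
  obtain ⟨z, hz⟩ := (Pr.exact x).1 (by
    simp only [hx, Pi.add_apply, Pi.sub_apply, Int.cast_add, Int.cast_sub, add_mul, sub_mul,
      Finset.sum_add_distrib, Finset.sum_sub_distrib, hsum', Pr.w_smul, Pr.w_y, mul_one, ha])
  have hN : ∀ t, z t + z (c • t) + z (u • t) + z (u • c • t) = 0 := by
    refine congrFun (Pr.injective (fun t => z t + z (c • t) + z (u • t) + z (u • c • t))
      fun ω => ?_)
    have h1 : ∀ (s : (ZMod n)ˣ) (z : Pr.T → ℤ) ω,
        ∑ t, z (s • t) * Pr.Φ t ω = ∑ t, z t * Pr.Φ t (s • ω) := fun s z ω =>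
      Fintype.sum_equiv (MulAction.toPerm s) _ _ fun t => by
        rw [MulAction.toPerm_apply, Pr.Φ_smul]
    have h2 : ∀ (s : (ZMod n)ˣ), s * s = 1 → ∀ α ω : Pr.Ω,
        (Pi.single α 1 : Pr.Ω → ℤ) (s • ω) = (Pi.single (s • α) 1 : Pr.Ω → ℤ) ω := by
      intro s hs α ω
      simp only [Pi.single_apply]
      refine if_congr ⟨fun h => ?_, fun h => ?_⟩ rfl rfl
      · rw [← h, smul_smul, hs, one_smul]
      · rw [h, smul_smul, hs, one_smul]
    simp only [add_mul, Finset.sum_add_distrib]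
    rw [h1 c z, h1 u z, h1 c (fun t => z (u • t)), h1 u z, ← hz, ← hz, ← hz, ← hz]
    simp only [hx, Pi.add_apply, Pi.sub_apply, h2 c hc, h2 u hu]
    have huc : c * (u * c) = u := by rw [mul_comm u c, ← mul_assoc, hc, one_mul]
    simp only [smul_smul, hc, hu, one_smul, mul_comm c u, huc]
    ring
  have hQ : ∑ ω, x ω * sq (Pr.w ω) = ε * sq 1 := by
    simp only [hx, Pi.add_apply, Pi.sub_apply, Int.cast_add, Int.cast_sub, add_mul, sub_mul,
      Finset.sum_add_distrib, Finset.sum_sub_distrib, hsum, Pr.w_smul, Pr.w_y, hsqc, hsqu]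
    ring
  have hQ' : ∑ ω, x ω * sq (Pr.w ω) = ∑ t, z t * q t := by
    simp only [hz, Int.cast_sum, Int.cast_mul, Finset.sum_mul, hq, Finset.mul_sum]
    rw [Finset.sum_comm]
    exact Finset.sum_congr rfl fun t _ => Finset.sum_congr rfl fun ω _ => by ring
  have h4 : 4 * ∑ t, z t * (q t).val = 0 := by
    have hs : ∀ s : (ZMod n)ˣ, (∀ t, q (s • t) = q t) →
        ∑ t, z t * ((q t).val : ℤ) = ∑ t, z (s • t) * (q t).val := fun s hs =>
      (Fintype.sum_equiv (MulAction.toPerm s) _ _ fun t => by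
        rw [MulAction.toPerm_apply, hs]).symm
    calc 4 * ∑ t, z t * ((q t).val : ℤ)
      _ = ∑ t, z t * ((q t).val : ℤ) + ∑ t, z t * ((q t).val : ℤ) +
          ∑ t, z t * ((q t).val : ℤ) + ∑ t, z t * ((q t).val : ℤ) := by ring
      _ = ∑ t, z t * ((q t).val : ℤ) + ∑ t, z (c • t) * ((q t).val : ℤ) +
          ∑ t, z (u • t) * ((q t).val : ℤ) + ∑ t, z ((u * c) • t) * ((q t).val : ℤ) := by
        rw [← hs c hqc, ← hs u hqu, ← hs (u * c) fun t => by rw [← smul_smul, hqu, hqc]]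
      _ = 0 := by
        simp only [← Finset.sum_add_distrib, ← add_mul, ← smul_smul, hN, zero_mul,
          Finset.sum_const_zero]
  have h5 := congrArg (Int.cast : ℤ → ZMod N) ((mul_eq_zero.1 h4).resolve_left four_ne_zero)
  rw [← hQ, hQ']
  simpa using h5

theorem PermPresentation.not_eight_dvd [NeZero n] (Pr : PermPresentation n) : ¬ 8 ∣ n := by
  intro h8
  obtain ⟨k, n', hn', hn⟩ := Nat.exists_eq_pow_mul_and_not_dvd (NeZero.ne n) 2 (by norm_num)
  have hk : 3 ≤ k := by
    have h1 : 2 ^ 3 ∣ 2 ^ k := Nat.Coprime.dvd_of_dvd_mul_right (k := 2 ^ 3) (n := n')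
      (Nat.Coprime.pow_left _ ((Nat.Prime.coprime_iff_not_dvd Nat.prime_two).2 hn'))
      (by rw [← hn]; exact h8)
    exact (Nat.pow_dvd_pow_iff_le_right (by norm_num)).1 h1
  obtain ⟨l, rfl⟩ := Nat.exists_eq_add_of_le' hk
  set P : ℤ := 2 ^ l with hP
  have hnP : (n : ℤ) = 8 * P * n' := by rw [hn]; push_cast; rw [hP]; ring
  have hcop : Nat.Coprime (2 ^ (l + 3)) n' :=
    Nat.Coprime.pow_left _ ((Nat.Prime.coprime_iff_not_dvd Nat.prime_two).2 hn')
  have hcopZ : IsCoprime (8 * P) (n' : ℤ) := by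
    have := hcop.isCoprime
    push_cast at this
    rwa [show (8 * P : ℤ) = 2 ^ (l + 3) by rw [hP]; ring]
  have hzero : ∀ X : ℤ, 8 * P ∣ X → (n' : ℤ) ∣ X → (X : ZMod n) = 0 := fun X h1 h2 => by
    rw [ZMod.intCast_zmod_eq_zero_iff_dvd, hnP]
    exact hcopZ.mul_dvd h1 h2
  have hcrt : ∀ A B : ℤ, ∃ X : ℤ, 8 * P ∣ X - A ∧ (n' : ℤ) ∣ X - B := fun A B => by
    obtain ⟨r, s, hrs⟩ := hcopZ
    exact ⟨B * (r * (8 * P)) + A * (s * n'), ⟨(B - A) * r, by linear_combination A * hrs⟩,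
      ⟨(A - B) * s, by linear_combination B * hrs⟩⟩
  obtain ⟨C, ⟨C1, hC1⟩, C2, hC2⟩ := hcrt (-1) 1
  obtain ⟨U, ⟨U1, hU1⟩, U2, hU2⟩ := hcrt (4 * P - 1) 1
  obtain ⟨a, ⟨a1, ha1⟩, a2, ha2⟩ := hcrt (2 * P - 1) 0
  have hCC : (C : ZMod n) * C = 1 := by
    have := hzero (C * C - 1) ⟨C1 * (C - 1), by linear_combination (C - 1) * hC1⟩
      ⟨C2 * (C + 1), by linear_combination (C + 1) * hC2⟩
    push_cast at this
    exact sub_eq_zero.1 this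
  have hUU : (U : ZMod n) * U = 1 := by
    have := hzero (U * U - 1) ⟨U1 * (U + 4 * P - 1) + (2 * P - 1), by
        linear_combination (U + 4 * P - 1) * hU1⟩
      ⟨U2 * (U + 1), by linear_combination (U + 1) * hU2⟩
    push_cast at this
    exact sub_eq_zero.1 this
  have ha : (C : ZMod n) * a - a + U - 1 = 0 := by
    have := hzero (C * a - a + U - 1) ⟨C1 * a - 2 * a1 + U1, by
        linear_combination a * hC1 - 2 * ha1 + hU1⟩
      ⟨C2 * a + U2, by linear_combination a * hC2 + hU2⟩
    push_cast at this
    exact this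
  have h16 : ((16 * P : ℤ) : ZMod (2 ^ (l + 4))) = 0 := by
    rw [ZMod.intCast_zmod_eq_zero_iff_dvd, hP]
    push_cast
    exact ⟨1, by ring⟩
  have hdvd : ∀ X Y : ℤ, 8 * P ∣ X - Y → ((X ^ 2 : ℤ) : ZMod (2 ^ (l + 4))) = (Y ^ 2 : ℤ) := by
    rintro X Y ⟨Z, hZ⟩
    rw [← sub_eq_zero, ← Int.cast_sub]
    have h1 : X ^ 2 - Y ^ 2 = 16 * P * (Z * (Y + 4 * P * Z)) := by
      linear_combination (X + Y + 8 * P * Z) * hZ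
    rw [h1, Int.cast_mul, h16, zero_mul]
  set sq : ZMod n → ZMod (2 ^ (l + 4)) := fun b => ((b.cast : ℤ) ^ 2 : ℤ) with hsq
  have hsqI : ∀ X : ℤ, sq X = (X ^ 2 : ℤ) := fun X => hdvd _ _ (by
    have h1 : (n : ℤ) ∣ ((X : ZMod n).cast : ℤ) - X := by
      rw [← ZMod.intCast_zmod_eq_zero_iff_dvd]
      simp
    exact Dvd.dvd.trans ⟨n', hnP⟩ h1)
  have hsqmul : ∀ (X : ℤ) (b : ZMod n), sq (X * b) = (X ^ 2 : ℤ) * sq b := fun X b => by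
    obtain ⟨Y, rfl⟩ := ZMod.intCast_surjective b
    rw [← Int.cast_mul, hsqI, hsqI, ← Int.cast_mul, mul_pow]
  set ε : ZMod (2 ^ (l + 4)) := ((8 * P : ℤ) : ZMod (2 ^ (l + 4))) with hε
  have hC : ((C ^ 2 : ℤ) : ZMod (2 ^ (l + 4))) = 1 := by
    rw [hdvd C (-1) ⟨C1, hC1⟩]
    simp
  have hU : ((U ^ 2 : ℤ) : ZMod (2 ^ (l + 4))) = 1 + ε := by
    rw [hdvd U (4 * P - 1) ⟨U1, hU1⟩, show (4 * P - 1) ^ 2 = 1 + 8 * P + 16 * P * (P - 1) by ring,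
      Int.cast_add, Int.cast_mul (16 * P), h16, zero_mul, add_zero, Int.cast_add, Int.cast_one]
  let c : (ZMod n)ˣ := ⟨C, C, hCC, hCC⟩
  let u : (ZMod n)ˣ := ⟨U, U, hUU, hUU⟩
  have key := Pr.mul_sq_one_eq_zero sq (ε := ε) (c := c) (u := u) (a := a)
    (fun b => by rw [hsqmul, hC, one_mul]) (fun b => by rw [hsqmul, hU]) (fun x hx => ?_)
    (Units.ext hCC) (Units.ext hUU) ha
  · have h1 : sq 1 = 1 := by simpa using hsqI 1
    rw [h1, mul_one, hε, ZMod.intCast_zmod_eq_zero_iff_dvd, hP] at key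
    have h2 : ((2 ^ (l + 4) : ℕ) : ℤ) = 2 ^ l * 16 := by push_cast; ring
    rw [h2, mul_comm (8 : ℤ)] at key
    have h3 := Int.dvd_of_mul_dvd_mul_left (pow_ne_zero l two_ne_zero) key
    norm_num at h3
  · have h2n : 2 ∣ n := Dvd.dvd.trans (by norm_num) h8
    have h2N : 2 ∣ 2 ^ (l + 4) := dvd_pow_self 2 (by omega)
    let g := ZMod.castHom h2n (ZMod 2)
    let f := ZMod.castHom h2N (ZMod 2)
    have hgf : ∀ b, f (sq b) = g b := fun b => by
      obtain ⟨Y, rfl⟩ := ZMod.intCast_surjective b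
      rw [hsqI, map_intCast, map_intCast, Int.cast_pow]
      generalize (Y : ZMod 2) = y
      revert y
      decide
    have h1 : f (∑ ω, (x ω : ZMod (2 ^ (l + 4))) * sq (Pr.w ω)) = 0 := by
      rw [map_sum, ← map_zero g, ← hx, map_sum]
      exact Finset.sum_congr rfl fun ω _ => by rw [map_mul, map_mul, hgf, map_intCast, map_intCast]
    obtain ⟨Y, hY⟩ := ZMod.intCast_surjective
      (∑ ω, (x ω : ZMod (2 ^ (l + 4))) * sq (Pr.w ω))
    rw [← hY] at h1 ⊢
    rw [map_intCast, ZMod.intCast_zmod_eq_zero_iff_dvd] at h1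
    obtain ⟨Z, rfl⟩ := h1
    rw [hε, ← Int.cast_mul, show 8 * P * ((2 : ℕ) * Z) = 16 * P * Z by push_cast; ring,
      Int.cast_mul, h16, zero_mul]

end EightDvd

section NormBound

open NumberField ComplexConjugate

variable {K : Type*} [Field K] [NumberField K] {α : 𝓞 K} {p : ℕ}

theorem prod_norm_embeddings (x : 𝓞 K) :
    ∏ φ : K →ₐ[ℚ] ℂ, ‖φ x‖ = ((Algebra.norm ℤ x).natAbs : ℝ) := by
  rw [← norm_prod, ← Algebra.norm_eq_prod_embeddings ℚ ℂ, ← Algebra.coe_norm_int, Nat.cast_natAbs]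
  simp

theorem pow_finrank_le_prod_norm {k : ℕ} {x : 𝓞 K} (hx : x ≠ 0) (hk : (k : 𝓞 K) ∣ x) :
    (k : ℝ) ^ Module.finrank ℚ K ≤ ∏ φ : K →ₐ[ℚ] ℂ, ‖φ x‖ := by
  obtain ⟨y, rfl⟩ := hk
  have hy : y ≠ 0 := right_ne_zero_of_mul hx
  have h1 : (1 : ℝ) ≤ ∏ φ : K →ₐ[ℚ] ℂ, ‖φ y‖ := by
    rw [prod_norm_embeddings]
    exact_mod_cast Int.natAbs_pos.2 (Algebra.norm_ne_zero_iff.2 hy)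
  simp only [map_mul, norm_mul, map_natCast, Finset.prod_mul_distrib, Finset.prod_const,
    Finset.card_univ, Complex.norm_natCast]
  rw [AlgHom.card]
  exact le_mul_of_one_le_right (by positivity) h1

theorem norm_smul_eq (σ : Gal(K/ℚ)) (x : 𝓞 K) : Algebra.norm ℤ (σ • x) = Algebra.norm ℤ x := by
  have h : ((σ • x : 𝓞 K) : K) = σ x := rfl
  apply Int.cast_injective (α := ℚ)
  rw [Algebra.coe_norm_int, Algebra.coe_norm_int, h, Algebra.norm_eq_of_algEquiv]

theorem prime_of_norm_natAbs (hp : p.Prime) (hα : (Algebra.norm ℤ α).natAbs = p) : Prime α := by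
  refine Ideal.prime_of_irreducible_absNorm_span ?_ ?_
  · rintro rfl
    exact hp.ne_zero (by simpa using hα.symm)
  · rw [Ideal.absNorm_span_singleton, hα]
    exact hp

theorem exists_int_dvd_sub (hp : p.Prime) (hα : (Algebra.norm ℤ α).natAbs = p) (x : 𝓞 K) :
    ∃ t : ℤ, α ∣ x - t := by
  have : Fact p.Prime := ⟨hp⟩
  have hcard : Nat.card (𝓞 K ⧸ Ideal.span {α}) = p := by
    rw [← hα, ← Ideal.absNorm_span_singleton]
    rfl
  have : Nontrivial (𝓞 K ⧸ Ideal.span {α}) := by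
    rw [Ideal.Quotient.nontrivial_iff, Ne, Ideal.span_singleton_eq_top]
    exact (prime_of_norm_natAbs hp hα).not_isUnit
  have h := zmultiples_eq_top_of_prime_card hcard (one_ne_zero (α := 𝓞 K ⧸ Ideal.span {α}))
  obtain ⟨t, ht⟩ := AddSubgroup.mem_zmultiples_iff.1
    (h ▸ AddSubgroup.mem_top (Ideal.Quotient.mk (Ideal.span {α}) x))
  refine ⟨t, ?_⟩
  rw [← Ideal.mem_span_singleton, ← Ideal.Quotient.eq, ← ht]
  simp

theorem dvd_smul_sub_of_dvd (hp : p.Prime) (hα : (Algebra.norm ℤ α).natAbs = p) {σ : Gal(K/ℚ)}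
    (h : α ∣ σ • α) (x : 𝓞 K) : α ∣ σ • x - x := by
  obtain ⟨t, ht⟩ := exists_int_dvd_sub hp hα x
  have h2 : σ • (x - (t : 𝓞 K)) = σ • x - t := by
    rw [smul_sub]
    congr 1
    exact map_intCast (MulSemiringAction.toRingHom (Gal(K/ℚ)) (𝓞 K) σ) t
  have h3 : α ∣ σ • x - t := by
    obtain ⟨y, hy⟩ := ht
    rw [← h2, hy, smul_mul']
    exact h.mul_right _
  simpa using dvd_sub h3 ht

theorem modEq_one_of_dvd_pow_sub (hp : p.Prime) (hα : (Algebra.norm ℤ α).natAbs = p) {ω : 𝓞 K}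
    (hω : IsPrimitiveRoot ω (p - 1)) {a : ℕ} (h : α ∣ ω ^ a - ω) : a ≡ 1 [MOD (p - 1)] := by
  have hp1 : NeZero (p - 1) := ⟨by have := hp.two_le; omega⟩
  have hn : Ideal.absNorm (Ideal.span {α}) = p := by rw [Ideal.absNorm_span_singleton, hα]
  have h1 := hω.idealQuotient_mk (I := Ideal.span {α}) (by rw [hn]; exact hp.ne_one)
    (by
      rw [hn, Nat.coprime_self_sub_right hp.one_le]
      exact Nat.coprime_one_right p)
  have h2 : (Ideal.Quotient.mk (Ideal.span {α}) ω) ^ a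
      = (Ideal.Quotient.mk (Ideal.span {α}) ω) ^ 1 := by
    rw [pow_one, ← map_pow, Ideal.Quotient.eq, Ideal.mem_span_singleton]
    exact h
  rw [(h1.isOfFinOrder hp1.ne).pow_inj_mod, ← h1.eq_orderOf] at h2
  exact h2

theorem pow_finrank_le_of_dvd_pow_sub (hp : p.Prime) (hα : (Algebra.norm ℤ α).natAbs = p)
    {c σ : Gal(K/ℚ)} (hc : ∀ (φ : K →ₐ[ℚ] ℂ) (x : K), φ (c x) = conj (φ x)) (hcσ : Commute c σ)
    {l r : ℕ} (hl : 0 < l) (hr : r ≤ l) (hσ : ∀ x : 𝓞 K, (l : 𝓞 K) ∣ x ^ l - (σ • x) ^ r)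
    (h1 : ¬ α ∣ c • α) (h2 : r < l ∨ ¬ α ∣ σ • α) :
    l ^ Module.finrank ℚ K ≤ 2 ^ Module.finrank ℚ K * p ^ (l + r) := by
  have hP := prime_of_norm_natAbs hp hα
  have hdvd : (l : 𝓞 K) ∣ α ^ l * (σ • c • α) ^ r - (σ • α) ^ r * (c • α) ^ l := by
    have e : α ^ l * (σ • c • α) ^ r - (σ • α) ^ r * (c • α) ^ l
        = (α ^ l - (σ • α) ^ r) * (σ • c • α) ^ r
          - (σ • α) ^ r * ((c • α) ^ l - (σ • c • α) ^ r) := by ring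
    rw [e]
    exact dvd_sub ((hσ α).mul_right _) ((hσ (c • α)).mul_left _)
  have hne : α ^ l * (σ • c • α) ^ r - (σ • α) ^ r * (c • α) ^ l ≠ 0 := by
    intro h
    have h3 : α ^ l ∣ (σ • α) ^ r :=
      hP.pow_dvd_of_dvd_mul_right l (fun h' => h1 (hP.dvd_of_dvd_pow h'))
        ⟨_, (sub_eq_zero.1 h).symm⟩
    have h4 : p ^ l ∣ p ^ r := by
      have := Int.natAbs_dvd_natAbs.2 (MonoidHom.map_dvd (Algebra.norm ℤ) h3)
      rwa [map_pow, map_pow, norm_smul_eq, Int.natAbs_pow, Int.natAbs_pow, hα] at this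
    have h5 := (Nat.pow_dvd_pow_iff_le_right hp.one_lt).1 h4
    rcases h2 with h2 | h2
    · omega
    · exact h2 (hP.dvd_of_dvd_pow ((dvd_pow_self α hl.ne').trans h3))
  have key := pow_finrank_le_prod_norm hne hdvd
  have hcoe : ∀ (τ : Gal(K/ℚ)) (x : 𝓞 K), ((τ • x : 𝓞 K) : K) = τ x := fun _ _ => rfl
  have hle : ∀ φ : K →ₐ[ℚ] ℂ,
      ‖φ ((α ^ l * (σ • c • α) ^ r - (σ • α) ^ r * (c • α) ^ l : 𝓞 K) : K)‖
        ≤ 2 * (‖φ α‖ ^ l * ‖φ ((σ • α : 𝓞 K) : K)‖ ^ r) := by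
    intro φ
    have e1 : ‖φ ((c • α : 𝓞 K) : K)‖ = ‖φ α‖ := by rw [hcoe, hc, Complex.norm_conj]
    have e2 : ‖φ ((σ • c • α : 𝓞 K) : K)‖ = ‖φ ((σ • α : 𝓞 K) : K)‖ := by
      rw [smul_smul, ← hcσ.eq, ← smul_smul, hcoe, hc, Complex.norm_conj]
    let ψ : 𝓞 K →+* ℂ := φ.toRingHom.comp (algebraMap (𝓞 K) K)
    change ‖ψ _‖ ≤ 2 * (‖ψ α‖ ^ l * ‖ψ (σ • α)‖ ^ r)
    change ‖ψ _‖ = ‖ψ α‖ at e1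
    change ‖ψ _‖ = ‖ψ (σ • α)‖ at e2
    rw [map_sub]
    refine (norm_sub_le _ _).trans (le_of_eq ?_)
    simp only [map_mul, map_pow, norm_mul, norm_pow, e1, e2]
    ring
  have h6 := key.trans (Finset.prod_le_prod (fun φ _ => norm_nonneg _) fun φ _ => hle φ)
  rw [Finset.prod_mul_distrib, Finset.prod_mul_distrib, Finset.prod_pow, Finset.prod_pow,
    prod_norm_embeddings, prod_norm_embeddings, norm_smul_eq, hα, ← pow_add, Finset.prod_const,
    Finset.card_univ, AlgHom.card] at h6
  exact_mod_cast h6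

end NormBound

section CyclotomicGalois

open NumberField ComplexConjugate

variable {m : ℕ} [NeZero m] {K : Type} [Field K] [NumberField K] [IsCyclotomicExtension {m} ℚ K]

variable (m) in
theorem exists_gal_smul_eq_pow {a : ℕ} (ha : a.Coprime m) :
    ∃ σ : Gal(K/ℚ), IsCyclotomicExtension.Rat.galEquivZMod m K σ = ZMod.unitOfCoprime a ha ∧
      ∀ x : 𝓞 K, x ^ m = 1 → σ • x = x ^ a := by
  refine ⟨(IsCyclotomicExtension.Rat.galEquivZMod m K).symm (ZMod.unitOfCoprime a ha),
    MulEquiv.apply_symm_apply _ _, fun x hx => ?_⟩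
  rw [IsCyclotomicExtension.Rat.galEquivZMod_smul_of_pow_eq m K _ hx, MulEquiv.apply_symm_apply,
    ZMod.coe_unitOfCoprime, ZMod.val_natCast, ← pow_eq_pow_mod _ hx]

omit [NeZero m] [IsCyclotomicExtension {m} ℚ K] in
theorem commute_gal (m : ℕ) [NeZero m] [IsCyclotomicExtension {m} ℚ K] (σ τ : Gal(K/ℚ)) :
    Commute σ τ :=
  (IsCyclotomicExtension.Rat.galEquivZMod m K).injective (by rw [map_mul, map_mul, mul_comm])

theorem ringHom_ext_toInteger {ζ : K} (hζ : IsPrimitiveRoot ζ m) {R : Type*} [CommRing R]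
    {f g : 𝓞 K →+* R} (h : f hζ.toInteger = g hζ.toInteger) : f = g := by
  have h2 : f.toIntAlgHom = g.toIntAlgHom :=
    hζ.integralPowerBasis.algHom_ext (by rw [hζ.integralPowerBasis_gen]; exact h)
  ext x
  exact DFunLike.congr_fun h2 x

theorem embedding_apply_eq_conj {ζ : K} (hζ : IsPrimitiveRoot ζ m) {c : Gal(K/ℚ)}
    (hc : c • hζ.toInteger = hζ.toInteger ^ (m - 1)) (φ : K →ₐ[ℚ] ℂ) (x : K) :
    φ (c x) = conj (φ x) := by
  have hcζ : c ζ = ζ ^ (m - 1) := congrArg (algebraMap (𝓞 K) K) hc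
  have h : φ.comp (c : K →ₐ[ℚ] K) = (Complex.conjAe.toAlgHom.restrictScalars ℚ).comp φ := by
    refine (hζ.powerBasis ℚ).algHom_ext ?_
    rw [IsPrimitiveRoot.powerBasis_gen]
    change φ (c ζ) = conj (φ ζ)
    have h1 : φ ζ ^ m = 1 := by rw [← map_pow, hζ.pow_eq_one, map_one]
    have h2 : φ ζ * conj (φ ζ) = 1 := by
      rw [Complex.mul_conj, Complex.normSq_eq_norm_sq, Complex.norm_eq_one_of_pow_eq_one h1
        (NeZero.ne m)]
      simp
    have h0 : φ ζ ≠ 0 := left_ne_zero_of_mul_eq_one h2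
    apply mul_left_cancel₀ h0
    rw [h2, hcζ, map_pow, ← pow_succ', Nat.sub_add_cancel (NeZero.one_le), h1]
  exact DFunLike.congr_fun h x

theorem dvd_pow_sub_smul_pow {ζ : K} (hζ : IsPrimitiveRoot ζ m) {l r : ℕ} (hl : l.Prime)
    (hr : r = 1 ∨ r = l) {σ : Gal(K/ℚ)} (hσ : hζ.toInteger ^ l = (σ • hζ.toInteger) ^ r)
    (x : 𝓞 K) : (l : 𝓞 K) ∣ x ^ l - (σ • x) ^ r := by
  by_cases hu : IsUnit (l : 𝓞 K)
  · exact hu.dvd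
  have : Fact l.Prime := ⟨hl⟩
  have : CharP (𝓞 K ⧸ Ideal.span {(l : 𝓞 K)}) l := CharP.quotient _ l hu
  obtain ⟨F, hF⟩ : ∃ F : (𝓞 K ⧸ Ideal.span {(l : 𝓞 K)}) →+* (𝓞 K ⧸ Ideal.span {(l : 𝓞 K)}),
      ∀ y, F y = y ^ r := by
    rcases hr with rfl | rfl
    · exact ⟨RingHom.id _, fun y => (pow_one y).symm⟩
    · exact ⟨frobenius _ _, fun y => rfl⟩
  have h := ringHom_ext_toInteger hζ
    (f := (frobenius (𝓞 K ⧸ Ideal.span {(l : 𝓞 K)}) l).comp (Ideal.Quotient.mk _))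
    (g := (F.comp (Ideal.Quotient.mk _)).comp (MulSemiringAction.toRingHom (Gal(K/ℚ)) (𝓞 K) σ))
    (by
      rw [RingHom.comp_apply, RingHom.comp_apply, RingHom.comp_apply, hF, frobenius_def,
        ← map_pow, ← map_pow, hσ]
      rfl)
  have h2 := DFunLike.congr_fun h x
  rw [RingHom.comp_apply, RingHom.comp_apply, RingHom.comp_apply, hF, frobenius_def,
    ← map_pow, ← map_pow, Ideal.Quotient.eq, Ideal.mem_span_singleton] at h2
  exact h2

variable {p j : ℕ} {α : 𝓞 K}

omit [IsCyclotomicExtension {m} ℚ K] in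
theorem modEq_one_of_dvd_smul (hp : p.Prime) (hm : m = p ^ j * (p - 1))
    (hα : (Algebra.norm ℤ α).natAbs = p) {ζ : K} (hζ : IsPrimitiveRoot ζ m) {a : ℕ}
    {σ : Gal(K/ℚ)} (hσ : ∀ x : 𝓞 K, x ^ m = 1 → σ • x = x ^ a) (h : α ∣ σ • α) :
    a ≡ 1 [MOD (p - 1)] := by
  have h1 := dvd_smul_sub_of_dvd hp hα h (hζ.toInteger ^ p ^ j)
  have h2 : (hζ.toInteger ^ p ^ j) ^ m = 1 := by
    rw [pow_right_comm, hζ.toInteger_isPrimitiveRoot.pow_eq_one, one_pow]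
  rw [hσ _ h2] at h1
  exact modEq_one_of_dvd_pow_sub hp hα
    (hζ.toInteger_isPrimitiveRoot.pow (NeZero.pos m) hm) h1

omit [IsCyclotomicExtension {m} ℚ K] in
theorem not_dvd_smul_conj (hp : p.Prime) (hp5 : 5 ≤ p) (hm : m = p ^ j * (p - 1))
    (hα : (Algebra.norm ℤ α).natAbs = p) {ζ : K} (hζ : IsPrimitiveRoot ζ m)
    {c : Gal(K/ℚ)} (hc : ∀ x : 𝓞 K, x ^ m = 1 → c • x = x ^ (m - 1)) : ¬ α ∣ c • α := by
  intro h
  have h1 := modEq_one_of_dvd_smul hp hm hα hζ hc h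
  have h2 : p - 1 ∣ m := hm ▸ dvd_mul_left _ _
  have h3 : p - 1 ∣ 2 := by
    have h4 : m - 1 + 1 ≡ 1 + 1 [MOD (p - 1)] := h1.add_right 1
    rw [Nat.sub_add_cancel NeZero.one_le] at h4
    exact (h4.dvd_iff dvd_rfl).1 h2
  have := Nat.le_of_dvd two_pos h3
  omega

theorem exists_conj (hζ : IsPrimitiveRoot (IsCyclotomicExtension.zeta m ℚ K) m) :
    ∃ c : Gal(K/ℚ), (IsCyclotomicExtension.Rat.galEquivZMod m K c = -1) ∧
      (∀ x : 𝓞 K, x ^ m = 1 → c • x = x ^ (m - 1)) ∧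
      ∀ (φ : K →ₐ[ℚ] ℂ) (x : K), φ (c x) = conj (φ x) := by
  obtain ⟨c, hc', hc⟩ := exists_gal_smul_eq_pow m (K := K) (a := m - 1)
    ((Nat.coprime_self_sub_left NeZero.one_le).2 (Nat.coprime_one_left m))
  refine ⟨c, ?_, hc, embedding_apply_eq_conj hζ (hc _ hζ.toInteger_isPrimitiveRoot.pow_eq_one)⟩
  rw [hc']
  ext
  simp [Nat.cast_sub (NeZero.one_le : 1 ≤ m)]

theorem pow_totient_le_of_not_dvd (hp : p.Prime) (hp5 : 5 ≤ p) (hm : m = p ^ j * (p - 1))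
    (hα : (Algebra.norm ℤ α).natAbs = p) {l : ℕ} (hl : l.Prime) (hlm : ¬ l ∣ m) :
    l ^ m.totient ≤ 2 ^ m.totient * p ^ (l + 1) := by
  have hζ := IsCyclotomicExtension.zeta_spec m ℚ K
  obtain ⟨c, -, hc, hc'⟩ := exists_conj hζ
  obtain ⟨σ, -, hσ⟩ := exists_gal_smul_eq_pow m (K := K) ((Nat.Prime.coprime_iff_not_dvd hl).2 hlm)
  rw [← IsCyclotomicExtension.Rat.finrank m K]
  refine pow_finrank_le_of_dvd_pow_sub hp hα hc' (commute_gal m c σ) hl.pos hl.one_le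
    (dvd_pow_sub_smul_pow hζ hl (Or.inl rfl) ?_) (not_dvd_smul_conj hp hp5 hm hα hζ hc)
    (Or.inl hl.one_lt)
  rw [pow_one, hσ _ hζ.toInteger_isPrimitiveRoot.pow_eq_one]

theorem five_pow_totient_le (hp : p.Prime) (hp7 : 7 ≤ p) (hm : m = p ^ j * (p - 1))
    (hα : (Algebra.norm ℤ α).natAbs = p) : 5 ^ m.totient ≤ 2 ^ m.totient * p ^ 10 := by
  by_cases h5 : 5 ∣ m
  swap
  · refine (pow_totient_le_of_not_dvd hp (by omega) hm hα Nat.prime_five h5).trans ?_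
    exact Nat.mul_le_mul_left _ (Nat.pow_le_pow_right hp.pos (by norm_num))
  have hζ := IsCyclotomicExtension.zeta_spec m ℚ K
  have hξ := hζ.toInteger_isPrimitiveRoot
  have h5p : ¬ 5 ∣ p := fun h => by
    have := (Nat.prime_dvd_prime_iff_eq Nat.prime_five hp).1 h
    omega
  have h5q : 5 ∣ p - 1 := by
    rw [hm, Nat.prime_five.dvd_mul] at h5
    exact h5.resolve_left fun h => h5p (Nat.prime_five.dvd_of_dvd_pow h)
  obtain ⟨q, hq⟩ := h5q
  have hmq : m = 5 * (p ^ j * q) := by rw [hm, hq]; ring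
  obtain ⟨i, hi5, hi⟩ : ∃ i : ℕ, ¬ 5 ∣ i ∧ (1 + i * (p ^ j * q)).Coprime m := by
    have key : ∀ i, ¬ 5 ∣ 1 + i * (p ^ j * q) → (1 + i * (p ^ j * q)).Coprime m := by
      intro i h
      rw [hmq]
      refine Nat.Coprime.mul_right ((Nat.Prime.coprime_iff_not_dvd Nat.prime_five).2 h).symm ?_
      simp
    by_cases h : 5 ∣ 1 + 1 * (p ^ j * q)
    · exact ⟨2, by norm_num, key 2 (by omega)⟩
    · exact ⟨1, by norm_num, key 1 h⟩
  obtain ⟨c, -, hc, hc'⟩ := exists_conj hζ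
  obtain ⟨σ, -, hσ⟩ := exists_gal_smul_eq_pow m (K := K) hi
  rw [← IsCyclotomicExtension.Rat.finrank m K]
  refine pow_finrank_le_of_dvd_pow_sub hp hα (r := 5) hc' (commute_gal m c σ) (by norm_num) le_rfl
    (dvd_pow_sub_smul_pow hζ Nat.prime_five (Or.inr rfl) ?_)
    (not_dvd_smul_conj hp (by omega) hm hα hζ hc) (Or.inr fun h => ?_)
  · rw [hσ _ hξ.pow_eq_one, ← pow_mul, add_mul, one_mul, pow_add]
    have : i * (p ^ j * q) * 5 = m * i := by rw [hmq]; ring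
    rw [this, pow_mul, hξ.pow_eq_one, one_pow, mul_one]
  · have h1 := modEq_one_of_dvd_smul hp hm hα hζ hσ h
    have h2 : 5 * q ∣ i * p ^ j * q := by
      have := (Nat.modEq_iff_dvd' (Nat.le_add_right 1 _)).1 h1.symm
      rw [Nat.add_sub_cancel_left, hq] at this
      rwa [mul_assoc]
    have hq0 : 0 < q := by omega
    have h3 := Nat.dvd_of_mul_dvd_mul_right hq0 h2
    rcases (Nat.prime_five.dvd_mul).1 h3 with h4 | h4
    · exact hi5 h4
    · exact h5p (Nat.prime_five.dvd_of_dvd_pow h4)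

end CyclotomicGalois

section FourDvd

open NumberField ComplexConjugate

theorem sq_norm_sub_conj_sq_mul_add_conj_le (z : ℂ) :
    27 * ‖(z - conj z) ^ 2 * (z + conj z)‖ ^ 2 ≤ 256 * ‖z‖ ^ 6 := by
  have h1 : z - conj z = ((2 * z.im : ℝ) : ℂ) * Complex.I := Complex.sub_conj z
  have h2 : z + conj z = ((2 * z.re : ℝ) : ℂ) := Complex.add_conj z
  have h3 : ‖z‖ ^ 6 = (z.re ^ 2 + z.im ^ 2) ^ 3 := by
    rw [show (6 : ℕ) = 2 * 3 from rfl, pow_mul, ← Complex.normSq_eq_norm_sq, Complex.normSq_apply]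
    ring
  rw [h1, h2, h3, norm_mul, norm_pow, norm_mul, Complex.norm_I, Complex.norm_real,
    Complex.norm_real, mul_one, mul_pow, ← pow_mul, mul_comm 2 2, pow_mul, Real.norm_eq_abs,
    Real.norm_eq_abs, sq_abs, sq_abs]
  nlinarith [mul_nonneg (sq_nonneg (z.im ^ 2 - 2 * z.re ^ 2))
    (by positivity : 0 ≤ 4 * z.re ^ 2 + z.im ^ 2), mul_nonneg (sq_nonneg (z.re ^ 2 * 2 - z.im ^ 2))
    (by positivity : 0 ≤ z.re ^ 2 + 4 * z.im ^ 2)]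

variable {m : ℕ} [NeZero m] {K : Type} [Field K] [NumberField K] [IsCyclotomicExtension {m} ℚ K]
  {p : ℕ} {α : 𝓞 K}

theorem pow_totient_le_of_four_dvd (hp : p.Prime) (hp5 : 5 ≤ p) (hm : m = p - 1) (h4 : 4 ∣ m)
    (hα : (Algebra.norm ℤ α).natAbs = p) : 108 ^ m.totient ≤ p ^ 24 := by
  have hm' : m = p ^ 0 * (p - 1) := by rw [pow_zero, one_mul, hm]
  have hζ := IsCyclotomicExtension.zeta_spec m ℚ K
  have hξ := hζ.toInteger_isPrimitiveRoot
  have hP := prime_of_norm_natAbs hp hα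
  obtain ⟨q, hq⟩ := h4
  obtain ⟨c, hc0, hc, hc'⟩ := exists_conj hζ
  obtain ⟨σ, -, hσ⟩ := exists_gal_smul_eq_pow m (K := K) (a := 1 + 2 * q) (by
    have h2 : (1 + 2 * q).Coprime 2 := by simp
    rw [hq, show 4 * q = 2 * (2 * q) by ring]
    exact Nat.Coprime.mul_right h2 (by simp))
  have hcσ := commute_gal m c σ
  have h1 := not_dvd_smul_conj hp hp5 hm' hα hζ hc
  have h2 : ¬ α ∣ σ • α := fun h => by
    have h1 := (Nat.modEq_iff_dvd' (Nat.le_add_right 1 _)).1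
      (modEq_one_of_dvd_smul hp hm' hα hζ hσ h).symm
    rw [Nat.add_sub_cancel_left] at h1
    have := Nat.le_of_dvd (by omega) h1
    omega
  have hdvd : ∀ x : 𝓞 K, (2 : 𝓞 K) ∣ x - σ • x := by
    have h := ringHom_ext_toInteger hζ (f := Ideal.Quotient.mk (Ideal.span {(2 : 𝓞 K)}))
      (g := (Ideal.Quotient.mk _).comp (MulSemiringAction.toRingHom (Gal(K/ℚ)) (𝓞 K) σ)) (by
        rw [RingHom.comp_apply, Ideal.Quotient.eq, Ideal.mem_span_singleton]
        have h3 : hζ.toInteger ^ (2 * q) = -1 :=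
          (hξ.pow (NeZero.pos m) (show m = 2 * q * 2 by omega)).eq_neg_one_of_two_right
        refine ⟨hζ.toInteger, ?_⟩
        rw [MulSemiringAction.toRingHom_apply, hσ _ hξ.pow_eq_one, pow_add, h3]
        ring)
    intro x
    rw [← Ideal.mem_span_singleton, ← Ideal.Quotient.eq]
    exact DFunLike.congr_fun h x
  obtain ⟨s, hs⟩ := hdvd α
  obtain ⟨t, ht⟩ := hdvd (c • α)
  set u : 𝓞 K := α ^ 2 * (σ • c • α) ^ 2 with hu
  set v : 𝓞 K := (σ • α) ^ 2 * (c • α) ^ 2 with hv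
  have hαv : ¬ α ∣ v := fun h => (hP.dvd_mul.1 h).elim (fun h => h2 (hP.dvd_of_dvd_pow h))
    fun h => h1 (hP.dvd_of_dvd_pow h)
  have hαu : α ∣ u := (dvd_pow_self α two_ne_zero).mul_right _
  have huv : (4 : 𝓞 K) ∣ u - v := by
    refine ⟨(s ^ 2 + s * σ • α) * (σ • c • α) ^ 2 - (σ • α) ^ 2 * (t ^ 2 + t * σ • c • α), ?_⟩
    rw [hu, hv]
    linear_combination (σ • c • α) ^ 2 * (α + σ • α + 2 * s) * hs
      - (σ • α) ^ 2 * (c • α + σ • c • α + 2 * t) * ht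
  have hw : ((32 : ℕ) : 𝓞 K) ∣ (u - v) ^ 2 * (u + v) := by
    obtain ⟨y, hy⟩ := huv
    refine ⟨y ^ 2 * (2 * y + v), ?_⟩
    rw [show u + v = u - v + 2 * v by ring, hy]
    push_cast
    ring
  have hw0 : (u - v) ^ 2 * (u + v) ≠ 0 := by
    refine mul_ne_zero (pow_ne_zero 2 fun h => hαv ?_) fun h => hαv ?_
    · rw [← sub_eq_zero.1 h]
      exact hαu
    · rw [← neg_eq_of_add_eq_zero_right h]
      exact hαu.neg_right
  have hcu : c • u = v := by
    rw [hu, smul_mul', smul_pow', smul_pow', smul_smul c σ, hcσ.eq, smul_smul, mul_assoc]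
    have : c * c = 1 := (IsCyclotomicExtension.Rat.galEquivZMod m K).injective (by
      rw [map_mul, hc0, neg_mul_neg, one_mul, map_one])
    rw [this, mul_one, mul_comm]
  have key := pow_finrank_le_prod_norm hw0 hw
  have hle : ∀ φ : K →ₐ[ℚ] ℂ, 27 * ‖φ (((u - v) ^ 2 * (u + v) : 𝓞 K) : K)‖ ^ 2
      ≤ 256 * ‖φ u‖ ^ 6 := by
    intro φ
    have h3 : φ (v : K) = conj (φ u) := by rw [← hcu, ← hc']; rfl
    let ψ : 𝓞 K →+* ℂ := φ.toRingHom.comp (algebraMap (𝓞 K) K)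
    change ψ v = conj (ψ u) at h3
    change 27 * ‖ψ _‖ ^ 2 ≤ 256 * ‖ψ u‖ ^ 6
    rw [map_mul, map_pow, map_sub, map_add, h3]
    exact sq_norm_sub_conj_sq_mul_add_conj_le _
  have hNu : (Algebra.norm ℤ u).natAbs = p ^ 4 := by
    rw [hu, map_mul, map_pow, map_pow, norm_smul_eq, norm_smul_eq, Int.natAbs_mul, Int.natAbs_pow,
      hα]
    ring
  have h6 := Finset.prod_le_prod (s := Finset.univ) (fun φ _ => by positivity) fun φ _ => hle φ
  rw [Finset.prod_mul_distrib, Finset.prod_mul_distrib, Finset.prod_pow, Finset.prod_pow,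
    prod_norm_embeddings u, hNu, Finset.prod_const, Finset.prod_const, Finset.card_univ,
    AlgHom.card] at h6
  have h7 : (27 : ℝ) ^ Module.finrank ℚ K * (((32 : ℕ) : ℝ) ^ Module.finrank ℚ K) ^ 2
      ≤ 256 ^ Module.finrank ℚ K * ((p ^ 4 : ℕ) : ℝ) ^ 6 :=
    (mul_le_mul_of_nonneg_left (pow_le_pow_left₀ (by positivity) key 2) (by positivity)).trans h6
  rw [IsCyclotomicExtension.Rat.finrank m K] at h7
  have h8 : 27 ^ m.totient * (32 ^ m.totient) ^ 2 ≤ 256 ^ m.totient * (p ^ 4) ^ 6 := by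
    exact_mod_cast h7
  rw [← pow_mul, mul_comm m.totient 2, pow_mul, ← mul_pow, ← pow_mul,
    show 27 * 32 ^ 2 = 256 * 108 by norm_num, mul_pow] at h8
  exact Nat.le_of_mul_le_mul_left h8 (by positivity)

end FourDvd

section QuadraticSubfield

open NumberField ComplexConjugate

theorem exists_sq_eq_sub_of_norm {K : Type*} [Field K] [NumberField K] [IsGalois ℚ K]
    {p : ℕ} {α : 𝓞 K} (hα : (Algebra.norm ℤ α).natAbs = p) (χ : Gal(K/ℚ) →* ℤ)
    {c : Gal(K/ℚ)} (hc : ∀ (φ : K →ₐ[ℚ] ℂ) (x : K), φ (c x) = conj (φ x)) (hχc : χ c = -1) :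
    ∃ (T : ℤ) (δ : 𝓞 K), T ^ 2 ≤ 4 * p ∧ δ ^ 2 = ((T ^ 2 - 4 * p : ℤ) : 𝓞 K) ∧
      ∀ τ, χ τ = 1 → τ • δ = δ := by
  have hχ : ∀ τ, χ τ = 1 ∨ χ τ = -1 := fun τ =>
    Int.isUnit_iff.1 ((Group.isUnit τ).map χ)
  set β : 𝓞 K := ∏ τ : Gal(K/ℚ) with χ τ = 1, τ • α with hβ
  have hmul : ∀ τ, τ • β = ∏ τ' : Gal(K/ℚ) with χ τ' = χ τ, τ' • α := by
    intro τ
    rw [hβ, Finset.smul_prod']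
    refine Finset.prod_equiv (Equiv.mulLeft τ) (fun τ' => ?_) fun τ' _ => smul_smul τ τ' α
    simp only [Finset.mem_filter, Finset.mem_univ, true_and, Equiv.coe_mulLeft, map_mul]
    rcases hχ τ with h | h <;> rw [h] <;> constructor <;> intro h' <;> linarith
  have hfix : ∀ τ, χ τ = 1 → τ • β = β := fun τ h => by rw [hmul, h]
  have hfix' : ∀ τ, χ τ = -1 → τ • β = c • β := fun τ h => by rw [hmul, hmul, h, hχc]
  have hcc : c • c • β = β := by rw [smul_smul, hfix]; rw [map_mul, hχc]; rfl
  have hfixc : ∀ τ, χ τ = 1 → τ • c • β = c • β := fun τ h => by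
    rw [smul_smul, hfix' (τ * c) (by rw [map_mul, h, hχc]; rfl)]
  have hfixc' : ∀ τ, χ τ = -1 → τ • c • β = β := fun τ h => by
    rw [smul_smul, hfix (τ * c) (by rw [map_mul, h, hχc]; rfl)]
  have hN : β * c • β = (Algebra.norm ℤ α : 𝓞 K) := by
    have h1 : β * c • β = ∏ τ : Gal(K/ℚ), τ • α := by
      rw [hmul, hβ, hχc, ← Finset.prod_filter_mul_prod_filter_not Finset.univ (fun τ => χ τ = 1)]
      congr 2
      ext τ
      simp only [Finset.mem_filter, Finset.mem_univ, true_and]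
      rcases hχ τ with h | h <;> rw [h] <;> norm_num
    rw [h1]
    apply RingOfIntegers.coe_injective
    have h2 := Algebra.norm_eq_prod_automorphisms ℚ (α : K)
    rw [← Algebra.coe_norm_int] at h2
    rw [map_prod]
    exact h2.symm.trans ((map_intCast (algebraMap ℚ K) _).trans
      (map_intCast (algebraMap (𝓞 K) K) _).symm)
  obtain ⟨T, hT⟩ := Algebra.IsInvariant.isInvariant (A := ℤ) (G := Gal(K/ℚ)) (β + c • β)
    (fun τ => by
      rw [smul_add]
      rcases hχ τ with h | h
      · rw [hfix τ h, hfixc τ h]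
      · rw [hfix' τ h, hfixc' τ h, add_comm])
  let φ : K →ₐ[ℚ] ℂ := IsAlgClosed.lift
  let ψ : 𝓞 K →+* ℂ := φ.toRingHom.comp (algebraMap (𝓞 K) K)
  have hψ : ψ (c • β) = conj (ψ β) := hc φ β
  have hp : Algebra.norm ℤ α = p := by
    have h1 : ψ (β * c • β) = (Complex.normSq (ψ β) : ℂ) := by
      rw [map_mul, hψ, Complex.mul_conj]
    rw [hN, map_intCast] at h1
    have h2 : ((Algebra.norm ℤ α : ℤ) : ℝ) = Complex.normSq (ψ β) := by exact_mod_cast h1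
    have h3 : 0 ≤ Algebra.norm ℤ α := by
      have := Complex.normSq_nonneg (ψ β)
      rw [← h2] at this
      exact_mod_cast this
    omega
  have hδ : (β - c • β) ^ 2 = ((T ^ 2 - 4 * p : ℤ) : 𝓞 K) := by
    rw [hp] at hN
    push_cast at hN ⊢
    rw [← hN, show (T : 𝓞 K) = β + c • β from hT]
    ring
  refine ⟨T, β - c • β, ?_, hδ, fun τ h => by rw [smul_sub, hfix τ h, hfixc τ h]⟩
  have h1 := congrArg ψ hδ
  rw [map_pow, map_sub, hψ, Complex.sub_conj, map_intCast, mul_pow, Complex.I_sq] at h1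
  have h2 : (T ^ 2 - 4 * p : ℤ) = (-(2 * (ψ β).im) ^ 2 : ℝ) := by
    apply Complex.ofReal_injective
    push_cast at h1 ⊢
    rw [← h1]
    ring
  have h3 : ((T ^ 2 - 4 * p : ℤ) : ℝ) ≤ 0 := by
    rw [h2]
    nlinarith [sq_nonneg ((ψ β).im)]
  have h4 : T ^ 2 - 4 * p ≤ 0 := by exact_mod_cast h3
  linarith

theorem int_dvd_of_dvd_coe {K : Type*} [Field K] [NumberField K] {a b : ℤ}
    (h : (a : 𝓞 K) ∣ b) : a ∣ b := by
  have h1 := MonoidHom.map_dvd (Algebra.norm ℤ) h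
  have h2 : ∀ x : ℤ, Algebra.norm ℤ (x : 𝓞 K) = x ^ Module.finrank ℤ (𝓞 K) :=
    fun x => Algebra.norm_algebraMap (S := 𝓞 K) x
  rw [h2, h2, Int.pow_dvd_pow_iff] at h1
  · exact h1
  · rw [RingOfIntegers.rank]
    exact Module.finrank_pos.ne'

variable {m : ℕ} [NeZero m] {K : Type} [Field K] [NumberField K] [IsCyclotomicExtension {m} ℚ K]

theorem exists_int_sq_le_of_norm {p : ℕ} {α : 𝓞 K} (hα : (Algebra.norm ℤ α).natAbs = p) {D : ℕ}
    (hD : D ∣ m) (hD' : jacobiSym (-1) D = -1) :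
    ∃ T : ℤ, T ^ 2 ≤ 4 * p ∧ ∀ q : ℕ, q.Prime → ¬ q ∣ m → jacobiSym q D = 1 → q ≠ 2 →
      (q : ℤ) ∣ (T ^ 2 - 4 * p) ^ ((q + 1) / 2) - (T ^ 2 - 4 * p) := by
  have hζ := IsCyclotomicExtension.zeta_spec m ℚ K
  have hJ : ∀ a b : ℤ, (a : ZMod m) = b → jacobiSym a D = jacobiSym b D := fun a b h =>
    jacobiSym.mod_left' ((((ZMod.intCast_eq_intCast_iff _ _ _).1 h).of_dvd
      (Int.natCast_dvd_natCast.2 hD)))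
  let χ : (ZMod m)ˣ →* ℤ :=
    { toFun := fun u => jacobiSym ((u : ZMod m).val : ℤ) D
      map_one' := by rw [hJ _ 1 (by simp), jacobiSym.one_left]
      map_mul' := fun u v => by
        rw [← jacobiSym.mul_left]
        exact hJ _ _ (by simp) }
  obtain ⟨c, hc0, -, hc⟩ := exists_conj (K := K) hζ
  have : IsGalois ℚ K := IsCyclotomicExtension.isGalois {m} ℚ K
  obtain ⟨T, δ, hT, hδ, hfix⟩ := exists_sq_eq_sub_of_norm hα
    (χ.comp (IsCyclotomicExtension.Rat.galEquivZMod m K).toMonoidHom) hc (by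
      change jacobiSym (((IsCyclotomicExtension.Rat.galEquivZMod m K c : (ZMod m)ˣ) : ZMod m).val) D
        = -1
      rw [hc0, ← hD']
      exact hJ _ _ (by simp))
  refine ⟨T, hT, fun q hq hqm hqD hq2 => int_dvd_of_dvd_coe (K := K) ?_⟩
  obtain ⟨σ, hσ', hσ⟩ := exists_gal_smul_eq_pow m (K := K)
    ((Nat.Prime.coprime_iff_not_dvd hq).2 hqm)
  have h1 := dvd_pow_sub_smul_pow (r := 1) hζ hq (Or.inl rfl) (σ := σ)
    (by rw [pow_one, hσ _ hζ.toInteger_isPrimitiveRoot.pow_eq_one]) δ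
  rw [pow_one, hfix σ (by
    change jacobiSym (((IsCyclotomicExtension.Rat.galEquivZMod m K σ : (ZMod m)ˣ) : ZMod m).val) D
      = 1
    rw [hσ', ← hqD]
    exact hJ _ _ (by simp))] at h1
  obtain ⟨k, hk⟩ := hq.odd_of_ne_two hq2
  have h2 : (q : 𝓞 K) ∣ δ ^ (q + 1) - δ ^ 2 := by
    convert h1.mul_left δ using 1
    ring
  rw [show q + 1 = 2 * ((q + 1) / 2) by omega, pow_mul, hδ] at h2
  push_cast at h2 ⊢
  exact h2

omit [NeZero m] [IsCyclotomicExtension {m} ℚ K] in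
theorem norm_natAbs_ne_47 [IsCyclotomicExtension {46} ℚ K] (α : 𝓞 K) :
    (Algebra.norm ℤ α).natAbs ≠ 47 := by
  intro h
  obtain ⟨T, hT, hq⟩ := exists_int_sq_le_of_norm (m := 46) h (D := 23) (by norm_num)
    (by norm_num)
  have h3 := hq 3 (by norm_num) (by norm_num) (by norm_num) (by norm_num)
  have h127 := hq 127 (by norm_num) (by norm_num) (by norm_num) (by norm_num)
  have hT' : T ^ 2 < 14 ^ 2 := by push_cast at hT; linarith
  obtain ⟨h1, h2⟩ := abs_lt.1 (abs_lt_of_sq_lt_sq hT' (by norm_num))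
  interval_cases T <;> revert h3 h127 <;> norm_num

omit [NeZero m] [IsCyclotomicExtension {m} ℚ K] in
theorem norm_natAbs_ne_79 [IsCyclotomicExtension {78} ℚ K] (α : 𝓞 K) :
    (Algebra.norm ℤ α).natAbs ≠ 79 := by
  intro h
  obtain ⟨T, hT, hq⟩ := exists_int_sq_le_of_norm (m := 78) h (D := 39) (by norm_num)
    (by norm_num)
  have h5 := hq 5 (by norm_num) (by norm_num) (by norm_num) (by norm_num)
  have h41 := hq 41 (by norm_num) (by norm_num) (by norm_num) (by norm_num)
  have h157 := hq 157 (by norm_num) (by norm_num) (by norm_num) (by norm_num)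
  have hT' : T ^ 2 < 18 ^ 2 := by push_cast at hT; linarith
  obtain ⟨h1, h2⟩ := abs_lt.1 (abs_lt_of_sq_lt_sq hT' (by norm_num))
  interval_cases T <;> revert h5 h41 h157 <;> norm_num

end QuadraticSubfield

section Totient

theorem pow_four_le_totient_pow_five {r : ℕ} (h2 : ¬ 2 ∣ r) (h3 : ¬ 3 ∣ r) :
    r ^ 4 ≤ r.totient ^ 5 := by
  induction r using Nat.recOnPosPrimePosCoprime with
  | prime_pow q k hq hk =>
    obtain ⟨s, rfl⟩ : ∃ s, k = s + 1 := ⟨k - 1, by omega⟩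
    have hq2 : q ≠ 2 := by rintro rfl; exact h2 (dvd_pow_self 2 hk.ne')
    have hq3 : q ≠ 3 := by rintro rfl; exact h3 (dvd_pow_self 3 hk.ne')
    have hq4 : q ≠ 4 := by rintro rfl; exact absurd hq (by norm_num)
    obtain ⟨t, rfl⟩ : ∃ t, q = t + 5 := ⟨q - 5, by have := hq.two_le; omega⟩
    rw [Nat.totient_prime_pow_succ hq, Nat.add_sub_assoc (by norm_num), pow_succ (t + 5), mul_pow,
      mul_pow]
    refine Nat.mul_le_mul ?_ ?_
    · exact Nat.pow_le_pow_right (pow_pos hq.pos s) (by norm_num)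
    · exact Nat.le.intro
        (show (t + 5) ^ 4 + (t ^ 5 + 19 * t ^ 4 + 140 * t ^ 3 + 490 * t ^ 2 + 780 * t + 399)
          = (t + 4) ^ 5 by ring)
  | zero => exact absurd (dvd_zero 2) h2
  | one => simp
  | coprime a b ha hb hab iha ihb =>
    rw [Nat.totient_mul hab, mul_pow, mul_pow]
    exact Nat.mul_le_mul (iha (fun h => h2 (h.mul_right b)) fun h => h3 (h.mul_right b))
      (ihb (fun h => h2 (h.mul_left a)) fun h => h3 (h.mul_left a))

theorem two_mul_pow_four_le {m : ℕ} (hm : m ≠ 0) : 2 * m ^ 4 ≤ 81 * m.totient ^ 5 := by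
  obtain ⟨a, n, hn2, rfl⟩ := Nat.exists_eq_pow_mul_and_not_dvd hm 2 (by norm_num)
  obtain ⟨b, r, hr3, rfl⟩ := Nat.exists_eq_pow_mul_and_not_dvd (right_ne_zero_of_mul hm) 3
    (by norm_num)
  have h2r : ¬ 2 ∣ r := fun h => hn2 (h.mul_left _)
  rw [Nat.totient_mul (((Nat.Prime.coprime_iff_not_dvd Nat.prime_two).2 hn2).pow_left a),
    Nat.totient_mul (((Nat.Prime.coprime_iff_not_dvd Nat.prime_three).2 hr3).pow_left b)]
  have h1 : (2 ^ a) ^ 4 ≤ 16 * (2 ^ a).totient ^ 5 := by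
    rcases a with _ | a
    · simp
    · rw [Nat.totient_prime_pow_succ Nat.prime_two, pow_succ 2 a, mul_pow, mul_pow]
      have : (2 ^ a) ^ 4 ≤ (2 ^ a) ^ 5 := Nat.pow_le_pow_right (by positivity) (by norm_num)
      omega
  have h2 : 32 * (3 ^ b) ^ 4 ≤ 81 * (3 ^ b).totient ^ 5 := by
    rcases b with _ | b
    · simp
    · rw [Nat.totient_prime_pow_succ Nat.prime_three, pow_succ 3 b, mul_pow, mul_pow]
      have : (3 ^ b) ^ 4 ≤ (3 ^ b) ^ 5 := Nat.pow_le_pow_right (by positivity) (by norm_num)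
      omega
  have h3 := pow_four_le_totient_pow_five h2r hr3
  have h4 := Nat.mul_le_mul (Nat.mul_le_mul h1 h2) h3
  have e1 : (2 ^ a) ^ 4 * (32 * (3 ^ b) ^ 4) * r ^ 4 = 16 * (2 * (2 ^ a * (3 ^ b * r)) ^ 4) := by
    ring
  have e2 : 16 * (2 ^ a).totient ^ 5 * (81 * (3 ^ b).totient ^ 5) * r.totient ^ 5
      = 16 * (81 * ((2 ^ a).totient * ((3 ^ b).totient * r.totient)) ^ 5) := by ring
  rw [e1, e2] at h4
  exact Nat.le_of_mul_le_mul_left h4 (by norm_num)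

theorem four_pow_mul_pow_lt {D : ℕ} (hD : 69 ≤ D) : 4 ^ D * (81 ^ 5 * D ^ 25) < 16 * 25 ^ D := by
  induction D, hD using Nat.le_induction with
  | base => norm_num
  | succ D hD ih =>
    have h1 : (69 * (D + 1)) ^ 25 ≤ (70 * D) ^ 25 := Nat.pow_le_pow_left (by omega) 25
    rw [mul_pow, mul_pow] at h1
    have h2 : 4 * (D + 1) ^ 25 ≤ 25 * D ^ 25 := by
      norm_num at h1
      omega
    calc 4 ^ (D + 1) * (81 ^ 5 * (D + 1) ^ 25) = 4 ^ D * 81 ^ 5 * (4 * (D + 1) ^ 25) := by ring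
      _ ≤ 4 ^ D * 81 ^ 5 * (25 * D ^ 25) := Nat.mul_le_mul_left _ h2
      _ = 25 * (4 ^ D * (81 ^ 5 * D ^ 25)) := by ring
      _ < 25 * (16 * 25 ^ D) := by omega
      _ = 16 * 25 ^ (D + 1) := by ring

theorem two_pow_mul_pow_ten_lt {m : ℕ} (hm : 500 ≤ m) :
    2 ^ m.totient * (m + 1) ^ 10 < 5 ^ m.totient := by
  have h1 := two_mul_pow_four_le (show m ≠ 0 by omega)
  have h69 : 69 ≤ m.totient := by
    by_contra! h
    have h2 : m.totient ^ 5 ≤ 68 ^ 5 := Nat.pow_le_pow_left (by omega) 5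
    have h3 : 500 ^ 4 ≤ m ^ 4 := Nat.pow_le_pow_left hm 4
    omega
  have h2 : (2 * m ^ 4) ^ 5 ≤ (81 * m.totient ^ 5) ^ 5 := Nat.pow_le_pow_left h1 5
  have h3 : (500 * (m + 1)) ^ 20 ≤ (501 * m) ^ 20 := Nat.pow_le_pow_left (by omega) 20
  have h4 : (m + 1) ^ 20 ≤ 2 * m ^ 20 := by
    rw [mul_pow, mul_pow] at h3
    have h : 501 ^ 20 * m ^ 20 ≤ 500 ^ 20 * (2 * m ^ 20) := by
      rw [← mul_assoc]
      exact Nat.mul_le_mul_right _ (by norm_num)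
    exact Nat.le_of_mul_le_mul_left (h3.trans h) (by norm_num)
  have h5 : 16 * (m + 1) ^ 20 ≤ 81 ^ 5 * m.totient ^ 25 := by
    rw [mul_pow, mul_pow, ← pow_mul, ← pow_mul] at h2
    have : 16 * (2 * m ^ 20) = 2 ^ 5 * m ^ (4 * 5) := by ring
    exact ((Nat.mul_le_mul_left 16 h4).trans_eq this).trans h2
  have h6 : 4 ^ m.totient * (m + 1) ^ 20 < 25 ^ m.totient := by
    have := (Nat.mul_le_mul_left (4 ^ m.totient) h5).trans_lt (four_pow_mul_pow_lt h69)
    rw [Nat.mul_left_comm] at this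
    exact Nat.lt_of_mul_lt_mul_left this
  refine lt_of_pow_lt_pow_left₀ 2 (Nat.zero_le _) ?_
  have e1 : (2 ^ m.totient * (m + 1) ^ 10) ^ 2 = 4 ^ m.totient * (m + 1) ^ 20 := by
    rw [mul_pow, ← pow_mul, ← pow_mul, mul_comm m.totient, pow_mul 2]
    norm_num
  have e2 : (5 ^ m.totient) ^ 2 = 25 ^ m.totient := by
    rw [← pow_mul, mul_comm, pow_mul]
    norm_num
  rwa [e1, e2]

theorem sixteen_pow_mul_pow_ten_lt {q : ℕ} (hq : 10 ≤ q) : 16 ^ q * (q + 1) ^ 10 < 625 ^ q := by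
  induction q, hq using Nat.le_induction with
  | base => norm_num
  | succ q hq ih =>
    have h1 : (11 * (q + 1 + 1)) ^ 10 ≤ (12 * (q + 1)) ^ 10 := Nat.pow_le_pow_left (by omega) 10
    rw [mul_pow, mul_pow] at h1
    have h2 : 16 * (q + 1 + 1) ^ 10 ≤ 625 * (q + 1) ^ 10 := by
      norm_num at h1
      omega
    calc 16 ^ (q + 1) * (q + 1 + 1) ^ 10 = 16 ^ q * (16 * (q + 1 + 1) ^ 10) := by ring
      _ ≤ 16 ^ q * (625 * (q + 1) ^ 10) := Nat.mul_le_mul_left _ h2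
      _ = 625 * (16 ^ q * (q + 1) ^ 10) := by ring
      _ < 625 * 625 ^ q := by omega
      _ = 625 ^ (q + 1) := by ring

theorem mem_or_lt_of_lt_501 : ∀ q < 500, 5 ≤ q + 1 →
    (∃ d ∈ [2, 3, 5, 7, 11, 13, 17, 19], d ∣ q + 1 ∧ d ≠ q + 1) ∨
    q + 1 ∈ [5, 7, 11, 13, 17, 19, 23, 29, 31, 37, 41, 43, 61, 67, 71, 47, 79] ∨
    (7 ≤ q + 1 ∧ 2 ^ q.totient * (q + 1) ^ 10 < 5 ^ q.totient) ∨
    (∃ l ∈ [5, 7, 11], ¬ l ∣ q ∧ 2 ^ q.totient * (q + 1) ^ (l + 1) < l ^ q.totient) ∨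
    (4 ∣ q ∧ (q + 1) ^ 24 < 108 ^ q.totient) := by
  decide +kernel

end Totient

section Cyclotomic

open NumberField

variable {m : ℕ} [NeZero m] {K : Type} [Field K] [NumberField K] [IsCyclotomicExtension {m} ℚ K]
  {p : ℕ} {α : 𝓞 K}

theorem mem_of_norm_eq (hp : p.Prime) (hp5 : 5 ≤ p) (hm : m = p - 1)
    (hα : (Algebra.norm ℤ α).natAbs = p) :
    p ∈ [5, 7, 11, 13, 17, 19, 23, 29, 31, 37, 41, 43, 61, 67, 71] := by
  have hm' : m = p ^ 0 * (p - 1) := by rw [pow_zero, one_mul, hm]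
  have hpm : p = m + 1 := by omega
  rcases lt_or_ge m 500 with h500 | h500
  · rcases mem_or_lt_of_lt_501 m h500 (by omega) with h | h | ⟨h7, h⟩ | ⟨l, hl, hlm, h⟩ | ⟨h4, h⟩
    · obtain ⟨d, hd, hdm, hne⟩ := h
      rw [← hpm] at hdm hne
      rcases (Nat.dvd_prime hp).1 hdm with rfl | h
      · simp at hd
      · exact absurd h hne
    · rw [← hpm] at h
      have h2 : p ∈ [5, 7, 11, 13, 17, 19, 23, 29, 31, 37, 41, 43, 61, 67, 71] ∨
          p = 47 ∨ p = 79 := by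
        simp only [List.mem_cons, List.not_mem_nil, or_false] at h ⊢
        tauto
      rcases h2 with h2 | rfl | rfl
      · exact h2
      · obtain rfl : m = 46 := hm
        exact absurd hα (norm_natAbs_ne_47 α)
      · obtain rfl : m = 78 := hm
        exact absurd hα (norm_natAbs_ne_79 α)
    · rw [← hpm] at h h7
      exact absurd (five_pow_totient_le hp h7 hm' hα) h.not_ge
    · have hl' : l.Prime := by
        simp only [List.mem_cons, List.not_mem_nil, or_false] at hl
        rcases hl with rfl | rfl | rfl <;> norm_num
      rw [← hpm] at h
      exact absurd (pow_totient_le_of_not_dvd hp hp5 hm' hα hl' hlm) h.not_ge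
    · rw [← hpm] at h
      exact absurd (pow_totient_le_of_four_dvd hp hp5 hm h4 hα) h.not_ge
  · have h := two_pow_mul_pow_ten_lt h500
    rw [← hpm] at h
    exact absurd (five_pow_totient_le hp (by omega) hm' hα) h.not_ge

theorem lt_eleven_of_norm_eq (hp : p.Prime) (hm : m = p * (p - 1))
    (hα : (Algebra.norm ℤ α).natAbs = p) : p < 11 := by
  by_contra! h11
  have h1 := five_pow_totient_le (m := m) (j := 1) hp (by omega) (by rw [pow_one, hm]) hα
  obtain ⟨q, rfl⟩ : ∃ q, p = q + 1 := ⟨p - 1, by omega⟩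
  have h4 : 4 ≤ q.totient := by
    by_contra! h
    have h2 := two_mul_pow_four_le (show q ≠ 0 by omega)
    have h3 : q.totient ^ 5 ≤ 3 ^ 5 := Nat.pow_le_pow_left (by omega) 5
    have h5 : 10 ^ 4 ≤ q ^ 4 := Nat.pow_le_pow_left (by omega) 4
    omega
  have hD : m.totient = q * q.totient := by
    rw [hm, Nat.add_sub_cancel, Nat.totient_mul (by simp), Nat.totient_prime hp,
      Nat.add_sub_cancel]
  obtain ⟨e, he⟩ : ∃ e, m.totient = 4 * q + e :=
    ⟨m.totient - 4 * q, by have := Nat.mul_le_mul_left q h4; omega⟩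
  rw [he, pow_add, pow_add, pow_mul, pow_mul] at h1
  have h2 := sixteen_pow_mul_pow_ten_lt (show 10 ≤ q by omega)
  have h3 : 2 ^ e ≤ 5 ^ e := Nat.pow_le_pow_left (by norm_num) e
  have h5 : (16 ^ q * (q + 1) ^ 10) * 2 ^ e < 625 ^ q * 5 ^ e :=
    Nat.mul_lt_mul_of_lt_of_le h2 h3 (by positivity)
  norm_num at h1
  rw [mul_right_comm] at h1
  omega

end Cyclotomic

section Main

variable {n : ℕ}

theorem PermPresentation.pow_dvd [NeZero n] (Pr : PermPresentation n) {p k : ℕ} (hp : p.Prime)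
    (hk : p ^ k ∣ n) : p ^ k ∣ 2 ^ 2 * 3 ^ n * 5 ^ 2 * 7 ^ 2 * 11 * 13 * 17 * 19 * 23 * 29 * 31 *
      37 * 41 * 43 * 61 * 67 * 71 := by
  have hn0 : n ≠ 0 := NeZero.ne n
  rcases Nat.eq_zero_or_pos k with rfl | hk0
  · simp
  by_cases hp2 : p = 2
  · subst hp2
    have hk2 : k ≤ 2 := by
      by_contra! h
      exact Pr.not_eight_dvd ((pow_dvd_pow 2 h).trans hk)
    exact (pow_dvd_pow 2 hk2).trans (by simp only [mul_assoc]; exact dvd_mul_right _ _)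
  by_cases hp3 : p = 3
  · subst hp3
    have hkn : k ≤ n := (Nat.lt_pow_self (by norm_num)).le.trans
      (Nat.le_of_dvd (Nat.pos_of_ne_zero hn0) hk)
    refine (pow_dvd_pow 3 hkn).trans ?_
    simp only [mul_assoc]
    exact (dvd_mul_right _ _).mul_left _
  have hp4 : p ≠ 4 := by rintro rfl; exact absurd hp (by norm_num)
  have hp5 : 5 ≤ p := by have := hp.two_le; omega
  obtain ⟨v, n', hn', hn⟩ := Nat.exists_eq_pow_mul_and_not_dvd hn0 p hp.ne_one
  have hkv : k ≤ v := by
    rw [hn] at hk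
    exact (Nat.pow_dvd_pow_iff_le_right hp.one_lt).1
      ((((Nat.Prime.coprime_iff_not_dvd hp).2 hn').pow_left k).dvd_of_dvd_mul_right hk)
  have hm : ∀ j, NeZero (p ^ j * (p - 1)) := fun j =>
    ⟨mul_ne_zero (pow_ne_zero _ hp.ne_zero) (by omega)⟩
  have hm0 := hm 0
  have hm1 := hm 1
  have hm2 := hm 2
  rcases (show v = 1 ∨ 2 ≤ v by omega) with rfl | hv
  · obtain ⟨δ, hδ⟩ := Pr.exists_norm_eq_prime hp hp2 hn hn' (j := 0) (by norm_num) fun _ => rfl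
    have h := mem_of_norm_eq (m := p ^ 0 * (p - 1)) hp hp5 (by rw [pow_zero, one_mul]) hδ
    obtain rfl : k = 1 := by omega
    rw [pow_one]
    have h3 : p ∣ 2 ^ 2 * 1 * 5 ^ 2 * 7 ^ 2 * 11 * 13 * 17 * 19 * 23 * 29 * 31 * 37 * 41 * 43 *
        61 * 67 * 71 := by
      simp only [List.mem_cons, List.not_mem_nil, or_false] at h
      rcases h with h | h | h | h | h | h | h | h | h | h | h | h | h | h | h <;>
        subst h <;> norm_num
    refine h3.trans ?_
    gcongr
    exact one_dvd _
  · obtain ⟨δ, hδ⟩ := Pr.exists_norm_eq_prime hp hp2 hn hn' (j := 1) (by omega) (by norm_num)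
    have h11 := lt_eleven_of_norm_eq (m := p ^ 1 * (p - 1)) hp (by rw [pow_one]) hδ
    have h57 : p = 5 ∨ p = 7 := by
      interval_cases p <;> first | omega | exact absurd hp (by norm_num)
    have hv2 : v = 2 := by
      by_contra hv2
      obtain ⟨δ, hδ⟩ := Pr.exists_norm_eq_prime hp hp2 hn hn' (j := 2) (by omega) (by norm_num)
      rcases h57 with rfl | rfl
      · have := pow_totient_le_of_not_dvd (j := 2) hp hp5 rfl hδ Nat.prime_three (by norm_num)
        revert this
        decide +kernel
      · have := pow_totient_le_of_not_dvd (j := 2) hp hp5 rfl hδ Nat.prime_five (by norm_num)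
        revert this
        decide +kernel
    have h3 : p ^ 2 ∣ 2 ^ 2 * 1 * 5 ^ 2 * 7 ^ 2 * 11 * 13 * 17 * 19 * 23 * 29 * 31 * 37 * 41 * 43 *
        61 * 67 * 71 := by
      rcases h57 with rfl | rfl <;> norm_num
    refine ((pow_dvd_pow p (hkv.trans hv2.le)).trans h3).trans ?_
    gcongr
    exact one_dvd _

theorem PermPresentation.dvd [NeZero n] (Pr : PermPresentation n) :
    n ∣ 2 ^ 2 * 3 ^ n * 5 ^ 2 * 7 ^ 2 * 11 * 13 * 17 * 19 * 23 * 29 * 31 * 37 * 41 * 43 * 61 * 67 *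
      71 :=
  (Nat.dvd_iff_prime_pow_dvd_dvd _ _).2 fun _ _ hp hk => Pr.pow_dvd hp hk

end Main

end NoetherCn

/-- Let `n` be a positive integer and let `σ` be the `ℚ`-automorphism of the rational
function field `ℚ(x₁, …, x_n) = Frac(ℚ[x₁, …, x_n])` cyclically permuting the
indeterminates, so that the cyclic group `C_n = ⟨σ⟩` acts regularly on `{x₁, …, x_n}`.
Then the fixed field `ℚ(x₁, …, x_n)^{C_n}` is rational (purely transcendental) over `ℚ`
if and only if `n` divides `2²·3^m·5²·7²·11·13·17·19·23·29·31·37·41·43·61·67·71`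
for some non-negative integer `m`. -/
theorem noether_problem_Cn_rational_iff_dvd
    (n : ℕ) (hn : 0 < n)
    (σ : FractionRing (MvPolynomial (Fin n) ℚ) ≃ₐ[ℚ] FractionRing (MvPolynomial (Fin n) ℚ))
    (hσ : ∀ i : Fin n,
      σ (algebraMap (MvPolynomial (Fin n) ℚ) (FractionRing (MvPolynomial (Fin n) ℚ))
          (MvPolynomial.X i)) =
        algebraMap (MvPolynomial (Fin n) ℚ) (FractionRing (MvPolynomial (Fin n) ℚ))
          (MvPolynomial.X (finRotate n i))) :
    Nonempty ((IntermediateField.fixedField (Subgroup.zpowers σ)) ≃ₐ[ℚ]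
        FractionRing (MvPolynomial (Fin n) ℚ)) ↔
      ∃ m : ℕ, n ∣ 2 ^ 2 * 3 ^ m * 5 ^ 2 * 7 ^ 2 * 11 * 13 * 17 * 19 * 23 * 29 * 31 * 37 *
        41 * 43 * 61 * 67 * 71 := by
  have : NeZero n := ⟨hn.ne'⟩
  rw [NoetherCn.fixedField_rational_iff σ hσ]
  constructor
  · rintro ⟨t, h1, h2⟩
    obtain ⟨Pr⟩ := NoetherCn.exists_permPresentation_of_generates h1 h2
    exact ⟨n, Pr.dvd⟩
  · rintro ⟨m, hm⟩
    exact NoetherCn.exists_generators_of_dvd hm
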